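/- Let N ∈ {2, 3, 5, 6, 7, 10, 13}. The generating function G₂^{(N*)}(τ) := Σ_{n≥-1} ( Σ_{r∈ℤ} t₂^{(N*)}(4n - r²) ) qⁿ is a weakly holomorphic modular form of weight 2 on Γ₀(N): it is holomorphic on ℍ, satisfies G₂^{(N*)}((aτ+b)/(cτ+d)) = (cτ+d)² G₂^{(N*)}(τ) for all [[a,b],[c,d]] ∈ Γ₀(N), and is meromorphic at the cusps. -/

import Mathlib

open Complex Matrix

noncomputable section

/-- `SL(2, ℝ)`. -/
abbrev SL2R := Matrix.SpecialLinearGroup (Fin 2) ℝ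

/-- `q = e^{2πiz}` (also used as `ζ = e^{2πiz}`). -/
def qc (z : ℂ) : ℂ := Complex.exp (2 * Real.pi * Complex.I * z)

/-- The Dedekind eta function `η(z) = q^{1/24} ∏_{n ≥ 1} (1 - q^n)` (intended for `Im z > 0`). -/
def dedekindEta (z : ℂ) : ℂ :=
  Complex.exp (Real.pi * Complex.I * z / 12) *
    ∏' n : ℕ, (1 - Complex.exp (2 * Real.pi * Complex.I * ((n : ℂ) + 1) * z))

/-- The hauptmodul `j_N` of `Γ₀(N)` for `N ∈ {2, 3, 5, 7, 13, 6, 10}`. -/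
def jn (N : ℕ) (z : ℂ) : ℂ :=
  if N = 6 then (dedekindEta (2 * z) * dedekindEta (3 * z) ^ 3 / (dedekindEta z * dedekindEta (6 * z) ^ 3)) ^ 3 - 3
  else if N = 10 then dedekindEta (2 * z) * dedekindEta (5 * z) ^ 5 / (dedekindEta z * dedekindEta (10 * z) ^ 5) - 1
  else (dedekindEta z / dedekindEta ((N : ℂ) * z)) ^ (24 / (N - 1)) + 24 / ((N : ℂ) - 1)

/-- The hauptmodul `j_N^*` of the Fricke group `Γ₀^*(N)` for `N ∈ {2, 3, 5, 7, 13, 6, 10}`. -/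
def jnStar (N : ℕ) (z : ℂ) : ℂ :=
  if N = 6 then
    (dedekindEta z * dedekindEta (3 * z) / (dedekindEta (2 * z) * dedekindEta (6 * z))) ^ 6 + 6 +
      2 ^ 6 * (dedekindEta (2 * z) * dedekindEta (6 * z) / (dedekindEta z * dedekindEta (3 * z))) ^ 6
  else if N = 10 then
    (dedekindEta z * dedekindEta (5 * z) / (dedekindEta (2 * z) * dedekindEta (10 * z))) ^ 4 + 4 +
      2 ^ 4 * (dedekindEta (2 * z) * dedekindEta (10 * z) / (dedekindEta z * dedekindEta (5 * z))) ^ 4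
  else
    (dedekindEta z / dedekindEta ((N : ℂ) * z)) ^ (24 / (N - 1)) + 24 / ((N : ℂ) - 1) +
      (N : ℂ) ^ (12 / (N - 1)) * (dedekindEta ((N : ℂ) * z) / dedekindEta z) ^ (24 / (N - 1))

/-- `f` has the `q`-expansion `f(τ) = Σ_{n ≥ n₀} (a n) q^n` on the upper half-plane. -/
def HasQExp (f : ℂ → ℂ) (a : ℤ → ℂ) (n₀ : ℤ) : Prop :=
  (∀ n < n₀, a n = 0) ∧
    ∀ τ : ℂ, 0 < τ.im →
      HasSum (fun m : ℕ => a (n₀ + m) * qc τ ^ (n₀ + (m : ℤ))) (f τ)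

/-- `Γ₀(N)` viewed as a subgroup of `SL(2, ℝ)`. -/
def Gamma0SL2R (N : ℕ) : Subgroup SL2R :=
  (CongruenceSubgroup.Gamma0 N).map
    (Matrix.SpecialLinearGroup.map (Int.castRingHom ℝ))

/-- The set of Atkin–Lehner matrices `W_e` of level `N`:
`W_e = e^{-1/2} [[xe, y], [zN, we]]`, `x, y, z, w ∈ ℤ` (determinant `1` being automatic). -/
def atkinLehnerSet (N e : ℕ) : Set SL2R :=
  { g | ∃ x y z w : ℤ,
      g.1 = (Real.sqrt e)⁻¹ • !![(x : ℝ) * e, (y : ℝ); (z : ℝ) * N, (w : ℝ) * e] }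

/-- The Fricke group `Γ₀^*(N)`, generated by `Γ₀(N)` and all Atkin–Lehner involutions `W_e`
for `e ∣ N` with `gcd(e, N/e) = 1`. -/
def FrickeGroup (N : ℕ) : Subgroup SL2R :=
  Subgroup.closure
    ((Gamma0SL2R N : Set SL2R) ∪
      ⋃ e ∈ {e : ℕ | e ∣ N ∧ Nat.Coprime e (N / e)}, atkinLehnerSet N e)

/-- The Gram matrix of the integral binary quadratic form `[a, b, c]`. -/
def formMat (a b c : ℤ) : Matrix (Fin 2) (Fin 2) ℝ :=
  !![(a : ℝ), (b : ℝ) / 2; (b : ℝ) / 2, (c : ℝ)]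

/-- `𝒬_{d,N}`: positive definite integral binary quadratic forms `[a, b, c]` of
discriminant `-d` with `N ∣ a`. -/
def QdN (d : ℤ) (N : ℕ) : Set (Matrix (Fin 2) (Fin 2) ℝ) :=
  { M | ∃ a b c : ℤ, M = formMat a b c ∧ 0 < a ∧ b ^ 2 - 4 * a * c = -d ∧ (N : ℤ) ∣ a }

/-- `𝒬_{d,N,h}`: members of `𝒬_{d,N}` with `b ≡ h (mod 2N)`. -/
def QdNh (d : ℤ) (N : ℕ) (h : ℤ) : Set (Matrix (Fin 2) (Fin 2) ℝ) :=
  { M | ∃ a b c : ℤ, M = formMat a b c ∧ 0 < a ∧ b ^ 2 - 4 * a * c = -d ∧ (N : ℤ) ∣ a ∧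
      (b : ZMod (2 * N)) = (h : ZMod (2 * N)) }

/-- Orbit relation of the (right) action `Q ↦ Q ∘ g`, i.e. `M ↦ gᵀ M g`, of `Γ ≤ SL(2, ℝ)`
on a set `S` of Gram matrices of quadratic forms. -/
def formRel (Γ : Subgroup SL2R) (S : Set (Matrix (Fin 2) (Fin 2) ℝ)) (Q Q' : S) : Prop :=
  ∃ g ∈ Γ, Q'.1 = (g.1)ᵀ * Q.1 * g.1

/-- The CM point `α_Q` of a positive definite form (as a point of `ℂ`; it lies in the upper
half-plane): `α_Q = (-b + i √d) / (2a) = (-(b/2) + i √(det M)) / a`. -/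
def cmPointC (M : Matrix (Fin 2) (Fin 2) ℝ) : ℂ :=
  ((-(M 0 1) : ℝ) + Complex.I * Real.sqrt M.det) / ((M 0 0 : ℝ) : ℂ)

/-- The order of the stabilizer of the form `M` in `Γ/{±1}` (the stabilizer in `Γ` contains
`±1` and has twice the cardinality). -/
def stabOrder (Γ : Subgroup SL2R) (M : Matrix (Fin 2) (Fin 2) ℝ) : ℕ :=
  Nat.card { g : SL2R // g ∈ Γ ∧ (g.1)ᵀ * M * g.1 = M } / 2

/-- The modular trace `Σ_{Q ∈ S/Γ} f(α_Q) / |Γ̄_Q|`. -/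
def classTrace (Γ : Subgroup SL2R) (f : ℂ → ℂ)
    (S : Set (Matrix (Fin 2) (Fin 2) ℝ)) : ℂ :=
  ∑ᶠ O : Quot (formRel Γ S),
    f (cmPointC (Quot.out O).1) / (stabOrder Γ (Quot.out O).1 : ℂ)

/-- `t₂^{(N*)}(d)`, where `P` is the polynomial with `φ₂(j_N^*) = P(j_N^*)`;
includes the paper's conventions at nonpositive indices. -/
def t2Star (N : ℕ) (P : Polynomial ℂ) (d : ℤ) : ℂ :=
  if 0 < d then
    classTrace (FrickeGroup N) (fun z => Polynomial.eval (jnStar N z) P) (QdN d N)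
  else if d = 0 then (if N = 2 then 5 else if N = 6 ∨ N = 10 then 5 / 2 else 3)
  else if d = -1 then -1
  else if d = -4 then -2
  else 0

/-- `σ₁^{(N)}(x) = Σ_{d ∣ x, N ∤ d} d` for `x ∈ ℤ_{>0}`, `(N-1)/24` at `x = 0`, and `0`
off `ℤ_{≥0}`. -/
def sigmaN (N : ℕ) (x : ℚ) : ℂ :=
  if x = 0 then ((N : ℂ) - 1) / 24
  else if 0 < x ∧ x.den = 1 then
    ∑ d ∈ (Nat.divisors x.num.toNat).filter (fun d => ¬ N ∣ d), (d : ℂ)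
  else 0

/-- `σ₁(x) = Σ_{d ∣ x} d` for `x ∈ ℤ_{>0}` and `0` otherwise. -/
def sigmaQ (x : ℚ) : ℂ :=
  if 0 < x ∧ x.den = 1 then ∑ d ∈ Nat.divisors x.num.toNat, (d : ℂ) else 0

/-- A weakly holomorphic Jacobi form of weight `k` and index `m`. -/
structure WeakJacobiForm (k : ℤ) (m : ℕ) where
  toFun : ℂ → ℂ → ℂ
  holo : DifferentiableOn ℂ (fun p : ℂ × ℂ => toFun p.1 p.2)
      ({τ : ℂ | 0 < τ.im} ×ˢ (Set.univ : Set ℂ))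
  slash_inv : ∀ a b c d : ℤ, a * d - b * c = 1 → ∀ τ z : ℂ, 0 < τ.im →
    ((c : ℂ) * τ + d) ^ (-k) *
        Complex.exp (-(2 * Real.pi * Complex.I * m * c * z ^ 2) / ((c : ℂ) * τ + d)) *
        toFun (((a : ℂ) * τ + b) / ((c : ℂ) * τ + d)) (z / ((c : ℂ) * τ + d)) =
      toFun τ z
  elliptic : ∀ lm mu : ℤ, ∀ τ z : ℂ, 0 < τ.im →
    Complex.exp (2 * Real.pi * Complex.I * m * ((lm : ℂ) ^ 2 * τ + 2 * lm * z)) *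
        toFun τ (z + lm * τ + mu) = toFun τ z
  coeff : ℤ → ℤ → ℂ
  coeff_neg_finite : {n : ℤ | n < 0 ∧ ∃ r : ℤ, coeff n r ≠ 0}.Finite
  expansion : ∀ τ z : ℂ, 0 < τ.im →
    HasSum (fun p : ℤ × ℤ => coeff p.1 p.2 * qc τ ^ p.1 * qc z ^ p.2) (toFun τ z)

/-- Meromorphy of weight `k` at all cusps: at each cusp `γ∞`, the function `F|_k γ` has a
Fourier expansion in fractional powers of `q` with only finitely many negative terms. -/
def MeromAtCusps (k : ℤ) (F : ℂ → ℂ) : Prop :=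
  ∀ a b c d : ℤ, a * d - b * c = 1 →
    ∃ (M : ℕ) (cs : ℤ → ℂ) (n₀ : ℤ), 0 < M ∧
      ∀ τ : ℂ, 0 < τ.im →
        HasSum
          (fun j : ℕ => cs (n₀ + j) *
            Complex.exp (2 * Real.pi * Complex.I * τ / M) ^ (n₀ + (j : ℤ)))
          (((c : ℂ) * τ + d) ^ (-k) * F (((a : ℂ) * τ + b) / ((c : ℂ) * τ + d)))

/-- The Möbius action of an element of `SL(2, ℝ)` on `ℂ`. -/
def moebius (g : SL2R) (z : ℂ) : ℂ :=
  ((g.1 0 0 : ℝ) * z + ((g.1 0 1 : ℝ) : ℂ)) / ((g.1 1 0 : ℝ) * z + ((g.1 1 1 : ℝ) : ℂ))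

/-- A weakly holomorphic modular function on `Γ`: holomorphic on the upper half-plane,
`Γ`-invariant, with poles only at the cusps. -/
def IsWeaklyHolModularFn (Γ : Subgroup SL2R) (f : ℂ → ℂ) : Prop :=
  DifferentiableOn ℂ f {z : ℂ | 0 < z.im} ∧
    (∀ g ∈ Γ, ∀ z : ℂ, 0 < z.im → f (moebius g z) = f z) ∧
    MeromAtCusps 0 f

/-- The set `L_{h, d/4N}` of vectors
`X = [[b + h/2N, c/N], [-a, -(b + h/2N)]]`, `a, b, c ∈ ℤ`, of norm `q(X) = d/4N`. -/
def LhSet (N : ℕ) (h d : ℤ) : Set (Matrix (Fin 2) (Fin 2) ℝ) :=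
  { X | ∃ a b c : ℤ,
      X = !![(b : ℝ) + (h : ℝ) / (2 * N), (c : ℝ) / N;
             -(a : ℝ), -((b : ℝ) + (h : ℝ) / (2 * N))] ∧
      (2 * b * N + h) ^ 2 - 4 * a * c * N = -d }

/-- The map `X ↦ N ⬝ [[0,-1],[1,0]] ⬝ X` from vectors to Gram matrices of quadratic forms. -/
def vecToForm (N : ℕ) (X : Matrix (Fin 2) (Fin 2) ℝ) : Matrix (Fin 2) (Fin 2) ℝ :=
  (N : ℝ) • (!![(0 : ℝ), -1; 1, 0] * X)

/-- Orbit relation of `Γ` acting by conjugation `g.X = g X g⁻¹` on a set `S` of vectors. -/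
def vecRel (Γ : Subgroup SL2R) (S : Set (Matrix (Fin 2) (Fin 2) ℝ)) (X X' : S) : Prop :=
  ∃ g ∈ Γ, X'.1 = g.1 * X.1 * (g⁻¹).1

/-- The Heegner point `D_X ∈ ℍ` of a vector `X` of positive norm. -/
def heegnerC (X : Matrix (Fin 2) (Fin 2) ℝ) : ℂ :=
  ((X 0 0 / X 1 0 : ℝ) : ℂ) + Complex.I * Real.sqrt (X.det / (X 1 0) ^ 2)

/-- The order of the stabilizer of the vector `X` in `Γ/{±1}`. -/
def vecStabOrder (Γ : Subgroup SL2R) (X : Matrix (Fin 2) (Fin 2) ℝ) : ℕ :=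
  Nat.card { g : SL2R // g ∈ Γ ∧ g.1 * X * (g⁻¹).1 = X } / 2

/-- The modular trace `t_f(h, m) = Σ_{X ∈ Γ\L_{h,m}} f(D_X) / |Γ̄_X|`. -/
def vecTrace (Γ : Subgroup SL2R) (f : ℂ → ℂ) (S : Set (Matrix (Fin 2) (Fin 2) ℝ)) : ℂ :=
  ∑ᶠ O : Quot (vecRel Γ S), f (heegnerC (Quot.out O).1) / (vecStabOrder Γ (Quot.out O).1 : ℂ)

/-- The weight-2 Eisenstein series `E₂(z) = 1 - 24 Σ_{n ≥ 1} σ₁(n) qⁿ`. -/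
def E2 (z : ℂ) : ℂ :=
  1 - 24 * ∑' n : ℕ, (∑ d ∈ Nat.divisors (n + 1), (d : ℂ)) * qc z ^ (n + 1)

/-- `E₂^{(N)}(z) = N E₂(Nz) - E₂(z)`. -/
def E2N (N : ℕ) (z : ℂ) : ℂ := (N : ℂ) * E2 ((N : ℂ) * z) - E2 z

end

open Filter Topology Asymptotics

noncomputable section
namespace TraceForm

/-- The upper half-plane as a subset of `ℂ`. -/
def UH : Set ℂ := {z | 0 < z.im}

/-- The filter of neighbourhoods of `i∞`. -/
def atI : Filter ℂ := comap Complex.im atTop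

abbrev MZ := Matrix (Fin 2) (Fin 2) ℤ

/-- The automorphy factor `cz + d`. -/
def den (A : MZ) (z : ℂ) : ℂ := A 1 0 * z + A 1 1

/-- The Möbius action of an integral matrix. -/
def act (A : MZ) (z : ℂ) : ℂ := (A 0 0 * z + A 0 1) / den A z

/-- Integral Atkin–Lehner matrices of determinant `e` and level `N`. -/
def AL (N e : ℕ) : Set MZ :=
  {A | (e : ℤ) ∣ A 0 0 ∧ (N : ℤ) ∣ A 1 0 ∧ (e : ℤ) ∣ A 1 1 ∧ A.det = e}

/-- Integral matrices of determinant `n` with lower left entry divisible by `N`. -/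
def Mn (N n : ℕ) : Set MZ := {A | (N : ℤ) ∣ A 1 0 ∧ A.det = n}

lemma isOpen_UH : IsOpen UH := isOpen_lt continuous_const Complex.continuous_im

lemma den_ne_zero {A : MZ} (hA : 0 < A.det) {z : ℂ} (hz : z ∈ UH) : den A z ≠ 0 := by
  intro h
  have him := congrArg Complex.im h
  have hre := congrArg Complex.re h
  simp only [den, Complex.add_im, Complex.mul_im, Complex.intCast_re, Complex.intCast_im,
    Complex.add_re, Complex.mul_re, Complex.zero_im, Complex.zero_re, zero_mul, add_zero,
    sub_zero] at him hre
  have hz' : z.im ≠ 0 := ne_of_gt hz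
  have h1 : (A 1 0 : ℝ) = 0 := by
    rcases mul_eq_zero.mp him with h | h
    · exact h
    · exact absurd h hz'
  rw [h1, zero_mul, zero_add] at hre
  have h1' : A 1 0 = 0 := by exact_mod_cast h1
  have h2' : A 1 1 = 0 := by exact_mod_cast hre
  rw [Matrix.det_fin_two, h1', h2'] at hA
  simp at hA

lemma im_act (A : MZ) (z : ℂ) :
    (act A z).im = A.det * z.im / Complex.normSq (den A z) := by
  rw [act, Complex.div_im, Matrix.det_fin_two]
  simp only [den, Complex.add_im, Complex.mul_im, Complex.intCast_re, Complex.intCast_im,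
    Complex.add_re, Complex.mul_re]
  push_cast
  ring

lemma act_mem {A : MZ} (hA : 0 < A.det) {z : ℂ} (hz : z ∈ UH) : act A z ∈ UH := by
  show 0 < (act A z).im
  rw [im_act]
  have h1 : 0 < Complex.normSq (den A z) := Complex.normSq_pos.mpr (den_ne_zero hA hz)
  have h2 : (0 : ℝ) < A.det := by exact_mod_cast hA
  have h3 : 0 < z.im := hz
  positivity

lemma den_mul {A B : MZ} (hB : 0 < B.det) {z : ℂ} (hz : z ∈ UH) :
    den (A * B) z = den A (act B z) * den B z := by
  have h := den_ne_zero hB hz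
  have : den A (act B z) * den B z
      = A 1 0 * (B 0 0 * z + B 0 1) + A 1 1 * den B z := by
    rw [den, act]; field_simp
  rw [this]
  simp only [den, Matrix.mul_apply, Fin.sum_univ_two]
  push_cast
  ring

lemma act_mul {A B : MZ} (hA : 0 < A.det) (hB : 0 < B.det) {z : ℂ} (hz : z ∈ UH) :
    act (A * B) z = act A (act B z) := by
  have h := den_ne_zero hB hz
  have h' := den_ne_zero hA (act_mem hB hz)
  rw [act, den_mul hB hz, div_eq_iff (mul_ne_zero h' h)]
  have : act A (act B z) * (den A (act B z) * den B z)
      = A 0 0 * (B 0 0 * z + B 0 1) + A 0 1 * den B z := by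
    rw [act.eq_1 A]
    field_simp
    rw [act]
    field_simp
  rw [this]
  simp only [den, Matrix.mul_apply, Fin.sum_univ_two]
  push_cast
  ring

lemma act_smul {k : ℤ} (hk : k ≠ 0) (A : MZ) (z : ℂ) : act (k • A) z = act A z := by
  have hk' : (k : ℂ) ≠ 0 := by exact_mod_cast hk
  simp only [act, den, Matrix.smul_apply, smul_eq_mul, Int.cast_mul]
  rw [show (k * A 0 0 * z + k * A 0 1 : ℂ) = k * (A 0 0 * z + A 0 1) by ring,
    show (k * A 1 0 * z + k * A 1 1 : ℂ) = k * (A 1 0 * z + A 1 1) by ring,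
    mul_div_mul_left _ _ hk']

lemma act_one (z : ℂ) : act 1 z = z := by simp [act, den]

lemma differentiableOn_act {A : MZ} (hA : 0 < A.det) : DifferentiableOn ℂ (act A) UH := by
  intro z hz
  have := den_ne_zero hA hz
  unfold act
  unfold den at *
  exact (by fun_prop (disch := assumption) :
    DifferentiableAt ℂ (fun z : ℂ => (A 0 0 * z + A 0 1) / (A 1 0 * z + A 1 1)) z).differentiableWithinAt

lemma DifferentiableOn.comp_act {F : ℂ → ℂ} (hF : DifferentiableOn ℂ F UH) {A : MZ}
    (hA : 0 < A.det) : DifferentiableOn ℂ (fun z => F (act A z)) UH :=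
  hF.comp (differentiableOn_act hA) fun _ hz => act_mem hA hz

lemma AL.det_pos {N e : ℕ} (he : 0 < e) {A : MZ} (hA : A ∈ AL N e) : 0 < A.det := by
  rw [hA.2.2.2]; exact_mod_cast he

lemma Mn.det_pos {N n : ℕ} (hn : 0 < n) {A : MZ} (hA : A ∈ Mn N n) : 0 < A.det := by
  rw [hA.2]; exact_mod_cast hn

lemma AL_one_iff {N : ℕ} {A : MZ} : A ∈ AL N 1 ↔ A ∈ Mn N 1 := by
  simp [AL, Mn]

lemma mem_AL_iff {N e : ℕ} {A : MZ} : A ∈ AL N e ↔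
    ∃ a b c d : ℤ, A = !![e * a, b; N * c, e * d] ∧ (e : ℤ) * a * (e * d) - b * (N * c) = e := by
  constructor
  · rintro ⟨⟨a, ha⟩, ⟨c, hc⟩, ⟨d, hd⟩, h⟩
    refine ⟨a, A 0 1, c, d, ?_, ?_⟩
    · rw [← ha, ← hc, ← hd]; exact Matrix.eta_fin_two A
    · rw [← ha, ← hc, ← hd, ← h, Matrix.det_fin_two]
  · rintro ⟨a, b, c, d, rfl, h⟩
    refine ⟨?_, ?_, ?_, ?_⟩ <;> simp [Matrix.det_fin_two, h]

lemma adjugate_mem_AL {N e : ℕ} {A : MZ} (hA : A ∈ AL N e) : A.adjugate ∈ AL N e := by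
  obtain ⟨h1, h2, h3, h4⟩ := hA
  rw [Matrix.adjugate_fin_two]
  refine ⟨by simpa, by simpa using h2, by simpa, ?_⟩
  rw [← h4, Matrix.det_fin_two, Matrix.det_fin_two]
  simp; ring

/-- The symmetric difference of two divisors of a squarefree number. -/
def symDiv (e f : ℕ) : ℕ := e / Nat.gcd e f * (f / Nat.gcd e f)

lemma symDiv_comm (e f : ℕ) : symDiv e f = symDiv f e := by
  simp [symDiv, Nat.gcd_comm, mul_comm]

lemma symDiv_self {e : ℕ} (he : 0 < e) : symDiv e e = 1 := by
  simp [symDiv, Nat.div_self he]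

lemma symDiv_one (e : ℕ) : symDiv e 1 = e := by simp [symDiv]

lemma one_symDiv (e : ℕ) : symDiv 1 e = e := by simp [symDiv]

lemma exists_gcd_decomp {N e f : ℕ} (hN : Squarefree N) (he : e ∣ N) (hf : f ∣ N) :
    ∃ g e' f' m : ℕ, Nat.gcd e f = g ∧ e = g * e' ∧ f = g * f' ∧ symDiv e f = e' * f' ∧
      N = g * e' * f' * m ∧ 0 < g := by
  have hN0 : N ≠ 0 := hN.ne_zero
  have he0 : 0 < e := Nat.pos_of_dvd_of_pos he (Nat.pos_of_ne_zero hN0)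
  have hg : 0 < Nat.gcd e f := Nat.gcd_pos_of_pos_left _ he0
  obtain ⟨e', he'⟩ := Nat.gcd_dvd_left e f
  obtain ⟨f', hf'⟩ := Nat.gcd_dvd_right e f
  have hl : Nat.lcm e f ∣ N := Nat.lcm_dvd he hf
  have h1 : e / Nat.gcd e f = e' := Nat.div_eq_of_eq_mul_right hg he'
  have h2 : f / Nat.gcd e f = f' := Nat.div_eq_of_eq_mul_right hg hf'
  have hlcm : Nat.lcm e f = Nat.gcd e f * e' * f' := by
    rw [Nat.lcm, ← h2, ← he', Nat.mul_div_assoc _ (Nat.gcd_dvd_right e f)]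
  obtain ⟨m, hm⟩ := hl
  exact ⟨_, e', f', m, rfl, he', hf', by rw [symDiv, h1, h2], by rw [← hlcm]; exact hm, hg⟩

lemma symDiv_dvd {N e f : ℕ} (hN : Squarefree N) (he : e ∣ N) (hf : f ∣ N) : symDiv e f ∣ N := by
  obtain ⟨g, e', f', m, -, -, -, hs, hm, -⟩ := exists_gcd_decomp hN he hf
  rw [hs, hm]; exact ⟨g * m, by ring⟩

lemma AL_mul {N e f : ℕ} (hN : Squarefree N) (he : e ∣ N) (hf : f ∣ N) {A B : MZ}
    (hA : A ∈ AL N e) (hB : B ∈ AL N f) :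
    ∃ C ∈ AL N (symDiv e f), A * B = (Nat.gcd e f : ℤ) • C := by
  obtain ⟨g, e', f', m, hg, he', hf', hs, hm, hg0⟩ := exists_gcd_decomp hN he hf
  obtain ⟨a, b, c, d, rfl, hdA⟩ := mem_AL_iff.mp hA
  obtain ⟨a', b', c', d', rfl, hdB⟩ := mem_AL_iff.mp hB
  rw [hg, hs]
  refine ⟨!![(e' * f' : ℕ) * (g * a * a' + m * b * c'), e' * a * b' + f' * b * d';
    N * (f' * c * a' + e' * d * c'), (e' * f' : ℕ) * (m * c * b' + g * d * d')],
    mem_AL_iff.mpr ⟨_, _, _, _, rfl, ?_⟩, ?_⟩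
  · have hgz : (g : ℤ) ≠ 0 := by exact_mod_cast hg0.ne'
    subst he'; subst hf'; subst hm
    push_cast at *
    have key : (g : ℤ) * g * ((e' * f' : ℤ) * (g * a * a' + m * b * c') *
        ((e' * f' : ℤ) * (m * c * b' + g * d * d')) - (e' * a * b' + f' * b * d') *
        (g * e' * f' * m * (f' * c * a' + e' * d * c'))) = g * g * (e' * f') := by
      have := congrArg₂ (· * ·) hdA hdB
      linear_combination this
    exact mul_left_cancel₀ (mul_ne_zero hgz hgz) key
  · subst he'; subst hf'; subst hm
    ext i j
    fin_cases i <;> fin_cases j <;> simp [Matrix.mul_apply, Fin.sum_univ_two] <;> ring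

lemma AL_mul_self {N e : ℕ} (hN : Squarefree N) (he : e ∣ N) {A B : MZ}
    (hA : A ∈ AL N e) (hB : B ∈ AL N e) : ∃ C ∈ AL N 1, A = C * B := by
  have he0 : 0 < e := Nat.pos_of_dvd_of_pos he (Nat.pos_of_ne_zero hN.ne_zero)
  obtain ⟨C, hC, h⟩ := AL_mul hN he he hA (adjugate_mem_AL hB)
  rw [symDiv_self he0] at hC
  rw [Nat.gcd_self] at h
  refine ⟨C, hC, ?_⟩
  have h2 : (e : ℤ) • A = (e : ℤ) • (C * B) := by
    rw [← Matrix.smul_mul, ← h, Matrix.mul_assoc, Matrix.adjugate_mul, hB.2.2.2,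
      Matrix.mul_smul, Matrix.mul_one]
  have hez : (e : ℤ) ≠ 0 := by exact_mod_cast he0.ne'
  exact smul_right_injective _ hez h2

lemma one_mem_AL (N : ℕ) : (1 : MZ) ∈ AL N 1 := by simp [AL]

lemma AL_one_mul {N e : ℕ} {A C : MZ} (hA : A ∈ AL N e) (hC : C ∈ AL N 1)
    (hN : Squarefree N) (he : e ∣ N) : C * A ∈ AL N e := by
  obtain ⟨D, hD, h⟩ := AL_mul hN (one_dvd N) he hC hA
  rw [one_symDiv] at hD
  simp at h
  rwa [h]

lemma AL_mul_one {N e : ℕ} {A C : MZ} (hA : A ∈ AL N e) (hC : C ∈ AL N 1)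
    (hN : Squarefree N) (he : e ∣ N) : A * C ∈ AL N e := by
  obtain ⟨D, hD, h⟩ := AL_mul hN he (one_dvd N) hA hC
  rw [symDiv_one] at hD
  simp at h
  rwa [h]

lemma exists_mem_AL {N e : ℕ} (hN : Squarefree N) (he : e ∣ N) : ∃ A, A ∈ AL N e := by
  obtain ⟨m, rfl⟩ := he
  have hc : IsCoprime (e : ℤ) (m : ℤ) := by
    rw [Nat.isCoprime_iff_coprime]
    exact Nat.coprime_of_squarefree_mul hN
  obtain ⟨u, v, h⟩ := hc
  refine ⟨!![e * 1, -v; (e * m : ℕ) * 1, e * u], mem_AL_iff.mpr ⟨1, -v, 1, u, rfl, ?_⟩⟩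
  push_cast
  linear_combination (e : ℤ) * h

/-- Every element of `SL₂(ℤ)` is an Atkin–Lehner matrix up to an upper triangular factor. -/
lemma exists_AL_of_det_one {N : ℕ} (hN : Squarefree N) {γ : MZ} (hγ : γ.det = 1) :
    ∃ e u : ℤ, ∃ e' : ℕ, (e' : ℤ) = e ∧ e' ∣ N ∧ γ * !![e, -u; 0, 1] ∈ AL N e' := by
  set f := Int.gcd (γ 1 0) N with hf
  have hfN : f ∣ N := by
    have : (f : ℤ) ∣ N := Int.gcd_dvd_right ..
    exact_mod_cast this
  obtain ⟨e, he⟩ := hfN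
  have hcop : Int.gcd (γ 1 0) e = 1 := by
    have h1 : Int.gcd (γ 1 0) e ∣ f := by
      apply Nat.dvd_of_mod_eq_zero
      apply Nat.mod_eq_zero_of_dvd
      have : ((Int.gcd (γ 1 0) e : ℕ) : ℤ) ∣ f := by
        rw [hf]
        refine Int.dvd_coe_gcd (Int.gcd_dvd_left ..) ?_
        refine (Int.gcd_dvd_right ..).trans ?_
        exact_mod_cast Dvd.intro_left _ he.symm
      exact_mod_cast this
    have h2 : Int.gcd (γ 1 0) e ∣ e := by
      have : ((Int.gcd (γ 1 0) e : ℕ) : ℤ) ∣ (e : ℤ) := Int.gcd_dvd_right ..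
      exact_mod_cast this
    have h3 : Int.gcd (γ 1 0) e * Int.gcd (γ 1 0) e ∣ N := by
      rw [he]; exact mul_dvd_mul h1 h2
    exact Nat.isUnit_iff.mp (hN _ h3)
  have hco : IsCoprime (γ 1 0) (e : ℤ) := Int.isCoprime_iff_gcd_eq_one.mpr hcop
  obtain ⟨u, v, huv⟩ := hco
  refine ⟨e, u * γ 1 1, e, rfl, ⟨f, by rw [he, mul_comm]⟩, ?_⟩
  have hfd : (f : ℤ) ∣ γ 1 0 := Int.gcd_dvd_left ..
  rw [Matrix.det_fin_two] at hγ
  refine ⟨?_, ?_, ?_, ?_⟩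
  · simp [Matrix.mul_apply, Fin.sum_univ_two]
  · simp only [Matrix.mul_apply, Fin.sum_univ_two, Matrix.of_apply, Matrix.cons_val_zero,
      Matrix.cons_val_one, Matrix.cons_val', Matrix.cons_val_fin_one, mul_zero, add_zero]
    rw [he]; push_cast
    exact mul_dvd_mul hfd dvd_rfl
  · simp only [Matrix.mul_apply, Fin.sum_univ_two, Matrix.of_apply, Matrix.cons_val_zero,
      Matrix.cons_val_one, Matrix.cons_val', Matrix.cons_val_fin_one, mul_one]
    exact ⟨v * γ 1 1, by linear_combination (-γ 1 1) * huv⟩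
  · rw [Matrix.det_mul, Matrix.det_fin_two γ, hγ]; simp [Matrix.det_fin_two]

open UpperHalfPlane ModularForm in
lemma coe_smul_eq_act (γ : SpecialLinearGroup (Fin 2) ℤ) (τ : ℍ) :
    ((γ • τ : ℍ) : ℂ) = act γ.1 τ := by
  rw [UpperHalfPlane.coe_specialLinearGroup_apply]
  simp [act, den]

lemma atI_basis_mem {s : Set ℂ} : s ∈ atI ↔ ∃ Y : ℝ, ∀ z : ℂ, Y ≤ z.im → z ∈ s := by
  rw [atI, mem_comap]
  constructor
  · rintro ⟨t, ht, hs⟩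
    obtain ⟨Y, hY⟩ := mem_atTop_sets.mp ht
    exact ⟨Y, fun z hz => hs (hY _ hz)⟩
  · rintro ⟨Y, hY⟩
    exact ⟨Set.Ici Y, Ici_mem_atTop Y, fun z hz => hY z hz⟩

lemma UH_mem_atI : UH ∈ atI := atI_basis_mem.mpr ⟨1, fun _ hz => lt_of_lt_of_le one_pos hz⟩

instance : atI.NeBot := by
  rw [neBot_iff]
  intro h
  obtain ⟨Y, hY⟩ := atI_basis_mem.mp (h ▸ mem_bot : (∅ : Set ℂ) ∈ atI)
  exact hY (Y * I) (by simp)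

/-- Affine substitutions `z ↦ (a z + b) / d` preserve the cusp `i∞`. -/
lemma tendsto_affine_atI {a d : ℝ} (ha : 0 < a) (hd : 0 < d) (b : ℝ) :
    Tendsto (fun z : ℂ => (a * z + b) / d) atI atI := by
  rw [atI, tendsto_comap_iff]
  have : (Complex.im ∘ fun z : ℂ => (a * z + b) / d) = fun z => a / d * z.im := by
    ext z
    simp only [Function.comp, Complex.div_ofReal_im, Complex.add_im, Complex.mul_im,
      Complex.ofReal_re, Complex.ofReal_im]
    ring
  rw [this]
  exact (tendsto_comap.const_mul_atTop (by positivity))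

open scoped ModularForm in
/-- A holomorphic function on the upper half-plane that is invariant under `Γ₀(N)` and bounded at
all cusps is constant. -/
theorem liouville {N : ℕ} (hN : Squarefree N) {F : ℂ → ℂ} (hF : DifferentiableOn ℂ F UH)
    (hinv : ∀ γ ∈ AL N 1, ∀ z ∈ UH, F (act γ z) = F z)
    (hb : ∀ e, e ∣ N → ∃ A ∈ AL N e, (fun z => F (act A z)) =O[atI] (fun _ => (1 : ℝ))) :
    ∃ c, ∀ z ∈ UH, F z = c := by
  have : NeZero N := ⟨hN.ne_zero⟩
  let f : ModularForm ((CongruenceSubgroup.Gamma0 N : Subgroup (SpecialLinearGroup (Fin 2) ℤ)) :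
      Subgroup (GL (Fin 2) ℝ)) 0 :=
    { toFun := fun τ => F τ
      slash_action_eq' := by
        rintro A ⟨γ, hγ, rfl⟩
        ext τ
        have : (γ : MZ) ∈ AL N 1 := by
          rw [AL_one_iff]
          refine ⟨?_, by simp [γ.2]⟩
          have := CongruenceSubgroup.Gamma0_mem.mp hγ
          exact (ZMod.intCast_zmod_eq_zero_iff_dvd _ _).mp this
        have h := hinv _ this τ τ.2
        rw [← coe_smul_eq_act] at h
        change ((fun τ : UpperHalfPlane => F τ) ∣[(0 : ℤ)] γ) τ = _
        rw [ModularForm.SL_slash_apply]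
        simpa using h
      holo' := by
        rw [UpperHalfPlane.mdifferentiable_iff]
        refine hF.congr fun z hz => ?_
        have hz' : 0 < z.im := hz
        simp [UpperHalfPlane.ofComplex_apply_of_im_pos hz']
      bdd_at_cusps' := by
        intro c hc
        rw [Subgroup.IsArithmetic.isCusp_iff_isCusp_SL2Z] at hc
        rw [OnePoint.isBoundedAt_iff_forall_SL2Z hc]
        intro γ _
        obtain ⟨e, u, e', he, hdvd, hmem⟩ := exists_AL_of_det_one hN γ.2
        obtain ⟨A, hA, hbd⟩ := hb e' hdvd
        obtain ⟨C, hC, hCA⟩ := AL_mul_self hN hdvd hmem hA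
        have he0 : 0 < e' := Nat.pos_of_dvd_of_pos hdvd (Nat.pos_of_ne_zero hN.ne_zero)
        have hlim := tendsto_affine_atI (a := 1) (d := e') one_pos (by exact_mod_cast he0) u
        have hbd' := hbd.comp_tendsto hlim
        obtain ⟨K, hK⟩ := hbd'.bound
        obtain ⟨Y, hY⟩ := atI_basis_mem.mp hK
        rw [UpperHalfPlane.isBoundedAtImInfty_iff]
        refine ⟨K, Y, fun τ hτ => ?_⟩
        have h1 := hY τ hτ
        rw [ModularForm.SL_slash_apply]
        have hw : ((1 : ℝ) * (τ : ℂ) + (u : ℝ)) / ((e' : ℝ) : ℂ) ∈ UH := by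
          have : 0 < (τ : ℂ).im := τ.2
          have h2 : (0 : ℝ) < e' := by exact_mod_cast he0
          show 0 < Complex.im _
          rw [Complex.div_ofReal_im]
          simp only [Complex.add_im, Complex.mul_im, Complex.ofReal_im,
            Complex.ofReal_one, Complex.one_re, Complex.one_im]
          have := UpperHalfPlane.coe_im τ
          rw [this]
          have := τ.im_pos
          simp; positivity
        have hez : (e : ℂ) = e' := by rw [← he]; simp
        have hez0 : (e : ℂ) ≠ 0 := by rw [hez]; exact_mod_cast he0.ne'
        have h3 : ((γ • τ : UpperHalfPlane) : ℂ)
            = act C (act A (((1 : ℝ) * (τ : ℂ) + (u : ℝ)) / ((e' : ℝ) : ℂ))) := by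
          rw [← act_mul (AL.det_pos one_pos hC) (AL.det_pos he0 hA) hw, ← hCA,
            act_mul (by rw [γ.2]; exact one_pos) (by simp [Matrix.det_fin_two, ← he, he0]) hw,
            coe_smul_eq_act]
          congr 1
          simp only [act, den, Matrix.of_apply, Matrix.cons_val_zero, Matrix.cons_val_one,
            Matrix.cons_val', Matrix.cons_val_fin_one]
          push_cast
          have h0 : (e' : ℂ) ≠ 0 := by exact_mod_cast he0.ne'
          simp only [hez]
          linear_combination (-((τ : ℂ) + u)) * mul_inv_cancel₀ h0
        have h4 : F ((γ • τ : UpperHalfPlane) : ℂ) = F (act A (((1 : ℝ) * (τ : ℂ) + (u : ℝ)) / ((e' : ℝ) : ℂ))) := by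
          rw [h3, hinv C hC _ (act_mem (AL.det_pos he0 hA) hw)]
        simp only [Function.comp, Set.mem_ofPred_eq, norm_one, mul_one] at h1
        simp only [neg_zero, zpow_zero, mul_one]
        rw [h4]
        exact h1 }
  obtain ⟨c, hc⟩ := ModularForm.eq_const_of_weight_zero f
  exact ⟨c, fun z hz => congrFun hc ⟨z, hz⟩⟩

lemma qc_eq_qParam (z : ℂ) : qc z = Function.Periodic.qParam 1 z := by
  simp [qc, Function.Periodic.qParam]

lemma qc_ne_zero (z : ℂ) : qc z ≠ 0 := Complex.exp_ne_zero _

lemma qc_add (z w : ℂ) : qc (z + w) = qc z * qc w := by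
  simp only [qc, mul_add, Complex.exp_add]

lemma qc_int (n : ℤ) : qc n = 1 := by
  rw [qc, Complex.exp_eq_one_iff]; exact ⟨n, by ring⟩

lemma qc_add_int (z : ℂ) (n : ℤ) : qc (z + n) = qc z := by rw [qc_add, qc_int, mul_one]

lemma qc_nat_mul (n : ℕ) (z : ℂ) : qc (n * z) = qc z ^ n := by
  rw [qc, qc, ← Complex.exp_nat_mul]; congr 1; ring

lemma qc_int_mul (n : ℤ) (z : ℂ) : qc (n * z) = qc z ^ n := by
  rw [qc, qc, ← Complex.exp_int_mul]; congr 1; ring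

lemma qc_eq_iff {z w : ℂ} : qc z = qc w ↔ ∃ n : ℤ, z = w + n := by
  rw [qc, qc, Complex.exp_eq_exp_iff_exists_int]
  have h : (2 * Real.pi * I : ℂ) ≠ 0 := Complex.two_pi_I_ne_zero
  constructor
  · rintro ⟨n, hn⟩
    exact ⟨n, mul_left_cancel₀ h (by rw [hn]; ring)⟩
  · rintro ⟨n, rfl⟩
    exact ⟨n, by ring⟩

lemma norm_qc (z : ℂ) : ‖qc z‖ = Real.exp (-2 * Real.pi * z.im) := by
  rw [qc_eq_qParam, Function.Periodic.norm_qParam]; simp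

lemma norm_qc_lt_one {z : ℂ} (hz : z ∈ UH) : ‖qc z‖ < 1 := by
  rw [qc_eq_qParam]; exact Function.Periodic.norm_qParam_lt_one one_pos hz

lemma differentiable_qc : Differentiable ℂ qc := by unfold qc; fun_prop

lemma tendsto_qc : Tendsto qc atI (𝓝[≠] 0) := by
  have := Function.Periodic.qParam_tendsto (h := 1) one_pos
  exact this.congr fun z => (qc_eq_qParam z).symm

lemma tendsto_qc_nhds : Tendsto qc atI (𝓝 0) := tendsto_qc.mono_right nhdsWithin_le_nhds

lemma exists_qc_eq {q : ℂ} (hq : q ≠ 0) (hq1 : ‖q‖ < 1) : ∃ z ∈ UH, qc z = q := by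
  refine ⟨Function.Periodic.invQParam 1 q, ?_, ?_⟩
  · show 0 < Complex.im _
    rw [Function.Periodic.im_invQParam]
    have := Real.log_neg (norm_pos_iff.mpr hq) hq1
    have := Real.pi_pos
    have h : -(1 : ℝ) / (2 * Real.pi) < 0 := div_neg_of_neg_of_pos (by norm_num) (by positivity)
    exact mul_pos_of_neg_of_neg h (by assumption)
  · rw [qc_eq_qParam, Function.Periodic.qParam_right_inv one_ne_zero hq]

/-- A periodic function bounded at `i∞` is holomorphic in `q`. -/
theorem exists_qexp {F : ℂ → ℂ} (hF : DifferentiableOn ℂ F UH)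
    (hper : ∀ z ∈ UH, F (z + 1) = F z) (hb : F =O[atI] (fun _ => (1 : ℝ))) :
    ∃ h : ℂ → ℂ, DifferentiableOn ℂ h (Metric.ball 0 1) ∧ ∀ z ∈ UH, F z = h (qc z) := by
  classical
  set f : ℂ → ℂ := fun z => if 0 < z.im then F z else 0 with hf
  have hfF : ∀ z ∈ UH, f z = F z := fun z hz => if_pos hz
  have hp : Function.Periodic f ((1 : ℝ) : ℂ) := by
    intro z
    have him : (z + ((1 : ℝ) : ℂ)).im = z.im := by simp
    simp only [hf, him]
    split_ifs with h
    · simpa using hper z h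
    · rfl
  have hd : ∀ z ∈ UH, DifferentiableAt ℂ f z := by
    intro z hz
    have h1 := hF.differentiableAt (isOpen_UH.mem_nhds hz)
    refine h1.congr_of_eventuallyEq ?_
    filter_upwards [isOpen_UH.mem_nhds hz] with w hw using hfF w hw
  have hev : ∀ᶠ z in comap Complex.im atTop, DifferentiableAt ℂ f z := by
    filter_upwards [UH_mem_atI] with z hz using hd z hz
  have hbd : BoundedAtFilter (comap Complex.im atTop) f := by
    have : f =O[atI] (fun _ => (1 : ℝ)) := hb.congr' (by
      filter_upwards [UH_mem_atI] with z hz using (hfF z hz).symm) (EventuallyEq.refl _ _)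
    exact this
  refine ⟨Function.Periodic.cuspFunction 1 f, ?_, ?_⟩
  · intro q hq
    apply DifferentiableAt.differentiableWithinAt
    by_cases h0 : q = 0
    · rw [h0]; exact Function.Periodic.differentiableAt_cuspFunction_zero one_pos hp hev hbd
    · obtain ⟨z, hz, rfl⟩ := exists_qc_eq h0 (mem_ball_zero_iff.mp hq)
      rw [qc_eq_qParam]
      exact Function.Periodic.differentiableAt_cuspFunction one_ne_zero hp (hd z hz)
  · intro z hz
    rw [qc_eq_qParam, Function.Periodic.eq_cuspFunction one_ne_zero hp, hfF z hz]

lemma tendsto_qexp {h : ℂ → ℂ} (hh : DifferentiableOn ℂ h (Metric.ball 0 1)) :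
    Tendsto (fun z => h (qc z)) atI (𝓝 (h 0)) :=
  ((hh.differentiableAt (Metric.ball_mem_nhds 0 one_pos)).continuousAt.tendsto).comp tendsto_qc_nhds

/-- Integral matrices of fixed determinant moving a bounded region to itself are finite in
number. -/
lemma finite_matrices (n : ℤ) (hn : 0 < n) {δ M : ℝ} (hδ : 0 < δ) :
    {A : MZ | A.det = n ∧ ∃ u : ℂ, δ ≤ u.im ∧ ‖u‖ ≤ M ∧ δ ≤ (act A u).im ∧ ‖act A u‖ ≤ M}.Finite := by
  obtain ⟨K, hK⟩ : ∃ K : ℝ, K = Real.sqrt (n * M / δ) := ⟨_, rfl⟩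
  have hK0 : 0 ≤ K := hK ▸ Real.sqrt_nonneg _
  obtain ⟨B, hB⟩ : ∃ B : ℝ, B = K / δ + (K + K / δ * M) + (M * K / δ) + (M * K + M * K / δ * M) :=
    ⟨_, rfl⟩
  have hfin : {A : MZ | ∀ i, A i ∈ {f : Fin 2 → ℤ | ∀ j, f j ∈ Set.Icc (-⌈B⌉) ⌈B⌉}}.Finite :=
    Set.Finite.pi' fun _ => Set.Finite.pi' fun _ => Set.finite_Icc _ _
  refine hfin.subset ?_
  rintro A ⟨hdet, u, hu1, hu2, hu3, hu4⟩
  have hdet0 : 0 < A.det := by rw [hdet]; exact hn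
  have hu : u ∈ UH := lt_of_lt_of_le hδ hu1
  have hne := den_ne_zero hdet0 hu
  have hM : 0 ≤ M := (norm_nonneg u).trans hu2
  have him : u.im ≤ M := (Complex.im_le_norm u).trans hu2
  have hnp : (0 : ℝ) < n := by exact_mod_cast hn
  have hden : ‖den A u‖ ≤ K := by
    rw [hK]
    apply Real.le_sqrt_of_sq_le
    rw [← Complex.normSq_eq_norm_sq]
    rw [im_act, hdet, le_div_iff₀ (Complex.normSq_pos.mpr hne)] at hu3
    rw [le_div_iff₀ hδ]
    nlinarith
  have hnum : ‖(A 0 0 * u + A 0 1 : ℂ)‖ ≤ M * K := by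
    have : (A 0 0 * u + A 0 1 : ℂ) = act A u * den A u := by
      rw [act]; field_simp
    rw [this, norm_mul]
    exact mul_le_mul hu4 hden (norm_nonneg _) hM
  have key : ∀ (c d : ℤ) (L : ℝ), ‖(c * u + d : ℂ)‖ ≤ L → |(c : ℝ)| ≤ L / δ ∧ |(d : ℝ)| ≤ L + L / δ * M := by
    intro c d L hL
    have h1 : |(c : ℝ)| ≤ L / δ := by
      rw [le_div_iff₀ hδ]
      have := (Complex.abs_im_le_norm (c * u + d : ℂ)).trans hL
      simp only [Complex.add_im, Complex.mul_im, Complex.intCast_re, Complex.intCast_im,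
        zero_mul, add_zero] at this
      rw [abs_mul, abs_of_pos (lt_of_lt_of_le hδ hu1)] at this
      exact (mul_le_mul_of_nonneg_left hu1 (abs_nonneg _)).trans this
    refine ⟨h1, ?_⟩
    have h2 : (d : ℂ) = (c * u + d) - c * u := by ring
    have h3 : ‖(d : ℂ)‖ = |(d : ℝ)| := by simp
    have h4 : ‖(c : ℂ)‖ = |(c : ℝ)| := by simp
    rw [← h3, h2]
    refine (norm_sub_le _ _).trans (add_le_add hL ?_)
    rw [norm_mul, h4]
    exact mul_le_mul h1 hu2 (norm_nonneg _) (le_trans (abs_nonneg _) h1)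
  obtain ⟨h1, h2⟩ := key _ _ _ hden
  obtain ⟨h3, h4⟩ := key _ _ _ hnum
  have p1 : 0 ≤ K / δ := by positivity
  have p2 : 0 ≤ K + K / δ * M := by positivity
  have p3 : 0 ≤ M * K / δ := by positivity
  have p4 : 0 ≤ M * K + M * K / δ * M := by positivity
  have fin : ∀ c : ℤ, |(c : ℝ)| ≤ B → c ∈ Set.Icc (-⌈B⌉) ⌈B⌉ := by
    intro c hc
    have hc' : |(c : ℝ)| ≤ ⌈B⌉ := hc.trans (Int.le_ceil B)
    rw [abs_le] at hc'
    constructor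
    · exact_mod_cast hc'.1
    · exact_mod_cast hc'.2
  intro i j
  apply fin
  fin_cases i <;> fin_cases j <;> simp only [Fin.zero_eta, Fin.mk_one, Fin.isValue] <;> linarith

/-- Every point is the image of a point of bounded height under some Atkin–Lehner matrix. -/
lemma exists_AL_high {N : ℕ} (hN : Squarefree N) {z : ℂ} (hz : z ∈ UH) :
    ∃ e, e ∣ N ∧ ∃ A ∈ AL N e, ∃ v ∈ UH, z = act A v ∧ 1 / (2 * N : ℝ) ≤ v.im := by
  obtain ⟨g, hg⟩ := ModularGroup.exists_smul_mem_fd ⟨z, hz⟩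
  have h3 := ModularGroup.three_le_four_mul_im_sq_of_mem_fd hg
  set τ : UpperHalfPlane := g • ⟨z, hz⟩ with hτ
  have hzτ : z = act (g⁻¹).1 τ := by
    rw [← coe_smul_eq_act, hτ, inv_smul_smul]
  have him : 1 / 2 ≤ (τ : ℂ).im := by
    have := τ.im_pos
    rw [UpperHalfPlane.coe_im]
    nlinarith
  have hτU : (τ : ℂ) ∈ UH := τ.2
  obtain ⟨e, u, e', he, hdvd, hmem⟩ := exists_AL_of_det_one hN (g⁻¹).2
  have he0 : 0 < e' := Nat.pos_of_dvd_of_pos hdvd (Nat.pos_of_ne_zero hN.ne_zero)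
  have hle : (e' : ℝ) ≤ N := by exact_mod_cast Nat.le_of_dvd (Nat.pos_of_ne_zero hN.ne_zero) hdvd
  have he0' : (0 : ℝ) < e' := by exact_mod_cast he0
  have hvim : (((τ : ℂ) + u) / e').im = (τ : ℂ).im / e' := by
    rw [show ((e' : ℂ)) = ((e' : ℝ) : ℂ) by simp, Complex.div_ofReal_im]; simp
  have hv : ((τ : ℂ) + u) / e' ∈ UH := by
    show 0 < Complex.im _
    rw [hvim]; positivity
  refine ⟨e', hdvd, _, hmem, ((τ : ℂ) + u) / e', hv, ?_, ?_⟩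
  · rw [act_mul (by rw [(g⁻¹).2]; exact one_pos) (by simp [Matrix.det_fin_two, ← he, he0]) hv, hzτ]
    congr 1
    have h0 : (e' : ℂ) ≠ 0 := by exact_mod_cast he0.ne'
    simp only [act, den, Matrix.of_apply, Matrix.cons_val_zero, Matrix.cons_val_one,
      Matrix.cons_val', Matrix.cons_val_fin_one, ← he]
    push_cast
    linear_combination (-((τ : ℂ) + u)) * mul_inv_cancel₀ h0
  · rw [hvim, div_le_div_iff₀ (by linarith) he0']
    nlinarith

lemma isPreconnected_UH : IsPreconnected UH := (convex_halfSpace_im_gt 0).isPreconnected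

lemma analyticOnNhd_UH {F : ℂ → ℂ} (hF : DifferentiableOn ℂ F UH) : AnalyticOnNhd ℂ F UH :=
  hF.analyticOnNhd isOpen_UH

lemma eqOn_of_eventuallyEq_atI {F G : ℂ → ℂ} (hF : DifferentiableOn ℂ F UH)
    (hG : DifferentiableOn ℂ G UH) (h : F =ᶠ[atI] G) : Set.EqOn F G UH := by
  obtain ⟨Y, hY⟩ := atI_basis_mem.mp h
  have hz : ((|Y| + 1 : ℝ) * I : ℂ) ∈ UH := by
    show 0 < Complex.im _
    simp; positivity
  refine (analyticOnNhd_UH hF).eqOn_of_preconnected_of_eventuallyEq (analyticOnNhd_UH hG)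
    isPreconnected_UH hz ?_
  have hop : IsOpen {z : ℂ | Y < z.im} := isOpen_lt continuous_const Complex.continuous_im
  filter_upwards [hop.mem_nhds (show Y < (((|Y| + 1 : ℝ) * I : ℂ)).im by
    simp; linarith [le_abs_self Y])] with w hw using hY w (le_of_lt hw)

lemma symDiv_ne_one {e f : ℕ} (hef : e ≠ f) : symDiv e f ≠ 1 := by
  intro h
  have h1 := Nat.eq_one_of_mul_eq_one_right h
  have h2 := Nat.eq_one_of_mul_eq_one_left h
  have h3 := Nat.div_mul_cancel (Nat.gcd_dvd_left e f)
  have h4 := Nat.div_mul_cancel (Nat.gcd_dvd_right e f)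
  rw [h1] at h3
  rw [h2] at h4
  exact hef (h3.symm.trans h4)

/-- A Hauptmodul of `Γ₀(N)` with a simple pole at `i∞` and expansion `q⁻¹ + g(q)`, `g(0) = 0`. -/
structure Haupt (N : ℕ) (t g : ℂ → ℂ) : Prop where
  sqf : Squarefree N
  diff : DifferentiableOn ℂ t UH
  inv : ∀ γ ∈ AL N 1, ∀ z ∈ UH, t (act γ z) = t z
  g_diff : DifferentiableOn ℂ g (Metric.ball 0 1)
  g_zero : g 0 = 0
  expand : ∀ z ∈ UH, t z = (qc z)⁻¹ + g (qc z)
  bdd : ∀ e, e ∣ N → e ≠ 1 → ∃ A ∈ AL N e, (fun z => t (act A z)) =O[atI] (fun _ => (1 : ℝ))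

open Classical in
/-- A representative Atkin–Lehner matrix. -/
def rep (N e : ℕ) : MZ := if h : ∃ A, A ∈ AL N e then h.choose else 1

lemma rep_mem {N e : ℕ} (hN : Squarefree N) (he : e ∣ N) : rep N e ∈ AL N e := by
  have h := exists_mem_AL hN he
  rw [rep, dif_pos h]
  exact h.choose_spec

/-- The function `t` at the cusp belonging to `e`. -/
def te (N : ℕ) (t : ℂ → ℂ) (e : ℕ) (z : ℂ) : ℂ := t (act (rep N e) z)

/-- The value of `t` at the cusp belonging to `e`. -/
def xe (N : ℕ) (t : ℂ → ℂ) (e : ℕ) : ℂ := limUnder atI (te N t e)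

namespace Haupt

variable {N : ℕ} {t g : ℂ → ℂ}

lemma pos (H : Haupt N t g) : 0 < N := Nat.pos_of_ne_zero H.sqf.ne_zero

lemma dvd_pos (H : Haupt N t g) {e : ℕ} (he : e ∣ N) : 0 < e := Nat.pos_of_dvd_of_pos he H.pos

lemma te_eq (H : Haupt N t g) {e : ℕ} (he : e ∣ N) {A : MZ} (hA : A ∈ AL N e) {z : ℂ}
    (hz : z ∈ UH) : t (act A z) = te N t e z := by
  obtain ⟨C, hC, h⟩ := AL_mul_self H.sqf he hA (rep_mem H.sqf he)
  have hd := AL.det_pos (H.dvd_pos he) (rep_mem H.sqf he)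
  rw [h, act_mul (AL.det_pos one_pos hC) hd hz, H.inv C hC _ (act_mem hd hz), te]

lemma te_one (H : Haupt N t g) {z : ℂ} (hz : z ∈ UH) : te N t 1 z = t z := by
  rw [← H.te_eq (one_dvd N) (one_mem_AL N) hz, act_one]

lemma te_diff (H : Haupt N t g) {e : ℕ} (he : e ∣ N) : DifferentiableOn ℂ (te N t e) UH :=
  DifferentiableOn.comp_act H.diff (AL.det_pos (H.dvd_pos he) (rep_mem H.sqf he))

lemma te_act (H : Haupt N t g) {e f : ℕ} (he : e ∣ N) (hf : f ∣ N) {B : MZ} (hB : B ∈ AL N f)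
    {z : ℂ} (hz : z ∈ UH) : te N t e (act B z) = te N t (symDiv e f) z := by
  obtain ⟨C, hC, h⟩ := AL_mul H.sqf he hf (rep_mem H.sqf he) hB
  have hd := AL.det_pos (H.dvd_pos he) (rep_mem H.sqf he)
  rw [te, ← act_mul hd (AL.det_pos (H.dvd_pos hf) hB) hz, h, act_smul,
    H.te_eq (symDiv_dvd H.sqf he hf) hC hz]
  exact_mod_cast (Nat.gcd_pos_of_pos_left _ (H.dvd_pos he)).ne'

lemma te_inv (H : Haupt N t g) {e : ℕ} (he : e ∣ N) {γ : MZ} (hγ : γ ∈ AL N 1)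
    {z : ℂ} (hz : z ∈ UH) : te N t e (act γ z) = te N t e z := by
  rw [H.te_act he (one_dvd N) hγ hz, symDiv_one]

lemma translate_mem (N : ℕ) (n : ℤ) : (!![1, n; 0, 1] : MZ) ∈ AL N 1 := by
  simp [AL, Matrix.det_fin_two]

lemma act_translate (n : ℤ) (z : ℂ) : act !![1, n; 0, 1] z = z + n := by
  simp [act, den]

lemma te_add_int (H : Haupt N t g) {e : ℕ} (he : e ∣ N) {z : ℂ} (hz : z ∈ UH) (n : ℤ) :
    te N t e (z + n) = te N t e z := by
  rw [← act_translate, H.te_inv he (translate_mem N n) hz]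

lemma te_bdd (H : Haupt N t g) {e : ℕ} (he : e ∣ N) (he1 : e ≠ 1) :
    te N t e =O[atI] (fun _ => (1 : ℝ)) := by
  obtain ⟨A, hA, h⟩ := H.bdd e he he1
  refine h.congr' ?_ (EventuallyEq.refl _ _)
  filter_upwards [UH_mem_atI] with z hz using H.te_eq he hA hz

lemma te_qexp (H : Haupt N t g) {e : ℕ} (he : e ∣ N) (he1 : e ≠ 1) :
    ∃ h : ℂ → ℂ, DifferentiableOn ℂ h (Metric.ball 0 1) ∧ (∀ z ∈ UH, te N t e z = h (qc z)) ∧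
      h 0 = xe N t e := by
  obtain ⟨h, h1, h2⟩ := exists_qexp (H.te_diff he)
    (fun z hz => by simpa using H.te_add_int he hz 1) (H.te_bdd he he1)
  refine ⟨h, h1, h2, ?_⟩
  have : Tendsto (te N t e) atI (𝓝 (h 0)) := by
    refine (tendsto_qexp h1).congr' ?_
    filter_upwards [UH_mem_atI] with z hz using (h2 z hz).symm
  exact this.limUnder_eq.symm

lemma tendsto_te (H : Haupt N t g) {e : ℕ} (he : e ∣ N) (he1 : e ≠ 1) :
    Tendsto (te N t e) atI (𝓝 (xe N t e)) := by
  obtain ⟨h, h1, h2, h3⟩ := H.te_qexp he he1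
  rw [← h3]
  refine (tendsto_qexp h1).congr' ?_
  filter_upwards [UH_mem_atI] with z hz using (h2 z hz).symm

/-- `q t = 1 + q g(q)`. -/
lemma qc_mul_t (H : Haupt N t g) {z : ℂ} (hz : z ∈ UH) :
    qc z * t z = 1 + qc z * g (qc z) := by
  rw [H.expand z hz]; field_simp [qc_ne_zero z]

lemma tendsto_qc_mul_t (H : Haupt N t g) : Tendsto (fun z => qc z * t z) atI (𝓝 1) := by
  have h : Tendsto (fun z => 1 + qc z * g (qc z)) atI (𝓝 (1 + 0 * g 0)) :=
    tendsto_const_nhds.add (tendsto_qc_nhds.mul (tendsto_qexp H.g_diff))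
  rw [zero_mul, add_zero] at h
  refine h.congr' ?_
  filter_upwards [UH_mem_atI] with z hz using (H.qc_mul_t hz).symm

lemma t_isBigO (H : Haupt N t g) : t =O[atI] (fun z => (qc z)⁻¹) := by
  have h := (H.tendsto_qc_mul_t.isBigO_one ℂ).mul (isBigO_refl (fun z => (qc z)⁻¹) atI)
  refine (h.congr' ?_ ?_)
  · filter_upwards with z
    field_simp [qc_ne_zero z]
  · filter_upwards with z
    simp

lemma tendsto_t (H : Haupt N t g) : Tendsto (fun z => ‖t z‖) atI atTop := by
  have h1 : Tendsto (fun z => ‖(qc z)⁻¹‖) atI atTop :=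
    tendsto_norm_inv_nhdsNE_zero_atTop.comp tendsto_qc
  have h2 := h1.atTop_mul_pos one_pos (by simpa using H.tendsto_qc_mul_t.norm)
  refine h2.congr fun z => ?_
  rw [← norm_mul, ← norm_mul, inv_mul_cancel_left₀ (qc_ne_zero z)]

lemma t_ne_eventually (H : Haupt N t g) (x : ℂ) : ∀ᶠ z in atI, t z ≠ x := by
  filter_upwards [H.tendsto_t.eventually_gt_atTop ‖x‖] with z hz h
  rw [h] at hz; exact lt_irrefl _ hz

lemma te_sub_isBigO (H : Haupt N t g) {e : ℕ} (he : e ∣ N) (he1 : e ≠ 1) :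
    (fun z => te N t e z - xe N t e) =O[atI] qc := by
  obtain ⟨h, h1, h2, h3⟩ := H.te_qexp he he1
  have h4 := (h1.differentiableAt (Metric.ball_mem_nhds 0 one_pos)).isBigO_sub
  have h5 := h4.comp_tendsto tendsto_qc_nhds
  refine h5.congr' ?_ (by filter_upwards with z; simp)
  filter_upwards [UH_mem_atI] with z hz
  simp [h2 z hz, h3]

lemma sub_const_bdd {F : ℂ → ℂ} (hF : F =O[atI] (fun _ => (1 : ℝ))) (x : ℂ) :
    (fun z => F z - x) =O[atI] (fun _ => (1 : ℝ)) :=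
  hF.sub (isBigO_const_const x one_ne_zero atI)

lemma t_sub_isBigO (H : Haupt N t g) (x : ℂ) :
    (fun z => t z - x) =O[atI] (fun z => (qc z)⁻¹) := by
  refine H.t_isBigO.sub ?_
  have : (fun _ : ℂ => (1 : ℂ)) =O[atI] (fun z => (qc z)⁻¹) := by
    refine IsBigO.of_bound 1 ?_
    filter_upwards [UH_mem_atI] with z hz
    rw [norm_one, one_mul, norm_inv]
    exact (one_le_inv₀ (norm_pos_iff.mpr (qc_ne_zero z))).mpr (norm_qc_lt_one hz).le
  exact (isBigO_const_const x one_ne_zero atI).trans this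

/-- The Fricke-type relation between `t` and its transform at another cusp. -/
theorem moebius_relation (H : Haupt N t g) {e : ℕ} (he : e ∣ N) (he1 : e ≠ 1) :
    ∃ ν : ℂ, ν ≠ 0 ∧ ∀ z ∈ UH, (t z - xe N t e) * (te N t e z - xe N t e) = ν := by
  have hprod : (fun z => (t z - xe N t e) * (te N t e z - xe N t e)) =O[atI]
      (fun _ => (1 : ℝ)) := by
    refine ((H.t_sub_isBigO (xe N t e)).mul (H.te_sub_isBigO he he1)).trans ?_
    refine IsBigO.of_bound 1 ?_
    filter_upwards with z
    rw [inv_mul_cancel₀ (qc_ne_zero z)]; simp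
  have hdiff : DifferentiableOn ℂ (fun z => (t z - xe N t e) * (te N t e z - xe N t e)) UH :=
    (H.diff.sub_const _).mul ((H.te_diff he).sub_const _)
  obtain ⟨ν, hν⟩ := liouville H.sqf hdiff (fun γ hγ z hz => by
      simp only [H.inv γ hγ z hz, H.te_inv he hγ hz]) (fun f hf => by
    refine ⟨rep N f, rep_mem H.sqf hf, ?_⟩
    have hA := rep_mem H.sqf hf
    by_cases hf1 : f = 1
    · subst hf1
      refine hprod.congr' ?_ (EventuallyEq.refl _ _)
      filter_upwards [UH_mem_atI] with z hz
      rw [H.inv _ hA z hz, H.te_inv he hA hz]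
    by_cases hfe : f = e
    · subst hfe
      refine hprod.congr' ?_ (EventuallyEq.refl _ _)
      filter_upwards [UH_mem_atI] with z hz
      rw [H.te_eq hf hA hz, H.te_act hf hf hA hz, symDiv_self (H.dvd_pos hf), H.te_one hz, mul_comm]
    · have h1 := sub_const_bdd (H.te_bdd hf hf1) (xe N t e)
      have h2 := sub_const_bdd (H.te_bdd (symDiv_dvd H.sqf he hf)
        (symDiv_ne_one (Ne.symm hfe))) (xe N t e)
      have h3 := h1.mul h2
      refine h3.congr' ?_ (by filter_upwards with z; simp)
      filter_upwards [UH_mem_atI] with z hz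
      rw [H.te_eq hf hA hz, H.te_act he hf hA hz])
  refine ⟨ν, ?_, hν⟩
  rintro rfl
  have h1 : te N t e =ᶠ[atI] fun _ => xe N t e := by
    filter_upwards [UH_mem_atI, H.t_ne_eventually (xe N t e)] with z hz hne
    rcases mul_eq_zero.mp (hν z hz) with h | h
    · exact absurd (sub_eq_zero.mp h) hne
    · exact sub_eq_zero.mp h
  have h2 := eqOn_of_eventuallyEq_atI (H.te_diff he) (differentiableOn_const _) h1
  obtain ⟨z, hne, hz⟩ := ((H.t_ne_eventually (xe N t e)).and UH_mem_atI).exists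
  apply hne
  have hA := rep_mem H.sqf he
  have := h2 (act_mem (AL.det_pos (H.dvd_pos he) hA) hz)
  rwa [H.te_act he he hA hz, symDiv_self (H.dvd_pos he), H.te_one hz] at this

/-- The constant of the relation between `t` and `te e`. -/
def nu (N : ℕ) (t : ℂ → ℂ) (e : ℕ) : ℂ := (t I - xe N t e) * (te N t e I - xe N t e)

lemma I_mem : I ∈ UH := by show 0 < I.im; simp

lemma nu_spec (H : Haupt N t g) {e : ℕ} (he : e ∣ N) (he1 : e ≠ 1) {z : ℂ} (hz : z ∈ UH) :
    (t z - xe N t e) * (te N t e z - xe N t e) = nu N t e := by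
  obtain ⟨ν, -, h⟩ := H.moebius_relation he he1
  rw [h z hz, nu, h I I_mem]

lemma nu_ne_zero (H : Haupt N t g) {e : ℕ} (he : e ∣ N) (he1 : e ≠ 1) : nu N t e ≠ 0 := by
  obtain ⟨ν, h0, h⟩ := H.moebius_relation he he1
  rw [nu, h I I_mem]; exact h0

lemma t_sub_ne_zero (H : Haupt N t g) {e : ℕ} (he : e ∣ N) (he1 : e ≠ 1) {z : ℂ} (hz : z ∈ UH) :
    t z - xe N t e ≠ 0 := by
  intro h
  have := H.nu_spec he he1 hz
  rw [h, zero_mul] at this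
  exact H.nu_ne_zero he he1 this.symm

lemma te_sub (H : Haupt N t g) {e : ℕ} (he : e ∣ N) (he1 : e ≠ 1) {z : ℂ} (hz : z ∈ UH) :
    te N t e z - xe N t e = nu N t e / (t z - xe N t e) := by
  rw [eq_div_iff (H.t_sub_ne_zero he he1 hz), mul_comm, H.nu_spec he he1 hz]

lemma te_sub_te (H : Haupt N t g) {e : ℕ} (he : e ∣ N) (he1 : e ≠ 1) {z w : ℂ} (hz : z ∈ UH)
    (hw : w ∈ UH) : te N t e z - te N t e w =
      -nu N t e * (t z - t w) / ((t z - xe N t e) * (t w - xe N t e)) := by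
  have h1 := H.t_sub_ne_zero he he1 hz
  have h2 := H.t_sub_ne_zero he he1 hw
  have : te N t e z - te N t e w = (te N t e z - xe N t e) - (te N t e w - xe N t e) := by ring
  rw [this, H.te_sub he he1 hz, H.te_sub he he1 hw]
  field_simp
  ring

lemma xe_ne (H : Haupt N t g) {e f : ℕ} (he : e ∣ N) (he1 : e ≠ 1) (hf : f ∣ N) (hf1 : f ≠ 1)
    (hef : e ≠ f) : xe N t f ≠ xe N t e := by
  intro h
  have hA := rep_mem H.sqf hf
  have h1 : Tendsto (fun z => (te N t f z - xe N t e) * (te N t (symDiv e f) z - xe N t e)) atI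
      (𝓝 ((xe N t f - xe N t e) * (xe N t (symDiv e f) - xe N t e))) :=
    ((H.tendsto_te hf hf1).sub_const _).mul ((H.tendsto_te (symDiv_dvd H.sqf he hf)
      (symDiv_ne_one hef)).sub_const _)
  rw [h, sub_self, zero_mul] at h1
  have h2 : Tendsto (fun _ : ℂ => nu N t e) atI (𝓝 0) := by
    refine h1.congr' ?_
    filter_upwards [UH_mem_atI] with z hz
    rw [← H.nu_spec he he1 (act_mem (AL.det_pos (H.dvd_pos hf) hA) hz), H.te_eq hf hA hz,
      H.te_act he hf hA hz]
  exact H.nu_ne_zero he he1 (tendsto_nhds_unique tendsto_const_nhds h2)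

end Haupt

/-- The real power `q^κ = e^{2πiκz}`. -/
def ex (κ : ℝ) (z : ℂ) : ℂ := Complex.exp (2 * Real.pi * I * (κ * z))

lemma ex_ne_zero (κ : ℝ) (z : ℂ) : ex κ z ≠ 0 := Complex.exp_ne_zero _

lemma ex_add (κ μ : ℝ) (z : ℂ) : ex (κ + μ) z = ex κ z * ex μ z := by
  rw [ex, ex, ex, ← Complex.exp_add]; push_cast; congr 1; ring

lemma ex_zero (z : ℂ) : ex 0 z = 1 := by simp [ex]

lemma ex_int (n : ℤ) (z : ℂ) : ex n z = qc z ^ n := by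
  rw [← qc_int_mul, ex, qc]; push_cast; rfl

lemma ex_one (z : ℂ) : ex 1 z = qc z := by
  have := ex_int 1 z
  simpa using this

lemma ex_neg (κ : ℝ) (z : ℂ) : ex (-κ) z = (ex κ z)⁻¹ := by
  exact eq_inv_of_mul_eq_one_left (by rw [← ex_add, neg_add_cancel, ex_zero])

lemma norm_ex (κ : ℝ) (z : ℂ) : ‖ex κ z‖ = Real.exp (-(2 * Real.pi * κ) * z.im) := by
  rw [ex, Complex.norm_exp]
  congr 1
  simp [Complex.mul_re, Complex.mul_im]
  ring

lemma tendsto_ex {κ : ℝ} (hκ : 0 < κ) : Tendsto (ex κ) atI (𝓝 0) := by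
  rw [tendsto_zero_iff_norm_tendsto_zero]
  simp only [norm_ex]
  refine Real.tendsto_exp_atBot.comp ?_
  have : Tendsto Complex.im atI atTop := tendsto_comap
  refine this.const_mul_atTop_of_neg ?_
  have := Real.pi_pos
  have : 0 < 2 * Real.pi * κ := by positivity
  linarith

/-- `F ~ C q^κ` at `i∞`, with `C ≠ 0`. -/
def Asy (F : ℂ → ℂ) (κ : ℝ) (C : ℂ) : Prop :=
  C ≠ 0 ∧ Tendsto (fun z => F z * ex (-κ) z) atI (𝓝 C)

namespace Asy

variable {F G : ℂ → ℂ} {κ μ : ℝ} {C D : ℂ}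

lemma congr (hF : Asy F κ C) (h : ∀ z ∈ UH, F z = G z) : Asy G κ C := by
  refine ⟨hF.1, hF.2.congr' ?_⟩
  filter_upwards [UH_mem_atI] with z hz
  rw [h z hz]

lemma mul (hF : Asy F κ C) (hG : Asy G μ D) : Asy (fun z => F z * G z) (κ + μ) (C * D) := by
  refine ⟨mul_ne_zero hF.1 hG.1, (hF.2.mul hG.2).congr fun z => ?_⟩
  rw [neg_add, ex_add]; ring

lemma inv (hF : Asy F κ C) : Asy (fun z => (F z)⁻¹) (-κ) C⁻¹ := by
  refine ⟨inv_ne_zero hF.1, (hF.2.inv₀ hF.1).congr fun z => ?_⟩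
  rw [mul_inv, ← ex_neg]

lemma const (hC : C ≠ 0) : Asy (fun _ => C) 0 C := by
  refine ⟨hC, ?_⟩
  simp only [neg_zero, ex_zero, mul_one]
  exact tendsto_const_nhds

lemma of_tendsto (hC : C ≠ 0) (h : Tendsto F atI (𝓝 C)) : Asy F 0 C := by
  refine ⟨hC, ?_⟩
  simpa only [neg_zero, ex_zero, mul_one] using h

lemma tendsto (hF : Asy F 0 C) : Tendsto F atI (𝓝 C) := by
  simpa only [neg_zero, ex_zero, mul_one] using hF.2

lemma pow (hF : Asy F κ C) (n : ℕ) : Asy (fun z => F z ^ n) (n * κ) (C ^ n) := by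
  refine ⟨pow_ne_zero n hF.1, (hF.2.pow n).congr fun z => ?_⟩
  rw [mul_pow]
  congr 1
  rw [ex, ex, ← Complex.exp_nat_mul]; push_cast; congr 1; ring

lemma zpow (hF : Asy F κ C) (n : ℤ) : Asy (fun z => F z ^ n) (n * κ) (C ^ n) := by
  refine ⟨zpow_ne_zero n hF.1, (hF.2.zpow₀ n (Or.inl hF.1)).congr fun z => ?_⟩
  rw [mul_zpow]
  congr 1
  rw [ex, ex, ← Complex.exp_int_mul]; push_cast; congr 1; ring

lemma prod {ι : Type*} (s : Finset ι) {F : ι → ℂ → ℂ} {κ : ι → ℝ} {C : ι → ℂ}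
    (h : ∀ i ∈ s, Asy (F i) (κ i) (C i)) :
    Asy (fun z => ∏ i ∈ s, F i z) (∑ i ∈ s, κ i) (∏ i ∈ s, C i) := by
  classical
  induction s using Finset.induction_on with
  | empty => simpa using const one_ne_zero
  | insert a s ha ih =>
    simp only [Finset.prod_insert ha, Finset.sum_insert ha]
    exact (h a (Finset.mem_insert_self a s)).mul
      (ih fun i hi => h i (Finset.mem_insert_of_mem hi))

lemma ex_asy (κ : ℝ) : Asy (ex κ) κ 1 := by
  refine ⟨one_ne_zero, ?_⟩
  simp only [ex_neg, mul_inv_cancel₀ (ex_ne_zero κ _)]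
  exact tendsto_const_nhds

lemma comp_affine (hF : Asy F κ C) {a d : ℝ} (ha : 0 < a) (hd : 0 < d) (b : ℝ) :
    Asy (fun z => F ((a * z + b) / d)) (κ * a / d) (C * Complex.exp (2 * Real.pi * I * (κ * b / d))) := by
  refine ⟨mul_ne_zero hF.1 (Complex.exp_ne_zero _), ?_⟩
  have h := (hF.2.comp (tendsto_affine_atI ha hd b)).mul_const
    (Complex.exp (2 * Real.pi * I * (κ * b / d)))
  refine h.congr fun z => ?_
  simp only [Function.comp, mul_assoc]
  congr 1
  rw [ex, ex, ← Complex.exp_add]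
  push_cast
  congr 1
  ring

lemma exponent_le (hF : Asy F κ C) (hG : Asy F μ D) : κ ≤ μ := by
  by_contra h
  push Not at h
  have h1 : Tendsto (fun z => (F z * ex (-κ) z) * ex (κ - μ) z) atI (𝓝 (C * 0)) :=
    hF.2.mul (tendsto_ex (sub_pos.mpr h))
  have h2 : Tendsto (fun z => F z * ex (-μ) z) atI (𝓝 (C * 0)) := by
    refine h1.congr fun z => ?_
    rw [mul_assoc, ← ex_add]; congr 2; ring
  rw [mul_zero] at h2
  exact hG.1 (tendsto_nhds_unique hG.2 h2)

lemma exponent_eq (hF : Asy F κ C) (hG : Asy F μ D) : κ = μ :=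
  le_antisymm (hF.exponent_le hG) (hG.exponent_le hF)

lemma coeff_eq (hF : Asy F κ C) (hG : Asy F κ D) : C = D := tendsto_nhds_unique hF.2 hG.2

lemma isBigO (hF : Asy F κ C) : F =O[atI] ex κ := by
  have h := (hF.2.isBigO_one ℂ).mul (isBigO_refl (ex κ) atI)
  refine h.congr (fun z => ?_) (fun z => by simp)
  rw [mul_assoc, ← ex_add, neg_add_cancel, ex_zero, mul_one]

lemma bdd (hF : Asy F 0 C) : F =O[atI] (fun _ => (1 : ℝ)) := hF.tendsto.isBigO_one ℝ

lemma ne_zero (hF : Asy F κ C) : ∀ᶠ z in atI, F z ≠ 0 := by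
  filter_upwards [hF.2.eventually_ne hF.1] with z hz h
  exact hz (by rw [h, zero_mul])

end Asy

namespace Haupt

variable {N : ℕ} {t g : ℂ → ℂ}

lemma t_sub_asy (H : Haupt N t g) (x : ℂ) : Asy (fun z => t z - x) (-1) 1 := by
  refine ⟨one_ne_zero, ?_⟩
  have h : Tendsto (fun z => qc z * t z - x * qc z) atI (𝓝 (1 - x * 0)) :=
    H.tendsto_qc_mul_t.sub (tendsto_const_nhds.mul tendsto_qc_nhds)
  rw [mul_zero, sub_zero] at h
  refine h.congr fun z => ?_
  rw [neg_neg, ex_one]; ring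

lemma te_sub_asy (H : Haupt N t g) {e : ℕ} (he : e ∣ N) (he1 : e ≠ 1) :
    Asy (fun z => te N t e z - xe N t e) 1 (nu N t e) := by
  have h := (Asy.const (H.nu_ne_zero he he1)).mul (H.t_sub_asy (xe N t e)).inv
  norm_num at h
  refine h.congr fun z hz => ?_
  rw [H.te_sub he he1 hz, div_eq_mul_inv]

lemma te_sub_asy_of_ne (H : Haupt N t g) {f : ℕ} (hf : f ∣ N) (hf1 : f ≠ 1) {x : ℂ}
    (hx : xe N t f ≠ x) : Asy (fun z => te N t f z - x) 0 (xe N t f - x) :=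
  Asy.of_tendsto (sub_ne_zero.mpr hx) ((H.tendsto_te hf hf1).sub_const x)

lemma act_rep_mem (H : Haupt N t g) {e : ℕ} (he : e ∣ N) {z : ℂ} (hz : z ∈ UH) :
    act (rep N e) z ∈ UH := act_mem (AL.det_pos (H.dvd_pos he) (rep_mem H.sqf he)) hz

/-- An invariant function with poles only at `i∞` is a polynomial in `t`. -/
theorem exists_poly (H : Haupt N t g) (M : ℕ) : ∀ {G : ℂ → ℂ} (_ : DifferentiableOn ℂ G UH)
    (_ : ∀ γ ∈ AL N 1, ∀ z ∈ UH, G (act γ z) = G z)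
    (_ : ∀ e, e ∣ N → e ≠ 1 → (fun z => G (act (rep N e) z)) =O[atI] (fun _ => (1 : ℝ)))
    (_ : G =O[atI] (fun z => (qc z)⁻¹ ^ M)),
    ∃ R : Polynomial ℂ, ∀ z ∈ UH, G z = R.eval (t z) := by
  induction M with
  | zero =>
    intro G hd hi hb h
    obtain ⟨c, hc⟩ := liouville H.sqf hd hi (fun e he => by
      refine ⟨rep N e, rep_mem H.sqf he, ?_⟩
      by_cases he1 : e = 1
      · subst he1
        simp only [pow_zero] at h
        have h' : G =O[atI] (fun _ => (1 : ℝ)) := by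
          refine h.trans (IsBigO.of_bound 1 ?_)
          filter_upwards with z; simp
        refine h'.congr' ?_ (EventuallyEq.refl _ _)
        filter_upwards [UH_mem_atI] with z hz using (hi _ (rep_mem H.sqf he) z hz).symm
      · exact hb e he he1)
    exact ⟨Polynomial.C c, fun z hz => by simp [hc z hz]⟩
  | succ M ih =>
    intro G hd hi hb h
    have hqd : DifferentiableOn ℂ (fun z => qc z ^ (M + 1) * G z) UH :=
      (differentiable_qc.differentiableOn.pow _).mul hd
    obtain ⟨k, hk1, hk2⟩ := exists_qexp hqd (fun z hz => by
        have h1 := hi _ (translate_mem N 1) z hz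
        rw [act_translate] at h1
        have h2 := qc_add_int z 1
        push_cast at h1 h2
        simp only [h1, h2]) (by
        have := (isBigO_refl (fun z => qc z ^ (M + 1)) atI).mul h
        refine this.trans (IsBigO.of_bound 1 ?_)
        filter_upwards with z
        rw [← mul_pow, mul_inv_cancel₀ (qc_ne_zero z)]; simp)
    have hbt : ∀ e, e ∣ N → e ≠ 1 → (fun z => k 0 * t (act (rep N e) z) ^ (M + 1)) =O[atI]
        (fun _ => (1 : ℝ)) := by
      intro e he he1
      have := ((H.te_bdd he he1).pow (M + 1)).const_mul_left (k 0)
      simpa only [te, one_pow] using this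
    have hqt : (fun z => qc z * t z - 1) =O[atI] qc := by
      have h1 : (fun z => qc z * g (qc z)) =O[atI] (fun z => qc z * 1) :=
        (isBigO_refl qc atI).mul ((tendsto_qexp H.g_diff).isBigO_one ℂ)
      refine h1.congr' ?_ (by filter_upwards with z; simp)
      filter_upwards [UH_mem_atI] with z hz
      rw [H.qc_mul_t hz]; ring
    have hpow : (fun z => (qc z * t z) ^ (M + 1) - 1) =O[atI] qc := by
      have h1 : (fun z => ∑ i ∈ Finset.range (M + 1), (qc z * t z) ^ i) =O[atI]
          (fun _ => (1 : ℂ)) :=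
        (tendsto_finsetSum _ fun i _ => H.tendsto_qc_mul_t.pow i).isBigO_one ℂ
      refine (h1.mul hqt).congr (fun z => ?_) (fun z => by simp)
      exact geom_sum_mul _ _
    obtain ⟨R, hR⟩ := ih (G := fun z => G z - k 0 * t z ^ (M + 1))
      (hd.sub ((H.diff.pow _).const_mul _))
      (fun γ hγ z hz => by simp only [hi γ hγ z hz, H.inv γ hγ z hz])
      (fun e he he1 => (hb e he he1).sub (hbt e he he1)) (by
        have h1 : (fun z => qc z ^ (M + 1) * G z - k 0) =O[atI] qc := by
          have h4 := (hk1.differentiableAt (Metric.ball_mem_nhds 0 one_pos)).isBigO_sub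
          refine (h4.comp_tendsto tendsto_qc_nhds).congr' ?_ (by filter_upwards with z; simp)
          filter_upwards [UH_mem_atI] with z hz
          simp [hk2 z hz]
        have h2 := (h1.sub (hpow.const_mul_left (k 0))).mul
          (isBigO_refl (fun z => (qc z)⁻¹ ^ (M + 1)) atI)
        refine h2.congr (fun z => ?_) (fun z => ?_)
        · have h3 : qc z ^ (M + 1) * (qc z)⁻¹ ^ (M + 1) = 1 := by
            rw [← mul_pow, mul_inv_cancel₀ (qc_ne_zero z), one_pow]
          rw [mul_pow]
          linear_combination (G z - k 0 * t z ^ (M + 1)) * h3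
        · rw [pow_succ', mul_inv_cancel_left₀ (qc_ne_zero z)])
    refine ⟨R + Polynomial.C (k 0) * Polynomial.X ^ (M + 1), fun z hz => ?_⟩
    simp only [Polynomial.eval_add, Polynomial.eval_mul, Polynomial.eval_C, Polynomial.eval_pow,
      Polynomial.eval_X, ← hR z hz]
    ring

/-- The divisors `≠ 1`. -/
def W' (N : ℕ) : Finset ℕ := N.divisors.erase 1

lemma mem_W' (H : Haupt N t g) {e : ℕ} : e ∈ W' N ↔ e ∣ N ∧ e ≠ 1 := by
  simp [W', H.sqf.ne_zero, and_comm]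

/-- An invariant function of moderate growth at all cusps is a rational function of `t`. -/
theorem eq_of_t_eq (H : Haupt N t g) (M : ℕ) {G : ℂ → ℂ} (hd : DifferentiableOn ℂ G UH)
    (hi : ∀ γ ∈ AL N 1, ∀ z ∈ UH, G (act γ z) = G z)
    (hb : ∀ e, e ∣ N → (fun z => G (act (rep N e) z)) =O[atI] (fun z => (qc z)⁻¹ ^ M))
    {z w : ℂ} (hz : z ∈ UH) (hw : w ∈ UH) (h : t z = t w) : G z = G w := by
  have hq : ∀ k : ℕ, (fun z => qc z ^ k * (qc z)⁻¹ ^ k) =O[atI] (fun _ => (1 : ℝ)) := by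
    intro k
    refine IsBigO.of_bound 1 ?_
    filter_upwards with z
    rw [← mul_pow, mul_inv_cancel₀ (qc_ne_zero z)]; simp
  obtain ⟨R, hR⟩ := H.exists_poly (M + (W' N).card * M)
    (G := fun z => G z * ∏ e ∈ W' N, (t z - xe N t e) ^ M)
    (hd.mul (DifferentiableOn.fun_finsetProd fun e _ => (H.diff.sub_const _).pow _))
    (fun γ hγ z hz => by simp only [hi γ hγ z hz, H.inv γ hγ z hz])
    (fun f hf hf1 => by
      have hfW : f ∈ W' N := H.mem_W'.mpr ⟨hf, hf1⟩
      have h1 : (fun z => ∏ e ∈ (W' N).erase f, (te N t f z - xe N t e) ^ M) =O[atI]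
          (fun _ => (1 : ℂ)) :=
        (tendsto_finsetProd _ fun e _ => ((H.tendsto_te hf hf1).sub_const _).pow M).isBigO_one ℂ
      have h2 := ((hb f hf).mul ((H.te_sub_isBigO hf hf1).pow M)).mul h1
      refine (h2.congr (fun z => ?_) (fun z => ?_)).trans (hq M)
      · simp only [te]
        rw [mul_assoc, Finset.mul_prod_erase (W' N)
          (fun e => (t (act (rep N f) z) - xe N t e) ^ M) hfW]
      · ring) (by
      have h0 : G =O[atI] (fun z => (qc z)⁻¹ ^ M) := by
        refine (hb 1 (one_dvd N)).congr' ?_ (EventuallyEq.refl _ _)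
        filter_upwards [UH_mem_atI] with z hz using hi _ (rep_mem H.sqf (one_dvd N)) z hz
      have h1 : (fun z => ∏ e ∈ W' N, (t z - xe N t e) ^ M) =O[atI]
          (fun z => ∏ e ∈ W' N, (qc z)⁻¹ ^ M) :=
        IsBigO.finsetProd fun e _ => (H.t_sub_isBigO (xe N t e)).pow M
      refine (h0.mul h1).congr (fun z => rfl) (fun z => ?_)
      rw [Finset.prod_const, ← pow_mul, ← pow_add, mul_comm M])
  have hne : ∏ e ∈ W' N, (t w - xe N t e) ^ M ≠ 0 := by
    refine Finset.prod_ne_zero_iff.mpr fun e he => pow_ne_zero _ ?_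
    exact H.t_sub_ne_zero (H.mem_W'.mp he).1 (H.mem_W'.mp he).2 hw
  have h1 := hR z hz
  have h2 := hR w hw
  rw [h, ← h2] at h1
  exact mul_right_cancel₀ hne h1

/-- A nonvanishing-at-the-cusps invariant function, in terms of its divisor. -/
theorem exists_poly_of_asy (H : Haupt N t g) {G : ℂ → ℂ} (hd : DifferentiableOn ℂ G UH)
    (hi : ∀ γ ∈ AL N 1, ∀ z ∈ UH, G (act γ z) = G z) (o : ℕ → ℤ)
    (hb : ∀ e, e ∣ N → ∃ C, Asy (fun z => G (act (rep N e) z)) (o e) C) :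
    ∃ R : Polynomial ℂ, R ≠ 0 ∧
      (∀ z ∈ UH, G z = R.eval (t z) * ∏ e ∈ W' N, (t z - xe N t e) ^ (o e)) ∧
      (∀ e ∈ W' N, R.eval (xe N t e) ≠ 0) := by
  have hne : ∀ z ∈ UH, ∀ e ∈ W' N, t z - xe N t e ≠ 0 := fun z hz e he =>
    H.t_sub_ne_zero (H.mem_W'.mp he).1 (H.mem_W'.mp he).2 hz
  have hcusp : ∀ f ∈ W' N, ∃ D, Asy (fun z => G (act (rep N f) z) *
      ∏ e ∈ W' N, (te N t f z - xe N t e) ^ (-o e)) 0 D := by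
    intro f hf
    obtain ⟨hfN, hf1⟩ := H.mem_W'.mp hf
    obtain ⟨C, hC⟩ := hb f hfN
    have h1 := Asy.prod ((W' N).erase f) (F := fun e z => (te N t f z - xe N t e) ^ (-o e))
      (κ := fun e => (-o e : ℤ) * 0) fun e he => by
        have he' := H.mem_W'.mp (Finset.mem_of_mem_erase he)
        exact (H.te_sub_asy_of_ne hfN hf1
          (H.xe_ne he'.1 he'.2 hfN hf1 (Finset.ne_of_mem_erase he))).zpow (-o e)
    have h2 := hC.mul (((H.te_sub_asy hfN hf1).zpow (-o f)).mul h1)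
    simp only [mul_zero, Finset.sum_const_zero, add_zero, mul_one, Int.cast_neg,
      add_neg_cancel] at h2
    refine ⟨_, h2.congr fun z _ => ?_⟩
    rw [Finset.mul_prod_erase (W' N) (fun e => (te N t f z - xe N t e) ^ (-o e)) hf]
  obtain ⟨C, hC⟩ := hb 1 (one_dvd N)
  have hinf := hC.mul (Asy.prod (W' N) (F := fun e z => (t z - xe N t e) ^ (-o e))
      (κ := fun e => (-o e : ℤ) * (-1)) fun e he => (H.t_sub_asy (xe N t e)).zpow (-o e))
  set deg : ℤ := -(o 1 + ∑ e ∈ W' N, o e) with hdeg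
  have hexp : ((o 1 : ℝ) + ∑ e ∈ W' N, ((-o e : ℤ) : ℝ) * (-1)) = ((-deg : ℤ) : ℝ) := by
    rw [hdeg]; push_cast; simp
  rw [hexp] at hinf
  obtain ⟨R, hR⟩ := H.exists_poly deg.toNat
    (G := fun z => G z * ∏ e ∈ W' N, (t z - xe N t e) ^ (-o e))
    (hd.mul (DifferentiableOn.fun_finsetProd fun e he z hz =>
      ((H.diff z hz).sub_const _).zpow (Or.inl (hne z hz e he))))
    (fun γ hγ z hz => by simp only [hi γ hγ z hz, H.inv γ hγ z hz])
    (fun f hf hf1 => by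
      obtain ⟨D, hD⟩ := hcusp f (H.mem_W'.mpr ⟨hf, hf1⟩)
      exact hD.bdd) (by
      have h1 := hinf.isBigO
      have h2 : (fun z => G z * ∏ e ∈ W' N, (t z - xe N t e) ^ (-o e)) =O[atI]
          ex ((-deg : ℤ) : ℝ) := by
        refine h1.congr' ?_ (EventuallyEq.refl _ _)
        filter_upwards [UH_mem_atI] with z hz
        rw [hi _ (rep_mem H.sqf (one_dvd N)) z hz]
      refine h2.trans (IsBigO.of_bound 1 ?_)
      filter_upwards [UH_mem_atI] with z hz
      rw [ex_int, one_mul, inv_pow, _root_.zpow_neg, norm_inv, norm_inv, norm_zpow, norm_pow,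
        ← zpow_natCast]
      have hq := norm_pos_iff.mpr (qc_ne_zero z)
      refine inv_anti₀ (zpow_pos hq _) ?_
      exact zpow_le_zpow_right_of_le_one₀ hq (norm_qc_lt_one hz).le (Int.self_le_toNat deg))
  have hval : ∀ e ∈ W' N, R.eval (xe N t e) ≠ 0 := by
    intro f hf
    obtain ⟨hfN, hf1⟩ := H.mem_W'.mp hf
    obtain ⟨D, hD⟩ := hcusp f hf
    have h1 : Tendsto (fun z => R.eval (te N t f z)) atI (𝓝 (R.eval (xe N t f))) :=
      (R.continuous.tendsto _).comp (H.tendsto_te hfN hf1)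
    have h2 := hD.tendsto
    have : R.eval (xe N t f) = D := by
      refine tendsto_nhds_unique h1 (h2.congr' ?_)
      filter_upwards [UH_mem_atI] with z hz
      exact hR _ (H.act_rep_mem hfN hz)
    rw [this]; exact hD.1
  refine ⟨R, ?_, ?_, hval⟩
  · rintro rfl
    obtain ⟨z, h0, hz⟩ := (hinf.ne_zero.and UH_mem_atI).exists
    rw [hi _ (rep_mem H.sqf (one_dvd N)) z hz] at h0
    exact h0 (by rw [hR z hz]; simp)
  · intro z hz
    rw [← hR z hz, mul_assoc, ← Finset.prod_mul_distrib, Finset.prod_eq_one, mul_one]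
    intro e he
    rw [_root_.zpow_neg, inv_mul_cancel₀ (zpow_ne_zero _ (hne z hz e he))]

end Haupt

/-- Index set of the Hecke correspondence of degree `n`: tuples `(f, (a, d), b)` with `f ∣ N`,
`f a d = n` and `0 ≤ b < f d`. -/
def Ix (N n : ℕ) : Finset (Σ _ : ℕ, Σ _ : ℕ × ℕ, ℕ) :=
  (N.divisors.filter (· ∣ n)).sigma fun f =>
    (n / f).divisorsAntidiagonal.sigma fun ad => Finset.range (f * ad.2)

lemma mem_Ix {N n : ℕ} (hN : N ≠ 0) (hn : 0 < n) {i : Σ _ : ℕ, Σ _ : ℕ × ℕ, ℕ} :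
    i ∈ Ix N n ↔ i.1 ∣ N ∧ i.1 * i.2.1.1 * i.2.1.2 = n ∧ i.2.2 < i.1 * i.2.1.2 := by
  obtain ⟨f, ⟨a, d⟩, b⟩ := i
  simp only [Ix, Finset.mem_sigma, Finset.mem_filter, Nat.mem_divisors,
    Nat.mem_divisorsAntidiagonal, Finset.mem_range]
  constructor
  · rintro ⟨⟨⟨h1, -⟩, h2⟩, ⟨h3, h4⟩, h5⟩
    refine ⟨h1, ?_, h5⟩
    rw [mul_assoc, h3, Nat.mul_div_cancel' h2]
  · rintro ⟨h1, h2, h3⟩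
    have hfn : f ∣ n := ⟨a * d, by rw [← h2, mul_assoc]⟩
    have hf : 0 < f := Nat.pos_of_dvd_of_pos hfn hn
    have : a * d = n / f := by
      rw [← h2, mul_assoc, Nat.mul_div_cancel_left _ hf]
    refine ⟨⟨⟨h1, hN⟩, hfn⟩, ⟨this, ?_⟩, h3⟩
    rw [← this]
    rintro h0
    rw [mul_assoc, h0] at h2
    omega

/-- The affine matrix attached to an index. -/
def aff (i : Σ _ : ℕ, Σ _ : ℕ × ℕ, ℕ) : MZ := !![(i.1 * i.2.1.1 : ℤ), i.2.2; 0, (i.1 * i.2.1.2 : ℤ)]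

/-- The matrix attached to an index. -/
def Rp (N : ℕ) (i : Σ _ : ℕ, Σ _ : ℕ × ℕ, ℕ) : MZ :=
  !![(rep N i.1 * aff i) 0 0 / i.1, (rep N i.1 * aff i) 0 1 / i.1;
     (rep N i.1 * aff i) 1 0 / i.1, (rep N i.1 * aff i) 1 1 / i.1]

lemma smul_Rp {N n : ℕ} (hN : Squarefree N) (hn : 0 < n) {i : Σ _ : ℕ, Σ _ : ℕ × ℕ, ℕ}
    (hi : i ∈ Ix N n) : Rp N i ∈ Mn N n ∧ (i.1 : ℤ) • Rp N i = rep N i.1 * aff i := by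
  obtain ⟨h1, h2, h3⟩ := (mem_Ix hN.ne_zero hn).mp hi
  obtain ⟨f, ⟨a, d⟩, b⟩ := i
  simp only at h1 h2 h3
  obtain ⟨m, rfl⟩ := h1
  obtain ⟨x, y, c, w, hr, hdet⟩ := mem_AL_iff.mp (rep_mem hN (dvd_mul_right f m))
  have hf : (f : ℤ) ≠ 0 := by
    rintro h0
    have : f = 0 := by exact_mod_cast h0
    subst this
    simp at h2; omega
  have hR : Rp (f * m) ⟨f, ⟨a, d⟩, b⟩ =
      !![f * x * a, x * b + y * d; (f * m : ℕ) * c * a, m * c * b + f * w * d] := by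
    rw [Rp, hr]
    simp only [aff, Matrix.mul_fin_two]
    ext i j
    fin_cases i <;> fin_cases j <;> simp <;> refine Int.ediv_eq_of_eq_mul_right hf ?_ <;> ring
  rw [hR]
  refine ⟨⟨?_, ?_⟩, ?_⟩
  · exact ⟨c * a, by simp [mul_assoc]⟩
  · simp only [Matrix.det_fin_two_of]
    have h2' : (f : ℤ) * a * d = n := by exact_mod_cast h2
    refine mul_left_cancel₀ hf ?_
    push_cast at hdet ⊢
    linear_combination (f * a * d : ℤ) * hdet + f * h2'
  · rw [hr]
    simp only [aff, Matrix.mul_fin_two]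
    ext i j
    fin_cases i <;> fin_cases j <;> simp <;> ring

lemma act_aff {i : Σ _ : ℕ, Σ _ : ℕ × ℕ, ℕ} (z : ℂ) :
    act (aff i) z = ((i.1 * i.2.1.1 : ℝ) * z + (i.2.2 : ℝ)) / (i.1 * i.2.1.2 : ℝ) := by
  simp [act, den, aff]

lemma Ix_pos {N n : ℕ} (hN : N ≠ 0) (hn : 0 < n) {i : Σ _ : ℕ, Σ _ : ℕ × ℕ, ℕ}
    (hi : i ∈ Ix N n) : 0 < i.1 ∧ 0 < i.2.1.1 ∧ 0 < i.2.1.2 := by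
  obtain ⟨h1, h2, h3⟩ := (mem_Ix hN hn).mp hi
  refine ⟨?_, ?_, ?_⟩ <;> rw [pos_iff_ne_zero] <;> intro h <;> simp [h] at h2 <;> omega

lemma aff_det_pos {N n : ℕ} (hN : N ≠ 0) (hn : 0 < n) {i : Σ _ : ℕ, Σ _ : ℕ × ℕ, ℕ}
    (hi : i ∈ Ix N n) : 0 < (aff i).det := by
  obtain ⟨h1, h2, h3⟩ := Ix_pos hN hn hi
  simp only [aff, Matrix.det_fin_two_of]
  have h1' : (0:ℤ) < i.1 := by exact_mod_cast h1
  have h2' : (0:ℤ) < i.2.1.1 := by exact_mod_cast h2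
  have h3' : (0:ℤ) < i.2.1.2 := by exact_mod_cast h3
  simp only [mul_zero, sub_zero]
  positivity

lemma act_Rp {N n : ℕ} (hN : Squarefree N) (hn : 0 < n) {i : Σ _ : ℕ, Σ _ : ℕ × ℕ, ℕ}
    (hi : i ∈ Ix N n) {z : ℂ} (hz : z ∈ UH) :
    act (Rp N i) z = act (rep N i.1) (act (aff i) z) := by
  obtain ⟨h1, h2⟩ := smul_Rp hN hn hi
  have hf : (i.1 : ℤ) ≠ 0 := by exact_mod_cast (Ix_pos hN.ne_zero hn hi).1.ne'
  rw [← act_smul hf, h2, act_mul _ (aff_det_pos hN.ne_zero hn hi) hz]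
  exact AL.det_pos (Ix_pos hN.ne_zero hn hi).1 (rep_mem hN ((mem_Ix hN.ne_zero hn).mp hi).1)

/-- Every matrix in `Mn N n` is `Γ₀(N)`-equivalent to one of the standard representatives. -/
theorem exists_ix {N n : ℕ} (hN : Squarefree N) (hn : 0 < n) {A : MZ} (hA : A ∈ Mn N n) :
    ∃ i ∈ Ix N n, ∃ C ∈ AL N 1, A = C * Rp N i := by
  obtain ⟨a0, b0, c0, d0, rfl⟩ : ∃ a b c d, A = !![a, b; c, d] :=
    ⟨_, _, _, _, Matrix.eta_fin_two A⟩
  obtain ⟨hAc, hAd⟩ := hA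
  simp only [Matrix.det_fin_two_of, Matrix.of_apply, Matrix.cons_val', Matrix.cons_val_one,
    Matrix.cons_val_zero, Matrix.cons_val_fin_one] at hAc hAd
  set h : ℤ := (Int.gcd a0 c0 : ℤ) with hh
  have hh0 : 0 < h := by
    rw [hh]
    have : Int.gcd a0 c0 ≠ 0 := by
      intro h0
      rw [Int.gcd_eq_zero_iff] at h0
      rw [h0.1, h0.2] at hAd
      simp at hAd; omega
    exact_mod_cast Nat.pos_of_ne_zero this
  obtain ⟨a1, ha1⟩ : h ∣ a0 := Int.gcd_dvd_left ..
  obtain ⟨c1, hc1⟩ : h ∣ c0 := Int.gcd_dvd_right ..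
  obtain ⟨u, v, huv⟩ : ∃ u v : ℤ, u * a0 + v * c0 = h := by
    refine ⟨Int.gcdA a0 c0, Int.gcdB a0 c0, ?_⟩
    rw [hh, Int.gcd_eq_gcd_ab a0 c0]; ring
  have huv1 : u * a1 + v * c1 = 1 := by
    refine mul_left_cancel₀ hh0.ne' ?_
    rw [ha1, hc1] at huv; linear_combination huv
  obtain ⟨e0, s, e, rfl, heN, hB⟩ := exists_AL_of_det_one hN (γ := !![a1, -v; c1, u])
    (by rw [Matrix.det_fin_two_of]; linear_combination huv1)
  have he : 0 < e := Nat.pos_of_dvd_of_pos heN (Nat.pos_of_ne_zero hN.ne_zero)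
  obtain ⟨N1, rfl⟩ := heN
  obtain ⟨x, y, c, w, hBe, hdet⟩ := mem_AL_iff.mp hB
  have he' : (e : ℤ) ≠ 0 := by exact_mod_cast he.ne'
  have hdet1 : (e : ℤ) * x * w - y * N1 * c = 1 := by
    refine mul_left_cancel₀ he' ?_
    push_cast at hdet; linear_combination hdet
  have hc1' : c1 = N1 * c := by
    have := congrFun (congrFun hBe 1) 0
    simp at this
    refine mul_left_cancel₀ he' ?_
    linear_combination this
  have heh : (e : ℤ) ∣ h := by
    have h1 : (e : ℤ) ∣ h * c := by
      have hN1 : (N1 : ℤ) ≠ 0 := by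
        have := hN.ne_zero
        intro h0
        exact this (by simp [show N1 = 0 by exact_mod_cast h0])
      rw [hc1, hc1'] at hAc
      push_cast at hAc
      refine (mul_dvd_mul_iff_right hN1).mp ?_
      rwa [show h * c * N1 = h * (N1 * c) by ring]
    refine IsCoprime.dvd_of_dvd_mul_right ⟨x * w, -y * N1, ?_⟩ h1
    linear_combination hdet1
  obtain ⟨a, ha⟩ := heh
  have ha0 : 0 < a := by
    have : (0:ℤ) < e := by exact_mod_cast he
    rw [ha] at hh0
    exact pos_of_mul_pos_right hh0 this.le
  -- `A = γ * !![h, k; 0, m]`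
  set k : ℤ := u * b0 + v * d0 with hk
  set m : ℤ := a1 * d0 - c1 * b0 with hm
  have hmn : h * m = n := by rw [hm]; rw [ha1, hc1] at hAd; linear_combination hAd
  have hm0 : 0 < m := by
    have : (0:ℤ) < n := by exact_mod_cast hn
    rw [← hmn] at this
    exact pos_of_mul_pos_right this hh0.le
  have hem : (0:ℤ) < e * m := mul_pos (by exact_mod_cast he) hm0
  set j : ℤ := (k + s * m) / (e * m) with hj
  set b : ℤ := (k + s * m) % (e * m) with hb
  have hb0 : 0 ≤ b := Int.emod_nonneg _ hem.ne'
  have hb1 : b < e * m := Int.emod_lt_of_pos _ hem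
  have hbj : k + s * m = b + e * m * j := (Int.emod_add_mul_ediv _ _).symm
  lift a to ℕ using ha0.le
  lift m to ℕ using hm0.le with m'
  lift b to ℕ using hb0 with b'
  have hix : (⟨e, ⟨a, m'⟩, b'⟩ : Σ _ : ℕ, Σ _ : ℕ × ℕ, ℕ) ∈ Ix (e * N1) n := by
    refine (mem_Ix hN.ne_zero hn).mpr ⟨dvd_mul_right _ _, ?_, by exact_mod_cast hb1⟩
    have : (e : ℤ) * a * m' = n := by rw [← ha, hmn]
    exact_mod_cast this
  obtain ⟨C, hC, hCB⟩ := AL_mul_self hN (dvd_mul_right e N1)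
    (AL_mul_one hB (Haupt.translate_mem _ j) hN (dvd_mul_right e N1)) (rep_mem hN (dvd_mul_right e N1))
  refine ⟨_, hix, C, hC, ?_⟩
  have h1 := (smul_Rp hN hn hix).2
  have h2 : (e : ℤ) • (C * Rp (e * N1) ⟨e, ⟨a, m'⟩, b'⟩) =
      (e : ℤ) • (!![a0, b0; c0, d0] : MZ) := by
    rw [← Matrix.mul_smul, h1, ← mul_assoc, ← hCB]
    simp only [aff, Matrix.mul_fin_two]
    ext p q
    fin_cases p <;> fin_cases q <;> simp
    · rw [ha1, ha]; ring
    · linear_combination (-a1 * e) * hbj + e * b0 * huv1 + e * (a1 * hk - v * hm)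
    · rw [hc1, ha]; ring
    · linear_combination (-c1 * e) * hbj + e * d0 * huv1 + e * (c1 * hk + u * hm)
  ext p q
  have h3 := congrFun (congrFun h2 p) q
  simp only [Matrix.smul_apply, smul_eq_mul] at h3
  exact (mul_left_cancel₀ he' h3).symm

lemma Mn_conj {N n e : ℕ} (he : e ∣ N) (he0 : 0 < e) {A M : MZ} (hA : A ∈ AL N e)
    (hM : M ∈ Mn N n) : ∃ M' ∈ Mn N n, M * A = A * M' := by
  obtain ⟨m, rfl⟩ := he
  obtain ⟨x, y, c, w, rfl, hdet⟩ := mem_AL_iff.mp hA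
  obtain ⟨p, q, r', s, rfl⟩ : ∃ a b c d, M = !![a, b; c, d] :=
    ⟨_, _, _, _, Matrix.eta_fin_two M⟩
  obtain ⟨⟨r, hr⟩, hd⟩ := hM
  simp only [Matrix.det_fin_two_of, Matrix.of_apply, Matrix.cons_val', Matrix.cons_val_one,
    Matrix.cons_val_zero, Matrix.cons_val_fin_one] at hr hd
  subst hr
  have he' : (e : ℤ) ≠ 0 := by exact_mod_cast he0.ne'
  have hdet1 : (e : ℤ) * x * w - y * m * c = 1 := by
    refine mul_left_cancel₀ he' ?_
    push_cast at hdet; linear_combination hdet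
  push_cast at hd ⊢
  set X : MZ := !![(e * w * p - y * (e * m) * r) * x + (e * w * q - y * s) * (m * c),
      (w * p - y * m * r) * y + (e * w * q - y * s) * w;
      (e * m) * ((-c * p + e * x * r) * x + (-m * c * q + x * s) * c),
      (-m * c * p + x * (e * m) * r) * y + (-(e * m) * c * q + e * x * s) * w] with hX
  have hXe : !![p, q; (e : ℤ) * m * r, s] * !![(e : ℤ) * x, y; e * m * c, e * w] =
      !![(e : ℤ) * x, y; e * m * c, e * w] * X := by
    rw [hX]
    simp only [Matrix.mul_fin_two]
    ext i j
    fin_cases i <;> fin_cases j <;> simp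
    · linear_combination (-(e : ℤ) * (p * x + q * m * c)) * hdet1
    · linear_combination (-(p * y + q * (e : ℤ) * w)) * hdet1
    · linear_combination (-(e : ℤ) * m * (r * e * x + s * c)) * hdet1
    · linear_combination (-((e : ℤ) * m * r * y + s * e * w)) * hdet1
  refine ⟨X, ⟨by simp [hX], ?_⟩, hXe⟩
  have h1 := congrArg Matrix.det hXe
  rw [Matrix.det_mul, Matrix.det_mul, Matrix.det_fin_two_of, Matrix.det_fin_two_of, hd] at h1
  have h2 : (e : ℤ) * x * (e * w) - y * (e * m * c) = e := by push_cast at hdet; exact hdet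
  rw [h2, mul_comm] at h1
  exact (mul_left_cancel₀ he' h1).symm

lemma Mn_one_mul {N n : ℕ} {C M : MZ} (hC : C ∈ AL N 1) (hM : M ∈ Mn N n) : C * M ∈ Mn N n := by
  obtain ⟨-, h1, -, h2⟩ := hC
  obtain ⟨h3, h4⟩ := hM
  refine ⟨?_, by rw [Matrix.det_mul, h2, h4]; simp⟩
  rw [Matrix.mul_apply, Fin.sum_univ_two]
  exact dvd_add (h1.mul_right _) (h3.mul_left _)

lemma act_adjugate {A : MZ} (hA : 0 < A.det) {z : ℂ} (hz : z ∈ UH) :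
    act A (act A.adjugate z) = z := by
  have h : 0 < A.adjugate.det := by simpa [Matrix.det_adjugate] using hA
  rw [← act_mul hA h hz, Matrix.mul_adjugate, act_smul hA.ne', act_one]

lemma adjugate_det_pos {A : MZ} (hA : 0 < A.det) : 0 < A.adjugate.det := by
  simpa [Matrix.det_adjugate] using hA

/-- The functions `t ∘ A`, `A ∈ Mn N n`, in standard form. -/
def Tn (N : ℕ) (t : ℂ → ℂ) (i : Σ _ : ℕ, Σ _ : ℕ × ℕ, ℕ) (z : ℂ) : ℂ := t (act (Rp N i) z)

namespace Haupt

variable {N : ℕ} {t g : ℂ → ℂ}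

lemma act_Rp_mem (H : Haupt N t g) {n : ℕ} (hn : 0 < n) {i} (hi : i ∈ Ix N n) {z : ℂ}
    (hz : z ∈ UH) : act (Rp N i) z ∈ UH :=
  act_mem (Mn.det_pos hn (smul_Rp H.sqf hn hi).1) hz

lemma Tn_diff (H : Haupt N t g) {n : ℕ} (hn : 0 < n) {i} (hi : i ∈ Ix N n) :
    DifferentiableOn ℂ (Tn N t i) UH :=
  DifferentiableOn.comp_act H.diff (Mn.det_pos hn (smul_Rp H.sqf hn hi).1)

lemma Tn_eq (H : Haupt N t g) {n : ℕ} (hn : 0 < n) {i} (hi : i ∈ Ix N n) {z : ℂ}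
    (hz : z ∈ UH) : Tn N t i z = te N t i.1 (act (aff i) z) := by
  rw [Tn, act_Rp H.sqf hn hi hz, te]

lemma t_act_eq_Tn (H : Haupt N t g) {n : ℕ} (hn : 0 < n) {A : MZ} (hA : A ∈ Mn N n) :
    ∃ i ∈ Ix N n, ∀ z ∈ UH, t (act A z) = Tn N t i z := by
  obtain ⟨i, hi, C, hC, rfl⟩ := exists_ix H.sqf hn hA
  refine ⟨i, hi, fun z hz => ?_⟩
  rw [act_mul (AL.det_pos one_pos hC) (Mn.det_pos hn (smul_Rp H.sqf hn hi).1) hz,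
    H.inv C hC _ (H.act_Rp_mem hn hi hz), Tn]

lemma tendsto_act_aff {n : ℕ} (hN : N ≠ 0) (hn : 0 < n) {i} (hi : i ∈ Ix N n) :
    Tendsto (act (aff i)) atI atI := by
  obtain ⟨h1, h2, h3⟩ := Ix_pos hN hn hi
  have := tendsto_affine_atI (a := i.1 * i.2.1.1) (d := i.1 * i.2.1.2) (by positivity)
    (by positivity) i.2.2
  refine this.congr fun z => ?_
  rw [act_aff]

lemma act_aff_mem {n : ℕ} (hN : N ≠ 0) (hn : 0 < n) {i} (hi : i ∈ Ix N n) {z : ℂ}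
    (hz : z ∈ UH) : act (aff i) z ∈ UH := act_mem (aff_det_pos hN hn hi) hz

lemma tendsto_Tn (H : Haupt N t g) {n : ℕ} (hn : 0 < n) {i} (hi : i ∈ Ix N n) (hi1 : i.1 ≠ 1) :
    Tendsto (Tn N t i) atI (𝓝 (xe N t i.1)) := by
  have hiN := ((mem_Ix H.sqf.ne_zero hn).mp hi).1
  refine ((H.tendsto_te hiN hi1).comp (tendsto_act_aff H.sqf.ne_zero hn hi)).congr' ?_
  filter_upwards [UH_mem_atI] with z hz
  rw [Function.comp, H.Tn_eq hn hi hz]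

lemma comp_aff_asy {F : ℂ → ℂ} {κ : ℝ} {C : ℂ} (hF : Asy F κ C) {n : ℕ} (hN : N ≠ 0) (hn : 0 < n)
    {i} (hi : i ∈ Ix N n) :
    Asy (fun z => F (act (aff i) z)) (κ * (i.2.1.1 / i.2.1.2))
      (C * Complex.exp (2 * Real.pi * I * (κ * (i.2.2 / (i.1 * i.2.1.2))))) := by
  obtain ⟨h1, h2, h3⟩ := Ix_pos hN hn hi
  have := hF.comp_affine (a := i.1 * i.2.1.1) (d := i.1 * i.2.1.2) (by positivity)
    (by positivity) i.2.2
  have h1' : (i.1 : ℝ) ≠ 0 := by positivity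
  have h3' : (i.2.1.2 : ℝ) ≠ 0 := by positivity
  convert this using 2
  · rw [act_aff]
  · field_simp
  · push_cast; ring_nf

lemma Tn_asy_one (H : Haupt N t g) {n : ℕ} (hn : 0 < n) {i} (hi : i ∈ Ix N n) (hi1 : i.1 = 1) :
    Asy (Tn N t i) (-1 * (i.2.1.1 / i.2.1.2))
      (1 * Complex.exp (2 * Real.pi * I * ((-1 : ℝ) * (i.2.2 / (i.1 * i.2.1.2))))) := by
  have h := comp_aff_asy (H.t_sub_asy 0) H.sqf.ne_zero hn hi
  refine h.congr fun z hz => ?_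
  rw [sub_zero, H.Tn_eq hn hi hz, hi1, H.te_one (act_aff_mem H.sqf.ne_zero hn hi hz)]

lemma Tn_asy (H : Haupt N t g) {n : ℕ} (hn : 0 < n) {i} (hi : i ∈ Ix N n) (hi1 : i.1 ≠ 1) :
    Asy (fun z => Tn N t i z - xe N t i.1) (1 * (i.2.1.1 / i.2.1.2))
      (nu N t i.1 * Complex.exp (2 * Real.pi * I * ((1 : ℝ) * (i.2.2 / (i.1 * i.2.1.2))))) := by
  have hiN := ((mem_Ix H.sqf.ne_zero hn).mp hi).1
  have h := comp_aff_asy (H.te_sub_asy hiN hi1) H.sqf.ne_zero hn hi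
  refine h.congr fun z hz => ?_
  rw [H.Tn_eq hn hi hz]

lemma Tn_one_not_tendsto (H : Haupt N t g) {n : ℕ} (hn : 0 < n) {i} (hi : i ∈ Ix N n)
    (hi1 : i.1 = 1) (x : ℂ) : ¬ Tendsto (Tn N t i) atI (𝓝 x) := by
  intro hx
  obtain ⟨h1, h2, h3⟩ := Ix_pos H.sqf.ne_zero hn hi
  have hp : (0:ℝ) < -(-1 * (i.2.1.1 / i.2.1.2)) := by
    rw [neg_mul, one_mul, neg_neg]; positivity
  have h := H.Tn_asy_one hn hi hi1
  have h4 := hx.mul (tendsto_ex hp)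
  rw [mul_zero] at h4
  exact h.1 (tendsto_nhds_unique h.2 h4)

lemma exp_frac_inj {b b' D : ℕ} (hb : b < D) (hb' : b' < D) (s : ℤ) (hs : s * s = 1)
    (h : Complex.exp (2 * Real.pi * I * ((s : ℂ) * (b / D))) =
      Complex.exp (2 * Real.pi * I * ((s : ℂ) * (b' / D)))) : b = b' := by
  obtain ⟨k, hk⟩ := qc_eq_iff.mp h
  have hD : (D : ℂ) ≠ 0 := by
    have : 0 < D := by omega
    exact_mod_cast this.ne'
  have h1 : (s : ℂ) * b = s * b' + k * D := by
    field_simp at hk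
    linear_combination hk
  have h2 : s * b = s * b' + k * D := by exact_mod_cast h1
  have h3 : (b : ℤ) = b' + s * k * D := by
    linear_combination s * h2 + (b' - b : ℤ) * hs
  have h4 : s * k = 0 := by
    by_contra h0
    have hb1 : (b : ℤ) < D := by exact_mod_cast hb
    have hb2 : (b' : ℤ) < D := by exact_mod_cast hb'
    rcases lt_or_gt_of_ne h0 with h0 | h0
    · have : s * k ≤ -1 := by omega
      nlinarith
    · have : 1 ≤ s * k := by omega
      nlinarith
  rw [h4] at h3
  simpa using h3

/-- Different indices give different functions. -/
theorem Tn_inj (H : Haupt N t g) {n : ℕ} (hn : 0 < n) {i j} (hi : i ∈ Ix N n) (hj : j ∈ Ix N n)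
    (h : ∀ z ∈ UH, Tn N t i z = Tn N t j z) : i = j := by
  have hev : Tn N t i =ᶠ[atI] Tn N t j := by filter_upwards [UH_mem_atI] with z hz using h z hz
  have hf : i.1 = j.1 := by
    by_cases hi1 : i.1 = 1
    · by_contra hj1
      rw [hi1] at hj1
      exact H.Tn_one_not_tendsto hn hi hi1 _
        ((H.tendsto_Tn hn hj (Ne.symm hj1)).congr' hev.symm)
    · have hj1 : j.1 ≠ 1 := fun hj1 =>
        H.Tn_one_not_tendsto hn hj hj1 _ ((H.tendsto_Tn hn hi hi1).congr' hev)
      by_contra hij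
      exact H.xe_ne ((mem_Ix H.sqf.ne_zero hn).mp hi).1 hi1
        ((mem_Ix H.sqf.ne_zero hn).mp hj).1 hj1 hij
        (tendsto_nhds_unique (H.tendsto_Tn hn hj hj1) ((H.tendsto_Tn hn hi hi1).congr' hev))
  obtain ⟨i1, i2, i3⟩ := Ix_pos H.sqf.ne_zero hn hi
  obtain ⟨j1, j2, j3⟩ := Ix_pos H.sqf.ne_zero hn hj
  have key : ∃ s : ℤ, s * s = 1 ∧ (s : ℝ) * (i.2.1.1 / i.2.1.2) = s * (j.2.1.1 / j.2.1.2) ∧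
      ((s : ℝ) * (i.2.1.1 / i.2.1.2) = s * (j.2.1.1 / j.2.1.2) →
      Complex.exp (2 * Real.pi * I * ((s : ℂ) * (i.2.2 / (i.1 * i.2.1.2)))) =
      Complex.exp (2 * Real.pi * I * ((s : ℂ) * (j.2.2 / (j.1 * j.2.1.2))))) := by
    by_cases hi1 : i.1 = 1
    · have h1 := H.Tn_asy_one hn hi hi1
      have h2 := (H.Tn_asy_one hn hj (hf ▸ hi1)).congr fun z hz => (h z hz).symm
      refine ⟨-1, by norm_num, by simpa using h1.exponent_eq h2, fun h3 => ?_⟩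
      have h3' := h1.exponent_eq h2
      rw [← h3'] at h2
      have := h1.coeff_eq h2
      simpa using this
    · have h1 := H.Tn_asy hn hi hi1
      have h2 := (H.Tn_asy hn hj (hf ▸ hi1)).congr fun z hz =>
        congrArg (· - xe N t j.1) (h z hz).symm
      rw [← hf] at h2
      refine ⟨1, by norm_num, by simpa using h1.exponent_eq h2, fun h3 => ?_⟩
      have h3' := h1.exponent_eq h2
      rw [← h3'] at h2
      have := mul_left_cancel₀ (H.nu_ne_zero ((mem_Ix H.sqf.ne_zero hn).mp hi).1 hi1)
        (h1.coeff_eq h2)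
      rw [← hf]
      simpa using this
  obtain ⟨s, hs, hk1, hk2⟩ := key
  have hk3 := hk2 hk1
  obtain ⟨f, ⟨a, d⟩, b⟩ := i
  obtain ⟨f', ⟨a', d'⟩, b'⟩ := j
  simp only at hf hk1 hk3 i1 i2 i3 j1 j2 j3
  subst hf
  have hi' := (mem_Ix H.sqf.ne_zero hn).mp hi
  have hj' := (mem_Ix H.sqf.ne_zero hn).mp hj
  simp only at hi' hj'
  have hs0 : (s : ℝ) ≠ 0 := by
    intro h0
    have : s = 0 := by exact_mod_cast h0
    rw [this] at hs; omega
  have hcross : a * d' = a' * d := by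
    have := mul_left_cancel₀ hs0 hk1
    rw [div_eq_div_iff (by positivity) (by positivity)] at this
    exact_mod_cast this
  have hprod : a * d = a' * d' := by
    have := hi'.2.1.trans hj'.2.1.symm
    rw [mul_assoc, mul_assoc] at this
    exact Nat.eq_of_mul_eq_mul_left i1 this
  have haa : a = a' := by
    have : a * a = a' * a' := by
      refine Nat.eq_of_mul_eq_mul_right (Nat.mul_pos i3 j3) ?_
      calc a * a * (d * d') = (a * d) * (a * d') := by ring
        _ = a' * a' * (d * d') := by rw [hprod, hcross]; ring
    exact Nat.mul_self_inj.mp this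
  subst haa
  have hdd : d = d' := Nat.eq_of_mul_eq_mul_left i2 hprod
  subst hdd
  have : b = b' := by
    refine exp_frac_inj (D := f * d) hi'.2.2 hj'.2.2 s hs ?_
    push_cast
    exact hk3
  subst this
  rfl

/-- Precomposition with an Atkin–Lehner matrix permutes the correspondence. -/
theorem exists_perm (H : Haupt N t g) {n : ℕ} (hn : 0 < n) {e : ℕ} (he : e ∣ N) {A : MZ}
    (hA : A ∈ AL N e) : ∃ σ : (Σ _ : ℕ, Σ _ : ℕ × ℕ, ℕ) → (Σ _ : ℕ, Σ _ : ℕ × ℕ, ℕ),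
      Set.BijOn σ (Ix N n) (Ix N n) ∧
      ∀ i ∈ Ix N n, ∀ z ∈ UH, Tn N t i (act A z) = te N t e (act (Rp N (σ i)) z) := by
  have hAd := AL.det_pos (H.dvd_pos he) hA
  have h1 : ∀ i ∈ Ix N n, ∃ j ∈ Ix N n, ∀ z ∈ UH,
      Tn N t i (act A z) = te N t e (act (Rp N j) z) := by
    intro i hi
    have hR := (smul_Rp H.sqf hn hi).1
    obtain ⟨M', hM', hMA⟩ := Mn_conj he (H.dvd_pos he) hA hR
    obtain ⟨j, hj, C, hC, rfl⟩ := exists_ix H.sqf hn hM'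
    refine ⟨j, hj, fun z hz => ?_⟩
    have hj' := H.act_Rp_mem hn hj hz
    rw [Tn, ← act_mul (Mn.det_pos hn hR) hAd hz, hMA, act_mul hAd (Mn.det_pos hn hM') hz,
      act_mul (AL.det_pos one_pos hC) (Mn.det_pos hn (smul_Rp H.sqf hn hj).1) hz,
      H.te_eq he hA (act_mem (AL.det_pos one_pos hC) hj'), H.te_inv he hC hj']
  choose! σ hσ1 hσ2 using h1
  have hinj : Set.InjOn σ (Ix N n) := by
    intro i hi j hj hij
    refine H.Tn_inj hn hi hj fun z hz => ?_
    have hz' := act_mem (adjugate_det_pos hAd) hz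
    have h2 := hσ2 i hi _ hz'
    have h3 := hσ2 j hj _ hz'
    rw [act_adjugate hAd hz] at h2 h3
    rw [h2, h3, hij]
  exact ⟨σ, ⟨hσ1, hinj, Finset.surjOn_of_injOn_of_card_le σ hσ1 hinj le_rfl⟩, hσ2⟩

lemma te_affine_isBigO (H : Haupt N t g) {n : ℕ} (hn : 0 < n) {i} (hi : i ∈ Ix N n) {e : ℕ}
    (he : e ∣ N) : (fun z => te N t e (act (aff i) z)) =O[atI] (fun z => (qc z)⁻¹ ^ n) := by
  have hle : ∀ κ : ℝ, -(n : ℝ) ≤ κ → ex κ =O[atI] (fun z => (qc z)⁻¹ ^ n) := by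
    intro κ hκ
    refine IsBigO.of_bound 1 ?_
    filter_upwards [UH_mem_atI] with z hz
    have hz' : 0 < z.im := hz
    rw [one_mul, norm_ex, inv_pow, ← qc_nat_mul, ← Complex.ofReal_natCast, norm_inv, norm_qc,
      ← Real.exp_neg, Real.exp_le_exp]
    have h1 : ((n : ℝ) * z : ℂ).im = n * z.im := by simp
    rw [h1]
    have := Real.pi_pos
    have h2 : 0 ≤ 2 * Real.pi * z.im := by positivity
    nlinarith
  by_cases he1 : e = 1
  · subst he1
    obtain ⟨h1, h2, h3⟩ := Ix_pos H.sqf.ne_zero hn hi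
    have h := (comp_aff_asy (H.t_sub_asy 0) H.sqf.ne_zero hn hi).isBigO
    refine IsBigO.trans (h.congr' ?_ (EventuallyEq.refl _ _)) (hle _ ?_)
    · filter_upwards [UH_mem_atI] with z hz
      rw [sub_zero, H.te_one (act_aff_mem H.sqf.ne_zero hn hi hz)]
    · have h4 : i.2.1.1 ≤ n := by
        have := ((mem_Ix H.sqf.ne_zero hn).mp hi).2.1
        rw [← this]
        calc i.2.1.1 = 1 * i.2.1.1 * 1 := by ring
          _ ≤ _ := by gcongr <;> assumption
      have h5 : (i.2.1.1 : ℝ) / i.2.1.2 ≤ n := by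
        rw [div_le_iff₀ (by positivity)]
        have h4' : (i.2.1.1 : ℝ) ≤ n := by exact_mod_cast h4
        have h3' : (1 : ℝ) ≤ i.2.1.2 := by exact_mod_cast h3
        nlinarith [Nat.cast_nonneg (α := ℝ) n]
      linarith
  · have h := ((H.tendsto_te he he1).comp (tendsto_act_aff H.sqf.ne_zero hn hi)).isBigO_one ℂ
    refine IsBigO.trans h ?_
    refine (hle 0 (by simp)).congr_left fun z => ?_
    rw [ex_zero]

/-- If `t z = t w`, then `t` takes the same values on the Hecke translates of `z` and `w`. -/
theorem exists_translate (H : Haupt N t g) {n : ℕ} (hn : 0 < n) {z w : ℂ} (hz : z ∈ UH)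
    (hw : w ∈ UH) (h : t z = t w) {A : MZ} (hA : A ∈ Mn N n) :
    ∃ B ∈ Mn N n, t (act A z) = t (act B w) := by
  obtain ⟨i, hi, hAi⟩ := H.t_act_eq_Tn hn hA
  have key := H.eq_of_t_eq ((Ix N n).card * n) (G := fun u => ∏ j ∈ Ix N n, (Tn N t i z - Tn N t j u))
    (DifferentiableOn.fun_finsetProd fun j hj => (differentiableOn_const _).sub (H.Tn_diff hn hj))
    (fun γ hγ u hu => by
      obtain ⟨σ, hσ, hσ2⟩ := H.exists_perm hn (one_dvd N) hγ
      refine Finset.prod_nbij σ hσ.1 hσ.2.1 hσ.2.2 fun j hj => ?_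
      rw [hσ2 j hj u hu, H.te_one (H.act_Rp_mem hn (hσ.1 hj) hu)]; rfl)
    (fun e he => by
      obtain ⟨σ, hσ, hσ2⟩ := H.exists_perm hn he (rep_mem H.sqf he)
      have h1 : (fun u => ∏ j ∈ Ix N n, (Tn N t i z - Tn N t j (act (rep N e) u))) =O[atI]
          (fun u => ∏ j ∈ Ix N n, (qc u)⁻¹ ^ n) := by
        refine IsBigO.finsetProd fun j hj => ?_
        have hj' : σ j ∈ Ix N n := hσ.1 hj
        have hjN := ((mem_Ix H.sqf.ne_zero hn).mp hj').1
        have hone : (fun _ : ℂ => Tn N t i z) =O[atI] (fun u => (qc u)⁻¹ ^ n) := by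
          refine (isBigO_const_const (Tn N t i z) (one_ne_zero (α := ℂ)) atI).trans
            (IsBigO.of_bound 1 ?_)
          filter_upwards [UH_mem_atI] with u hu
          rw [norm_one, one_mul, norm_pow, norm_inv]
          exact one_le_pow₀ ((one_le_inv₀ (norm_pos_iff.mpr (qc_ne_zero u))).mpr
            (norm_qc_lt_one hu).le)
        refine hone.sub ((H.te_affine_isBigO hn hj' (symDiv_dvd H.sqf he hjN)).congr' ?_
          (EventuallyEq.refl _ _))
        filter_upwards [UH_mem_atI] with u hu
        rw [hσ2 j hj u hu, act_Rp H.sqf hn hj' hu,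
          H.te_act he hjN (rep_mem H.sqf hjN) (act_aff_mem H.sqf.ne_zero hn hj' hu)]
      refine h1.congr_right fun u => ?_
      rw [Finset.prod_const, ← pow_mul, mul_comm n])
    hz hw h
  have h0 : ∏ j ∈ Ix N n, (Tn N t i z - Tn N t j w) = 0 := by
    rw [← key]
    exact Finset.prod_eq_zero hi (sub_self _)
  obtain ⟨j, hj, hj0⟩ := Finset.prod_eq_zero_iff.mp h0
  exact ⟨Rp N j, (smul_Rp H.sqf hn hj).1, by rw [hAi z hz, sub_eq_zero.mp hj0, Tn]⟩

end Haupt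

/-- Near `(z₀, w₀)`, only matrices mapping `z₀` to `w₀` give equivalences. -/
theorem eventually_act_eq {n : ℤ} (hn : 0 < n) {z₀ w₀ : ℂ} (hz : z₀ ∈ UH) (hw : w₀ ∈ UH) :
    ∀ᶠ p : ℂ × ℂ in 𝓝 (z₀, w₀), ∀ A : MZ, A.det = n → act A p.1 = p.2 → act A z₀ = w₀ := by
  have hz' : 0 < z₀.im := hz
  have hw' : 0 < w₀.im := hw
  set δ := min (z₀.im / 2) (w₀.im / 2) with hδ
  set M := max (‖z₀‖ + 1) (‖w₀‖ + 1) with hM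
  have hδ0 : 0 < δ := lt_min (by linarith) (by linarith)
  have hfin := finite_matrices n hn (δ := δ) (M := M) hδ0
  have h1 : ∀ᶠ z : ℂ in 𝓝 z₀, δ ≤ z.im ∧ ‖z‖ ≤ M := by
    have a1 : ∀ᶠ z : ℂ in 𝓝 z₀, z₀.im / 2 < z.im :=
      Complex.continuous_im.continuousAt.eventually (lt_mem_nhds (by linarith))
    have a2 : ∀ᶠ z : ℂ in 𝓝 z₀, ‖z‖ < ‖z₀‖ + 1 :=
      continuous_norm.continuousAt.eventually (gt_mem_nhds (by linarith))
    filter_upwards [a1, a2] with z h1 h2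
    exact ⟨(min_le_left _ _).trans h1.le, h2.le.trans (le_max_left _ _)⟩
  have h2 : ∀ᶠ z : ℂ in 𝓝 w₀, δ ≤ z.im ∧ ‖z‖ ≤ M := by
    have a1 : ∀ᶠ z : ℂ in 𝓝 w₀, w₀.im / 2 < z.im :=
      Complex.continuous_im.continuousAt.eventually (lt_mem_nhds (by linarith))
    have a2 : ∀ᶠ z : ℂ in 𝓝 w₀, ‖z‖ < ‖w₀‖ + 1 :=
      continuous_norm.continuousAt.eventually (gt_mem_nhds (by linarith))
    filter_upwards [a1, a2] with z h1 h2
    exact ⟨(min_le_right _ _).trans h1.le, h2.le.trans (le_max_right _ _)⟩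
  have h3 : ∀ A ∈ hfin.toFinset, ∀ᶠ p : ℂ × ℂ in 𝓝 (z₀, w₀),
      act A p.1 = p.2 → act A z₀ = w₀ := by
    intro A hA
    have hAd : 0 < A.det := by
      rw [Set.Finite.mem_toFinset] at hA
      rw [hA.1]; exact hn
    by_cases h : act A z₀ = w₀
    · exact Eventually.of_forall fun _ _ => h
    · have hc : ContinuousAt (fun p : ℂ × ℂ => act A p.1 - p.2) (z₀, w₀) := by
        refine ContinuousAt.sub (ContinuousAt.comp (f := Prod.fst) (g := act A) ?_
          continuousAt_fst) continuousAt_snd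
        exact ((differentiableOn_act hAd).differentiableAt (isOpen_UH.mem_nhds hz)).continuousAt
      have := hc.eventually_ne (sub_ne_zero.mpr h)
      filter_upwards [this] with p hp h'
      exact absurd (sub_eq_zero.mpr h') hp
  have h4 := (Finset.eventually_all hfin.toFinset).mpr h3
  have h5 : ∀ᶠ p : ℂ × ℂ in 𝓝 (z₀, w₀), (δ ≤ p.1.im ∧ ‖p.1‖ ≤ M) ∧ (δ ≤ p.2.im ∧ ‖p.2‖ ≤ M) :=
    ((continuousAt_fst (p := (z₀, w₀))).eventually h1).and
      ((continuousAt_snd (p := (z₀, w₀))).eventually h2)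
  filter_upwards [h4, h5] with p hp hp2 A hA hAp
  refine hp A ?_ hAp
  rw [Set.Finite.mem_toFinset]
  exact ⟨hA, p.1, hp2.1.1, hp2.1.2, by rw [hAp]; exact hp2.2.1, by rw [hAp]; exact hp2.2.2⟩

/-- Points fixed by some nonscalar integral matrix. -/
def CM : Set ℂ := {z | z ∈ UH ∧ ∃ A : MZ, 0 < A.det ∧ A 1 0 ≠ 0 ∧ act A z = z}

lemma countable_CM : CM.Countable := by
  have h : CM ⊆ ⋃ A : {A : MZ // 0 < A.det ∧ A 1 0 ≠ 0}, {z | z ∈ UH ∧ act A.1 z = z} := by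
    rintro z ⟨hz, A, h1, h2, h3⟩
    exact Set.mem_iUnion.mpr ⟨⟨A, h1, h2⟩, hz, h3⟩
  have : Countable MZ := inferInstanceAs (Countable (Fin 2 → Fin 2 → ℤ))
  refine (Set.countable_iUnion fun A => Set.Finite.countable ?_).mono h
  obtain ⟨A, hA, hA1⟩ := A
  set P : Polynomial ℂ := Polynomial.C (A 1 0 : ℂ) * Polynomial.X ^ 2 +
    Polynomial.C (A 1 1 - A 0 0 : ℂ) * Polynomial.X + Polynomial.C (-A 0 1 : ℂ) with hP
  have hP0 : P ≠ 0 := by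
    intro h0
    have hA1' : (A 1 0 : ℂ) ≠ 0 := by exact_mod_cast hA1
    have : P.leadingCoeff = A 1 0 := Polynomial.leadingCoeff_quadratic hA1'
    rw [h0, Polynomial.leadingCoeff_zero] at this
    exact hA1' this.symm
  refine (P.roots.toFinset.finite_toSet).subset ?_
  rintro z ⟨hz, hAz⟩
  simp only [Finset.mem_coe, Multiset.mem_toFinset, Polynomial.mem_roots hP0, Polynomial.IsRoot.def]
  have := den_ne_zero hA hz
  simp only [act] at hAz
  rw [div_eq_iff this, den] at hAz
  simp only [hP, Polynomial.eval_add, Polynomial.eval_mul, Polynomial.eval_C, Polynomial.eval_X,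
    Polynomial.eval_pow]
  linear_combination -hAz

lemma eq_smul_one_of_fixed {A : MZ} (hA : 0 < A.det) {z : ℂ} (hz : z ∈ UH) (h : act A z = z)
    (h0 : A 1 0 = 0) : A = A 0 0 • (1 : MZ) := by
  have hden := den_ne_zero hA hz
  simp only [act] at h
  rw [div_eq_iff hden, den, h0] at h
  have him := congrArg Complex.im h
  simp at him
  have hz' : z.im ≠ 0 := (show 0 < z.im from hz).ne'
  have h1 : A 0 0 = A 1 1 := by
    have : ((A 0 0 : ℝ) - A 1 1) * z.im = 0 := by linarith
    have := (mul_eq_zero.mp this).resolve_right hz'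
    exact_mod_cast sub_eq_zero.mp this
  have h2 : A 0 1 = 0 := by
    rw [h1] at h
    have : (A 0 1 : ℂ) = 0 := by simp at h; linear_combination h
    exact_mod_cast this
  ext i j
  fin_cases i <;> fin_cases j <;> simp [h0, h1, h2]

namespace Haupt

variable {N : ℕ} {t g : ℂ → ℂ}

lemma bdd_of_qexp {h : ℂ → ℂ} (hh : DifferentiableOn ℂ h (Metric.ball 0 1)) {c : ℝ} (hc : 0 < c) :
    ∃ K : ℝ, ∀ z : ℂ, c ≤ z.im → ‖h (qc z)‖ ≤ K := by
  set r := Real.exp (-2 * Real.pi * c)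
  have hr : r < 1 := by
    have := Real.pi_pos
    rw [Real.exp_lt_one_iff]
    have : 0 < 2 * Real.pi * c := by positivity
    linarith
  obtain ⟨K, hK⟩ := (isCompact_closedBall (0 : ℂ) r).exists_bound_of_continuousOn
    (hh.continuousOn.mono (Metric.closedBall_subset_ball hr))
  refine ⟨K, fun z hz => hK _ ?_⟩
  rw [mem_closedBall_zero_iff, norm_qc, Real.exp_le_exp]
  have := Real.pi_pos
  nlinarith

theorem exists_high (H : Haupt N t g) : ∃ Y : ℝ, ∀ u ∈ UH, ∀ v ∈ UH, Y ≤ u.im → t u = t v →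
    ∃ γ ∈ AL N 1, v = act γ u := by
  have hc : 0 < 1 / (2 * N : ℝ) := by have := H.pos; positivity
  have hK : ∀ e, ∃ K : ℝ, e ∣ N → e ≠ 1 → ∀ z : ℂ, 1 / (2 * N : ℝ) ≤ z.im → ‖te N t e z‖ ≤ K := by
    intro e
    by_cases he : e ∣ N ∧ e ≠ 1
    · obtain ⟨h, h1, h2, -⟩ := H.te_qexp he.1 he.2
      obtain ⟨K, hK⟩ := bdd_of_qexp h1 hc
      exact ⟨K, fun _ _ z hz => by rw [h2 z (hc.trans_le hz)]; exact hK z hz⟩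
    · exact ⟨0, fun h1 h2 => absurd ⟨h1, h2⟩ he⟩
  choose K hK using hK
  obtain ⟨K0, hK0⟩ := bdd_of_qexp H.g_diff hc
  have hK0' : 0 ≤ K0 := (norm_nonneg _).trans (hK0 ((1 / (2 * N : ℝ) : ℝ) * I) (by simp))
  have hcd : ContDiffAt ℂ 1 g 0 :=
    ((H.g_diff.analyticOnNhd Metric.isOpen_ball) 0 (Metric.mem_ball_self one_pos)).contDiffAt
  obtain ⟨L, s, hs, hL⟩ := hcd.exists_lipschitzOnWith
  obtain ⟨r, hr, hrs⟩ := Metric.mem_nhds_iff.mp hs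
  -- a small radius
  set ρ : ℝ := min (r / 2) (1 / (2 * (L + 1))) with hρ
  have hρ0 : 0 < ρ := lt_min (by linarith) (by positivity)
  have hsmall : ∀ᶠ u in atI, (∀ e ∈ N.divisors, K e < ‖t u‖) ∧ ρ⁻¹ + K0 < ‖t u‖ ∧ ‖qc u‖ < ρ := by
    refine Filter.Eventually.and ?_ (Filter.Eventually.and (H.tendsto_t.eventually_gt_atTop _) ?_)
    · rw [Finset.eventually_all]
      exact fun e _ => H.tendsto_t.eventually_gt_atTop _
    · have := tendsto_qc_nhds.norm
      rw [norm_zero] at this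
      exact this.eventually (gt_mem_nhds hρ0)
  obtain ⟨Y, hY⟩ := atI_basis_mem.mp hsmall
  refine ⟨Y, fun u hu v hv huY htuv => ?_⟩
  obtain ⟨h1, h2, h3⟩ := hY u huY
  obtain ⟨e, he, A, hA, v', hv', rfl, hv'im⟩ := exists_AL_high H.sqf hv
  rw [H.te_eq he hA hv'] at htuv
  have he1 : e = 1 := by
    by_contra he1
    have := h1 e (Nat.mem_divisors.mpr ⟨he, H.sqf.ne_zero⟩)
    rw [htuv] at this
    exact absurd (hK e he he1 v' hv'im) (not_le.mpr this)
  subst he1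
  rw [H.te_one hv'] at htuv
  have hq' : ‖qc v'‖ < ρ := by
    by_contra hcon
    push Not at hcon
    have h4 : ‖t v'‖ ≤ ρ⁻¹ + K0 := by
      rw [H.expand v' hv']
      refine (norm_add_le _ _).trans (add_le_add ?_ (hK0 v' hv'im))
      rw [norm_inv]
      exact inv_anti₀ hρ0 hcon
    rw [← htuv] at h4
    linarith
  have hmem : ∀ x : ℂ, ‖x‖ < ρ → x ∈ s := fun x hx => hrs (by
    rw [mem_ball_zero_iff]
    have := min_le_left (r / 2) (1 / (2 * ((L : ℝ) + 1)))
    linarith)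
  have hlip : ‖g (qc v') - g (qc u)‖ ≤ L * ‖qc v' - qc u‖ := by
    have := hL.dist_le_mul _ (hmem _ hq') _ (hmem _ h3)
    rwa [dist_eq_norm, dist_eq_norm] at this
  have hqeq : qc v' = qc u := by
    have h5 : qc v' - qc u = qc u * qc v' * (g (qc v') - g (qc u)) := by
      have a1 := H.qc_mul_t hu
      have a2 := H.qc_mul_t hv'
      rw [← htuv] at a2
      linear_combination qc u * a2 - qc v' * a1
    have h6 : ‖qc v' - qc u‖ ≤ (1 / 2) * ‖qc v' - qc u‖ := by
      conv_lhs => rw [h5]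
      rw [norm_mul, norm_mul]
      have hr2 : ρ ≤ 1 / (2 * ((L : ℝ) + 1)) := min_le_right _ _
      have hL0 : (0 : ℝ) ≤ L := L.2
      have a1 : ‖qc u‖ * L ≤ 1 / 2 := by
        calc ‖qc u‖ * L ≤ 1 / (2 * ((L : ℝ) + 1)) * L := by gcongr; linarith
          _ ≤ 1 / 2 := by
            rw [div_mul_eq_mul_div, div_le_div_iff₀ (by positivity) (by positivity)]; nlinarith
      calc ‖qc u‖ * ‖qc v'‖ * ‖g (qc v') - g (qc u)‖
          ≤ ‖qc u‖ * 1 * (L * ‖qc v' - qc u‖) := by gcongr; exact (norm_qc_lt_one hv').le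
        _ = ‖qc u‖ * L * ‖qc v' - qc u‖ := by ring
        _ ≤ _ := by gcongr
    have h7 : ‖qc v' - qc u‖ = 0 := by
      have := norm_nonneg (qc v' - qc u)
      linarith
    exact sub_eq_zero.mp (norm_eq_zero.mp h7)
  obtain ⟨k, hk⟩ := qc_eq_iff.mp hqeq
  refine ⟨A * !![1, k; 0, 1], AL_mul_one hA (translate_mem N k) H.sqf he, ?_⟩
  rw [act_mul (AL.det_pos one_pos hA) (AL.det_pos one_pos (translate_mem N k)) hu, act_translate,
    hk]

lemma exists_Mn_sq (H : Haupt N t g) {z w : ℂ} (hz : z ∈ UH) (hw : w ∈ UH) (h : t z = t w) :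
    ∃ p₀ : ℕ, ∀ p, p₀ ≤ p → 0 < p → ∃ M ∈ Mn N (p ^ 2), w = act M z := by
  obtain ⟨Y, hY⟩ := H.exists_high
  have hz' : 0 < z.im := hz
  obtain ⟨p₀, hp₀⟩ := exists_nat_ge (Y / z.im)
  refine ⟨p₀, fun p hp hp0 => ?_⟩
  have hA : (!![(p : ℤ), 0; 0, 1] : MZ) ∈ Mn N p := by simp [Mn, Matrix.det_fin_two]
  obtain ⟨B, hB, hBt⟩ := H.exists_translate hp0 hz hw h hA
  have hAd := Mn.det_pos hp0 hA
  have hBd := Mn.det_pos hp0 hB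
  obtain ⟨γ, hγ, hγe⟩ := hY _ (act_mem hAd hz) _ (act_mem hBd hw) (by
    have : act !![(p : ℤ), 0; 0, 1] z = p * z := by simp [act, den]
    rw [this]
    have h1 : ((p : ℂ) * z).im = p * z.im := by simp
    rw [h1]
    have h2 : (p₀ : ℝ) ≤ p := by exact_mod_cast hp
    rw [div_le_iff₀ hz'] at hp₀
    nlinarith) hBt
  have hγd := AL.det_pos one_pos hγ
  refine ⟨B.adjugate * (γ * !![(p : ℤ), 0; 0, 1]), ⟨?_, ?_⟩, ?_⟩
  · have h1 := (Mn_one_mul hγ hA).1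
    rw [Matrix.mul_apply, Fin.sum_univ_two]
    refine dvd_add (Dvd.dvd.mul_right ?_ _) (h1.mul_left _)
    simpa [Matrix.adjugate_fin_two] using hB.1
  · rw [Matrix.det_mul, (Mn_one_mul hγ hA).2, Matrix.det_adjugate]
    simp [hB.2]; ring
  · have hd1 : 0 < (γ * !![(p : ℤ), 0; 0, 1] : MZ).det := Mn.det_pos hp0 (Mn_one_mul hγ hA)
    rw [act_mul (adjugate_det_pos hBd) hd1 hz, act_mul hγd hAd hz, ← hγe]
    rw [← act_mul (adjugate_det_pos hBd) hBd hw, Matrix.adjugate_mul, act_smul hBd.ne', act_one]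

/-- Points with the same `t`-value are equivalent unless the first is a CM point. -/
lemma equiv_of_not_CM (H : Haupt N t g) {z w : ℂ} (hz : z ∈ UH) (hw : w ∈ UH) (h : t z = t w)
    (hcm : z ∉ CM) : ∃ γ ∈ AL N 1, w = act γ z := by
  obtain ⟨p₀, hp₀⟩ := H.exists_Mn_sq hz hw h
  obtain ⟨p, hpge, hp⟩ := Nat.exists_infinite_primes (max p₀ (N + 1))
  obtain ⟨l, hlge, hl⟩ := Nat.exists_infinite_primes (max p₀ (p + 1))
  obtain ⟨M, hM, hMw⟩ := hp₀ p ((le_max_left _ _).trans hpge) hp.pos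
  obtain ⟨L, hL, hLw⟩ := hp₀ l ((le_max_left _ _).trans hlge) hl.pos
  have hpl : p < l := Nat.lt_of_succ_le ((le_max_right _ _).trans hlge)
  have hNp : N < p := Nat.lt_of_succ_le ((le_max_right _ _).trans hpge)
  have hMd := Mn.det_pos (pow_pos hp.pos 2) hM
  have hLd := Mn.det_pos (pow_pos hl.pos 2) hL
  set C := L.adjugate * M with hC
  have hCd : 0 < C.det := by rw [hC, Matrix.det_mul]; exact mul_pos (adjugate_det_pos hLd) hMd
  have hCz : act C z = z := by
    rw [hC, act_mul (adjugate_det_pos hLd) hMd hz, ← hMw, hLw,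
      ← act_mul (adjugate_det_pos hLd) hLd hz, Matrix.adjugate_mul, act_smul hLd.ne', act_one]
  have hC0 : C 1 0 = 0 := by
    by_contra h0
    exact hcm ⟨hz, C, hCd, h0, hCz⟩
  have hCs := eq_smul_one_of_fixed hCd hz hCz hC0
  set k := C 0 0 with hk
  have hdetC : k ^ 2 = (l * p : ℤ) ^ 2 := by
    have h1 : C.det = k ^ 2 := by rw [hCs, Matrix.det_smul]; simp
    rw [← h1, hC, Matrix.det_mul, Matrix.det_adjugate, hL.2, hM.2]
    simp; ring
  have hLM : (l : ℤ) ^ 2 • M = k • L := by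
    have h1 : L * C = L.det • M := by
      rw [hC, ← mul_assoc, Matrix.mul_adjugate, Matrix.smul_mul, one_mul]
    rw [hCs, Matrix.mul_smul, mul_one, hL.2] at h1
    rw [h1]; push_cast; rfl
  have hl0 : (l : ℤ) ≠ 0 := by exact_mod_cast hl.ne_zero
  have hp0 : (p : ℤ) ≠ 0 := by exact_mod_cast hp.ne_zero
  have hdiv : ∀ i j, (p : ℤ) ∣ M i j := by
    intro i j
    have h1 := congrFun (congrFun hLM i) j
    simp only [Matrix.smul_apply, smul_eq_mul] at h1
    have hcop : IsCoprime (p : ℤ) (l : ℤ) := by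
      rw [Nat.isCoprime_iff_coprime]
      exact (Nat.coprime_primes hp hl).mpr hpl.ne
    refine hcop.dvd_of_dvd_mul_left ?_
    rcases sq_eq_sq_iff_eq_or_eq_neg.mp hdetC with hk' | hk'
    · refine ⟨L i j, mul_left_cancel₀ hl0 ?_⟩
      rw [hk'] at h1; linear_combination h1
    · refine ⟨-L i j, mul_left_cancel₀ hl0 ?_⟩
      rw [hk'] at h1; linear_combination h1
  choose M' hM' using hdiv
  have hMM : M = (p : ℤ) • (Matrix.of M' : MZ) := by
    ext i j; simp [hM' i j]
  refine ⟨Matrix.of M', AL_one_iff.mpr ⟨?_, ?_⟩, ?_⟩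
  · have h1 := hM.1
    rw [hM' 1 0] at h1
    have hcop : IsCoprime (N : ℤ) (p : ℤ) := by
      rw [Nat.isCoprime_iff_coprime, Nat.coprime_comm, hp.coprime_iff_not_dvd]
      exact Nat.not_dvd_of_pos_of_lt H.pos hNp
    exact hcop.dvd_of_dvd_mul_left h1
  · have h1 := hM.2
    rw [hMM, Matrix.det_smul] at h1
    simp only [Fintype.card_fin] at h1
    push_cast at h1
    exact mul_left_cancel₀ (pow_ne_zero 2 hp0) (by rw [h1]; simp)
  · rw [hMw, hMM, act_smul hp0]

lemma t_not_const (H : Haupt N t g) (c : ℂ) : ∃ z ∈ UH, t z ≠ c := by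
  obtain ⟨z, h1, h2⟩ := ((H.t_ne_eventually c).and UH_mem_atI).exists
  exact ⟨z, h2, h1⟩

lemma isOpen_image (H : Haupt N t g) {s : Set ℂ} (hs : s ⊆ UH) (ho : IsOpen s) :
    IsOpen (t '' s) := by
  rcases (analyticOnNhd_UH H.diff).is_constant_or_isOpen isPreconnected_UH with ⟨c, hc⟩ | h
  · obtain ⟨z, hz, hne⟩ := H.t_not_const c
    exact absurd (hc z hz) hne
  · exact h s hs ho

/-- `t` separates `Γ₀(N)`-orbits. -/
theorem t_eq_iff (H : Haupt N t g) {z w : ℂ} (hz : z ∈ UH) (hw : w ∈ UH) :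
    t z = t w ↔ ∃ γ ∈ AL N 1, w = act γ z := by
  constructor
  swap
  · rintro ⟨γ, hγ, rfl⟩
    exact (H.inv γ hγ z hz).symm
  intro h
  by_contra hcon
  set Bad : Set ℂ := {z | z ∈ UH ∧ ∃ w ∈ UH, t z = t w ∧ ∀ γ ∈ AL N 1, w ≠ act γ z} with hBad
  have hopen : IsOpen Bad := by
    rw [isOpen_iff_mem_nhds]
    rintro z₀ ⟨hz₀, w₀, hw₀, ht, hne⟩
    have h1 := eventually_act_eq one_pos hz₀ hw₀
    rw [nhds_prod_eq] at h1
    obtain ⟨U, hU, V, hV, hUV⟩ := Filter.eventually_prod_iff.mp h1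
    obtain ⟨V', hV'1, hV'2, hV'3⟩ := mem_nhds_iff.mp (Filter.inter_mem hV (isOpen_UH.mem_nhds hw₀))
    have h2 : t '' V' ∈ 𝓝 (t z₀) := by
      rw [ht]
      exact (H.isOpen_image (fun x hx => (hV'1 hx).2) hV'2).mem_nhds ⟨w₀, hV'3, rfl⟩
    have h3 := ((H.diff.differentiableAt (isOpen_UH.mem_nhds hz₀)).continuousAt).eventually h2
    filter_upwards [hU, h3, isOpen_UH.mem_nhds hz₀] with z hz1 hz2 hz3
    obtain ⟨w, hwV, hwt⟩ := hz2
    refine ⟨hz3, w, (hV'1 hwV).2, hwt.symm, fun γ hγ hwγ => ?_⟩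
    have := hUV hz1 (hV'1 hwV).1 γ (by simpa using hγ.2.2.2) hwγ.symm
    exact hne γ hγ this.symm
  have hsub : Bad ⊆ CM := by
    rintro z ⟨hz, w, hw, ht, hne⟩
    by_contra hcm
    obtain ⟨γ, hγ, hγe⟩ := H.equiv_of_not_CM hz hw ht hcm
    exact hne γ hγ hγe
  have hmem : z ∈ Bad := ⟨hz, w, hw, h, fun γ hγ hwγ => hcon ⟨γ, hγ, hwγ⟩⟩
  obtain ⟨x, hx1, hx2⟩ := ((countable_CM.mono hsub).dense_compl ℂ).inter_open_nonempty Bad hopen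
    ⟨z, hmem⟩
  exact hx2 hx1

end Haupt

/-- `F` vanishes to exact order `k` at `α`. -/
def OrdAt (α : ℂ) (F : ℂ → ℂ) (k : ℕ) : Prop :=
  ∃ C : ℂ, C ≠ 0 ∧ Tendsto (fun z => F z / (z - α) ^ k) (𝓝[≠] α) (𝓝 C)

namespace OrdAt

variable {α : ℂ} {F G : ℂ → ℂ} {k l : ℕ}

lemma congr (hF : OrdAt α F k) (h : ∀ᶠ z in 𝓝[≠] α, F z = G z) : OrdAt α G k := by
  obtain ⟨C, hC, hl⟩ := hF
  refine ⟨C, hC, hl.congr' ?_⟩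
  filter_upwards [h] with z hz
  rw [hz]

lemma mul (hF : OrdAt α F k) (hG : OrdAt α G l) : OrdAt α (fun z => F z * G z) (k + l) := by
  obtain ⟨C, hC, h1⟩ := hF
  obtain ⟨D, hD, h2⟩ := hG
  refine ⟨C * D, mul_ne_zero hC hD, (h1.mul h2).congr fun z => ?_⟩
  rw [pow_add, div_mul_div_comm]

lemma of_ne_zero (hF : ContinuousAt F α) (h0 : F α ≠ 0) : OrdAt α F 0 :=
  ⟨F α, h0, by simpa using hF.tendsto.mono_left nhdsWithin_le_nhds⟩

lemma pow (hF : OrdAt α F k) (n : ℕ) : OrdAt α (fun z => F z ^ n) (n * k) := by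
  obtain ⟨C, hC, h1⟩ := hF
  refine ⟨C ^ n, pow_ne_zero n hC, (h1.pow n).congr fun z => ?_⟩
  rw [div_pow, ← pow_mul, mul_comm k]

lemma prod {ι : Type*} (s : Finset ι) {F : ι → ℂ → ℂ} {k : ι → ℕ}
    (h : ∀ i ∈ s, OrdAt α (F i) (k i)) :
    OrdAt α (fun z => ∏ i ∈ s, F i z) (∑ i ∈ s, k i) := by
  classical
  induction s using Finset.induction_on with
  | empty => simpa using of_ne_zero (F := fun _ => (1 : ℂ)) continuousAt_const one_ne_zero
  | insert i s hi ih =>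
    simp only [Finset.prod_insert hi, Finset.sum_insert hi]
    exact (h i (Finset.mem_insert_self i s)).mul
      (ih fun j hj => h j (Finset.mem_insert_of_mem hj))

lemma le (hF : OrdAt α F k) (hG : OrdAt α F l) : k ≤ l := by
  by_contra hlt
  push Not at hlt
  obtain ⟨C, hC, h1⟩ := hF
  obtain ⟨D, hD, h2⟩ := hG
  have h3 : Tendsto (fun z => (z - α) ^ (k - l)) (𝓝[≠] α) (𝓝 0) := by
    have : Tendsto (fun z => (z - α) ^ (k - l)) (𝓝 α) (𝓝 ((α - α) ^ (k - l))) :=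
      (by fun_prop : Continuous fun z : ℂ => (z - α) ^ (k - l)).tendsto α
    rw [sub_self, zero_pow (by omega)] at this
    exact this.mono_left nhdsWithin_le_nhds
  have h4 := h1.mul h3
  rw [mul_zero] at h4
  refine hD (tendsto_nhds_unique (h2.congr' ?_) h4)
  filter_upwards [self_mem_nhdsWithin] with z hz
  have hz' : z - α ≠ 0 := sub_ne_zero.mpr hz
  rw [div_mul_eq_mul_div, div_eq_div_iff (pow_ne_zero _ hz') (pow_ne_zero _ hz'), mul_assoc,
    ← pow_add, Nat.sub_add_cancel hlt.le]

lemma unique (hF : OrdAt α F k) (hG : OrdAt α F l) : k = l := le_antisymm (hF.le hG) (hG.le hF)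

end OrdAt

lemma act_sub {A : MZ} (hA : 0 < A.det) {z w : ℂ} (hz : z ∈ UH) (hw : w ∈ UH) :
    act A z - act A w = A.det * (z - w) / (den A z * den A w) := by
  have h1 := den_ne_zero hA hz
  have h2 := den_ne_zero hA hw
  rw [act, act, div_sub_div _ _ h1 h2]
  congr 1
  rw [den, den, Matrix.det_fin_two]
  push_cast
  ring

/-- The multiplier of a matrix at a fixed point. -/
def lam (A : MZ) (α : ℂ) : ℂ := A.det / den A α ^ 2

lemma tendsto_lam {A : MZ} (hA : 0 < A.det) {α : ℂ} (hα : α ∈ UH) (hf : act A α = α) :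
    Tendsto (fun z => (act A z - α) / (z - α)) (𝓝[≠] α) (𝓝 (lam A α)) := by
  have h1 : Tendsto (fun z => (A.det : ℂ) / (den A z * den A α)) (𝓝[≠] α) (𝓝 (lam A α)) := by
    rw [lam, sq]
    refine Tendsto.mono_left (ContinuousAt.tendsto ?_) nhdsWithin_le_nhds
    have := mul_ne_zero (den_ne_zero hA hα) (den_ne_zero hA hα)
    refine ContinuousAt.div continuousAt_const ?_ this
    simp only [den]
    fun_prop
  refine h1.congr' ?_
  filter_upwards [self_mem_nhdsWithin, nhdsWithin_le_nhds (isOpen_UH.mem_nhds hα)] with z hz hzU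
  have hz' : z - α ≠ 0 := sub_ne_zero.mpr hz
  conv_rhs => rw [← hf, act_sub hA hzU hα, hf]
  field_simp

/-- The stabilizer of `α` in `Γ₀(N)`. -/
def Stab (N : ℕ) (α : ℂ) : Set MZ := {γ | γ ∈ AL N 1 ∧ act γ α = α}

/-- The matrices of determinant `n` fixing `α`. -/
def FixA (N n : ℕ) (α : ℂ) : Set MZ := {A | A ∈ Mn N n ∧ act A α = α}

lemma Stab_eq (N : ℕ) (α : ℂ) : Stab N α = FixA N 1 α := by
  ext A; simp [Stab, FixA, AL_one_iff]

lemma finite_FixA {N n : ℕ} (hn : 0 < n) {α : ℂ} (hα : α ∈ UH) : (FixA N n α).Finite := by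
  refine (finite_matrices n (by exact_mod_cast hn) (δ := α.im) (M := ‖α‖) hα).subset ?_
  rintro A ⟨hA, hf⟩
  exact ⟨hA.2, α, le_rfl, le_rfl, by rw [hf], by rw [hf]⟩

lemma tendsto_act_nhds {A : MZ} (hA : 0 < A.det) {α : ℂ} (hα : α ∈ UH) :
    Tendsto (act A) (𝓝 α) (𝓝 (act A α)) :=
  ((differentiableOn_act hA).differentiableAt (isOpen_UH.mem_nhds hα)).continuousAt

lemma act_ne {A : MZ} (hA : 0 < A.det) {z w : ℂ} (hz : z ∈ UH) (hw : w ∈ UH) (h : z ≠ w) :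
    act A z ≠ act A w := by
  intro he
  have h1 := act_sub hA hz hw
  rw [he, sub_self, eq_comm, div_eq_zero_iff] at h1
  rcases h1 with h1 | h1
  · rcases mul_eq_zero.mp h1 with h2 | h2
    · exact hA.ne' (by exact_mod_cast h2)
    · exact h (sub_eq_zero.mp h2)
  · exact mul_ne_zero (den_ne_zero hA hz) (den_ne_zero hA hw) h1

lemma tendsto_act_punctured {A : MZ} (hA : 0 < A.det) {α : ℂ} (hα : α ∈ UH) (hf : act A α = α) :
    Tendsto (act A) (𝓝[≠] α) (𝓝[≠] α) := by
  rw [tendsto_nhdsWithin_iff]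
  constructor
  · have := tendsto_act_nhds hA hα
    rw [hf] at this
    exact this.mono_left nhdsWithin_le_nhds
  · filter_upwards [self_mem_nhdsWithin, nhdsWithin_le_nhds (isOpen_UH.mem_nhds hα)] with z hz hzU
    have := act_ne hA hzU hα hz
    rwa [hf] at this

lemma tendsto_comp_act {F : ℂ → ℂ} {α C : ℂ} {m : ℕ}
    (h : Tendsto (fun z => F z / (z - α) ^ m) (𝓝[≠] α) (𝓝 C)) {A : MZ} (hA : 0 < A.det)
    (hα : α ∈ UH) (hf : act A α = α) :
    Tendsto (fun z => F (act A z) / (z - α) ^ m) (𝓝[≠] α) (𝓝 (C * lam A α ^ m)) := by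
  have h1 := (h.comp (tendsto_act_punctured hA hα hf)).mul ((tendsto_lam hA hα hf).pow m)
  refine h1.congr' ?_
  filter_upwards [(tendsto_act_punctured hA hα hf).eventually self_mem_nhdsWithin] with z hz
  have hz' : act A z - α ≠ 0 := sub_ne_zero.mpr hz
  simp only [Function.comp]
  rw [div_pow, div_mul_div_cancel₀ (pow_ne_zero _ hz')]

lemma eq_scalar_of_den_sq {n : ℕ} {A : MZ} (hA : A.det = n) (hn : 0 < n) {α : ℂ} (hα : α ∈ UH)
    (hf : act A α = α) (h : den A α ^ 2 = n) : A = A 0 0 • (1 : MZ) := by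
  have hd : 0 < A.det := by rw [hA]; exact_mod_cast hn
  refine eq_smul_one_of_fixed hd hα hf ?_
  have him := congrArg Complex.im h
  have hre := congrArg Complex.re h
  simp only [den, sq, Complex.mul_im, Complex.mul_re, Complex.add_re, Complex.add_im,
    Complex.intCast_re, Complex.intCast_im, Complex.natCast_re, Complex.natCast_im] at him hre
  have hα' : 0 < α.im := hα
  have hn' : (0 : ℝ) < n := by exact_mod_cast hn
  by_contra h0
  have h0' : (A 1 0 : ℝ) ≠ 0 := by exact_mod_cast h0
  have h1 : (A 1 0 : ℝ) * α.re + A 1 1 = 0 := by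
    have : (A 1 0 * α.im) * ((A 1 0 : ℝ) * α.re + A 1 1) = 0 := by linarith
    exact (mul_eq_zero.mp this).resolve_left (mul_ne_zero h0' hα'.ne')
  nlinarith [mul_self_nonneg ((A 1 0 : ℝ) * α.im)]

namespace Haupt

variable {N : ℕ} {t g : ℂ → ℂ}

lemma exists_local (H : Haupt N t g) {α : ℂ} (hα : α ∈ UH) :
    ∃ (m : ℕ) (φ : ℂ → ℂ), 0 < m ∧ AnalyticAt ℂ φ α ∧ φ α ≠ 0 ∧
      ∀ᶠ z in 𝓝 α, t z - t α = (z - α) ^ m * φ z := by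
  have han : AnalyticAt ℂ (fun z => t z - t α) α :=
    (analyticOnNhd_UH H.diff α hα).sub analyticAt_const
  have hne : ¬ ∀ᶠ z in 𝓝 α, t z - t α = 0 := by
    intro h
    have h1 : Set.EqOn t (fun _ => t α) UH :=
      (analyticOnNhd_UH H.diff).eqOn_of_preconnected_of_eventuallyEq analyticOnNhd_const
        isPreconnected_UH hα (h.mono fun z hz => sub_eq_zero.mp hz)
    obtain ⟨z, hz, hz'⟩ := H.t_not_const (t α)
    exact hz' (h1 hz)
  obtain ⟨m, φ, h1, h2, h3⟩ := han.exists_eventuallyEq_pow_smul_nonzero_iff.mpr hne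
  refine ⟨m, φ, ?_, h1, h2, h3⟩
  rcases Nat.eq_zero_or_pos m with rfl | hm
  · have := h3.self_of_nhds
    simp at this
    exact absurd this.symm h2
  · exact hm

/-- The order of `t - t α` at `α`. -/
def od (t : ℂ → ℂ) (α : ℂ) : ℕ := by
  classical exact if h : ∃ m, OrdAt α (fun z => t z - t α) m then h.choose else 0

lemma od_spec (H : Haupt N t g) {α : ℂ} (hα : α ∈ UH) :
    OrdAt α (fun z => t z - t α) (od t α) := by
  have h : ∃ m, OrdAt α (fun z => t z - t α) m := by
    obtain ⟨m, φ, -, h1, h2, h3⟩ := H.exists_local hα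
    refine ⟨m, φ α, h2, (h1.continuousAt.tendsto.mono_left nhdsWithin_le_nhds).congr' ?_⟩
    filter_upwards [nhdsWithin_le_nhds h3, self_mem_nhdsWithin] with z hz hz'
    rw [hz, mul_div_cancel_left₀ _ (pow_ne_zero _ (sub_ne_zero.mpr hz'))]
  rw [od, dif_pos h]
  exact h.choose_spec

lemma od_local (H : Haupt N t g) {α : ℂ} (hα : α ∈ UH) :
    0 < od t α ∧ ∃ φ : ℂ → ℂ, AnalyticAt ℂ φ α ∧ φ α ≠ 0 ∧
      ∀ᶠ z in 𝓝 α, t z - t α = (z - α) ^ od t α * φ z := by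
  obtain ⟨m, φ, h0, h1, h2, h3⟩ := H.exists_local hα
  have : OrdAt α (fun z => t z - t α) m := by
    refine ⟨φ α, h2, (h1.continuousAt.tendsto.mono_left nhdsWithin_le_nhds).congr' ?_⟩
    filter_upwards [nhdsWithin_le_nhds h3, self_mem_nhdsWithin] with z hz hz'
    rw [hz, mul_div_cancel_left₀ _ (pow_ne_zero _ (sub_ne_zero.mpr hz'))]
  rw [(H.od_spec hα).unique this]
  exact ⟨h0, φ, h1, h2, h3⟩

lemma lam_pow (H : Haupt N t g) {α : ℂ} (hα : α ∈ UH) {γ : MZ} (hγ : γ ∈ Stab N α) :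
    lam γ α ^ od t α = 1 := by
  obtain ⟨C, hC, h⟩ := H.od_spec hα
  have h1 := tendsto_comp_act h (AL.det_pos one_pos hγ.1) hα hγ.2
  have h2 := tendsto_nhds_unique h (h1.congr' (by
    filter_upwards [nhdsWithin_le_nhds (isOpen_UH.mem_nhds hα)] with z hz
    rw [H.inv γ hγ.1 z hz]))
  have h3 : C * (lam γ α ^ od t α - 1) = 0 := by linear_combination -h2
  exact sub_eq_zero.mp ((mul_eq_zero.mp h3).resolve_left hC)

/-- An analytic `m`-th root of `t - t α` at `α`. -/
lemma exists_root (H : Haupt N t g) {α : ℂ} (hα : α ∈ UH) :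
    ∃ ψ : ℂ → ℂ, AnalyticAt ℂ ψ α ∧ ψ α ≠ 0 ∧
      ∀ᶠ z in 𝓝 α, t z - t α = ((z - α) * ψ z) ^ od t α := by
  obtain ⟨hm, φ, h1, h2, h3⟩ := H.od_local hα
  set m := od t α
  obtain ⟨c, hc⟩ := IsAlgClosed.exists_pow_nat_eq (φ α) hm
  have hc0 : c ≠ 0 := by rintro rfl; rw [zero_pow hm.ne'] at hc; exact h2 hc.symm
  have han : AnalyticAt ℂ (fun z => φ z / φ α) α := h1.div analyticAt_const h2
  have hlog : AnalyticAt ℂ (fun z => Complex.log (φ z / φ α)) α :=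
    han.clog (by rw [div_self h2]; exact Complex.one_mem_slitPlane)
  refine ⟨fun z => c * Complex.exp (Complex.log (φ z / φ α) / m),
    analyticAt_const.mul (hlog.div_const).cexp, mul_ne_zero hc0 (Complex.exp_ne_zero _), ?_⟩
  filter_upwards [h3, h1.continuousAt.eventually_ne h2] with z hz hz'
  rw [hz, mul_pow, mul_pow, hc, ← Complex.exp_nat_mul,
    mul_div_cancel₀ _ (by exact_mod_cast hm.ne' : (m : ℂ) ≠ 0), Complex.exp_log (div_ne_zero hz' h2),
    mul_div_cancel₀ _ h2]

lemma exists_stab (H : Haupt N t g) {α : ℂ} (hα : α ∈ UH) {ζ : ℂ} (hζ : ζ ^ od t α = 1) :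
    ∃ γ ∈ Stab N α, lam γ α = ζ := by
  obtain ⟨ψ, h1, h2, h3⟩ := H.exists_root hα
  set v : ℂ → ℂ := fun z => (z - α) * ψ z with hv
  have hvan : AnalyticAt ℂ v α := (analyticAt_id.sub analyticAt_const).mul h1
  have hvd : HasDerivAt v (ψ α) α := by
    have := ((hasDerivAt_id α).sub_const α).mul h1.differentiableAt.hasDerivAt
    have h4 : HasDerivAt v (1 * ψ α + (id α - α) * deriv ψ α) α := this
    rwa [one_mul, id, sub_self, zero_mul, add_zero] at h4
  have hvs : HasStrictDerivAt v (ψ α) α := by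
    have := hvan.hasStrictDerivAt
    rwa [hvd.deriv] at this
  have hmap := hvs.map_nhds_eq h2
  have hvα : v α = 0 := by simp [hv]
  rw [hvα] at hmap
  obtain ⟨U, hU, V, hV, hUV⟩ := Filter.eventually_prod_iff.mp
    (by have := eventually_act_eq one_pos hα hα; rwa [nhds_prod_eq] at this)
  have hV2 : ∀ᶠ w in 𝓝 (0 : ℂ), ∃ z, (V z ∧ z ∈ UH ∧ t z - t α = v z ^ od t α) ∧ v z = w := by
    have : v '' {z | V z ∧ z ∈ UH ∧ t z - t α = v z ^ od t α} ∈ 𝓝 (0 : ℂ) := by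
      rw [← hmap]
      exact Filter.image_mem_map (Filter.Eventually.and hV (Filter.Eventually.and (isOpen_UH.mem_nhds hα) h3))
    exact this
  have hcont : Tendsto (fun z => ζ * v z) (𝓝 α) (𝓝 0) := by
    have := hvan.continuousAt.tendsto.const_mul ζ
    rwa [hvα, mul_zero] at this
  have hev : ∀ᶠ z in 𝓝[≠] α, ∃ γ ∈ Stab N α, v (act γ z) = ζ * v z := by
    refine nhdsWithin_le_nhds ?_
    filter_upwards [hcont.eventually hV2, hU, h3, isOpen_UH.mem_nhds hα] with z hz hzU hz3 hzH
    obtain ⟨z', ⟨a1, a2, a3⟩, a4⟩ := hz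
    have heq : t z = t z' := by
      rw [a4, mul_pow, hζ, one_mul, ← hz3] at a3
      linear_combination -a3
    obtain ⟨γ, hγ, rfl⟩ := (H.t_eq_iff hzH a2).mp heq
    refine ⟨γ, ⟨hγ, hUV hzU a1 γ (by simpa using hγ.2.2.2) rfl⟩, a4⟩
  by_contra hcon
  push Not at hcon
  have hfin : (Stab N α).Finite := by rw [Stab_eq]; exact finite_FixA one_pos hα
  have hno : ∀ γ ∈ hfin.toFinset, ∀ᶠ z in 𝓝[≠] α, v (act γ z) ≠ ζ * v z := by
    intro γ hγ
    rw [Set.Finite.mem_toFinset] at hγ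
    have hd := AL.det_pos one_pos hγ.1
    have hvl : Tendsto (fun z => v z / (z - α) ^ 1) (𝓝[≠] α) (𝓝 (ψ α)) := by
      refine (h1.continuousAt.tendsto.mono_left nhdsWithin_le_nhds).congr' ?_
      filter_upwards [self_mem_nhdsWithin] with z hz
      rw [hv, pow_one, mul_div_cancel_left₀ _ (sub_ne_zero.mpr hz)]
    have h4 := (tendsto_comp_act hvl hd hα hγ.2).sub (hvl.const_mul ζ)
    have h5 := h4.eventually_ne (b₂ := 0) (by
      rw [pow_one, mul_comm (ψ α), ← sub_mul]
      exact mul_ne_zero (sub_ne_zero.mpr (hcon γ hγ)) h2)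
    filter_upwards [h5] with z hz he
    apply hz
    rw [he]; ring
  have := ((Finset.eventually_all _).mpr hno).and hev
  obtain ⟨z, hz1, γ, hγ, hz2⟩ := this.exists
  exact hz1 γ (hfin.mem_toFinset.mpr hγ) hz2

/-- A matrix fixing `α` either preserves `t` or contributes the full order. -/
lemma ord_sub_act (H : Haupt N t g) {n : ℕ} (hn : 0 < n) {α : ℂ} (hα : α ∈ UH) {A : MZ}
    (hA : A ∈ FixA N n α) (hne : ¬ ∀ z ∈ UH, t (act A z) = t z) :
    OrdAt α (fun z => t z - t (act A z)) (od t α) := by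
  have hAd := Mn.det_pos hn hA.1
  obtain ⟨C, hC, h⟩ := H.od_spec hα
  have h1 := h.sub (tendsto_comp_act h hAd hα hA.2)
  by_cases hl : lam A α ^ od t α = 1
  · exfalso
    apply hne
    obtain ⟨γ, hγ, hγl⟩ := H.exists_stab hα hl
    have hγd := AL.det_pos one_pos hγ.1
    have hγd' := adjugate_det_pos hγd
    have hdet1 : γ.det = 1 := by simpa using hγ.1.2.2.2
    have hadj : γ * γ.adjugate = 1 := by rw [Matrix.mul_adjugate, hdet1, one_smul]
    have hadj' : γ.adjugate * γ = 1 := by rw [Matrix.adjugate_mul, hdet1, one_smul]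
    set B := γ.adjugate * A with hB
    have hBd : B.det = n := by rw [hB, Matrix.det_mul, Matrix.det_adjugate, hdet1, hA.1.2]; simp
    have hγα : act γ.adjugate α = α := by
      conv_lhs => rw [← hγ.2]
      rw [← act_mul hγd' hγd hα, hadj', act_one]
    have hBα : act B α = α := by rw [hB, act_mul hγd' hAd hα, hA.2, hγα]
    have hden : den γ.adjugate α * den γ α = 1 := by
      have := den_mul (A := γ.adjugate) hγd hα
      rw [hadj', hγ.2] at this
      rw [← this]; simp [den]
    have hdB : den B α ^ 2 = n := by
      have e1 := den_ne_zero hγd hα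
      have e2 := den_ne_zero hAd hα
      rw [hB, den_mul hAd hα, hA.2, mul_pow]
      rw [lam, lam, hdet1, hA.1.2, div_eq_div_iff (pow_ne_zero 2 e1) (pow_ne_zero 2 e2)] at hγl
      push_cast at hγl
      linear_combination (den γ.adjugate α ^ 2) * hγl + n * (den γ.adjugate α * den γ α + 1) * hden
    have hBs := eq_scalar_of_den_sq hBd hn hα hBα hdB
    intro z hz
    have hAe : A = B 0 0 • γ := by
      have : γ * B = A := by rw [hB, ← mul_assoc, hadj, one_mul]
      rw [← this]
      conv_lhs => rw [hBs]
      rw [Matrix.mul_smul, mul_one]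
    have hB0 : B 0 0 ≠ 0 := by
      intro h0
      rw [h0, zero_smul] at hAe
      rw [hAe] at hAd
      simp at hAd
    rw [hAe, act_smul hB0, H.inv γ hγ.1 z hz]
  · refine ⟨C - C * lam A α ^ od t α, ?_, h1.congr fun z => by ring⟩
    intro h0
    have : C * (1 - lam A α ^ od t α) = 0 := by linear_combination h0
    rcases mul_eq_zero.mp this with h | h
    · exact hC h
    · exact hl (sub_eq_zero.mp h).symm

end Haupt

lemma lam_one_det {γ : MZ} (h : γ.det = 1) (α : ℂ) : lam γ α = (den γ α ^ 2)⁻¹ := by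
  rw [lam, h, Int.cast_one, one_div]

lemma den_neg (A : MZ) (z : ℂ) : den (-A) z = -den A z := by simp [den]; ring

lemma act_neg (A : MZ) (z : ℂ) : act (-A) z = act A z := by
  rw [← neg_one_smul ℤ A, act_smul (by norm_num)]

lemma det_neg' (A : MZ) : (-A).det = A.det := by simp [Matrix.det_fin_two]

lemma neg_mem_FixA {N n : ℕ} {α : ℂ} {A : MZ} (hA : A ∈ FixA N n α) : -A ∈ FixA N n α :=
  ⟨⟨by simpa using hA.1.1, by rw [det_neg']; exact hA.1.2⟩, by rw [act_neg]; exact hA.2⟩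

lemma eq_of_den_eq {A B : MZ} (hA : 0 < A.det) {α : ℂ} (hα : α ∈ UH)
    (h1 : act A α = α) (h2 : act B α = α) (h : den A α = den B α) : A = B := by
  have hα' : α.im ≠ 0 := (show 0 < α.im from hα).ne'
  have key : ∀ a b c d : ℤ, (a : ℂ) * α + b = c * α + d → a = c ∧ b = d := by
    intro a b c d he
    have him := congrArg Complex.im he
    simp at him
    have hac : a = c := by
      rcases him with h | h
      · exact_mod_cast h
      · exact absurd h hα'
    refine ⟨hac, ?_⟩
    rw [hac] at he
    exact_mod_cast add_left_cancel he
  have hdA := den_ne_zero hA hα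
  have hdB : den B α ≠ 0 := h ▸ hdA
  obtain ⟨e1, e2⟩ := key _ _ _ _ h
  rw [act, div_eq_iff hdA] at h1
  rw [act, div_eq_iff hdB, ← h, ← h1] at h2
  obtain ⟨e3, e4⟩ := key _ _ _ _ h2
  ext i j
  fin_cases i <;> fin_cases j
  exacts [e3.symm, e4.symm, e1, e2]

/-- The matrices of determinant `n` fixing `α` with positive lower left entry. -/
def Apos (N n : ℕ) (α : ℂ) : Set MZ := {A | A ∈ FixA N n α ∧ 0 < A 1 0}

/-- `1` if `n` is a square, `0` otherwise. -/
def sqI (n : ℕ) : ℕ := by classical exact if IsSquare n then 1 else 0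

lemma smul_one_mem_FixA {N n : ℕ} {k : ℤ} (hk : k ^ 2 = n) (hn : 0 < n) (α : ℂ) :
    k • (1 : MZ) ∈ FixA N n α := by
  have hk0 : k ≠ 0 := by
    rintro rfl
    simp at hk
    omega
  refine ⟨⟨by simp, ?_⟩, by rw [act_smul hk0, act_one]⟩
  rw [Matrix.det_smul, Matrix.det_one]
  simpa using hk

lemma scalar_ncard {N n : ℕ} (hn : 0 < n) {α : ℂ} (hα : α ∈ UH) :
    {A | A ∈ FixA N n α ∧ A 1 0 = 0}.ncard = 2 * sqI n := by
  classical
  have hsub : ∀ A, (A ∈ FixA N n α ∧ A 1 0 = 0) → A = A 0 0 • (1 : MZ) ∧ (A 0 0) ^ 2 = n := by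
    rintro A ⟨hA, h0⟩
    have h1 := eq_smul_one_of_fixed (Mn.det_pos hn hA.1) hα hA.2 h0
    refine ⟨h1, ?_⟩
    have h2 := hA.1.2
    rw [h1, Matrix.det_smul, Matrix.det_one] at h2
    simpa using h2
  rw [sqI]
  split_ifs with hs
  · obtain ⟨k, rfl⟩ := hs
    have hk : 0 < k := by by_contra h; simp at h; subst h; simp at hn
    have : {A | A ∈ FixA N (k * k) α ∧ A 1 0 = 0} = {(k : ℤ) • (1 : MZ), (-k : ℤ) • (1 : MZ)} := by
      ext A
      constructor
      · intro hA
        obtain ⟨h1, h2⟩ := hsub A hA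
        have : (A 0 0) ^ 2 = (k : ℤ) ^ 2 := by rw [h2]; push_cast; ring
        rw [h1]
        rcases sq_eq_sq_iff_eq_or_eq_neg.mp this with h | h <;> simp [h]
      · rintro (rfl | rfl)
        · exact ⟨smul_one_mem_FixA (by push_cast; ring) hn α, by simp⟩
        · exact ⟨smul_one_mem_FixA (by push_cast; ring) hn α, by simp⟩
    rw [this, Set.ncard_pair]
    intro h
    have := congrFun (congrFun h 0) 0
    simp at this
    omega
  · rw [mul_zero, Set.ncard_eq_zero ((finite_FixA hn hα).subset fun A hA => hA.1)]
    ext A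
    simp only [Set.mem_empty_iff_false, iff_false]
    intro hA
    obtain ⟨-, h2⟩ := hsub A hA
    apply hs
    refine ⟨(A 0 0).natAbs, ?_⟩
    zify
    rw [← h2, ← sq, sq_abs]

lemma FixA_ncard {N n : ℕ} (hn : 0 < n) {α : ℂ} (hα : α ∈ UH) :
    (FixA N n α).ncard = 2 * (Apos N n α).ncard + 2 * sqI n := by
  have hfin := finite_FixA (N := N) hn hα
  have h1 : FixA N n α = (Apos N n α ∪ {A | A ∈ FixA N n α ∧ A 1 0 < 0}) ∪
      {A | A ∈ FixA N n α ∧ A 1 0 = 0} := by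
    ext A
    constructor
    · intro hA
      rcases lt_trichotomy (A 1 0) 0 with h | h | h
      · exact Or.inl (Or.inr ⟨hA, h⟩)
      · exact Or.inr ⟨hA, h⟩
      · exact Or.inl (Or.inl ⟨hA, h⟩)
    · rintro ((h | h) | h) <;> exact h.1
  have hneg : {A | A ∈ FixA N n α ∧ A 1 0 < 0} = (fun A : MZ => -A) '' Apos N n α := by
    ext A
    constructor
    · rintro ⟨hA, h⟩
      exact ⟨-A, ⟨neg_mem_FixA hA, by simpa using h⟩, by simp⟩
    · rintro ⟨B, ⟨hB, h⟩, rfl⟩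
      exact ⟨neg_mem_FixA hB, by simpa using h⟩
  have hf1 : (Apos N n α).Finite := hfin.subset fun A hA => hA.1
  have hf2 : {A | A ∈ FixA N n α ∧ A 1 0 < 0}.Finite := hfin.subset fun A hA => hA.1
  have hf3 : {A | A ∈ FixA N n α ∧ A 1 0 = 0}.Finite := hfin.subset fun A hA => hA.1
  conv_lhs => rw [h1]
  rw [Set.ncard_union_eq _ (hf1.union hf2) hf3, Set.ncard_union_eq _ hf1 hf2, scalar_ncard hn hα,
    hneg, Set.ncard_image_of_injective _ neg_injective]
  · ring
  · rw [Set.disjoint_left]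
    rintro A ⟨-, h⟩ ⟨-, h'⟩
    exact absurd h (not_lt.mpr h'.le)
  · rw [Set.disjoint_left]
    rintro A (⟨-, h⟩ | ⟨-, h⟩) ⟨-, h'⟩
    · exact h.ne' h'
    · exact h.ne h'

lemma FixA_ncard_le {N n e : ℕ} (hn : 0 < n) (he : e ∣ N) (he0 : 0 < e) {B : MZ} (hB : B ∈ AL N e)
    {α : ℂ} (hα : α ∈ UH) : (FixA N n (act B α)).ncard ≤ (FixA N n α).ncard := by
  have hBd := AL.det_pos he0 hB
  have hex : ∀ M ∈ FixA N n (act B α), ∃ M' ∈ FixA N n α, M * B = B * M' := by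
    rintro M ⟨hM, hf⟩
    obtain ⟨M', hM', h⟩ := Mn_conj he he0 hB hM
    refine ⟨M', ⟨hM', ?_⟩, h⟩
    have hMd := Mn.det_pos hn hM
    have hMd' := Mn.det_pos hn hM'
    by_contra hne
    refine act_ne hBd (act_mem hMd' hα) hα hne ?_
    rw [← act_mul hBd hMd' hα, ← h, act_mul hMd hBd hα, hf]
  choose! f hf hfe using hex
  refine Set.ncard_le_ncard_of_injOn f hf ?_ (finite_FixA hn hα)
  intro M hM M' hM' he
  have h1 : M * B = M' * B := by rw [hfe M hM, hfe M' hM', he]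
  have h2 : B.det • M = B.det • M' := by
    have := congrArg (· * B.adjugate) h1
    simpa only [mul_assoc, Matrix.mul_adjugate, Matrix.mul_smul, mul_one] using this
  exact smul_right_injective _ hBd.ne' h2

lemma FixA_ncard_act {N n e : ℕ} (hn : 0 < n) (he : e ∣ N) (he0 : 0 < e) {B : MZ}
    (hB : B ∈ AL N e) {α : ℂ} (hα : α ∈ UH) :
    (FixA N n (act B α)).ncard = (FixA N n α).ncard := by
  have hBd := AL.det_pos he0 hB
  refine le_antisymm (FixA_ncard_le hn he he0 hB hα) ?_
  have := FixA_ncard_le hn he he0 (adjugate_mem_AL hB) (act_mem hBd hα)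
  rwa [← act_mul (adjugate_det_pos hBd) hBd hα, Matrix.adjugate_mul, act_smul hBd.ne', act_one]
    at this

lemma Apos_ncard_act {N n e : ℕ} (hn : 0 < n) (he : e ∣ N) (he0 : 0 < e) {B : MZ}
    (hB : B ∈ AL N e) {α : ℂ} (hα : α ∈ UH) :
    (Apos N n (act B α)).ncard = (Apos N n α).ncard := by
  have h1 := FixA_ncard_act hn he he0 hB hα
  rw [FixA_ncard hn hα, FixA_ncard hn (act_mem (AL.det_pos he0 hB) hα)] at h1
  omega

namespace Haupt

variable {N : ℕ} {t g : ℂ → ℂ}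

lemma od_pos (H : Haupt N t g) {α : ℂ} (hα : α ∈ UH) : 0 < od t α := (H.od_local hα).1

theorem Stab_ncard (H : Haupt N t g) {α : ℂ} (hα : α ∈ UH) :
    (Stab N α).ncard = 2 * od t α := by
  classical
  have hfin : (Stab N α).Finite := by rw [Stab_eq]; exact finite_FixA one_pos hα
  have hm := H.od_pos hα
  have : NeZero (od t α) := ⟨hm.ne'⟩
  set S := hfin.toFinset with hS
  have hmem : ∀ γ, γ ∈ S ↔ γ ∈ Stab N α := fun γ => hfin.mem_toFinset
  set R := Polynomial.nthRootsFinset (od t α) (1 : ℂ) with hR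
  have hRmem : ∀ ζ, ζ ∈ R ↔ ζ ^ od t α = 1 := fun ζ => Polynomial.mem_nthRootsFinset hm 1
  have hmaps : ∀ γ ∈ S, lam γ α ∈ R := fun γ hγ =>
    (hRmem _).mpr (H.lam_pow hα ((hmem γ).mp hγ))
  rw [Set.ncard_eq_toFinset_card _ hfin, Finset.card_eq_sum_card_fiberwise hmaps]
  have hcard : R.card = od t α := (Complex.isPrimitiveRoot_exp _ hm.ne').card_nthRootsFinset
  rw [Finset.sum_const_nat (m := 2), hcard, mul_comm]
  intro ζ hζ
  obtain ⟨γ, hγ, hγζ⟩ := H.exists_stab hα ((hRmem ζ).mp hζ)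
  have hd := AL.det_pos one_pos hγ.1
  have hdet : ∀ γ ∈ Stab N α, γ.det = 1 := fun γ hγ => by simpa using hγ.1.2.2.2
  have hneg : -γ ∈ Stab N α := by rw [Stab_eq] at hγ ⊢; exact neg_mem_FixA hγ
  have : S.filter (fun γ' => lam γ' α = ζ) = {γ, -γ} := by
    ext γ'
    simp only [Finset.mem_filter, hmem, Finset.mem_insert, Finset.mem_singleton]
    constructor
    · rintro ⟨h1, h2⟩
      rw [← hγζ, lam_one_det (hdet _ h1), lam_one_det (hdet _ hγ), _root_.inv_inj] at h2
      have hd' := AL.det_pos one_pos h1.1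
      rcases sq_eq_sq_iff_eq_or_eq_neg.mp h2 with h | h
      · exact Or.inl (eq_of_den_eq hd' hα h1.2 hγ.2 h)
      · rw [← den_neg] at h
        exact Or.inr (eq_of_den_eq hd' hα h1.2 hneg.2 h)
    · rintro (rfl | rfl)
      · exact ⟨hγ, hγζ⟩
      · refine ⟨hneg, ?_⟩
        rw [lam_one_det (hdet _ hneg), den_neg, neg_sq, ← lam_one_det (hdet _ hγ), hγζ]
  rw [this, Finset.card_pair]
  intro h
  have h2 : ∀ i j, γ i j = 0 := fun i j => by
    have := congrFun (congrFun h i) j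
    rw [Matrix.neg_apply] at this
    omega
  rw [Matrix.det_fin_two, h2 0 0, h2 0 1] at hd
  simp at hd

lemma od_act (H : Haupt N t g) {e : ℕ} (he : e ∣ N) {B : MZ} (hB : B ∈ AL N e) {α : ℂ}
    (hα : α ∈ UH) : od t (act B α) = od t α := by
  have h1 := FixA_ncard_act one_pos he (H.dvd_pos he) hB hα
  rw [← Stab_eq, ← Stab_eq, H.Stab_ncard hα,
    H.Stab_ncard (act_mem (AL.det_pos (H.dvd_pos he) hB) hα)] at h1
  omega

theorem FixA_ncard_eq (H : Haupt N t g) {n : ℕ} (hn : 0 < n) {α : ℂ} (hα : α ∈ UH)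
    [DecidablePred fun i => Tn N t i α = t α] :
    (FixA N n α).ncard = 2 * od t α * ((Ix N n).filter fun i => Tn N t i α = t α).card := by
  classical
  set J := (Ix N n).filter fun i => Tn N t i α = t α with hJ
  have hC : ∀ i ∈ J, ∃ C ∈ AL N 1, act (C * Rp N i) α = α := by
    intro i hi
    obtain ⟨hi1, hi2⟩ := Finset.mem_filter.mp hi
    obtain ⟨γ, hγ, h⟩ := (H.t_eq_iff (H.act_Rp_mem hn hi1 hα) hα).mp hi2
    refine ⟨γ, hγ, ?_⟩
    rw [act_mul (AL.det_pos one_pos hγ) (Mn.det_pos hn (smul_Rp H.sqf hn hi1).1) hα, ← h]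
  choose! C hCm hCf using hC
  rw [← H.Stab_ncard hα, ← Set.ncard_coe_finset J, ← Set.ncard_prod]
  symm
  have hRm : ∀ i ∈ J, Rp N i ∈ Mn N n := fun i hi =>
    (smul_Rp H.sqf hn (Finset.mem_filter.mp hi).1).1
  have hT : ∀ p : MZ × (Σ _ : ℕ, Σ _ : ℕ × ℕ, ℕ), p.1 ∈ Stab N α → p.2 ∈ J →
      ∀ z ∈ UH, t (act (p.1 * (C p.2 * Rp N p.2)) z) = Tn N t p.2 z := by
    intro p h1 h2 z hz
    have hd1 := AL.det_pos one_pos h1.1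
    have hd2 := AL.det_pos one_pos (hCm _ h2)
    have hd3 := Mn.det_pos hn (hRm _ h2)
    have hd4 := Mn.det_pos hn (Mn_one_mul (hCm _ h2) (hRm _ h2))
    rw [act_mul hd1 hd4 hz, H.inv _ h1.1 _ (act_mem hd4 hz), act_mul hd2 hd3 hz,
      H.inv _ (hCm _ h2) _ (act_mem hd3 hz), Tn]
  refine Set.ncard_congr (fun p _ => p.1 * (C p.2 * Rp N p.2)) ?_ ?_ ?_
  · rintro ⟨γ, i⟩ ⟨h1, h2⟩
    have hm := Mn_one_mul (hCm i h2) (hRm i h2)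
    refine ⟨Mn_one_mul h1.1 hm, ?_⟩
    dsimp only at *
    rw [act_mul (AL.det_pos one_pos h1.1) (Mn.det_pos hn hm) hα, hCf i h2, h1.2]
  · rintro ⟨γ, i⟩ ⟨γ', j⟩ ⟨h1, h2⟩ ⟨h3, h4⟩ he
    dsimp only at *
    have hij : i = j := by
      refine H.Tn_inj hn (Finset.mem_filter.mp h2).1 (Finset.mem_filter.mp h4).1 fun z hz => ?_
      rw [← hT (γ, i) h1 h2 z hz, ← hT (γ', j) h3 h4 z hz]
      dsimp only
      rw [he]
    subst hij
    have hd := Mn.det_pos hn (Mn_one_mul (hCm i h2) (hRm i h2))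
    have h5 := congrArg (· * (C i * Rp N i).adjugate) he
    simp only [mul_assoc γ, mul_assoc γ', Matrix.mul_adjugate, Matrix.mul_smul, mul_one] at h5
    rw [smul_right_injective _ hd.ne' h5]
  · intro A hA
    obtain ⟨i, hi, D, hD, rfl⟩ := exists_ix H.sqf hn hA.1
    have hRi := (smul_Rp H.sqf hn hi).1
    have hDd := AL.det_pos one_pos hD
    have hRd := Mn.det_pos hn hRi
    have hiJ : i ∈ J := by
      refine Finset.mem_filter.mpr ⟨hi, ?_⟩
      rw [Tn, ← H.inv D hD _ (act_mem hRd hα), ← act_mul hDd hRd hα, hA.2]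
    have hCd := AL.det_pos one_pos (hCm i hiJ)
    have hC1 : (C i).det = 1 := by simpa using (hCm i hiJ).2.2.2
    have hadj : (C i).adjugate * C i = 1 := by rw [Matrix.adjugate_mul, hC1, one_smul]
    have hmul : D * (C i).adjugate * (C i * Rp N i) = D * Rp N i := by
      rw [mul_assoc, ← mul_assoc _ (C i), hadj, one_mul]
    have hmemS : D * (C i).adjugate ∈ AL N 1 :=
      AL_one_mul (adjugate_mem_AL (hCm i hiJ)) hD H.sqf (one_dvd N)
    refine ⟨(D * (C i).adjugate, i), ⟨⟨hmemS, ?_⟩, hiJ⟩, hmul⟩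
    have := hA.2
    rw [← hmul, act_mul (AL.det_pos one_pos hmemS) (Mn.det_pos hn (Mn_one_mul (hCm i hiJ) hRi)) hα,
      hCf i hiJ] at this
    exact this

end Haupt

lemma exists_not_CM : ∃ z ∈ UH, z ∉ CM := by
  obtain ⟨x, hx1, hx2⟩ := (countable_CM.dense_compl ℂ).inter_open_nonempty UH isOpen_UH ⟨I, Haupt.I_mem⟩
  exact ⟨x, hx1, hx2⟩

namespace Haupt
variable {N : ℕ} {t g : ℂ → ℂ}

/-- The indices of the correspondence whose branch differs from `t` itself. -/
def Io (N : ℕ) (t : ℂ → ℂ) (n : ℕ) : Finset (Σ _ : ℕ, Σ _ : ℕ × ℕ, ℕ) := by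
  classical exact (Ix N n).filter fun i => ¬ ∀ z ∈ UH, Tn N t i z = t z

lemma mem_Io {n : ℕ} {i} : i ∈ Io N t n ↔ i ∈ Ix N n ∧ ¬ ∀ z ∈ UH, Tn N t i z = t z := by
  simp [Io]

/-- The number of nontrivial branches passing through `(t α, t α)`. -/
def mult (N : ℕ) (t : ℂ → ℂ) (n : ℕ) (α : ℂ) : ℕ := by
  classical exact ((Io N t n).filter fun i => Tn N t i α = t α).card

lemma sqI_eq_one {n : ℕ} (h : IsSquare n) : sqI n = 1 := by simp [sqI, h]

lemma sqI_eq_zero {n : ℕ} (h : ¬ IsSquare n) : sqI n = 0 := by simp [sqI, h]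

lemma card_diag (H : Haupt N t g) {n : ℕ} (hn : 0 < n)
    [DecidablePred fun i => ∀ z ∈ UH, Tn N t i z = t z] :
    ((Ix N n).filter fun i => ∀ z ∈ UH, Tn N t i z = t z).card = sqI n := by
  classical
  refine le_antisymm ?_ ?_
  · obtain ⟨α, hα, hcm⟩ := exists_not_CM
    have hA : Apos N n α = ∅ := by
      ext A
      simp only [Set.mem_empty_iff_false, iff_false]
      rintro ⟨hA, h⟩
      exact hcm ⟨hα, A, Mn.det_pos hn hA.1, h.ne', hA.2⟩
    have h1 := FixA_ncard (N := N) hn hα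
    rw [hA, Set.ncard_empty, H.FixA_ncard_eq hn hα] at h1
    have h2 : ((Ix N n).filter fun i => ∀ z ∈ UH, Tn N t i z = t z).card ≤
        ((Ix N n).filter fun i => Tn N t i α = t α).card := by
      refine Finset.card_le_card fun i hi => ?_
      rw [Finset.mem_filter] at hi ⊢
      exact ⟨hi.1, hi.2 α hα⟩
    have h3 := H.od_pos hα
    nlinarith
  · by_cases hs : IsSquare n
    · rw [sqI_eq_one hs, Nat.succ_le_iff, Finset.card_pos]
      obtain ⟨k, hk⟩ := hs
      have hm : ((k : ℤ) • (1 : MZ)) ∈ FixA N n I :=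
        smul_one_mem_FixA (by rw [hk]; push_cast; ring) hn I
      obtain ⟨i, hi, h⟩ := H.t_act_eq_Tn hn hm.1
      refine ⟨i, Finset.mem_filter.mpr ⟨hi, fun z hz => ?_⟩⟩
      have hk0 : (k : ℤ) ≠ 0 := by rintro h0; simp at h0; subst h0; omega
      rw [← h z hz, act_smul hk0, act_one]
    · rw [sqI_eq_zero hs]; exact Nat.zero_le _

lemma card_fiber (H : Haupt N t g) {n : ℕ} (hn : 0 < n) {α : ℂ} (hα : α ∈ UH)
    [DecidablePred fun i => Tn N t i α = t α] :
    ((Ix N n).filter fun i => Tn N t i α = t α).card = mult N t n α + sqI n := by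
  classical
  rw [← H.card_diag hn, mult, Io, Finset.filter_filter, add_comm,
    ← Finset.card_filter_add_card_filter_not (s := (Ix N n).filter fun i => Tn N t i α = t α)
      (fun i => ∀ z ∈ UH, Tn N t i z = t z), Finset.filter_filter, Finset.filter_filter]
  congr 2
  · ext i
    simp only [Finset.mem_filter, and_congr_right_iff]
    exact fun _ => ⟨fun h => h.2, fun h => ⟨h α hα, h⟩⟩
  · ext i
    simp only [Finset.mem_filter, and_congr_right_iff]
    exact fun _ => and_comm

lemma card_Apos (H : Haupt N t g) {n : ℕ} (hn : 0 < n) {α : ℂ} (hα : α ∈ UH) :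
    (Apos N n α).ncard + sqI n = od t α * (mult N t n α + sqI n) := by
  classical
  have h1 := FixA_ncard (N := N) hn hα
  rw [H.FixA_ncard_eq hn hα, H.card_fiber hn hα] at h1
  nlinarith

/-- The value of the modular polynomial on the diagonal, with the trivial branch removed. -/
def Psi (N : ℕ) (t : ℂ → ℂ) (n : ℕ) (z : ℂ) : ℂ := ∏ i ∈ Io N t n, (t z - Tn N t i z)

lemma Psi_ord (H : Haupt N t g) {n : ℕ} (hn : 0 < n) {α : ℂ} (hα : α ∈ UH) :
    OrdAt α (Psi N t n) (mult N t n α * od t α) := by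
  classical
  have h : ∀ i ∈ Io N t n, OrdAt α (fun z => t z - Tn N t i z)
      (if Tn N t i α = t α then od t α else 0) := by
    intro i hi
    obtain ⟨hi, hne⟩ := mem_Io.mp hi
    split_ifs with h
    · have hRm := (smul_Rp H.sqf hn hi).1
      have hR := H.act_Rp_mem hn hi hα
      obtain ⟨γ, hγ, hγα⟩ := (H.t_eq_iff hR hα).mp h
      have hd := Mn.det_pos hn hRm
      have hA : γ * Rp N i ∈ FixA N n α :=
        ⟨Mn_one_mul hγ hRm, by rw [act_mul (AL.det_pos one_pos hγ) hd hα, ← hγα]⟩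
      have ht : ∀ z ∈ UH, t (act (γ * Rp N i) z) = Tn N t i z := fun z hz => by
        rw [act_mul (AL.det_pos one_pos hγ) hd hz, H.inv γ hγ _ (H.act_Rp_mem hn hi hz), Tn]
      refine (H.ord_sub_act hn hα hA fun h' => hne fun z hz => ?_).congr ?_
      · rw [← ht z hz, h' z hz]
      · refine Filter.Eventually.filter_mono nhdsWithin_le_nhds ?_
        filter_upwards [isOpen_UH.mem_nhds hα] with z hz
        rw [ht z hz]
    · refine OrdAt.of_ne_zero ?_ (sub_ne_zero.mpr (Ne.symm h))
      exact ((H.diff.differentiableAt (isOpen_UH.mem_nhds hα)).sub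
        ((H.Tn_diff hn hi).differentiableAt (isOpen_UH.mem_nhds hα))).continuousAt
  have := OrdAt.prod (Io N t n) h
  rw [← Finset.sum_filter, Finset.sum_const, smul_eq_mul] at this
  exact this

lemma poly_ord (H : Haupt N t g) {α : ℂ} (hα : α ∈ UH) {R : Polynomial ℂ} (hR : R ≠ 0)
    (o : ℕ → ℤ) :
    OrdAt α (fun z => R.eval (t z) * ∏ e ∈ W' N, (t z - xe N t e) ^ o e)
      (R.rootMultiplicity (t α) * od t α) := by
  obtain ⟨S, hS, hS0⟩ := Polynomial.exists_eq_pow_rootMultiplicity_mul_and_not_dvd R hR (t α)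
  rw [Polynomial.dvd_iff_isRoot] at hS0
  set m := R.rootMultiplicity (t α)
  have ht := (H.diff.differentiableAt (isOpen_UH.mem_nhds hα)).continuousAt
  have h1 := (H.od_spec hα).pow m
  have hx : ∀ e ∈ W' N, t α - xe N t e ≠ 0 := fun e he => by
    obtain ⟨h1, h2⟩ := H.mem_W'.mp he
    exact H.t_sub_ne_zero h1 h2 hα
  have h2 : OrdAt α (fun z => S.eval (t z) * ∏ e ∈ W' N, (t z - xe N t e) ^ o e) 0 := by
    refine OrdAt.of_ne_zero ?_ (mul_ne_zero hS0
      (Finset.prod_ne_zero_iff.mpr fun e he => zpow_ne_zero _ (hx e he)))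
    refine ContinuousAt.mul (S.continuous.continuousAt.comp ht) ?_
    refine tendsto_finsetProd _ fun e he => ?_
    exact (ht.sub continuousAt_const).zpow₀ _ (Or.inl (hx e he))
  refine (h1.mul h2).congr (Eventually.of_forall fun z => ?_)
  conv_rhs => rw [hS]
  simp [mul_assoc]

/-- Every value other than those at the cusps is attained. -/
lemma exists_t_eq (H : Haupt N t g) {ρ : ℂ} (hρ : ∀ e ∈ W' N, ρ ≠ xe N t e) :
    ∃ α ∈ UH, t α = ρ := by
  by_contra! hne
  have h0 : ∀ z ∈ UH, t z - ρ ≠ 0 := fun z hz => sub_ne_zero.mpr (hne z hz)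
  obtain ⟨c, hc⟩ := liouville H.sqf (F := fun z => (t z - ρ)⁻¹)
    ((H.diff.sub (differentiableOn_const ρ)).inv h0)
    (fun γ hγ z hz => by simp only [H.inv γ hγ z hz]) (fun e he => by
      refine ⟨rep N e, rep_mem H.sqf he, ?_⟩
      by_cases he1 : e = 1
      · subst he1
        have := (H.t_sub_asy ρ).inv
        rw [neg_neg] at this
        have h2 : Tendsto (fun z => (t z - ρ)⁻¹) atI (𝓝 0) :=
          this.isBigO.trans_tendsto (tendsto_ex one_pos)
        refine (h2.isBigO_one ℝ).congr' ?_ EventuallyEq.rfl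
        filter_upwards [UH_mem_atI] with z hz
        rw [← H.te_one hz, te]
      · have hx := hρ e (H.mem_W'.mpr ⟨he, he1⟩)
        have := (H.tendsto_te he he1).sub_const ρ
        exact (this.inv₀ (sub_ne_zero.mpr hx.symm)).isBigO_one ℝ)
  have h2 := H.t_not_const (c⁻¹ + ρ)
  obtain ⟨z, hz, hzne⟩ := h2
  apply hzne
  rw [← hc z hz, inv_inv]; ring

/-- The zeros of a function in terms of the polynomial expressing it. -/
lemma rootMultiplicity_eq (H : Haupt N t g) {α : ℂ} (hα : α ∈ UH) {R : Polynomial ℂ} (hR : R ≠ 0)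
    {o : ℕ → ℤ} {G : ℂ → ℂ} {k : ℕ}
    (hG : ∀ z ∈ UH, G z = R.eval (t z) * ∏ e ∈ W' N, (t z - xe N t e) ^ o e)
    (hk : OrdAt α G k) : R.rootMultiplicity (t α) * od t α = k := by
  refine OrdAt.unique ((H.poly_ord hα hR o).congr ?_) hk
  refine Filter.Eventually.filter_mono nhdsWithin_le_nhds ?_
  filter_upwards [isOpen_UH.mem_nhds hα] with z hz
  rw [hG z hz]

end Haupt

/-- `F = C q^o (1 + a q + b q² + o(q²))` at `i∞`, where `β = b - a² / 2` is the
second coefficient of the logarithm. -/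
def X2 (F : ℂ → ℂ) (o : ℤ) (β : ℂ) : Prop :=
  ∃ C : ℂ, C ≠ 0 ∧ ∃ a : ℂ,
    (fun z => F z * qc z ^ (-o) - C * (1 + a * qc z + (β + a ^ 2 / 2) * qc z ^ 2)) =o[atI]
      (fun z => qc z ^ 2)

lemma isBigO_one_of_continuous {p : ℂ → ℂ} (hp : Continuous p) :
    (fun z => p (qc z)) =O[atI] (fun _ => (1 : ℂ)) :=
  ((hp.tendsto 0).comp tendsto_qc_nhds).isBigO_one ℂ

lemma qc_cube_isLittleO {p : ℂ → ℂ} (hp : Continuous p) :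
    (fun z => qc z ^ 3 * p (qc z)) =o[atI] (fun z => qc z ^ 2) := by
  have h1 : (fun z => qc z ^ 3) =o[atI] (fun z => qc z ^ 2) :=
    (isLittleO_pow_pow (𝕜 := ℂ) (m := 2) (n := 3) (by norm_num)).comp_tendsto tendsto_qc_nhds
  simpa using h1.mul_isBigO (isBigO_one_of_continuous hp)

lemma qc_sq_tendsto : Tendsto (fun z => qc z ^ 2) atI (𝓝 0) := by
  simpa using tendsto_qc_nhds.pow 2

namespace X2
variable {F G : ℂ → ℂ} {o o' : ℤ} {β β' : ℂ}

lemma congr (hF : X2 F o β) (h : F =ᶠ[atI] G) : X2 G o β := by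
  obtain ⟨C, hC, a, h1⟩ := hF
  refine ⟨C, hC, a, h1.congr' ?_ EventuallyEq.rfl⟩
  filter_upwards [h] with z hz
  rw [hz]

lemma tendsto_of {F : ℂ → ℂ} {o : ℤ} {C a b : ℂ}
    (h1 : (fun z => F z * qc z ^ (-o) - C * (1 + a * qc z + b * qc z ^ 2)) =o[atI]
      (fun z => qc z ^ 2)) : Tendsto (fun z => F z * qc z ^ (-o)) atI (𝓝 C) := by
  have h2 := h1.isBigO.trans_tendsto qc_sq_tendsto
  have hc : Continuous fun q : ℂ => C * (1 + a * q + b * q ^ 2) := by fun_prop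
  have h3 := h2.add ((hc.tendsto 0).comp tendsto_qc_nhds)
  simpa using h3

lemma asy (hF : X2 F o β) : ∃ C, Asy F o C := by
  obtain ⟨C, hC, a, h1⟩ := hF
  refine ⟨C, hC, (tendsto_of h1).congr fun z => ?_⟩
  rw [← ex_int]; push_cast; rfl

lemma mul (hF : X2 F o β) (hG : X2 G o' β') : X2 (fun z => F z * G z) (o + o') (β + β') := by
  obtain ⟨C, hC, a, h1⟩ := hF
  obtain ⟨D, hD, a', h2⟩ := hG
  refine ⟨C * D, mul_ne_zero hC hD, a + a', ?_⟩
  have t1 : (fun z => F z * qc z ^ (-o)) =O[atI] (fun _ => (1 : ℂ)) := (tendsto_of h1).isBigO_one ℂ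
  have t2 := isBigO_one_of_continuous
    (p := fun q => D * (1 + a' * q + (β' + a' ^ 2 / 2) * q ^ 2)) (by fun_prop)
  have e1 := t1.mul_isLittleO h2
  have e2 := t2.mul_isLittleO h1
  have e3 := qc_cube_isLittleO (p := fun q => C * D * (a * (β' + a' ^ 2 / 2) +
    a' * (β + a ^ 2 / 2) + (β + a ^ 2 / 2) * (β' + a' ^ 2 / 2) * q)) (by fun_prop)
  simp only [one_mul] at e1 e2
  refine ((e1.add e2).add e3).congr_left fun z => ?_
  rw [neg_add, zpow_add₀ (qc_ne_zero z)]
  ring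

lemma inv (hF : X2 F o β) : X2 (fun z => (F z)⁻¹) (-o) (-β) := by
  obtain ⟨C, hC, a, h1⟩ := hF
  refine ⟨C⁻¹, inv_ne_zero hC, -a, ?_⟩
  have t1 := tendsto_of h1
  have t2 : (fun z => (F z * qc z ^ (-o))⁻¹) =O[atI] (fun _ => (1 : ℂ)) :=
    (t1.inv₀ hC).isBigO_one ℂ
  have t3 := isBigO_one_of_continuous
    (p := fun q => -C⁻¹ * (1 + -a * q + (-β + (-a) ^ 2 / 2) * q ^ 2)) (by fun_prop)
  have e1 := t3.mul_isLittleO h1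
  have e2 := qc_cube_isLittleO (p := fun q => -(a * (-β + a ^ 2 / 2) - a * (β + a ^ 2 / 2) +
    (β + a ^ 2 / 2) * (-β + a ^ 2 / 2) * q)) (by fun_prop)
  have e3 := t2.mul_isLittleO (e1.add (by simpa using e2))
  simp only [one_mul] at e3
  refine e3.congr' ?_ EventuallyEq.rfl
  filter_upwards [t1.eventually_ne hC] with z hz
  have h4 : (F z)⁻¹ * qc z ^ (- -o) = (F z * qc z ^ (-o))⁻¹ := by
    rw [mul_inv, _root_.zpow_neg (qc z) (-o)]
  rw [h4]
  generalize F z * qc z ^ (-o) = U at hz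
  field_simp
  ring

lemma const {C : ℂ} (hC : C ≠ 0) : X2 (fun _ => C) 0 0 := by
  refine ⟨C, hC, 0, ?_⟩
  simp

lemma prod {ι : Type*} (s : Finset ι) {F : ι → ℂ → ℂ} {o : ι → ℤ} {β : ι → ℂ}
    (h : ∀ i ∈ s, X2 (F i) (o i) (β i)) :
    X2 (fun z => ∏ i ∈ s, F i z) (∑ i ∈ s, o i) (∑ i ∈ s, β i) := by
  classical
  induction s using Finset.induction_on with
  | empty => simpa using const one_ne_zero
  | insert i s hi ih =>
    simp only [Finset.prod_insert hi, Finset.sum_insert hi]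
    exact (h i (Finset.mem_insert_self i s)).mul
      (ih fun j hj => h j (Finset.mem_insert_of_mem hj))

lemma pow (hF : X2 F o β) (n : ℕ) : X2 (fun z => F z ^ n) (n * o) (n * β) := by
  have := prod (Finset.range n) (F := fun _ => F) (o := fun _ => o) (β := fun _ => β)
    fun _ _ => hF
  simpa using this

lemma zpow (hF : X2 F o β) (n : ℤ) : X2 (fun z => F z ^ n) (n * o) (n * β) := by
  obtain ⟨n, rfl | rfl⟩ := n.eq_nat_or_neg
  · simpa using hF.pow n
  · have := (hF.pow n).inv
    simpa [_root_.zpow_neg] using this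

lemma qzpow (m : ℤ) : X2 (fun z => qc z ^ m) m 0 := by
  refine ⟨1, one_ne_zero, 0, ?_⟩
  refine (isLittleO_zero _ _).congr_left fun z => ?_
  rw [← zpow_add₀ (qc_ne_zero z)]
  simp

lemma eq_zero_of_isLittleO {a b c : ℂ}
    (h : (fun z => a + b * qc z + c * qc z ^ 2) =o[atI] (fun z => qc z ^ 2)) :
    a = 0 ∧ b = 0 ∧ c = 0 := by
  have hq : Tendsto (fun z => qc z) atI (𝓝 0) := tendsto_qc_nhds
  have ha : a = 0 := by
    have h1 := h.isBigO.trans_tendsto qc_sq_tendsto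
    have hc : Continuous fun q : ℂ => a + b * q + c * q ^ 2 := by fun_prop
    have h2 := (hc.tendsto 0).comp hq
    simpa using tendsto_nhds_unique h2 h1
  subst ha
  have h2 := h.tendsto_div_nhds_zero
  have hb : b = 0 := by
    have h3 := h2.mul hq
    have hc : Continuous fun q : ℂ => b + c * q := by fun_prop
    have h4 := (hc.tendsto 0).comp hq
    have h5 : b + c * 0 = 0 * 0 := by
      refine tendsto_nhds_unique h4 (h3.congr fun z => ?_)
      have := qc_ne_zero z
      simp only [Function.comp]
      field_simp
      ring
    simpa using h5
  subst hb
  refine ⟨rfl, rfl, tendsto_nhds_unique tendsto_const_nhds (h2.congr fun z => ?_)⟩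
  have := qc_ne_zero z
  field_simp
  ring

lemma unique (hF : X2 F o β) (hG : X2 F o' β') : o = o' ∧ β = β' := by
  obtain ⟨_, h1⟩ := hF.asy
  obtain ⟨_, h2⟩ := hG.asy
  have ho : o = o' := by exact_mod_cast h1.exponent_eq h2
  subst ho
  refine ⟨rfl, ?_⟩
  obtain ⟨C, hC, a, h1⟩ := hF
  obtain ⟨D, hD, a', h2⟩ := hG
  have h3 : (fun z => (C - D) + (C * a - D * a') * qc z +
      (C * (β + a ^ 2 / 2) - D * (β' + a' ^ 2 / 2)) * qc z ^ 2) =o[atI] (fun z => qc z ^ 2) :=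
    (h2.sub h1).congr_left fun z => by ring
  obtain ⟨e1, e2, e3⟩ := eq_zero_of_isLittleO h3
  obtain rfl := sub_eq_zero.mp e1
  have e4 : a = a' := mul_left_cancel₀ hC (sub_eq_zero.mp e2)
  subst e4
  have := mul_left_cancel₀ hC (sub_eq_zero.mp e3)
  exact add_right_cancel this

lemma of_isLittleO (h : (fun z => F z - 1) =o[atI] (fun z => qc z ^ 2)) : X2 F 0 0 := by
  refine ⟨1, one_ne_zero, 0, ?_⟩
  simpa using h

end X2

/-- The polynomial `A` such that `A (t) = q⁻² + O(q)`. -/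
def Aq (g : ℂ → ℂ) (x : ℂ) : ℂ := x ^ 2 - 2 * deriv g 0

namespace Haupt
variable {N : ℕ} {t g : ℂ → ℂ}

lemma g_analyticAt (H : Haupt N t g) : AnalyticAt ℂ g 0 :=
  H.g_diff.analyticAt (Metric.ball_mem_nhds 0 one_pos)

lemma g_isLittleO (H : Haupt N t g) :
    (fun z => g (qc z) - deriv g 0 * qc z) =o[atI] qc := by
  have h := H.g_analyticAt.differentiableAt.hasDerivAt.isLittleO.comp_tendsto tendsto_qc_nhds
  refine (h.congr_left fun z => ?_).congr_right fun z => ?_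
  · simp [H.g_zero, mul_comm]
  · simp

lemma t_sub_X2 (H : Haupt N t g) (x : ℂ) : X2 (fun z => t z - x) (-1) (-Aq g x / 2) := by
  refine ⟨1, one_ne_zero, -x, ?_⟩
  have h := (isBigO_refl qc atI).mul_isLittleO H.g_isLittleO
  refine (h.congr' ?_ EventuallyEq.rfl).congr_right fun z => by ring
  filter_upwards [UH_mem_atI] with z hz
  rw [H.expand z hz, Aq]
  have := qc_ne_zero z
  simp only [neg_neg, zpow_one]
  field_simp
  ring

lemma multiset_X2 (H : Haupt N t g) (s : Multiset ℂ) :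
    X2 (fun z => (s.map fun ρ => t z - ρ).prod) (-s.card) (-(s.map (Aq g)).sum / 2) := by
  induction s using Multiset.induction_on with
  | empty => simpa using X2.const one_ne_zero
  | cons a s ih =>
    have := (H.t_sub_X2 a).mul ih
    simp only [Multiset.map_cons, Multiset.prod_cons, Multiset.card_cons, Multiset.sum_cons]
    convert this using 1
    · push_cast; ring
    · ring

/-- The residue theorem on `X₀(N)` for `A(t) · dlog G`. -/
theorem residue_sum (H : Haupt N t g) {G : ℂ → ℂ} (hd : DifferentiableOn ℂ G UH)
    (hi : ∀ γ ∈ AL N 1, ∀ z ∈ UH, G (act γ z) = G z) (o : ℕ → ℤ)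
    (hb : ∀ e ∈ W' N, ∃ C, Asy (te N G e) (o e) C) {β : ℂ}
    (hX : X2 G (o 1) β) :
    ∃ R : Polynomial ℂ, R ≠ 0 ∧
      (∀ z ∈ UH, G z = R.eval (t z) * ∏ e ∈ W' N, (t z - xe N t e) ^ (o e)) ∧
      (∀ ρ ∈ R.roots, ∃ α ∈ UH, t α = ρ) ∧
      (R.roots.card : ℤ) = -∑ e ∈ N.divisors, o e ∧
      (R.roots.map (Aq g)).sum = -2 * β - ∑ e ∈ W' N, o e * Aq g (xe N t e) := by
  have hb' : ∀ e, e ∣ N → ∃ C, Asy (fun z => G (act (rep N e) z)) (o e) C := by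
    intro e he
    by_cases he1 : e = 1
    · subst he1
      obtain ⟨C, hC⟩ := hX.asy
      refine ⟨C, hC.congr fun z hz => ?_⟩
      have h := rep_mem H.sqf he
      rw [hi _ h z hz]
    · exact hb e (H.mem_W'.mpr ⟨he, he1⟩)
  obtain ⟨R, hR, hG, hx⟩ := H.exists_poly_of_asy hd hi o hb'
  refine ⟨R, hR, hG, fun ρ hρ => H.exists_t_eq fun e he h => ?_, ?_⟩
  · rw [Polynomial.mem_roots hR] at hρ
    exact hx e he (h ▸ hρ)
  have hlc : R.leadingCoeff ≠ 0 := Polynomial.leadingCoeff_ne_zero.mpr hR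
  have hev : ∀ y, R.eval y = R.leadingCoeff * (R.roots.map fun ρ => y - ρ).prod := fun y => by
    have hs := (IsAlgClosed.splits R).eval_eq_prod_roots y
    exact hs
  have h1 := ((X2.const hlc).mul (H.multiset_X2 R.roots)).mul
    (X2.prod (W' N) (F := fun e z => (t z - xe N t e) ^ o e) fun e _ =>
      (H.t_sub_X2 (xe N t e)).zpow (o e))
  have h2 := h1.congr (G := G) (by
    filter_upwards [UH_mem_atI] with z hz
    rw [hG z hz, hev])
  obtain ⟨e1, e2⟩ := h2.unique hX
  have hdiv : ∑ e ∈ N.divisors, o e = ∑ e ∈ W' N, o e + o 1 := by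
    rw [W', Finset.sum_erase_add _ _ (Nat.one_mem_divisors.mpr H.sqf.ne_zero)]
  constructor
  · rw [hdiv, ← e1]
    simp only [mul_neg, mul_one, Finset.sum_neg_distrib]
    ring
  · rw [← e2, zero_add]
    have : ∑ e ∈ W' N, (o e : ℂ) * (-Aq g (xe N t e) / 2) =
        -(∑ e ∈ W' N, (o e : ℂ) * Aq g (xe N t e)) / 2 := by
      rw [← Finset.sum_neg_distrib, Finset.sum_div]
      exact Finset.sum_congr rfl fun e _ => by ring
    rw [this]
    ring

end Haupt

/-- Taylor coefficients at the origin. -/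
def cf (φ : ℂ → ℂ) (n : ℕ) : ℂ := iteratedDeriv n φ 0 / n.factorial

lemma sum_primitive_pow {D : ℕ} {ζ : ℂ} (hζ : IsPrimitiveRoot ζ D) {k : ℕ} (hk : ¬ D ∣ k) :
    ∑ b ∈ Finset.range D, (ζ ^ b) ^ k = 0 := by
  have h1 : ζ ^ k ≠ 1 := fun h => hk ((hζ.pow_eq_one_iff_dvd k).mp h)
  have h2 : ∑ b ∈ Finset.range D, (ζ ^ b) ^ k = ∑ b ∈ Finset.range D, (ζ ^ k) ^ b :=
    Finset.sum_congr rfl fun b _ => by rw [← pow_mul, ← pow_mul, mul_comm]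
  rw [h2, geom_sum_eq h1, ← pow_mul, mul_comm k D, pow_mul, hζ.pow_eq_one, one_pow, sub_self,
    zero_div]

lemma average {φ : ℂ → ℂ} (hφ : AnalyticAt ℂ φ 0) (h0 : φ 0 = 0) {D : ℕ} {ζ : ℂ}
    (hζ : IsPrimitiveRoot ζ D) {l : Filter ℂ} {u : ℂ → ℂ} (hu : Tendsto u l (𝓝 0)) :
    (fun z => ∑ b ∈ Finset.range D, φ (ζ ^ b * u z) - D * cf φ D * u z ^ D) =O[l]
      (fun z => u z ^ (D + 1)) := by
  have hp := hφ.hasFPowerSeriesAt.isBigO_sub_partialSum_pow (D + 1)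
  have h1 : ∀ b ∈ Finset.range D,
      (fun z => φ (ζ ^ b * u z) - ∑ k ∈ Finset.range (D + 1), cf φ k * (ζ ^ b * u z) ^ k) =O[l]
        (fun z => u z ^ (D + 1)) := by
    intro b _
    have ht : Tendsto (fun z => ζ ^ b * u z) l (𝓝 0) := by simpa using hu.const_mul (ζ ^ b)
    have h2 := hp.comp_tendsto ht
    refine (h2.congr_left fun z => ?_).trans ?_
    · simp only [Function.comp, zero_add, FormalMultilinearSeries.partialSum]
      congr 1
      refine Finset.sum_congr rfl fun k _ => ?_
      simp [FormalMultilinearSeries.ofScalars, cf]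
    · refine IsBigO.of_bound (‖ζ ^ b‖ ^ (D + 1)) (Eventually.of_forall fun z => ?_)
      simp [mul_pow]
  refine (IsBigO.fun_sum h1).congr_left fun z => ?_
  rw [Finset.sum_sub_distrib, Finset.sum_comm]
  congr 1
  have h3 : ∀ k ∈ Finset.range (D + 1), ∑ b ∈ Finset.range D, cf φ k * (ζ ^ b * u z) ^ k =
      cf φ k * u z ^ k * ∑ b ∈ Finset.range D, (ζ ^ b) ^ k := fun k _ => by
    rw [Finset.mul_sum]
    exact Finset.sum_congr rfl fun b _ => by ring
  rw [Finset.sum_congr rfl h3, Finset.sum_range_succ, Finset.sum_eq_zero, zero_add]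
  · have : ∀ b ∈ Finset.range D, (ζ ^ b) ^ D = 1 := fun b _ => by
      rw [← pow_mul, mul_comm, pow_mul, hζ.pow_eq_one, one_pow]
    rw [Finset.sum_congr rfl this]
    simp
    ring
  · intro k hk
    rw [Finset.mem_range] at hk
    by_cases h : k = 0
    · subst h
      simp [cf, h0]
    · rw [sum_primitive_pow hζ (fun hd => absurd (Nat.le_of_dvd (Nat.pos_of_ne_zero h) hd)
        (not_le.mpr hk)), mul_zero]

lemma prod_one_sub {ι : Type*} (S : Finset ι) {s : ℂ → ℂ} {F φ : ι → ℂ → ℂ}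
    (hs : s =O[atI] qc) (hφ : ∀ i ∈ S, Tendsto (φ i) atI (𝓝 0))
    (hF : ∀ i ∈ S, (fun z => F i z - (1 - s z * φ i z)) =o[atI] (fun z => qc z ^ 2)) :
    (fun z => ∏ i ∈ S, F i z - (1 - s z * ∑ i ∈ S, φ i z)) =o[atI] (fun z => qc z ^ 2) := by
  classical
  induction S using Finset.induction_on with
  | empty => simp
  | insert i S hi ih =>
    have hS := ih (fun j hj => hφ j (Finset.mem_insert_of_mem hj))
      (fun j hj => hF j (Finset.mem_insert_of_mem hj))
    have hFi := hF i (Finset.mem_insert_self i S)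
    have hφi := hφ i (Finset.mem_insert_self i S)
    have hsum : Tendsto (fun z => ∑ j ∈ S, φ j z) atI (𝓝 0) := by
      simpa using tendsto_finsetSum S (fun j hj => hφ j (Finset.mem_insert_of_mem hj))
    have hs0 : Tendsto s atI (𝓝 0) := hs.trans_tendsto tendsto_qc_nhds
    have b1 : (fun z => 1 - s z * ∑ j ∈ S, φ j z) =O[atI] (fun _ => (1 : ℂ)) := by
      have := (tendsto_const_nhds (x := (1 : ℂ))).sub (hs0.mul hsum)
      exact this.isBigO_one ℂ
    have b2 : F i =O[atI] (fun _ => (1 : ℂ)) := by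
      have h1 := (hFi.isBigO.trans_tendsto qc_sq_tendsto).add
        ((tendsto_const_nhds (x := (1 : ℂ))).sub (hs0.mul hφi))
      simp only [sub_add_cancel] at h1
      exact h1.isBigO_one ℂ
    have e1 := b2.mul_isLittleO hS
    have e2 := b1.mul_isLittleO hFi
    have e3 : (fun z => s z * s z * ((∑ j ∈ S, φ j z) * φ i z)) =o[atI]
        (fun z => qc z * qc z * 1) :=
      (hs.mul hs).mul_isLittleO ((isLittleO_one_iff ℂ).mpr (by simpa using hsum.mul hφi))
    simp only [one_mul, mul_one, ← pow_two] at e1 e2 e3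
    refine ((e1.add e2).add e3).congr_left fun z => ?_
    rw [Finset.prod_insert hi, Finset.sum_insert hi]
    ring

/-- The local parameter at a branch. -/
def ul (a d : ℕ) (z : ℂ) : ℂ := qc (a * z / d)

lemma tendsto_ul {a d : ℕ} (ha : 0 < a) (hd : 0 < d) : Tendsto (ul a d) atI (𝓝 0) := by
  have h := tendsto_affine_atI (a := a) (d := d) (by exact_mod_cast ha) (by exact_mod_cast hd) 0
  have := tendsto_qc_nhds.comp h
  refine this.congr fun z => ?_
  simp [ul]

lemma ul_pow {f a d : ℕ} (hd : 0 < d) (z : ℂ) : ul a d z ^ (f * d) = qc z ^ (f * a) := by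
  rw [ul, ← qc_nat_mul, ← qc_nat_mul]
  congr 1
  have : (d : ℂ) ≠ 0 := by exact_mod_cast hd.ne'
  push_cast
  field_simp

/-- The standard primitive root of unity. -/
def zt (D : ℕ) : ℂ := qc (1 / D)

lemma zt_primitive {D : ℕ} (hD : 0 < D) : IsPrimitiveRoot (zt D) D := by
  have := Complex.isPrimitiveRoot_exp D hD.ne'
  rw [zt, qc]
  convert this using 2
  ring

lemma qc_branch {f a d : ℕ} (hf : 0 < f) (hd : 0 < d) (b : ℕ) (z : ℂ) :
    qc (((f * a : ℝ) * z + (b : ℝ)) / (f * d : ℝ)) = zt (f * d) ^ b * ul a d z := by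
  rw [zt, ul, ← qc_nat_mul, ← qc_add]
  congr 1
  have : (d : ℂ) ≠ 0 := by exact_mod_cast hd.ne'
  have : (f : ℂ) ≠ 0 := by exact_mod_cast hf.ne'
  push_cast
  field_simp
  ring

lemma branch_mem {f a d : ℕ} (hf : 0 < f) (ha : 0 < a) (hd : 0 < d) (b : ℕ) {z : ℂ} (hz : z ∈ UH) :
    (((f * a : ℝ) : ℂ) * z + (b : ℝ)) / ((f * d : ℝ) : ℂ) ∈ UH := by
  show 0 < Complex.im _
  rw [Complex.div_ofReal_im]
  have hz' : 0 < z.im := hz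
  simp only [Complex.add_im, Complex.im_ofReal_mul, Complex.ofReal_im, add_zero]
  positivity

lemma average_branch {φ : ℂ → ℂ} (hφ : AnalyticAt ℂ φ 0) (h0 : φ 0 = 0) {f a d : ℕ} (hf : 0 < f)
    (ha : 0 < a) (hd : 0 < d) {s : ℂ → ℂ} (hs : s =O[atI] qc) :
    (fun z => s z * ∑ b ∈ Finset.range (f * d), φ (zt (f * d) ^ b * ul a d z) -
      (f * d : ℕ) * cf φ (f * d) * (s z * qc z ^ (f * a))) =o[atI] (fun z => qc z ^ 2) := by
  have hD : 0 < f * d := Nat.mul_pos hf hd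
  have h1 := average hφ h0 (zt_primitive hD) (tendsto_ul ha hd)
  have h2 : (fun z => ul a d z ^ (f * d + 1)) =o[atI] qc := by
    have h3 : (fun z => qc z ^ (f * a)) =O[atI] qc := by
      obtain ⟨m, hm⟩ : ∃ m, f * a = m + 1 := ⟨f * a - 1, by have := Nat.mul_pos hf ha; omega⟩
      rw [hm]
      have : (fun z => qc z ^ m) =O[atI] (fun _ => (1 : ℂ)) :=
        (tendsto_qc_nhds.pow m).isBigO_one ℂ
      simpa [pow_succ] using this.mul (isBigO_refl qc atI)
    have h4 := h3.mul_isLittleO ((isLittleO_one_iff ℂ).mpr (tendsto_ul ha hd))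
    simp only [mul_one] at h4
    refine h4.congr_left fun z => ?_
    rw [pow_succ, ul_pow hd]
  have h5 := hs.mul_isLittleO (h1.trans_isLittleO h2)
  refine (h5.congr_left fun z => ?_).congr_right fun z => by ring
  rw [ul_pow hd]
  ring

lemma pow_qc_isLittleO {s : ℂ → ℂ} (hs : s =O[atI] qc) {m : ℕ} (hm : 2 ≤ m) :
    (fun z => s z * qc z ^ m) =o[atI] (fun z => qc z ^ 2) := by
  have h1 : (fun z => qc z ^ m) =o[atI] (fun z => qc z ^ 1) :=
    (isLittleO_pow_pow (𝕜 := ℂ) (by omega)).comp_tendsto tendsto_qc_nhds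
  refine (hs.mul_isLittleO h1).congr_right fun z => by ring

namespace Haupt
variable {N : ℕ} {t g : ℂ → ℂ}

lemma inv_t_sub_isBigO (H : Haupt N t g) (x : ℂ) : (fun z => (t z - x)⁻¹) =O[atI] qc := by
  have := (H.t_sub_asy x).inv
  rw [neg_neg] at this
  exact this.isBigO.congr_right fun z => ex_one z

lemma block_ne (H : Haupt N t g) {f a d : ℕ} (hf : f ∣ N) (hf1 : f ≠ 1) (ha : 0 < a) (hd : 0 < d) :
    X2 (fun z => ∏ b ∈ Finset.range (f * d),
        (t z - te N t f (((f * a : ℝ) * z + (b : ℝ)) / (f * d : ℝ))))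
      (-(f * d)) (f * d * (-Aq g (xe N t f) / 2)) := by
  obtain ⟨h, hh, hte, h0⟩ := H.te_qexp hf hf1
  have hf0 := H.dvd_pos hf
  set x := xe N t f
  have hφ : AnalyticAt ℂ (fun y => h y - x) 0 :=
    (hh.analyticAt (Metric.ball_mem_nhds 0 one_pos)).sub analyticAt_const
  have hs := H.inv_t_sub_isBigO x
  have hφt : ∀ b, Tendsto (fun z => h (zt (f * d) ^ b * ul a d z) - x) atI (𝓝 0) := fun b => by
    have h1 : Tendsto (fun z => zt (f * d) ^ b * ul a d z) atI (𝓝 0) := by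
      simpa using (tendsto_ul ha hd).const_mul (zt (f * d) ^ b)
    have := hφ.continuousAt.tendsto.comp h1
    simpa [h0, Function.comp_def] using this
  have h1 := prod_one_sub (Finset.range (f * d)) hs (fun b _ => hφt b)
    (F := fun b z => 1 - (t z - x)⁻¹ * (h (zt (f * d) ^ b * ul a d z) - x)) (fun b _ => by simp)
  have h2 := average_branch hφ (by simp [h0]) hf0 ha hd hs
  have h3 := (pow_qc_isLittleO hs (m := f * a) (by
    have : 2 ≤ f := by omega
    nlinarith)).const_mul_left ((f * d : ℕ) * cf (fun y => h y - x) (f * d))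
  have h4 := X2.of_isLittleO (F := fun z => ∏ b ∈ Finset.range (f * d),
    (1 - (t z - x)⁻¹ * (h (zt (f * d) ^ b * ul a d z) - x)))
    ((h1.sub (h2.add h3)).congr_left fun z => by ring)
  have h5 := ((H.t_sub_X2 x).pow (f * d)).mul h4
  push_cast at h5
  rw [mul_neg_one, add_zero, add_zero] at h5
  refine h5.congr ?_
  filter_upwards [UH_mem_atI] with z hz
  have hne := H.t_sub_ne_zero hf hf1 hz
  have hpow : (t z - x) ^ (f * d) = ∏ _b ∈ Finset.range (f * d), (t z - x) := by simp
  rw [hpow, ← Finset.prod_mul_distrib]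
  refine Finset.prod_congr rfl fun b _ => ?_
  have hmem := branch_mem hf0 ha hd b hz
  have hq := qc_branch (a := a) hf0 hd b z
  push_cast at hq hmem ⊢
  rw [hte _ hmem, hq, mul_sub, mul_one, mul_inv_cancel_left₀ hne]
  ring

end Haupt

lemma prod_sub_zt {D : ℕ} (hD : 0 < D) (x y : ℂ) :
    ∏ b ∈ Finset.range D, (x - (zt D ^ b)⁻¹ * y) = x ^ D - y ^ D := by
  have hζ := (zt_primitive hD).inv
  rw [hζ.pow_sub_pow_eq_prod_sub_mul x y hD]
  refine Finset.prod_nbij (fun b => (zt D)⁻¹ ^ b) ?_ ?_ ?_ ?_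
  · intro b _
    rw [Polynomial.mem_nthRootsFinset hD, ← pow_mul, mul_comm, pow_mul, hζ.pow_eq_one, one_pow]
  · intro b hb b' hb' h
    simp only [Finset.coe_range, Set.mem_Iio] at hb hb'
    exact hζ.pow_inj hb hb' h
  · intro w hw
    rw [Finset.mem_coe, Polynomial.mem_nthRootsFinset hD] at hw
    have : NeZero D := ⟨hD.ne'⟩
    obtain ⟨i, hi, h⟩ := hζ.eq_pow_of_pow_eq_one hw
    exact ⟨i, by simpa using hi, h⟩
  · intro b _
    rw [inv_pow]

lemma X2.of_sq {F : ℂ → ℂ} {B : ℂ}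
    (h : (fun z => F z - (1 + B * qc z ^ 2)) =o[atI] (fun z => qc z ^ 2)) : X2 F 0 B := by
  refine ⟨1, one_ne_zero, 0, ?_⟩
  simpa using h

/-- Twice the negative of the second logarithmic coefficient of `q^{-d} - q^{-a}`. -/
def gap (a d : ℕ) : ℕ := if a = d + 1 ∨ d = a + 1 then 1 else if a = d + 2 ∨ d = a + 2 then 2 else 0

lemma gap_comm (a d : ℕ) : gap a d = gap d a := by simp [gap, or_comm]

lemma X2_gap_aux {a : ℕ} (m : ℕ) (hm : 0 < m) :
    X2 (fun z => (qc z)⁻¹ ^ (a + m) - (qc z)⁻¹ ^ a) (-(a + m : ℕ)) (-(gap a (a + m) : ℂ) / 2) := by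
  have h : X2 (fun z => 1 - qc z ^ m) 0 (-(gap a (a + m) : ℂ) / 2) := by
    rcases (by omega : m = 1 ∨ m = 2 ∨ 3 ≤ m) with rfl | rfl | h3
    · refine ⟨1, one_ne_zero, -1, ?_⟩
      refine (isLittleO_zero _ _).congr_left fun z => ?_
      simp [gap]
      ring
    · have hg : gap a (a + 2) = 2 := by
        rw [gap, if_neg (by omega), if_pos (by omega)]
      rw [hg]
      refine X2.of_sq ((isLittleO_zero _ _).congr_left fun z => ?_)
      push_cast
      ring
    · have h4 : (fun z => qc z ^ m) =o[atI] (fun z => qc z ^ 2) :=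
        (isLittleO_pow_pow (𝕜 := ℂ) (by omega)).comp_tendsto tendsto_qc_nhds
      have hg : gap a (a + m) = 0 := by
        rw [gap, if_neg (by omega), if_neg (by omega)]
      rw [hg]
      refine X2.of_sq (h4.neg_left.congr_left fun z => ?_)
      simp
  have h1 := (X2.qzpow (-(a + m : ℕ))).mul h
  rw [add_zero, zero_add] at h1
  refine h1.congr (Eventually.of_forall fun z => ?_)
  have := qc_ne_zero z
  change qc z ^ (-((a + m : ℕ) : ℤ)) * (1 - qc z ^ m) = _
  rw [_root_.zpow_neg, zpow_natCast, ← inv_pow, mul_sub, mul_one, pow_add, mul_assoc, ← mul_pow,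
    inv_mul_cancel₀ this, one_pow, mul_one]
  simp only [pow_add]

lemma X2.neg {F : ℂ → ℂ} {o : ℤ} {β : ℂ} (hF : X2 F o β) : X2 (fun z => -F z) o β := by
  simpa using (X2.const (C := -1) (by norm_num)).mul hF

lemma X2_gap {a d : ℕ} (had : a ≠ d) :
    X2 (fun z => (qc z)⁻¹ ^ d - (qc z)⁻¹ ^ a) (-(max a d : ℕ)) (-(gap a d : ℂ) / 2) := by
  rcases Nat.lt_or_gt_of_ne had with h | h
  · obtain ⟨m, rfl⟩ := Nat.exists_eq_add_of_lt h
    rw [max_eq_right (by omega)]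
    exact X2_gap_aux (m + 1) (by omega)
  · obtain ⟨m, rfl⟩ := Nat.exists_eq_add_of_lt h
    rw [max_eq_left (by omega), gap_comm]
    refine (X2_gap_aux (m + 1) (by omega)).neg.congr (Eventually.of_forall fun z => ?_)
    ring

namespace Haupt
variable {N : ℕ} {t g : ℂ → ℂ}

lemma exists_lipschitz (H : Haupt N t g) : ∃ k : ℂ → ℂ, (∀ y, g y = y * k y) ∧
    ∃ L : ℝ, ∀ᶠ w : ℂ × ℂ in 𝓝 (0, 0), ‖(k w.1 - k w.2) / (w.1 - w.2)‖ ≤ L := by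
  refine ⟨dslope g 0, fun y => ?_, ?_⟩
  · have := sub_smul_dslope g 0 y
    rw [H.g_zero, sub_zero, sub_zero, smul_eq_mul] at this
    exact this.symm
  · have hd : DifferentiableOn ℂ (dslope g 0) (Metric.ball 0 1) :=
      (Complex.differentiableOn_dslope (Metric.ball_mem_nhds 0 one_pos)).mpr H.g_diff
    have ha := hd.analyticAt (Metric.ball_mem_nhds 0 one_pos)
    have hc : ContDiffAt ℂ 1 (dslope g 0) 0 := ha.contDiffAt
    obtain ⟨K, s, hs, hL⟩ := hc.exists_lipschitzOnWith
    refine ⟨K, ?_⟩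
    filter_upwards [prod_mem_nhds hs hs] with w hw
    have := hL.dist_le_mul w.1 hw.1 w.2 hw.2
    rw [dist_eq_norm, dist_eq_norm] at this
    rw [norm_div]
    exact div_le_of_le_mul₀ (norm_nonneg _) K.2 this

/-- Factorisation of `t(z) - t(w)` in terms of the local parameters. -/
lemma exists_factor (H : Haupt N t g) : ∃ E : ℂ → ℂ → ℂ,
    (∀ z ∈ UH, ∀ w ∈ UH, t z - t w = ((qc z)⁻¹ - (qc w)⁻¹) * E (qc z) (qc w)) ∧
    ∀ y : ℂ → ℂ, Tendsto y atI (𝓝 0) →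
      (fun z => E (qc z) (y z) - (1 - qc z * g (y z))) =o[atI] (fun z => qc z ^ 2) := by
  obtain ⟨k, hk, L, hL⟩ := H.exists_lipschitz
  refine ⟨fun p y => 1 - p * g y - p ^ 2 * (y * ((k p - k y) / (p - y))), ?_, ?_⟩
  · intro z hz w hw
    have h1 := qc_ne_zero z
    have h2 := qc_ne_zero w
    rw [H.expand z hz, H.expand w hw]
    generalize qc z = p at *
    generalize qc w = y at *
    by_cases h : p = y
    · subst h; simp
    · have h3 : p - y ≠ 0 := sub_ne_zero.mpr h
      simp only [hk]
      field_simp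
      ring
  · intro y hy
    have hp : Tendsto (fun z => (qc z, y z)) atI (𝓝 (0, 0)) := tendsto_qc_nhds.prodMk_nhds hy
    have hb : (fun z => (k (qc z) - k (y z)) / (qc z - y z)) =O[atI] (fun _ => (1 : ℂ)) := by
      refine IsBigO.of_bound L ?_
      filter_upwards [hp.eventually hL] with z hz
      simpa using hz
    have h1 := (isBigO_refl (fun z => -qc z ^ 2) atI).mul_isLittleO
      (((isLittleO_one_iff ℂ).mpr hy).mul_isBigO hb)
    simp only [mul_one] at h1
    refine (h1.congr_left fun z => ?_).trans_isBigO (IsBigO.of_bound 1 (by simp))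
    ring

/-- The contribution of the coefficients of `t` to a block. -/
def ind (a : ℕ) : ℂ := if a = 1 then 1 else 0

lemma sum_branch (H : Haupt N t g) {a d : ℕ} (ha : 0 < a) (hd : 0 < d) :
    (fun z => qc z * ∑ b ∈ Finset.range d, g (zt d ^ b * ul a d z) -
      ind a * (d * cf g d) * qc z ^ 2) =o[atI] (fun z => qc z ^ 2) := by
  have h := average_branch (f := 1) H.g_analyticAt H.g_zero one_pos ha hd (isBigO_refl qc atI)
  simp only [one_mul] at h
  rw [ind]
  split_ifs with h1
  · subst h1
    exact h.congr_left fun z => by ring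
  · have h2 := (pow_qc_isLittleO (isBigO_refl qc atI) (m := a) (by omega)).const_mul_left
      (d * cf g d)
    refine (h.add h2).congr_left fun z => ?_
    ring

lemma block_one (H : Haupt N t g) {a d : ℕ} (ha : 0 < a) (hd : 0 < d) (had : a ≠ d) :
    X2 (fun z => ∏ b ∈ Finset.range d,
        (t z - t ((((1 : ℕ) * a : ℝ) * z + (b : ℝ)) / ((1 : ℕ) * d : ℝ))))
      (-(max a d : ℕ)) (-(gap a d : ℂ) / 2 - ind a * (d * cf g d)) := by
  obtain ⟨E, hE, hE2⟩ := H.exists_factor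
  have hy : ∀ b, Tendsto (fun z => zt d ^ b * ul a d z) atI (𝓝 0) := fun b => by
    simpa using (tendsto_ul ha hd).const_mul (zt d ^ b)
  have hg : ∀ b, Tendsto (fun z => g (zt d ^ b * ul a d z)) atI (𝓝 0) := fun b => by
    have := H.g_analyticAt.continuousAt.tendsto.comp (hy b)
    simpa [H.g_zero, Function.comp_def] using this
  have h1 := prod_one_sub (Finset.range d) (isBigO_refl qc atI) (fun b _ => hg b)
    (F := fun b z => E (qc z) (zt d ^ b * ul a d z)) (fun b _ => hE2 _ (hy b))
  have h2 := X2.of_sq (F := fun z => ∏ b ∈ Finset.range d, E (qc z) (zt d ^ b * ul a d z))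
    (B := -(ind a * (d * cf g d))) ((h1.sub (H.sum_branch ha hd)).congr_left fun z => by ring)
  have h3 := (X2_gap had).mul h2
  rw [add_zero, ← sub_eq_add_neg] at h3
  refine h3.congr ?_
  filter_upwards [UH_mem_atI] with z hz
  have hu : (qc z)⁻¹ ^ a = (ul a d z)⁻¹ ^ d := by
    have := ul_pow (f := 1) (a := a) hd z
    simp only [one_mul] at this
    rw [inv_pow, inv_pow, this]
  rw [hu, ← prod_sub_zt hd, ← Finset.prod_mul_distrib]
  refine Finset.prod_congr rfl fun b _ => ?_
  have hmem := branch_mem (f := 1) one_pos ha hd b hz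
  have hq := qc_branch (f := 1) (a := a) one_pos hd b z
  rw [hE z hz _ hmem, hq, one_mul, mul_inv]

lemma block_diag (H : Haupt N t g) {d : ℕ} (hd : 0 < d) :
    X2 (fun z => ∏ b ∈ (Finset.range d).erase 0,
        (t z - t ((((1 : ℕ) * d : ℝ) * z + (b : ℝ)) / ((1 : ℕ) * d : ℝ))))
      (1 - d) (deriv g 0 - ind d * (d * cf g d)) := by
  obtain ⟨E, hE, hE2⟩ := H.exists_factor
  have hy : ∀ b, Tendsto (fun z => zt d ^ b * ul d d z) atI (𝓝 0) := fun b => by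
    simpa using (tendsto_ul hd hd).const_mul (zt d ^ b)
  have hg : ∀ b, Tendsto (fun z => g (zt d ^ b * ul d d z)) atI (𝓝 0) := fun b => by
    have := H.g_analyticAt.continuousAt.tendsto.comp (hy b)
    simpa [H.g_zero, Function.comp_def] using this
  have hu : ∀ z, ul d d z = qc z := fun z => by
    have : (d : ℂ) ≠ 0 := by exact_mod_cast hd.ne'
    rw [ul, mul_div_cancel_left₀ _ this]
  have h1 := prod_one_sub ((Finset.range d).erase 0) (isBigO_refl qc atI) (fun b _ => hg b)
    (F := fun b z => E (qc z) (zt d ^ b * ul d d z)) (fun b _ => hE2 _ (hy b))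
  have h0 : (0 : ℕ) ∈ Finset.range d := by simpa using hd
  have h4 : (fun z => qc z * (g (qc z) - deriv g 0 * qc z)) =o[atI] (fun z => qc z ^ 2) :=
    ((isBigO_refl qc atI).mul_isLittleO H.g_isLittleO).congr_right fun z => by ring
  have h2 := X2.of_sq
    (F := fun z => ∏ b ∈ (Finset.range d).erase 0, E (qc z) (zt d ^ b * ul d d z))
    (B := deriv g 0 - ind d * (d * cf g d))
    (((h1.sub (H.sum_branch hd hd)).add h4).congr_left fun z => by
      rw [← Finset.add_sum_erase _ _ h0, pow_zero, one_mul, hu]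
      ring)
  set C := ∏ b ∈ (Finset.range d).erase 0, (1 - (zt d ^ b)⁻¹) with hC
  have hC0 : C ≠ 0 := by
    refine Finset.prod_ne_zero_iff.mpr fun b hb => ?_
    rw [Finset.mem_erase, Finset.mem_range] at hb
    refine sub_ne_zero.mpr fun h => ?_
    have h5 : zt d ^ b = 1 := by rw [← inv_inv (zt d ^ b), ← h, inv_one]
    exact (zt_primitive hd).pow_ne_one_of_pos_of_lt hb.1 hb.2 h5
  have h3 := ((X2.qzpow (1 - d)).mul (X2.const hC0)).mul h2
  rw [add_zero, add_zero, add_zero, zero_add] at h3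
  refine h3.congr ?_
  filter_upwards [UH_mem_atI] with z hz
  have hq1 : qc z ^ (1 - d : ℤ) = ∏ _b ∈ (Finset.range d).erase 0, (qc z)⁻¹ := by
    rw [Finset.prod_const, Finset.card_erase_of_mem h0, Finset.card_range, ← zpow_natCast,
      _root_.inv_zpow', Nat.cast_sub hd]
    congr 1
    push_cast
    ring
  rw [hq1, hC, ← Finset.prod_mul_distrib, ← Finset.prod_mul_distrib]
  refine Finset.prod_congr rfl fun b _ => ?_
  have hmem := branch_mem (f := 1) one_pos hd hd b hz
  have hq := qc_branch (f := 1) (a := d) one_pos hd b z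
  rw [hE z hz _ hmem, hq, one_mul, mul_inv, hu]
  ring

end Haupt

/-- `f σ(n/f)` if `f ∣ n`, and `0` otherwise. -/
def sg (n f : ℕ) : ℕ := if f ∣ n then f * ∑ x ∈ (n / f).divisorsAntidiagonal, x.2 else 0

def maxS (n : ℕ) : ℕ := ∑ x ∈ n.divisorsAntidiagonal, max x.1 x.2
def minS (n : ℕ) : ℕ := ∑ x ∈ n.divisorsAntidiagonal, min x.1 x.2
def gapS (n : ℕ) : ℕ := ∑ x ∈ n.divisorsAntidiagonal, gap x.1 x.2

namespace Haupt
variable {N : ℕ} {t g : ℂ → ℂ}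

lemma sum_diag {M : Type*} [AddCommMonoid M] {n : ℕ} (hn : 0 < n) (F : ℕ → M) :
    ∑ x ∈ n.divisorsAntidiagonal, (if x.1 = x.2 then F x.1 else 0) = sqI n • F (Nat.sqrt n) := by
  by_cases h : IsSquare n
  · obtain ⟨k, rfl⟩ := h
    have hk : k ≠ 0 := by rintro rfl; simp at hn
    rw [sqI_eq_one ⟨k, rfl⟩, one_smul, Nat.sqrt_eq,
      Finset.sum_eq_single_of_mem (k, k) (by simp [hk])]
    · simp
    · rintro ⟨a, d⟩ hx hne
      simp only [Nat.mem_divisorsAntidiagonal] at hx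
      refine if_neg ?_
      rintro (h : a = d)
      subst h
      exact hne (by rw [Nat.mul_self_inj.mp hx.1])
  · rw [sqI_eq_zero h, zero_smul]
    refine Finset.sum_eq_zero ?_
    rintro ⟨a, d⟩ hx
    simp only [Nat.mem_divisorsAntidiagonal] at hx
    refine if_neg ?_
    rintro (h' : a = d)
    exact h ⟨a, by rw [← hx.1, h']⟩

lemma sum_ind {n : ℕ} (hn : 0 < n) (F : ℕ → ℂ) :
    ∑ x ∈ n.divisorsAntidiagonal, ind x.1 * F x.2 = F n := by
  rw [Finset.sum_eq_single_of_mem (1, n) (by simp [hn.ne'])]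
  · simp [ind]
  · rintro ⟨a, d⟩ hx hne
    simp only [Nat.mem_divisorsAntidiagonal] at hx
    have : a ≠ 1 := by
      rintro rfl
      exact hne (by rw [← hx.1, one_mul])
    simp [ind, this]

lemma diag_iff (H : Haupt N t g) {n : ℕ} (hn : 0 < n) {i} (hi : i ∈ Ix N n) :
    (∀ z ∈ UH, Tn N t i z = t z) ↔ i.1 = 1 ∧ i.2.1.1 = i.2.1.2 ∧ i.2.2 = 0 := by
  classical
  have hN := H.sqf.ne_zero
  have key : ∀ j ∈ Ix N n, (j.1 = 1 ∧ j.2.1.1 = j.2.1.2 ∧ j.2.2 = 0) →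
      ∀ z ∈ UH, Tn N t j z = t z := by
    intro j hj ⟨h1, h2, h3⟩ z hz
    have hp := Ix_pos hN hn hj
    rw [H.Tn_eq hn hj hz, h1, act_aff, h1, h2, h3]
    have : ((j.2.1.2 : ℝ) : ℂ) ≠ 0 := by exact_mod_cast hp.2.2.ne'
    have h5 : (((((1 : ℕ) : ℝ) * (j.2.1.2 : ℝ) : ℝ) : ℂ) * z + ((0 : ℕ) : ℝ)) /
      (((1 : ℕ) : ℝ) * (j.2.1.2 : ℝ) : ℝ) = z := by
      push_cast at this ⊢
      field_simp
      ring
    push_cast at h5 ⊢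
    rw [h5, H.te_one hz]
  refine ⟨fun h => ?_, key i hi⟩
  have hc := H.card_diag hn
  have hpos : 0 < sqI n := by
    rw [← hc]
    exact Finset.card_pos.mpr ⟨i, Finset.mem_filter.mpr ⟨hi, h⟩⟩
  have hs : IsSquare n := by
    by_contra hs
    rw [sqI_eq_zero hs] at hpos
    exact lt_irrefl _ hpos
  obtain ⟨k, rfl⟩ := hs
  have hk : 0 < k := by
    rcases Nat.eq_zero_or_pos k with rfl | hk
    · simp at hn
    · exact hk
  have hj : (⟨1, ⟨(k, k), 0⟩⟩ : Σ _ : ℕ, Σ _ : ℕ × ℕ, ℕ) ∈ Ix N (k * k) := by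
    rw [mem_Ix hN hn]
    exact ⟨one_dvd _, by simp, by simpa using hk⟩
  have := H.Tn_inj hn hi hj fun z hz => (h z hz).trans (key _ hj ⟨rfl, rfl, rfl⟩ z hz).symm
  rw [this]
  exact ⟨rfl, rfl, rfl⟩

lemma Psi_eq (H : Haupt N t g) {n : ℕ} (hn : 0 < n) {z : ℂ} (hz : z ∈ UH) :
    Psi N t n z = ∏ f ∈ N.divisors.filter (· ∣ n), ∏ x ∈ (n / f).divisorsAntidiagonal,
      ∏ b ∈ Finset.range (f * x.2), (if f = 1 ∧ x.1 = x.2 ∧ b = 0 then 1 else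
        t z - te N t f (((f * x.1 : ℝ) * z + (b : ℝ)) / (f * x.2 : ℝ))) := by
  classical
  have h1 : Psi N t n z = ∏ i ∈ Ix N n, (if i.1 = 1 ∧ i.2.1.1 = i.2.1.2 ∧ i.2.2 = 0 then 1 else
        t z - te N t i.1 (((i.1 * i.2.1.1 : ℝ) * z + (i.2.2 : ℝ)) / (i.1 * i.2.1.2 : ℝ))) := by
    have h2 : Io N t n = (Ix N n).filter fun i => ¬ (i.1 = 1 ∧ i.2.1.1 = i.2.1.2 ∧ i.2.2 = 0) := by
      ext i
      rw [mem_Io, Finset.mem_filter]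
      exact and_congr_right fun hi => not_congr (H.diag_iff hn hi)
    rw [Psi, h2, Finset.prod_filter]
    refine Finset.prod_congr rfl fun i hi => ?_
    rw [ite_not, H.Tn_eq hn hi hz, act_aff]
  rw [h1, Ix, Finset.prod_sigma]
  refine Finset.prod_congr rfl fun f _ => ?_
  rw [Finset.prod_sigma]

lemma Psi_X2 (H : Haupt N t g) {n : ℕ} (hn : 0 < n) :
    X2 (Psi N t n) (sqI n - maxS n - ∑ f ∈ W' N, (sg n f : ℤ))
      (-(∑ f ∈ W' N, sg n f * Aq g (xe N t f) + gapS n + 2 * (n * cf g n)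
        - 2 * (sqI n * deriv g 0)) / 2) := by
  classical
  set oB : ℕ → ℕ × ℕ → ℤ := fun f x => if f = 1 then
    ((if x.1 = x.2 then 1 else 0) - (max x.1 x.2 : ℕ)) else -(f * x.2) with hoB
  set bB : ℕ → ℕ × ℕ → ℂ := fun f x => if f = 1 then
    (-(gap x.1 x.2 : ℂ) / 2 - ind x.1 * (x.2 * cf g x.2) + if x.1 = x.2 then deriv g 0 else 0) else
      (f * x.2 * (-Aq g (xe N t f) / 2)) with hbB
  have hX := X2.prod (N.divisors.filter (· ∣ n)) (F := fun f z =>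
      ∏ x ∈ (n / f).divisorsAntidiagonal,
      ∏ b ∈ Finset.range (f * x.2), (if f = 1 ∧ x.1 = x.2 ∧ b = 0 then 1 else
        t z - te N t f (((f * x.1 : ℝ) * z + (b : ℝ)) / (f * x.2 : ℝ))))
    (o := fun f => ∑ x ∈ (n / f).divisorsAntidiagonal, oB f x)
    (β := fun f => ∑ x ∈ (n / f).divisorsAntidiagonal, bB f x) ?_
  · have hX' := hX.congr (G := Psi N t n)
      (by filter_upwards [UH_mem_atI] with z hz using (H.Psi_eq hn hz).symm)
    have hsplit : ∀ {M : Type} [AddCommMonoid M] (F : ℕ → M),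
        ∑ f ∈ N.divisors.filter (· ∣ n), F f = F 1 + ∑ f ∈ W' N, if f ∣ n then F f else 0 := by
      intro M _ F
      rw [Finset.sum_filter, W', ← Finset.add_sum_erase _ _ (Nat.one_mem_divisors.mpr H.sqf.ne_zero),
        if_pos (one_dvd n)]
    convert hX' using 1
    · rw [hsplit, Nat.div_one]
      have e1 : ∑ x ∈ n.divisorsAntidiagonal, oB 1 x = sqI n - maxS n := by
        simp only [hoB, if_true]
        rw [Finset.sum_sub_distrib, sum_diag hn (fun _ => (1 : ℤ)), maxS]
        simp
      have e2 : ∑ f ∈ W' N, (if f ∣ n then ∑ x ∈ (n / f).divisorsAntidiagonal, oB f x else 0) =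
          - ∑ f ∈ W' N, (sg n f : ℤ) := by
        rw [← Finset.sum_neg_distrib]
        refine Finset.sum_congr rfl fun f hf => ?_
        rw [sg]
        split_ifs with h
        · push_cast
          rw [Finset.mul_sum, ← Finset.sum_neg_distrib]
          refine Finset.sum_congr rfl fun x _ => ?_
          simp [hoB, (H.mem_W'.mp hf).2]
        · simp
      rw [e1, e2]
      ring
    · rw [hsplit, Nat.div_one]
      have e1 : ∑ x ∈ n.divisorsAntidiagonal, bB 1 x =
          -(gapS n : ℂ) / 2 - n * cf g n + sqI n * deriv g 0 := by
        simp only [hbB, if_true]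
        rw [Finset.sum_add_distrib, Finset.sum_sub_distrib, sum_diag hn (fun _ => deriv g 0),
          sum_ind hn (fun d => (d * cf g d)), ← Finset.sum_div, Finset.sum_neg_distrib, gapS]
        simp
      have e2 : ∑ f ∈ W' N, (if f ∣ n then ∑ x ∈ (n / f).divisorsAntidiagonal, bB f x else 0) =
          - (∑ f ∈ W' N, sg n f * Aq g (xe N t f)) / 2 := by
        rw [← Finset.sum_neg_distrib, Finset.sum_div]
        refine Finset.sum_congr rfl fun f hf => ?_
        rw [sg]
        split_ifs with h
        · push_cast
          rw [Finset.mul_sum, Finset.sum_mul, ← Finset.sum_neg_distrib, Finset.sum_div]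
          refine Finset.sum_congr rfl fun x _ => ?_
          simp only [hbB, (H.mem_W'.mp hf).2, if_false]
          ring
        · simp
      rw [e1, e2]
      ring
  · intro f hf
    rw [Finset.mem_filter, Nat.mem_divisors] at hf
    refine X2.prod _ fun x hx => ?_
    obtain ⟨hx1, hx2⟩ := Nat.mem_divisorsAntidiagonal.mp hx
    have ha : 0 < x.1 := Nat.pos_of_ne_zero fun h => hx2 (by rw [← hx1, h, zero_mul])
    have hd : 0 < x.2 := Nat.pos_of_ne_zero fun h => hx2 (by rw [← hx1, h, mul_zero])
    by_cases hf1 : f = 1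
    · subst hf1
      simp only [hoB, hbB, if_true, true_and]
      have hmem : ∀ {z : ℂ}, z ∈ UH → ∀ b : ℕ,
          (((1 : ℕ) * x.1 : ℝ) * z + (b : ℝ)) / ((1 : ℕ) * x.2 : ℝ) ∈ UH := fun hz b => by
        simpa using branch_mem (f := 1) one_pos ha hd b hz
      by_cases had : x.1 = x.2
      · rw [if_pos had, if_pos had]
        have h5 : gap x.1 x.2 = 0 := by rw [gap, if_neg (by omega), if_neg (by omega)]
        rw [h5, had, max_self]
        have := H.block_diag hd
        convert this.congr ?_ using 1
        · push_cast
          ring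
        · filter_upwards [UH_mem_atI] with z hz
          rw [one_mul, ← Finset.mul_prod_erase _ _ (Finset.mem_range.mpr hd), if_pos (by simp), one_mul]
          refine Finset.prod_congr rfl fun b hb => ?_
          rw [if_neg (by simpa using (Finset.mem_erase.mp hb).1)]
          have := hmem hz b
          rw [had] at this
          rw [H.te_one this]
      · rw [if_neg had, if_neg had]
        have := H.block_one ha hd had
        convert this.congr ?_ using 1
        · push_cast
          ring
        · ring
        · filter_upwards [UH_mem_atI] with z hz
          rw [one_mul]
          refine Finset.prod_congr rfl fun b hb => ?_
          rw [if_neg (by simp [had]), H.te_one (hmem hz b)]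
    · simp only [hoB, hbB, hf1, if_false, false_and]
      exact H.block_ne hf.1.1 hf1 ha hd

lemma Psi_diff (H : Haupt N t g) {n : ℕ} (hn : 0 < n) : DifferentiableOn ℂ (Psi N t n) UH := by
  refine DifferentiableOn.fun_finsetProd fun i hi => ?_
  exact H.diff.sub (H.Tn_diff hn (mem_Io.mp hi).1)

end Haupt

lemma sum_fst_eq_snd (n : ℕ) :
    ∑ x ∈ n.divisorsAntidiagonal, x.1 = ∑ x ∈ n.divisorsAntidiagonal, x.2 := by
  rw [Nat.sum_divisorsAntidiagonal (f := fun a _ => a), Nat.sum_divisorsAntidiagonal' (f := fun _ a => a)]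

lemma maxS_add_minS (n : ℕ) :
    maxS n + minS n = 2 * ∑ x ∈ n.divisorsAntidiagonal, x.2 := by
  rw [maxS, minS, ← Finset.sum_add_distrib, two_mul]
  nth_rw 2 [← sum_fst_eq_snd]
  rw [← Finset.sum_add_distrib]
  refine Finset.sum_congr rfl fun x _ => ?_
  rw [max_add_min, add_comm]

namespace Haupt
variable {N : ℕ} {t g : ℂ → ℂ}

lemma te_eq_iff (H : Haupt N t g) {e : ℕ} (he : e ∣ N) {z w : ℂ} (hz : z ∈ UH) (hw : w ∈ UH) :
    te N t e z = te N t e w ↔ t z = t w := by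
  by_cases he1 : e = 1
  · rw [he1, H.te_one hz, H.te_one hw]
  rw [← sub_eq_zero, H.te_sub_te he he1 hz hw, div_eq_zero_iff, mul_eq_zero, neg_eq_zero,
    mul_eq_zero, sub_eq_zero (a := t z) (b := t w)]
  have h1 := H.nu_ne_zero he he1
  have h2 := H.t_sub_ne_zero he he1 hz
  have h3 := H.t_sub_ne_zero he he1 hw
  tauto

lemma perm_Io (H : Haupt N t g) {n : ℕ} (hn : 0 < n) {e : ℕ} (he : e ∣ N) {A : MZ}
    (hA : A ∈ AL N e) : ∃ σ : (Σ _ : ℕ, Σ _ : ℕ × ℕ, ℕ) → (Σ _ : ℕ, Σ _ : ℕ × ℕ, ℕ),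
      Set.BijOn σ (Io N t n) (Io N t n) ∧
      ∀ i ∈ Io N t n, ∀ z ∈ UH, Tn N t i (act A z) = te N t e (act (Rp N (σ i)) z) := by
  obtain ⟨σ, hσ, h⟩ := H.exists_perm hn he hA
  have hdet := AL.det_pos (H.dvd_pos he) hA
  have hiff : ∀ i ∈ Ix N n, i ∈ Io N t n ↔ σ i ∈ Io N t n := by
    intro i hi
    have hsi : σ i ∈ Ix N n := hσ.mapsTo hi
    rw [mem_Io, mem_Io, and_iff_right hi, and_iff_right hsi, not_iff_not]
    constructor
    · intro h1 z hz
      have := h i hi z hz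
      rw [h1 _ (act_mem hdet hz), ← H.te_one (act_mem hdet hz), H.te_act (one_dvd N) he hA hz,
        one_symDiv, H.te_eq_iff he hz (H.act_Rp_mem hn hsi hz)] at this
      exact this.symm
    · intro h1 z hz
      have hz' := act_mem (adjugate_det_pos hdet) hz
      have := h i hi _ hz'
      rw [(H.te_eq_iff he (H.act_Rp_mem hn hsi hz') hz').mpr (h1 _ hz'), act_adjugate hdet hz] at this
      rw [this]
      have h2 := H.te_act (one_dvd N) he hA hz'
      rw [act_adjugate hdet hz, one_symDiv, H.te_one hz] at h2
      exact h2.symm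
  have hsub : ∀ i ∈ Io N t n, i ∈ Ix N n := fun i hi => (mem_Io.mp hi).1
  refine ⟨σ, ⟨fun i hi => (hiff i (hsub i hi)).mp hi, hσ.injOn.mono hsub, fun j hj => ?_⟩,
    fun i hi => h i (hsub i hi)⟩
  obtain ⟨i, hi, rfl⟩ := hσ.surjOn (hsub j hj)
  exact ⟨i, (hiff i hi).mpr hj, rfl⟩

lemma Psi_act (H : Haupt N t g) {n : ℕ} (hn : 0 < n) {e : ℕ} (he : e ∣ N) {A : MZ}
    (hA : A ∈ AL N e) {z : ℂ} (hz : z ∈ UH) :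
    Psi N t n (act A z) = ∏ i ∈ Io N t n, (te N t e z - te N t e (act (Rp N i) z)) := by
  obtain ⟨σ, hσ, h⟩ := H.perm_Io hn he hA
  have hdet := AL.det_pos (H.dvd_pos he) hA
  rw [Psi]
  refine Finset.prod_nbij σ hσ.mapsTo hσ.injOn hσ.surjOn fun i hi => ?_
  rw [h i hi z hz, ← H.te_one (act_mem hdet hz), H.te_act (one_dvd N) he hA hz, one_symDiv]

lemma Psi_inv (H : Haupt N t g) {n : ℕ} (hn : 0 < n) {γ : MZ} (hγ : γ ∈ AL N 1) {z : ℂ}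
    (hz : z ∈ UH) : Psi N t n (act γ z) = Psi N t n z := by
  rw [H.Psi_act hn (one_dvd N) hγ hz, Psi]
  refine Finset.prod_congr rfl fun i hi => ?_
  rw [H.te_one hz, H.te_one (H.act_Rp_mem hn (mem_Io.mp hi).1 hz), Tn]

/-- The order at infinity of the factor `T_i - x_e`. -/
def kap (e : ℕ) (i : Σ _ : ℕ, Σ _ : ℕ × ℕ, ℕ) : ℝ :=
  if i.1 = 1 then -(i.2.1.1 / i.2.1.2) else if i.1 = e then i.2.1.1 / i.2.1.2 else 0

lemma Tn_sub_asy (H : Haupt N t g) {n : ℕ} (hn : 0 < n) {e : ℕ} (he : e ∣ N) (he1 : e ≠ 1) {i}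
    (hi : i ∈ Ix N n) : ∃ C, Asy (fun z => Tn N t i z - xe N t e) (kap e i) C := by
  have hN := H.sqf.ne_zero
  have hiN := ((mem_Ix hN hn).mp hi).1
  have key : ∀ {κ : ℝ} {C : ℂ}, Asy (fun z => te N t i.1 z - xe N t e) κ C →
      ∃ C, Asy (fun z => Tn N t i z - xe N t e) (κ * (i.2.1.1 / i.2.1.2)) C := by
    intro κ C h
    exact ⟨_, (comp_aff_asy h hN hn hi).congr fun z hz => by rw [H.Tn_eq hn hi hz]⟩
  rw [kap]
  split_ifs with h1 h2
  · rw [← neg_one_mul]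
    refine key (C := 1) ((H.t_sub_asy (xe N t e)).congr fun z hz => ?_)
    rw [h1, H.te_one hz]
  · obtain ⟨C, hC⟩ := key (κ := 1) (C := nu N t e) (by rw [h2]; exact H.te_sub_asy he he1)
    rw [one_mul] at hC
    exact ⟨C, hC⟩
  · obtain ⟨C, hC⟩ := key (H.te_sub_asy_of_ne hiN h1 (H.xe_ne he he1 hiN h1 (Ne.symm h2)))
    rw [zero_mul] at hC
    exact ⟨C, hC⟩

lemma sum_Ix {M : Type*} [AddCommMonoid M] (n : ℕ) (F : ℕ → ℕ × ℕ → M) :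
    ∑ i ∈ Ix N n, F i.1 i.2.1 = ∑ f ∈ N.divisors, if f ∣ n then
      ∑ x ∈ (n / f).divisorsAntidiagonal, (f * x.2) • F f x else 0 := by
  rw [Ix, Finset.sum_sigma, Finset.sum_filter]
  refine Finset.sum_congr rfl fun f _ => ?_
  rw [Finset.sum_sigma]
  simp

lemma card_Ix (H : Haupt N t g) (n : ℕ) :
    (Ix N n).card = ∑ x ∈ n.divisorsAntidiagonal, x.2 + ∑ f ∈ W' N, sg n f := by
  rw [Finset.card_eq_sum_ones, sum_Ix n fun _ _ => 1, W',
    ← Finset.add_sum_erase _ _ (Nat.one_mem_divisors.mpr H.sqf.ne_zero)]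
  simp [sg, Finset.mul_sum]

lemma card_Io (H : Haupt N t g) {n : ℕ} (hn : 0 < n) :
    (Io N t n).card + sqI n = ∑ x ∈ n.divisorsAntidiagonal, x.2 + ∑ f ∈ W' N, sg n f := by
  classical
  rw [← H.card_Ix n, ← H.card_diag hn, Io, add_comm]
  convert Finset.card_filter_add_card_filter_not _

lemma sum_kap (H : Haupt N t g) {n : ℕ} (hn : 0 < n) {e : ℕ} (he : e ∣ N) (he1 : e ≠ 1) :
    ∑ i ∈ Io N t n, kap e i =
      sqI n + sg n e - ((∑ x ∈ n.divisorsAntidiagonal, x.2 : ℕ) : ℝ) := by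
  classical
  have hN := H.sqf.ne_zero
  have h1 : ∑ i ∈ Ix N n, kap e i = sg n e - ((∑ x ∈ n.divisorsAntidiagonal, x.2 : ℕ) : ℝ) := by
    have := sum_Ix (N := N) n (fun f x => if f = 1 then -((x.1 : ℝ) / x.2) else
      if f = e then (x.1 : ℝ) / x.2 else 0)
    simp only [kap]
    rw [this, ← Finset.add_sum_erase _ _ (Nat.one_mem_divisors.mpr hN), add_comm,
      Finset.sum_eq_single_of_mem e
        (Finset.mem_erase.mpr ⟨he1, Nat.mem_divisors.mpr ⟨he, hN⟩⟩)]
    · have e1 : ∀ m : ℕ, ∀ x ∈ m.divisorsAntidiagonal, ∀ f : ℕ,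
          (f * x.2) • ((x.1 : ℝ) / x.2) = f * x.1 := by
        intro m x hx f
        obtain ⟨hx1, hx2⟩ := Nat.mem_divisorsAntidiagonal.mp hx
        have : (x.2 : ℝ) ≠ 0 := by
          refine Nat.cast_ne_zero.mpr fun h => hx2 (by rw [← hx1, h, mul_zero])
        rw [nsmul_eq_mul]
        push_cast
        field_simp
      rw [sub_eq_add_neg]
      congr 1
      · simp only [sg, if_neg he1, if_true]
        split_ifs with h
        · rw [← sum_fst_eq_snd]
          push_cast
          rw [Finset.mul_sum]
          refine Finset.sum_congr rfl fun x hx => ?_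
          rw [e1 _ x hx]
        · simp
      · rw [if_pos (one_dvd n), Nat.div_one, ← sum_fst_eq_snd]
        push_cast
        rw [← Finset.sum_neg_distrib]
        refine Finset.sum_congr rfl fun x hx => ?_
        rw [smul_neg, e1 _ x hx]
        simp
    · intro f hf hne
      have := (Finset.mem_erase.mp hf).1
      simp [this, hne]
  have h2 : ∑ i ∈ (Ix N n).filter (fun i => ∀ z ∈ UH, Tn N t i z = t z), kap e i = -(sqI n : ℝ) := by
    rw [← H.card_diag hn, Finset.cast_card, ← Finset.sum_neg_distrib]
    refine Finset.sum_congr rfl fun i hi => ?_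
    rw [Finset.mem_filter] at hi
    have := (H.diag_iff hn hi.1).mp hi.2
    have h3 := Ix_pos hN hn hi.1
    have : (i.2.1.2 : ℝ) ≠ 0 := by exact_mod_cast h3.2.2.ne'
    simp [kap, *]
  have h3 := Finset.sum_filter_add_sum_filter_not (Ix N n) (fun i => ∀ z ∈ UH, Tn N t i z = t z)
    (kap e)
  have h4 : Io N t n = (Ix N n).filter fun i => ¬ ∀ z ∈ UH, Tn N t i z = t z := by
    rw [Io]
  rw [h4]
  linarith

/-- The order of `Psi` at the cusp indexed by `e`. -/
def oPsi (N n : ℕ) (e : ℕ) : ℤ :=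
  if e = 1 then sqI n - maxS n - ∑ f ∈ W' N, (sg n f : ℤ) else minS n - sqI n - sg n e

lemma Psi_asy (H : Haupt N t g) {n : ℕ} (hn : 0 < n) {e : ℕ} (he : e ∣ N) (he1 : e ≠ 1) :
    ∃ C, Asy (te N (Psi N t n) e) (oPsi N n e) C := by
  choose! C hC using fun i (hi : i ∈ Ix N n) => H.Tn_sub_asy hn he he1 hi
  obtain ⟨C0, h0⟩ := (H.Psi_X2 hn).asy
  have h1 := Asy.prod (Io N t n) (F := fun i z => -nu N t e * ((t z - xe N t e)⁻¹ *
    (Tn N t i z - xe N t e)⁻¹)) fun i hi => (Asy.const (neg_ne_zero.mpr (H.nu_ne_zero he he1))).mul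
      ((H.t_sub_asy (xe N t e)).inv.mul (hC i (mem_Io.mp hi).1).inv)
  have h2 := h0.mul h1
  have h3 : (((sqI n - maxS n - ∑ f ∈ W' N, (sg n f : ℤ) : ℤ) : ℝ) +
      ∑ i ∈ Io N t n, (0 + (-(-1) + -kap e i))) = oPsi N n e := by
    rw [oPsi, if_neg he1]
    simp only [neg_neg, zero_add, Finset.sum_add_distrib, Finset.sum_neg_distrib, Finset.sum_const,
      nsmul_eq_mul, mul_one, H.sum_kap hn he he1]
    have h4 : ((Io N t n).card : ℝ) + sqI n = (∑ x ∈ n.divisorsAntidiagonal, x.2 : ℕ) +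
      ∑ f ∈ W' N, (sg n f : ℝ) := by exact_mod_cast H.card_Io hn
    have h5 : (maxS n : ℝ) + minS n = 2 * (∑ x ∈ n.divisorsAntidiagonal, x.2 : ℕ) := by
      exact_mod_cast maxS_add_minS n
    push_cast at h4 h5 ⊢
    linarith
  rw [h3] at h2
  refine ⟨_, h2.congr fun z hz => ?_⟩
  rw [te, H.Psi_act hn he (rep_mem H.sqf he) hz, Psi, ← Finset.prod_mul_distrib]
  refine Finset.prod_congr rfl fun i hi => ?_
  rw [H.te_sub_te he he1 hz (H.act_Rp_mem hn (mem_Io.mp hi).1 hz), Tn, div_eq_mul_inv, mul_inv]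
  ring

lemma Psi_residue (H : Haupt N t g) {n : ℕ} (hn : 0 < n) : ∃ R : Polynomial ℂ, R ≠ 0 ∧
    (∀ α ∈ UH, R.rootMultiplicity (t α) = mult N t n α) ∧
    (∀ ρ ∈ R.roots, ∃ α ∈ UH, t α = ρ) ∧
    (R.roots.card : ℤ) = -∑ e ∈ N.divisors, oPsi N n e ∧
    (R.roots.map (Aq g)).sum = ∑ f ∈ W' N, sg n f * Aq g (xe N t f) + gapS n + 2 * (n * cf g n)
        - 2 * (sqI n * deriv g 0) - ∑ e ∈ W' N, oPsi N n e * Aq g (xe N t e) := by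
  have hX := H.Psi_X2 hn
  obtain ⟨R, h1, h2, h3, h4, h5⟩ := H.residue_sum (H.Psi_diff hn)
    (fun γ hγ z hz => H.Psi_inv hn hγ hz) (oPsi N n)
    (fun e he => H.Psi_asy hn (H.mem_W'.mp he).1 (H.mem_W'.mp he).2)
    (by rw [oPsi, if_pos rfl]; exact hX)
  refine ⟨R, h1, fun α hα => ?_, h3, h4, ?_⟩
  · have := H.rootMultiplicity_eq hα h1 h2 (H.Psi_ord hn hα)
    exact Nat.eq_of_mul_eq_mul_right (H.od_pos hα) this
  · rw [h5]
    ring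

end Haupt

/-- The Euler product `∏ (1 - q^n)`. -/
def eul (q : ℂ) : ℂ := ∏' n : ℕ, (1 - q ^ (n + 1))

lemma eul_diff : DifferentiableOn ℂ eul (Metric.ball 0 1) :=
  ModularForm.differentiableOn_tprod_one_sub_pow

lemma eul_zero : eul 0 = 1 := by simp [eul]

lemma dedekindEta_eq (z : ℂ) : dedekindEta z = ex (1 / 24) z * eul (qc z) := by
  rw [dedekindEta, eul, ex]
  congr 1
  · congr 1
    push_cast
    ring
  · refine tprod_congr fun n => ?_
    rw [qc, ← Complex.exp_nat_mul]
    congr 2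
    push_cast
    ring

lemma dedekindEta_eq_eta (z : ℂ) : dedekindEta z = ModularForm.eta z := by
  rw [dedekindEta_eq, ModularForm.eta, eul, ex]
  congr 1
  · rw [Function.Periodic.qParam]
    congr 1
    push_cast
    ring
  · refine tprod_congr fun n => ?_
    rw [ModularForm.eta_q_eq_pow, qc]

lemma eul_ne_zero {q : ℂ} (hq : ‖q‖ < 1) : eul q ≠ 0 := by
  rcases eq_or_ne q 0 with rfl | h0
  · simp [eul_zero]
  obtain ⟨z, hz, rfl⟩ := exists_qc_eq h0 hq
  intro h
  have := ModularForm.eta_ne_zero (z := z) hz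
  rw [← dedekindEta_eq_eta, dedekindEta_eq, h, mul_zero] at this
  exact this rfl

/-- The square of the Dedekind eta function. -/
def et (z : ℂ) : ℂ := dedekindEta z ^ 2

lemma et_eq (z : ℂ) : et z = ex (1 / 12) z * eul (qc z) ^ 2 := by
  rw [et, dedekindEta_eq, mul_pow, ex, ex, ← Complex.exp_nat_mul]
  congr 2
  push_cast
  ring

lemma et_ne_zero {z : ℂ} (hz : z ∈ UH) : et z ≠ 0 := by
  rw [et_eq]
  exact mul_ne_zero (ex_ne_zero _ _) (pow_ne_zero _ (eul_ne_zero (norm_qc_lt_one hz)))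

lemma et_diff : DifferentiableOn ℂ et UH := by
  refine DifferentiableOn.pow (fun z hz => ?_) 2
  have : dedekindEta = ModularForm.eta := funext dedekindEta_eq_eta
  rw [this]
  exact (ModularForm.differentiableAt_eta_of_mem_upperHalfPlaneSet hz).differentiableWithinAt

lemma et_asy : Asy et (1 / 12) 1 := by
  have h : Tendsto (fun z => eul (qc z) ^ 2) atI (𝓝 1) := by
    have h1 : Tendsto eul (𝓝 0) (𝓝 1) := by
      rw [← eul_zero]
      exact (eul_diff.differentiableAt (Metric.ball_mem_nhds 0 one_pos)).continuousAt
    simpa using (h1.comp tendsto_qc_nhds).pow 2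
  have := (Asy.ex_asy (1 / 12)).mul (Asy.of_tendsto one_ne_zero h)
  rw [add_zero, one_mul] at this
  exact this.congr fun z _ => (et_eq z).symm

/-- The primitive twelfth root of unity `e^{2πi/12}`. -/
def z12 : ℂ := ex (1 / 12) 1

lemma z12_pow : z12 ^ 12 = 1 := by
  rw [z12, ex, ← Complex.exp_nat_mul]
  convert Complex.exp_two_pi_mul_I using 2
  push_cast
  ring

lemma z12_ne : z12 ≠ 0 := ex_ne_zero _ _

lemma z12_zpow {k l : ℤ} (h : (12 : ℤ) ∣ k - l) : z12 ^ k = z12 ^ l := by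
  obtain ⟨m, hm⟩ := h
  have : k = l + 12 * m := by omega
  rw [this, zpow_add₀ z12_ne, _root_.zpow_mul]
  norm_cast
  rw [z12_pow]
  simp

lemma z12_pow_three : z12 ^ 3 = I := by
  rw [z12, ex, ← Complex.exp_nat_mul]
  convert Complex.exp_pi_div_two_mul_I using 2
  push_cast
  ring

lemma et_add_one (z : ℂ) : et (z + 1) = z12 * et z := by
  rw [et_eq, et_eq, qc_add, show qc 1 = 1 by simpa using qc_int 1, mul_one, z12, ← mul_assoc]
  congr 1
  rw [ex, ex, ex, ← Complex.exp_add]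
  congr 1
  ring

lemma et_neg_inv {z : ℂ} (hz : z ∈ UH) : et (-1 / z) = z12 ^ (-3 : ℤ) * z * et z := by
  have h := ModularForm.eta_comp_eq_csqrt_I_inv hz
  simp only [Function.comp_apply, Pi.smul_apply, Pi.mul_apply, smul_eq_mul] at h
  rw [et, et, dedekindEta_eq_eta, dedekindEta_eq_eta, h, mul_pow, mul_pow, inv_pow]
  have hs : ∀ w : ℂ, Complex.sqrt w ^ 2 = w := fun w => by
    rw [Complex.sqrt, ← Complex.cpow_nat_mul]
    norm_num
  rw [hs, hs]
  have : z12 ^ (-3 : ℤ) = I⁻¹ := by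
    rw [_root_.zpow_neg]
    norm_cast
    rw [z12_pow_three]
  rw [this]
  ring

/-- `et` transforms under `A` with multiplier `z12 ^ k`. -/
def Good (A : MZ) (k : ℤ) : Prop := ∀ z ∈ UH, et (act A z) = z12 ^ k * den A z * et z

lemma Good.mul {A B : MZ} (hA : 0 < A.det) (hB : 0 < B.det) {k l : ℤ} (h1 : Good A k)
    (h2 : Good B l) : Good (A * B) (k + l) := by
  intro z hz
  rw [act_mul hA hB hz, h1 _ (act_mem hB hz), h2 z hz, den_mul hB hz, zpow_add₀ z12_ne]
  ring

lemma Good.inv {A B : MZ} (hA : 0 < A.det) (hB : 0 < B.det) (hAB : A * B = 1) {k : ℤ}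
    (h : Good A k) : Good B (-k) := by
  intro z hz
  have h1 := h _ (act_mem hB hz)
  rw [← act_mul hA hB hz, hAB, act_one] at h1
  have h2 : den A (act B z) * den B z = 1 := by
    rw [← den_mul hB hz, hAB]
    simp [den]
  rw [h1, _root_.zpow_neg]
  have h3 := zpow_ne_zero k z12_ne
  calc et (act B z) = (z12 ^ k)⁻¹ * z12 ^ k * (den A (act B z) * den B z) * et (act B z) := by
        rw [h2, inv_mul_cancel₀ h3]; ring
    _ = _ := by ring

/-- The exponent of the multiplier of `η²`. -/
def Xf {R : Type*} [CommRing R] (a b c d : R) : R :=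
  (1 - c ^ 2) * (b * d + 3 * (c - 1) * d + c + 3) + c * (a + d - 3)

lemma cast_Xf (R : Type*) [CommRing R] (a b c d : ℤ) :
    ((Xf a b c d : ℤ) : R) = Xf (a : R) (b : R) (c : R) (d : R) := by
  simp [Xf]

lemma twelve_dvd {x : ℤ} (h3 : (x : ZMod 3) = 0) (h4 : (x : ZMod 4) = 0) : (12 : ℤ) ∣ x := by
  rw [ZMod.intCast_zmod_eq_zero_iff_dvd] at h3 h4
  push_cast at h3 h4
  omega

lemma Xf_T {a b c d : ℤ} (h : a * d - b * c = 1) :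
    (12 : ℤ) ∣ Xf a (a + b) c (c + d) - (Xf a b c d + 1) := by
  have h3 := congrArg (Int.cast : ℤ → ZMod 3) h
  have h4 := congrArg (Int.cast : ℤ → ZMod 4) h
  push_cast at h3 h4
  apply twelve_dvd <;> push_cast [cast_Xf]
  · generalize (a : ZMod 3) = a at *
    generalize (b : ZMod 3) = b at *
    generalize (c : ZMod 3) = c at *
    generalize (d : ZMod 3) = d at *
    revert a b c d
    decide
  · generalize (a : ZMod 4) = a at *
    generalize (b : ZMod 4) = b at *
    generalize (c : ZMod 4) = c at *
    generalize (d : ZMod 4) = d at *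
    revert a b c d
    decide

lemma Xf_S {a b c d : ℤ} (h : a * d - b * c = 1) :
    (12 : ℤ) ∣ Xf b (-a) d (-c) - (Xf a b c d - 3) := by
  have h3 := congrArg (Int.cast : ℤ → ZMod 3) h
  have h4 := congrArg (Int.cast : ℤ → ZMod 4) h
  push_cast at h3 h4
  apply twelve_dvd <;> push_cast [cast_Xf]
  · generalize (a : ZMod 3) = a at *
    generalize (b : ZMod 3) = b at *
    generalize (c : ZMod 3) = c at *
    generalize (d : ZMod 3) = d at *
    revert a b c d
    decide
  · generalize (a : ZMod 4) = a at *
    generalize (b : ZMod 4) = b at *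
    generalize (c : ZMod 4) = c at *
    generalize (d : ZMod 4) = d at *
    revert a b c d
    decide

/-- `Xf` on matrices. -/
def Xm (A : MZ) : ℤ := Xf (A 0 0) (A 0 1) (A 1 0) (A 1 1)

lemma Good.congr {A : MZ} {k l : ℤ} (h : Good A k) (hkl : (12 : ℤ) ∣ k - l) : Good A l := by
  intro z hz
  rw [h z hz, z12_zpow hkl]

lemma good_T : Good !![1, 1; 0, 1] 1 := by
  intro z _
  have : act !![1, 1; 0, 1] z = z + 1 := by simp [act, den]
  rw [this, et_add_one]
  simp [den]

lemma good_S : Good !![0, -1; 1, 0] (-3) := by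
  intro z hz
  have : act !![0, -1; 1, 0] z = -1 / z := by simp [act, den]
  rw [this, et_neg_inv hz]
  simp [den]

/-- The transformation formula for `η²` under the modular group. -/
theorem good_of_det_one {A : MZ} (hA : A.det = 1) : Good A (Xm A) := by
  suffices h : ∀ γ : SpecialLinearGroup (Fin 2) ℤ, Good γ.1 (Xm γ.1) from h ⟨A, hA⟩
  have hpos : ∀ γ : SpecialLinearGroup (Fin 2) ℤ, 0 < γ.1.det := fun γ => by
    rw [γ.2]; exact one_pos
  have hdet : ∀ γ : SpecialLinearGroup (Fin 2) ℤ, γ.1 0 0 * γ.1 1 1 - γ.1 0 1 * γ.1 1 0 = 1 :=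
    fun γ => by rw [← Matrix.det_fin_two, γ.2]
  have hXT : ∀ γ : SpecialLinearGroup (Fin 2) ℤ,
      (12 : ℤ) ∣ Xm (γ * ModularGroup.T).1 - (Xm γ.1 + 1) := by
    intro γ
    convert Xf_T (hdet γ) using 2
    · simp [Xm, Matrix.mul_apply]
    · rw [Xm]
  have hXS : ∀ γ : SpecialLinearGroup (Fin 2) ℤ,
      (12 : ℤ) ∣ Xm (γ * ModularGroup.S).1 - (Xm γ.1 + -3) := by
    intro γ
    convert Xf_S (hdet γ) using 2
    · simp [Xm, Matrix.mul_apply]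
    · rw [Xm]
      ring
  intro γ
  have hγ : γ ∈ Subgroup.closure {ModularGroup.S, ModularGroup.T} := by
    simp [SpecialLinearGroup.SL2Z_generators]
  induction hγ using Subgroup.closure_induction_right with
  | one =>
    intro z _
    simp [Xm, Xf, act_one, den]
  | mul_right x _ y hy ih =>
    rcases hy with rfl | rfl
    · refine (ih.mul (hpos x) (hpos _) (B := (ModularGroup.S).1) good_S).congr ?_
      have := hXS x
      rw [← dvd_neg, neg_sub]
      exact this
    · refine (ih.mul (hpos x) (hpos _) (B := (ModularGroup.T).1) good_T).congr ?_
      have := hXT x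
      rw [← dvd_neg, neg_sub]
      exact this
  | mul_inv_cancel x _ y hy ih =>
    have hinv : y.1 * (y⁻¹).1 = 1 := by
      have := congrArg Subtype.val (_root_.mul_inv_cancel y)
      exact this
    rcases hy with rfl | rfl
    · refine (ih.mul (hpos x) (hpos _) (Good.inv (hpos _) (hpos _) hinv good_S)).congr ?_
      have := hXS (x * (ModularGroup.S)⁻¹)
      rw [inv_mul_cancel_right] at this
      omega
    · refine (ih.mul (hpos x) (hpos _) (Good.inv (hpos _) (hpos _) hinv good_T)).congr ?_
      have := hXT (x * (ModularGroup.T)⁻¹)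
      rw [inv_mul_cancel_right] at this
      omega

/-- The levels under consideration. -/
def Lv : Finset ℕ := {2, 3, 5, 6, 7, 10, 13}

/-- The multiplier exponent of `η(δ z)²` under an Atkin–Lehner matrix of determinant `e`. -/
def Xd {R : Type*} [CommRing R] (N e δ : ℕ) (a b c d : R) : R :=
  Xf ((Nat.gcd e δ : ℕ) * a) ((δ / Nat.gcd e δ : ℕ) * b) ((N / (e * (δ / Nat.gcd e δ)) : ℕ) * c)
    ((e / Nat.gcd e δ : ℕ) * d)

lemma cast_Xd (R : Type*) [CommRing R] (N e δ : ℕ) (a b c d : ℤ) :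
    ((Xd N e δ a b c d : ℤ) : R) = Xd N e δ (a : R) (b : R) (c : R) (d : R) := by
  rw [Xd, cast_Xf, Xd]
  simp only [Int.cast_mul, Int.cast_natCast]

/-- The transformation of `η(δ z)²` under Atkin–Lehner matrices. -/
lemma et_AL {N e δ : ℕ} (hN : Squarefree N) (he : e ∣ N) (hδ : δ ∣ N) {a b c d : ℤ}
    (hdet : e * a * (e * d) - b * (N * c) = (e : ℤ)) {z : ℂ} (hz : z ∈ UH) :
    et (δ * act !![e * a, b; N * c, e * d] z) = z12 ^ Xd N e δ a b c d *
      (den !![e * a, b; N * c, e * d] z / (Nat.gcd e δ : ℕ)) * et ((symDiv e δ : ℕ) * z) := by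
  obtain ⟨g, e', f', m, hg, he', hf', hs, hm, hg0⟩ := exists_gcd_decomp hN he hδ
  have hN0 := Nat.pos_of_ne_zero hN.ne_zero
  have he0 : 0 < e' := by
    rcases Nat.eq_zero_or_pos e' with h | h
    · rw [hm, h] at hN0; simp at hN0
    · exact h
  have hf0 : 0 < f' := by
    rcases Nat.eq_zero_or_pos f' with h | h
    · rw [hm, h] at hN0; simp at hN0
    · exact h
  have h1 : δ / g = f' := by rw [hf', Nat.mul_div_cancel_left _ hg0]
  have h2 : e / g = e' := by rw [he', Nat.mul_div_cancel_left _ hg0]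
  have h3 : N / (e * f') = m := by
    rw [hm, he', Nat.mul_div_cancel_left _ (by positivity)]
  set γ : MZ := !![g * a, f' * b; m * c, e' * d] with hγ
  have hdetγ : γ.det = 1 := by
    have hgz : (g : ℤ) * e' ≠ 0 := by positivity
    apply mul_left_cancel₀ hgz
    rw [hγ, Matrix.det_fin_two_of]
    rw [he', hm] at hdet
    push_cast at hdet
    linear_combination hdet
  have hw : ((symDiv e δ : ℕ) : ℂ) * z ∈ UH := by
    show 0 < Complex.im _
    have : 0 < symDiv e δ := by rw [hs]; positivity
    have h5 : (((symDiv e δ : ℕ) : ℂ) * z).im = (symDiv e δ : ℝ) * z.im := by simp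
    rw [h5]
    exact mul_pos (by exact_mod_cast this) hz
  have hg1 : (g : ℂ) ≠ 0 := by exact_mod_cast hg0.ne'
  have hden : den γ ((symDiv e δ : ℕ) * z) = den !![(e : ℤ) * a, b; N * c, e * d] z / g := by
    rw [hs, eq_div_iff hg1]
    simp [den, hγ]
    rw [hm, he']
    push_cast
    ring
  have hact : δ * act !![(e : ℤ) * a, b; N * c, e * d] z = act γ ((symDiv e δ : ℕ) * z) := by
    rw [act, act, hden, hs]
    have hd0 : den !![(e : ℤ) * a, b; N * c, e * d] z ≠ 0 := by
      refine den_ne_zero ?_ hz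
      rw [Matrix.det_fin_two_of, hdet, he']
      positivity
    field_simp
    simp [hγ]
    rw [hf', he']
    push_cast
    ring
  rw [hact, good_of_det_one hdetγ _ hw, hden, hg]
  congr 3
  rw [Xm, Xd, hg, h1, h2, h3]
  simp [hγ]

/-- Eta quotients, normalised by squares. -/
def EQ (N : ℕ) (r : ℕ → ℤ) (z : ℂ) : ℂ := ∏ δ ∈ N.divisors, et (δ * z) ^ r δ

lemma natmul_mem {δ : ℕ} (hδ : 0 < δ) {z : ℂ} (hz : z ∈ UH) : (δ : ℂ) * z ∈ UH := by
  have h5 : ((δ : ℂ) * z).im = (δ : ℝ) * z.im := by simp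
  show 0 < Complex.im _
  rw [h5]
  exact mul_pos (by exact_mod_cast hδ) hz

lemma EQ_ne_zero {N : ℕ} (r : ℕ → ℤ) {z : ℂ} (hz : z ∈ UH) : EQ N r z ≠ 0 :=
  Finset.prod_ne_zero_iff.mpr fun _ hδ =>
    zpow_ne_zero _ (et_ne_zero (natmul_mem (Nat.pos_of_mem_divisors hδ) hz))

lemma et_natmul_diff {δ : ℕ} (hδ : 0 < δ) : DifferentiableOn ℂ (fun z => et (δ * z)) UH :=
  et_diff.comp (by fun_prop) fun _ hz => natmul_mem hδ hz

lemma EQ_diff (N : ℕ) (r : ℕ → ℤ) : DifferentiableOn ℂ (EQ N r) UH := by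
  refine DifferentiableOn.fun_finsetProd fun δ hδ => ?_
  have hp := Nat.pos_of_mem_divisors hδ
  exact (et_natmul_diff hp).zpow (Or.inl fun z hz => et_ne_zero (natmul_mem hp hz))

lemma et_natmul_asy {δ : ℕ} (hδ : 0 < δ) : Asy (fun z => et (δ * z)) (δ / 12) 1 := by
  have h := et_asy.comp_affine (a := δ) (d := 1) (by exact_mod_cast hδ) one_pos 0
  have e1 : (1 / 12 : ℝ) * δ / 1 = δ / 12 := by ring
  rw [e1] at h
  simpa using h

lemma EQ_AL {N e : ℕ} (hN : Squarefree N) (he : e ∣ N) {r : ℕ → ℤ}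
    (hr : ∑ δ ∈ N.divisors, r δ = 0) {a b c d : ℤ}
    (hdet : e * a * (e * d) - b * (N * c) = (e : ℤ)) {z : ℂ} (hz : z ∈ UH) :
    EQ N r (act !![e * a, b; N * c, e * d] z) = z12 ^ (∑ δ ∈ N.divisors, r δ * Xd N e δ a b c d) *
      (∏ δ ∈ N.divisors, ((Nat.gcd e δ : ℕ) : ℂ) ^ (-r δ)) *
      ∏ δ ∈ N.divisors, et ((symDiv e δ : ℕ) * z) ^ r δ := by
  have hd0 : den !![(e : ℤ) * a, b; N * c, e * d] z ≠ 0 := by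
    refine den_ne_zero ?_ hz
    rw [Matrix.det_fin_two_of, hdet]
    exact_mod_cast Nat.pos_of_dvd_of_pos he (Nat.pos_of_ne_zero hN.ne_zero)
  have h1 : ∏ δ ∈ N.divisors, den !![(e : ℤ) * a, b; N * c, e * d] z ^ r δ = 1 := by
    have : ∀ s : Finset ℕ, ∏ δ ∈ s, den !![(e : ℤ) * a, b; N * c, e * d] z ^ r δ =
        den !![(e : ℤ) * a, b; N * c, e * d] z ^ (∑ δ ∈ s, r δ) := by
      intro s
      induction s using Finset.induction_on with
      | empty => simp
      | insert i s hi ih => rw [Finset.prod_insert hi, Finset.sum_insert hi, zpow_add₀ hd0, ih]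
    rw [this, hr, zpow_zero]
  have h2 : z12 ^ (∑ δ ∈ N.divisors, r δ * Xd N e δ a b c d) =
      ∏ δ ∈ N.divisors, z12 ^ (r δ * Xd N e δ a b c d) := by
    generalize N.divisors = s
    induction s using Finset.induction_on with
    | empty => simp
    | insert i s hi ih => rw [Finset.prod_insert hi, Finset.sum_insert hi, zpow_add₀ z12_ne, ih]
  rw [EQ, h2, ← mul_one (_ * _ * _), ← h1, ← Finset.prod_mul_distrib, ← Finset.prod_mul_distrib,
    ← Finset.prod_mul_distrib]
  refine Finset.prod_congr rfl fun δ hδ => ?_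
  rw [et_AL hN he (Nat.dvd_of_mem_divisors hδ) hdet hz, mul_zpow, mul_zpow, div_zpow,
    ← _root_.zpow_mul, mul_comm (Xd N e δ a b c d), _root_.zpow_neg]
  ring

/-- Exponents of the hauptmodul of `Γ₀(N)`. -/
def rr (N δ : ℕ) : ℤ :=
  if N = 6 then (if δ = 1 then -2 else if δ = 2 then 4 else if δ = 3 then 2 else -4)
  else if N = 10 then (if δ = 1 then -1 else if δ = 2 then 2 else if δ = 3 then 1 else if δ = 5
    then 1 else -2)
  else if δ = 1 then (12 / (N - 1) : ℕ) else -(12 / (N - 1) : ℕ)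

/-- Exponents of the function entering the Fricke hauptmodul. -/
def vv (N δ : ℕ) : ℤ :=
  if N = 6 then (if δ % 2 = 1 then 3 else -3)
  else if N = 10 then (if δ % 2 = 1 then 2 else -2)
  else if δ = 1 then (12 / (N - 1) : ℕ) else -(12 / (N - 1) : ℕ)

/-- The sign with which an Atkin–Lehner involution acts on the exponents `vv`. -/
def sgn (N e : ℕ) : ℤ := vv N e / vv N 1

lemma Lv_squarefree : ∀ N ∈ Lv, Squarefree N := by decide +kernel

lemma Lv_sum_rr : ∀ N ∈ Lv, ∑ δ ∈ N.divisors, rr N δ = 0 := by decide +kernel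

lemma Lv_sum_vv : ∀ N ∈ Lv, ∑ δ ∈ N.divisors, vv N δ = 0 := by decide +kernel

lemma Lv_order_rr : ∀ N ∈ Lv, ∑ δ ∈ N.divisors, rr N δ * δ = -12 := by decide +kernel

lemma Lv_order_nonneg : ∀ N ∈ Lv, ∀ e ∈ N.divisors, e ≠ 1 →
    0 ≤ ∑ δ ∈ N.divisors, rr N δ * symDiv e δ := by decide +kernel

lemma Lv_symDiv : ∀ N ∈ Lv, ∀ e ∈ N.divisors, ∀ δ ∈ N.divisors, symDiv e (symDiv e δ) = δ := by
  decide +kernel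

lemma Lv_vv_symDiv : ∀ N ∈ Lv, ∀ e ∈ N.divisors, (sgn N e = 1 ∨ sgn N e = -1) ∧
    ∀ δ ∈ N.divisors, vv N (symDiv e δ) = sgn N e * vv N δ := by decide +kernel

lemma Lv_rr_mod : ∀ N ∈ Lv,
    (∀ a b c d : ZMod 3, a * d - N * b * c = 1 →
      ∑ δ ∈ N.divisors, (rr N δ : ZMod 3) * Xd N 1 δ a b c d = 0) ∧
    (∀ a b c d : ZMod 4, a * d - N * b * c = 1 →
      ∑ δ ∈ N.divisors, (rr N δ : ZMod 4) * Xd N 1 δ a b c d = 0) := by decide +kernel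

lemma Lv_vv_mod : ∀ N ∈ Lv, ∀ e ∈ N.divisors,
    (∀ a b c d : ZMod 3, e * a * d - (N / e : ℕ) * b * c = 1 →
      ∑ δ ∈ N.divisors, (vv N δ : ZMod 3) * Xd N e δ a b c d = 0) ∧
    (∀ a b c d : ZMod 4, e * a * d - (N / e : ℕ) * b * c = 1 →
      ∑ δ ∈ N.divisors, (vv N δ : ZMod 4) * Xd N e δ a b c d = 0) := by decide +kernel

/-- The regular factor of the `q`-expansion of an eta quotient. -/
def EP (N : ℕ) (r : ℕ → ℤ) (q : ℂ) : ℂ := ∏ δ ∈ N.divisors, (eul (q ^ δ) ^ 2) ^ r δ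

lemma pow_mem_ball {q : ℂ} (hq : q ∈ Metric.ball (0 : ℂ) 1) {δ : ℕ} (hδ : 0 < δ) :
    q ^ δ ∈ Metric.ball (0 : ℂ) 1 := by
  rw [mem_ball_zero_iff] at hq ⊢
  rw [norm_pow]
  exact pow_lt_one₀ (norm_nonneg _) hq hδ.ne'

lemma EP_diff (N : ℕ) (r : ℕ → ℤ) : DifferentiableOn ℂ (EP N r) (Metric.ball 0 1) := by
  refine DifferentiableOn.fun_finsetProd fun δ hδ => ?_
  have hp := Nat.pos_of_mem_divisors hδ
  have h1 : DifferentiableOn ℂ (fun q : ℂ => eul (q ^ δ) ^ 2) (Metric.ball 0 1) :=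
    (eul_diff.comp (by fun_prop) fun q hq => pow_mem_ball hq hp).pow 2
  exact h1.zpow (Or.inl fun q hq =>
    pow_ne_zero _ (eul_ne_zero (mem_ball_zero_iff.mp (pow_mem_ball hq hp))))

lemma EP_zero (N : ℕ) (r : ℕ → ℤ) : EP N r 0 = 1 := by
  refine Finset.prod_eq_one fun δ hδ => ?_
  rw [zero_pow (Nat.pos_of_mem_divisors hδ).ne', eul_zero, one_pow, _root_.one_zpow]

lemma prod_zpow_sum {ι : Type*} {s : Finset ι} {x : ℂ} (hx : x ≠ 0) (f : ι → ℤ) :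
    ∏ i ∈ s, x ^ f i = x ^ ∑ i ∈ s, f i := by
  classical
  induction s using Finset.induction_on with
  | empty => simp
  | insert i s hi ih => rw [Finset.prod_insert hi, Finset.sum_insert hi, zpow_add₀ hx, ih]

lemma EQ_eq_EP (N : ℕ) (r : ℕ → ℤ) {m : ℤ} (hm : ∑ δ ∈ N.divisors, r δ * δ = 12 * m) (z : ℂ) :
    EQ N r z = qc z ^ m * EP N r (qc z) := by
  have h1 : qc z ^ m = ∏ δ ∈ N.divisors, ex (1 / 12) (δ * z) ^ r δ := by
    have h2 : ∀ δ ∈ N.divisors, ex (1 / 12) (δ * z) ^ r δ = ex (1 / 12) z ^ (r δ * δ) := by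
      intro δ _
      rw [ex, ex, ← Complex.exp_int_mul, ← Complex.exp_int_mul]
      congr 1
      push_cast
      ring
    rw [Finset.prod_congr rfl h2, prod_zpow_sum (ex_ne_zero _ _), hm, qc, ex, ← Complex.exp_int_mul,
      ← Complex.exp_int_mul]
    congr 1
    push_cast
    ring
  rw [h1, EQ, EP, ← Finset.prod_mul_distrib]
  refine Finset.prod_congr rfl fun δ _ => ?_
  rw [et_eq, mul_zpow, qc_nat_mul]

lemma EQ_prod_asy (N : ℕ) (r : ℕ → ℤ) (s : ℕ → ℕ) (hs : ∀ δ ∈ N.divisors, 0 < s δ) :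
    Asy (fun z => ∏ δ ∈ N.divisors, et (s δ * z) ^ r δ)
      (((∑ δ ∈ N.divisors, r δ * s δ : ℤ) : ℝ) / 12) 1 := by
  have h := Asy.prod N.divisors (F := fun δ z => et (s δ * z) ^ r δ)
    (κ := fun δ => r δ * ((s δ : ℝ) / 12)) (C := fun δ => 1 ^ r δ)
    (fun δ hδ => (et_natmul_asy (hs δ hδ)).zpow (r δ))
  convert h using 1
  · push_cast
    rw [Finset.sum_div]
    exact Finset.sum_congr rfl fun δ _ => by ring
  · simp

lemma Asy.bdd_of_nonneg {F : ℂ → ℂ} {κ : ℝ} {C : ℂ} (h : Asy F κ C) (hκ : 0 ≤ κ) :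
    F =O[atI] (fun _ => (1 : ℝ)) := by
  refine h.isBigO.trans (IsBigO.of_bound 1 ?_)
  filter_upwards [UH_mem_atI] with z hz
  rw [norm_ex, norm_one, mul_one, Real.exp_le_one_iff]
  have : 0 < z.im := hz
  have := Real.pi_pos
  have : 0 ≤ 2 * Real.pi * κ * z.im := by positivity
  linarith

lemma Lv_pos : ∀ N ∈ Lv, 0 < N := by decide +kernel

/-- The constant term of the eta quotient of level `N`. -/
def tc (N : ℕ) : ℂ := deriv (EP N (rr N)) 0

/-- The normalised hauptmodul of `Γ₀(N)`. -/
def tN (N : ℕ) (z : ℂ) : ℂ := EQ N (rr N) z - tc N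

/-- The regular part of the `q`-expansion of the hauptmodul. -/
def gN (N : ℕ) (q : ℂ) : ℂ := dslope (EP N (rr N)) 0 q - tc N

lemma EQ_rr_inv {N : ℕ} (hN : N ∈ Lv) {γ : MZ} (hγ : γ ∈ AL N 1) {z : ℂ} (hz : z ∈ UH) :
    EQ N (rr N) (act γ z) = EQ N (rr N) z := by
  obtain ⟨a, b, c, d, rfl, hdet⟩ := mem_AL_iff.mp hγ
  rw [EQ_AL (Lv_squarefree N hN) (one_dvd N) (Lv_sum_rr N hN) hdet hz]
  have h0 : (12 : ℤ) ∣ (∑ δ ∈ N.divisors, rr N δ * Xd N 1 δ a b c d) - 0 := by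
    rw [sub_zero]
    refine twelve_dvd ?_ ?_
    · push_cast [cast_Xd]
      refine (Lv_rr_mod N hN).1 _ _ _ _ ?_
      have := congrArg (Int.cast : ℤ → ZMod 3) hdet
      push_cast at this
      linear_combination this
    · push_cast [cast_Xd]
      refine (Lv_rr_mod N hN).2 _ _ _ _ ?_
      have := congrArg (Int.cast : ℤ → ZMod 4) hdet
      push_cast at this
      linear_combination this
  rw [z12_zpow h0]
  simp [EQ, one_symDiv]

theorem haupt {N : ℕ} (hN : N ∈ Lv) : Haupt N (tN N) (gN N) where
  sqf := Lv_squarefree N hN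
  diff := (EQ_diff N _).sub_const _
  inv γ hγ z hz := by rw [tN, tN, EQ_rr_inv hN hγ hz]
  g_diff := by
    refine DifferentiableOn.sub_const ?_ _
    exact (Complex.differentiableOn_dslope (Metric.ball_mem_nhds 0 one_pos)).mpr (EP_diff N _)
  g_zero := by rw [gN, dslope_same, tc, sub_self]
  expand z _ := by
    have h := EQ_eq_EP N (rr N) (m := -1) (by rw [Lv_order_rr N hN]; rfl) z
    rw [tN, gN, h, dslope_of_ne _ (qc_ne_zero z), slope_def_field, EP_zero, sub_zero,
      _root_.zpow_neg, zpow_one]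
    have := qc_ne_zero z
    field_simp
    ring
  bdd e he he1 := by
    have hsq := Lv_squarefree N hN
    obtain ⟨A, hA⟩ := exists_mem_AL hsq he
    refine ⟨A, hA, ?_⟩
    obtain ⟨a, b, c, d, rfl, hdet⟩ := mem_AL_iff.mp hA
    have hmem : e ∈ N.divisors := Nat.mem_divisors.mpr ⟨he, hsq.ne_zero⟩
    have h1 := EQ_prod_asy N (rr N) (symDiv e) (fun δ hδ => Nat.pos_of_dvd_of_pos
      (symDiv_dvd hsq he (Nat.dvd_of_mem_divisors hδ)) (Lv_pos N hN))
    have h2 := h1.bdd_of_nonneg (by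
      have : (0 : ℝ) ≤ ((∑ δ ∈ N.divisors, rr N δ * symDiv e δ : ℤ) : ℝ) := by
        exact_mod_cast Lv_order_nonneg N hN e hmem he1
      positivity)
    have h3 := (h2.const_mul_left (z12 ^ (∑ δ ∈ N.divisors, rr N δ * Xd N e δ a b c d) *
      (∏ δ ∈ N.divisors, ((Nat.gcd e δ : ℕ) : ℂ) ^ (-rr N δ)))).sub
      (isBigO_const_const (tc N) (one_ne_zero (α := ℝ)) atI)
    refine h3.congr' ?_ EventuallyEq.rfl
    filter_upwards [UH_mem_atI] with z hz
    rw [tN, EQ_AL hsq he (Lv_sum_rr N hN) hdet hz]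

/-- The norm constant of the Fricke hauptmodul. -/
def cN (N : ℕ) : ℕ := if N = 6 then 64 else if N = 10 then 16 else N ^ (12 / (N - 1))

/-- The constant term of the Fricke hauptmodul. -/
def kN (N : ℕ) : ℂ := if N = 6 then 6 else if N = 10 then 4 else 24 / ((N : ℂ) - 1)

lemma Lv_gcd_prod : ∀ N ∈ Lv, ∀ e ∈ N.divisors,
    ∏ δ ∈ N.divisors, ((Nat.gcd e δ : ℕ) : ℚ) ^ (-vv N δ) =
      if sgn N e = 1 then (1 : ℚ) else cN N := by
  decide +kernel

lemma Lv_divisors : (∀ N ∈ Lv, N ≠ 6 → N ≠ 10 → N.divisors = {1, N} ∧ 24 / (N - 1) = 2 * (12 / (N - 1)) ∧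
    vv N 1 = (12 / (N - 1) : ℕ) ∧ vv N N = -(12 / (N - 1) : ℕ) ∧ 1 ≠ N) ∧
    Nat.divisors 6 = {1, 2, 3, 6} ∧ Nat.divisors 10 = {1, 2, 5, 10} := by
  decide +kernel

lemma jnStar_eq {N : ℕ} (hN : N ∈ Lv) (z : ℂ) :
    jnStar N z = EQ N (vv N) z + kN N + cN N * (EQ N (vv N) z)⁻¹ := by
  by_cases h6 : N = 6
  · subst h6
    rw [EQ, Lv_divisors.2.1, jnStar, if_pos rfl, kN, cN, if_pos rfl, if_pos rfl]
    simp [Finset.prod_insert, vv, et, _root_.zpow_neg, div_pow, mul_pow]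
    field_simp
    ring
  by_cases h10 : N = 10
  · subst h10
    rw [EQ, Lv_divisors.2.2, jnStar, if_neg h6, if_pos rfl, kN, cN, if_neg h6, if_pos rfl,
      if_neg h6, if_pos rfl]
    simp [Finset.prod_insert, vv, et, _root_.zpow_neg, div_pow, mul_pow]
    field_simp
    ring
  obtain ⟨h1, h2, h3, h4, h5⟩ := Lv_divisors.1 N hN h6 h10
  rw [EQ, h1, jnStar, if_neg h6, if_neg h10, kN, cN, if_neg h6, if_neg h10,
    if_neg h6, if_neg h10, Finset.prod_pair h5, h3, h4, h2, _root_.zpow_neg, zpow_natCast, zpow_natCast,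
    et, et, ← pow_mul, ← pow_mul]
  simp only [Nat.cast_one, one_mul, Nat.cast_pow, mul_inv, inv_inv, div_eq_mul_inv]
  ring

lemma EQ_vv_AL {N e : ℕ} (hN : N ∈ Lv) (he : e ∣ N) {A : MZ} (hA : A ∈ AL N e) {z : ℂ}
    (hz : z ∈ UH) : EQ N (vv N) (act A z) = if sgn N e = 1 then EQ N (vv N) z
      else cN N * (EQ N (vv N) z)⁻¹ := by
  obtain ⟨a, b, c, d, rfl, hdet⟩ := mem_AL_iff.mp hA
  have hsq := Lv_squarefree N hN
  have hmem : e ∈ N.divisors := Nat.mem_divisors.mpr ⟨he, hsq.ne_zero⟩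
  have he0 : e ≠ 0 := (Nat.pos_of_mem_divisors hmem).ne'
  rw [EQ_AL hsq he (Lv_sum_vv N hN) hdet hz]
  have hdet' : (e : ℤ) * a * d - (N / e : ℕ) * b * c = 1 := by
    obtain ⟨m, rfl⟩ := he
    rw [Nat.mul_div_cancel_left _ (Nat.pos_of_ne_zero he0)]
    have : (e : ℤ) ≠ 0 := by exact_mod_cast he0
    refine mul_left_cancel₀ this ?_
    push_cast at hdet
    linear_combination hdet
  have h0 : (12 : ℤ) ∣ (∑ δ ∈ N.divisors, vv N δ * Xd N e δ a b c d) - 0 := by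
    rw [sub_zero]
    refine twelve_dvd ?_ ?_
    · push_cast [cast_Xd]
      refine (Lv_vv_mod N hN e hmem).1 _ _ _ _ ?_
      have := congrArg (Int.cast : ℤ → ZMod 3) hdet'
      simpa only [Int.cast_sub, Int.cast_mul, Int.cast_natCast, Int.cast_one] using this
    · push_cast [cast_Xd]
      refine (Lv_vv_mod N hN e hmem).2 _ _ _ _ ?_
      have := congrArg (Int.cast : ℤ → ZMod 4) hdet'
      simpa only [Int.cast_sub, Int.cast_mul, Int.cast_natCast, Int.cast_one] using this
  rw [z12_zpow h0, zpow_zero, one_mul]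
  obtain ⟨hs, hv⟩ := Lv_vv_symDiv N hN e hmem
  have hprod : ∏ δ ∈ N.divisors, et ((symDiv e δ : ℕ) * z) ^ vv N δ =
      EQ N (vv N) z ^ sgn N e := by
    rw [EQ, ← Finset.prod_zpow]
    have hsd : ∀ δ ∈ N.divisors, symDiv e δ ∈ N.divisors := fun δ hδ =>
      Nat.mem_divisors.mpr ⟨symDiv_dvd hsq he (Nat.dvd_of_mem_divisors hδ), hsq.ne_zero⟩
    refine Finset.prod_nbij (symDiv e) hsd ?_ ?_ ?_
    · intro x hx y hy hxy
      rw [← Lv_symDiv N hN e hmem x hx, ← Lv_symDiv N hN e hmem y hy, hxy]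
    · intro x hx
      exact ⟨symDiv e x, hsd x hx, Lv_symDiv N hN e hmem x hx⟩
    · intro δ hδ
      rw [hv δ hδ, ← _root_.zpow_mul]
      congr 1
      rcases hs with h | h <;> rw [h] <;> ring
  have hg := congrArg (Rat.cast : ℚ → ℂ) (Lv_gcd_prod N hN e hmem)
  push_cast at hg
  rw [hprod, hg]
  rcases hs with h | h
  · simp [h]
  · simp [h]

theorem jnStar_AL {N e : ℕ} (hN : N ∈ Lv) (he : e ∣ N) {A : MZ} (hA : A ∈ AL N e) {z : ℂ}
    (hz : z ∈ UH) : jnStar N (act A z) = jnStar N z := by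
  rw [jnStar_eq hN, jnStar_eq hN, EQ_vv_AL hN he hA hz]
  split_ifs with h
  · rfl
  · have h1 : EQ N (vv N) z ≠ 0 := EQ_ne_zero _ hz
    have h2 : (cN N : ℂ) ≠ 0 := by
      have : ∀ N ∈ Lv, cN N ≠ 0 := by decide +kernel
      exact_mod_cast this N hN
    field_simp
    ring

lemma jnStar_diff {N : ℕ} (hN : N ∈ Lv) : DifferentiableOn ℂ (jnStar N) UH := by
  have h : DifferentiableOn ℂ (fun z => EQ N (vv N) z + kN N + cN N * (EQ N (vv N) z)⁻¹) UH :=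
    ((EQ_diff N _).add_const _).add (((EQ_diff N _).inv fun z hz => EQ_ne_zero _ hz).const_mul _)
  exact h.congr fun z _ => jnStar_eq hN z

open Haupt

lemma symDiv_mem {N e δ : ℕ} (hN : Squarefree N) (he : e ∈ N.divisors) (hδ : δ ∈ N.divisors) :
    symDiv e δ ∈ N.divisors :=
  Nat.mem_divisors.mpr
    ⟨symDiv_dvd hN (Nat.dvd_of_mem_divisors he) (Nat.dvd_of_mem_divisors hδ), hN.ne_zero⟩

lemma sum_symDiv {M : Type*} [AddCommMonoid M] {N e : ℕ} (hN : N ∈ Lv) (he : e ∈ N.divisors)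
    (F : ℕ → M) :
    ∑ f ∈ N.divisors, F (symDiv f e) = ∑ f ∈ N.divisors, F f := by
  have hsq := Lv_squarefree N hN
  refine Finset.sum_nbij' (symDiv e) (symDiv e) (fun f hf => symDiv_mem hsq he hf)
    (fun f hf => symDiv_mem hsq he hf) (fun f hf => Lv_symDiv N hN e he f hf)
    (fun f hf => Lv_symDiv N hN e he f hf) fun f _ => by rw [symDiv_comm]

lemma tendsto_of_hasQExp {f : ℂ → ℂ} {a : ℤ → ℂ} (h : HasQExp f a (-2)) (h2 : a (-2) = 1)
    (h1 : a (-1) = 0) (h0 : a 0 = 0) : Tendsto (fun z => f z - (qc z)⁻¹ ^ 2) atI (𝓝 0) := by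
  have key : ∀ z ∈ UH, HasSum (fun m : ℕ => a (m + 1) * qc z ^ m * qc z) (f z - (qc z)⁻¹ ^ 2) := by
    intro z hz
    have h3 := (hasSum_nat_add_iff' 3).mpr (h.2 z hz)
    have h4 : ∑ i ∈ Finset.range 3, a (-2 + (i : ℤ)) * qc z ^ (-2 + (i : ℤ)) = (qc z)⁻¹ ^ 2 := by
      simp [Finset.sum_range_succ, h2, h1, h0, _root_.zpow_neg]
    rw [h4] at h3
    refine h3.congr_fun ?_
    intro m
    have h5 : (-2 + ((m + 3 : ℕ) : ℤ)) = m + 1 := by push_cast; ring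
    rw [h5, mul_assoc, ← pow_succ]
    congr 1
  have hI : (I : ℂ) ∈ UH := by simp [UH]
  have hs : Summable fun m : ℕ => ‖a (m + 1)‖ * ‖qc I‖ ^ m := by
    have h3 := (key I hI).summable.mul_right (qc I)⁻¹
    refine (h3.norm).congr fun m => ?_
    rw [mul_assoc, mul_inv_cancel₀ (qc_ne_zero I), mul_one, norm_mul, norm_pow]
  set M := ∑' m : ℕ, ‖a (m + 1)‖ * ‖qc I‖ ^ m
  have hq : Tendsto (fun z => M * ‖qc z‖) atI (𝓝 0) := by
    simpa using (tendsto_qc_nhds.norm).const_mul M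
  refine squeeze_zero_norm' ?_ hq
  have hsmall : ∀ᶠ z in atI, ‖qc z‖ < ‖qc I‖ := by
    have := tendsto_qc_nhds.norm
    rw [norm_zero] at this
    exact this.eventually_lt_const (norm_pos_iff.mpr (qc_ne_zero I))
  filter_upwards [hsmall, UH_mem_atI] with z hz hU
  rw [← (key z hU).tsum_eq]
  have hle : ∀ m : ℕ, ‖a (m + 1) * qc z ^ m * qc z‖ ≤ ‖a (m + 1)‖ * ‖qc I‖ ^ m * ‖qc z‖ := by
    intro m
    rw [norm_mul, norm_mul, norm_pow]
    gcongr
  rw [← tsum_mul_right]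
  exact tsum_of_norm_bounded (hs.mul_right _).hasSum hle

/-- The values of the quadratic Faber polynomial at the cusps, normalised to vanish at infinity. -/
def Ac (N e : ℕ) : ℂ := if e = 1 then 0 else Aq (gN N) (xe N (tN N) e)

/-- The Faber polynomial of degree two of the Fricke hauptmodul in terms of `Γ₀(N)`. -/
def fS (N : ℕ) (z : ℂ) : ℂ :=
  ∑ e ∈ N.divisors, Aq (gN N) (te N (tN N) e z) - ∑ e ∈ N.divisors, Ac N e

lemma fS_diff {N : ℕ} (hN : N ∈ Lv) : DifferentiableOn ℂ (fS N) UH := by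
  refine DifferentiableOn.sub_const (DifferentiableOn.fun_sum fun e he => ?_) _
  exact (((haupt hN).te_diff (Nat.dvd_of_mem_divisors he)).pow 2).sub_const _

lemma fS_AL {N e : ℕ} (hN : N ∈ Lv) (he : e ∣ N) {A : MZ} (hA : A ∈ AL N e) {z : ℂ} (hz : z ∈ UH) :
    fS N (act A z) = fS N z := by
  have hmem : e ∈ N.divisors := Nat.mem_divisors.mpr ⟨he, (Lv_pos N hN).ne'⟩
  have h : ∑ f ∈ N.divisors, Aq (gN N) (te N (tN N) f (act A z)) =
      ∑ f ∈ N.divisors, Aq (gN N) (te N (tN N) f z) := by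
    rw [← sum_symDiv hN hmem (fun f => Aq (gN N) (te N (tN N) f z))]
    refine Finset.sum_congr rfl fun f hf => ?_
    rw [(haupt hN).te_act (Nat.dvd_of_mem_divisors hf) he hA hz]
  rw [fS, fS, h]

lemma tendsto_fS {N : ℕ} (hN : N ∈ Lv) : Tendsto (fun z => fS N z - (qc z)⁻¹ ^ 2) atI (𝓝 0) := by
  have H := haupt hN
  have h1 : Tendsto (fun z => Aq (gN N) (te N (tN N) 1 z) - (qc z)⁻¹ ^ 2) atI (𝓝 0) := by
    have h2 : Tendsto (fun z => (gN N (qc z) - deriv (gN N) 0 * qc z) / qc z) atI (𝓝 0) :=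
      H.g_isLittleO.tendsto_div_nhds_zero
    have h3 := tendsto_qexp H.g_diff
    rw [H.g_zero] at h3
    have h4 := (h2.const_mul 2).add (h3.pow 2)
    simp only [mul_zero, ne_eq, OfNat.ofNat_ne_zero, not_false_eq_true, zero_pow, add_zero] at h4
    refine h4.congr' ?_
    filter_upwards [UH_mem_atI] with z hz
    rw [H.te_one hz, H.expand z hz, Aq]
    have := qc_ne_zero z
    field_simp
    ring
  have h5 : Tendsto (fun z => ∑ e ∈ W' N, (Aq (gN N) (te N (tN N) e z) - Ac N e)) atI
      (𝓝 (∑ e ∈ W' N, 0)) := by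
    refine tendsto_finsetSum _ fun e he => ?_
    obtain ⟨he, he1⟩ := H.mem_W'.mp he
    have := ((H.tendsto_te he he1).pow 2).sub_const (2 * deriv (gN N) 0)
    have h6 := this.sub_const (Ac N e)
    rw [Ac, if_neg he1] at h6 ⊢
    simpa only [Aq, sub_self] using h6
  have h7 := h1.add h5
  simp only [Finset.sum_const_zero, add_zero] at h7
  refine h7.congr fun z => ?_
  have h1N : 1 ∈ N.divisors := Nat.mem_divisors.mpr ⟨one_dvd N, (Lv_pos N hN).ne'⟩
  rw [fS, ← Finset.sum_sub_distrib, ← Finset.add_sum_erase _ _ h1N, W', Ac, if_pos rfl]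
  ring

theorem eval_jnStar {N : ℕ} (hN : N ∈ Lv) {P : Polynomial ℂ} {a : ℤ → ℂ}
    (h : HasQExp (fun z => P.eval (jnStar N z)) a (-2)) (h2 : a (-2) = 1)
    (h1 : a (-1) = 0) (h0 : a 0 = 0) : ∀ z ∈ UH, P.eval (jnStar N z) = fS N z := by
  have hd : DifferentiableOn ℂ (fun z => P.eval (jnStar N z) - fS N z) UH :=
    (P.differentiable.comp_differentiableOn (jnStar_diff hN)).sub (fS_diff hN)
  have hA : ∀ e, e ∣ N → ∀ A ∈ AL N e, ∀ z ∈ UH, P.eval (jnStar N (act A z)) - fS N (act A z) =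
      P.eval (jnStar N z) - fS N z := fun e he A hA z hz => by
    rw [jnStar_AL hN he hA hz, fS_AL hN he hA hz]
  have hl : Tendsto (fun z => P.eval (jnStar N z) - fS N z) atI (𝓝 0) := by
    have := (tendsto_of_hasQExp h h2 h1 h0).sub (tendsto_fS hN)
    rw [sub_zero] at this
    exact this.congr fun z => by ring
  obtain ⟨c, hc⟩ := liouville (Lv_squarefree N hN) hd (hA 1 (one_dvd N)) (by
    intro e he
    obtain ⟨A, hAm⟩ := exists_mem_AL (Lv_squarefree N hN) he
    refine ⟨A, hAm, (hl.isBigO_one ℝ).congr' ?_ EventuallyEq.rfl⟩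
    filter_upwards [UH_mem_atI] with z hz
    exact (hA e he A hAm z hz).symm)
  have hc0 : c = 0 := tendsto_nhds_unique (tendsto_const_nhds.congr' (by
    filter_upwards [UH_mem_atI] with z hz
    exact (hc z hz).symm)) hl
  intro z hz
  have := hc z hz
  rw [hc0] at this
  exact sub_eq_zero.mp this

lemma taylor_two {h : ℂ → ℂ} (hh : AnalyticAt ℂ h 0) :
    (fun w => h w - (h 0 + deriv h 0 * w + deriv (deriv h) 0 / 2 * w ^ 2)) =o[𝓝 0]
      (fun w => w ^ 2) := by
  have h3 := hh.hasFPowerSeriesAt.isBigO_sub_partialSum_pow 3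
  refine IsBigO.trans_isLittleO (g := fun w : ℂ => w ^ 3) ?_
    (isLittleO_pow_pow (𝕜 := ℂ) (m := 2) (n := 3) (by norm_num))
  refine (h3.congr_left fun z => ?_).trans (IsBigO.of_norm_left ?_)
  · simp [FormalMultilinearSeries.partialSum, Finset.sum_range_succ,
      FormalMultilinearSeries.ofScalars, iteratedDeriv_succ]
  · exact IsBigO.of_bound 1 (Eventually.of_forall fun z => by simp)

lemma isBigO_of_hasSum {F : ℂ → ℂ} {a : ℕ → ℂ}
    (h : ∀ z ∈ UH, HasSum (fun m : ℕ => a m * qc z ^ m) (F z)) (k : ℕ) :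
    (fun z => F z - ∑ m ∈ Finset.range k, a m * qc z ^ m) =O[atI] (fun z => qc z ^ k) := by
  have key : ∀ z ∈ UH, HasSum (fun m : ℕ => a (m + k) * qc z ^ m * qc z ^ k)
      (F z - ∑ m ∈ Finset.range k, a m * qc z ^ m) := by
    intro z hz
    have h3 := (hasSum_nat_add_iff' k).mpr (h z hz)
    exact h3.congr_fun fun m => by rw [pow_add, mul_assoc]
  have hI : (I : ℂ) ∈ UH := by simp [UH]
  have hs : Summable fun m : ℕ => ‖a (m + k)‖ * ‖qc I‖ ^ m := by
    have h3 := (key I hI).summable.mul_right (qc I ^ k)⁻¹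
    refine (h3.norm).congr fun m => ?_
    rw [mul_assoc, mul_inv_cancel₀ (pow_ne_zero _ (qc_ne_zero I)), mul_one, norm_mul, norm_pow]
  refine IsBigO.of_bound (∑' m : ℕ, ‖a (m + k)‖ * ‖qc I‖ ^ m) ?_
  have hsmall : ∀ᶠ z in atI, ‖qc z‖ < ‖qc I‖ := by
    have := tendsto_qc_nhds.norm
    rw [norm_zero] at this
    exact this.eventually_lt_const (norm_pos_iff.mpr (qc_ne_zero I))
  filter_upwards [hsmall, UH_mem_atI] with z hz hU
  rw [← (key z hU).tsum_eq, ← tsum_mul_right]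
  refine tsum_of_norm_bounded (hs.mul_right _).hasSum fun m => ?_
  rw [norm_mul, norm_mul, norm_pow]
  gcongr

/-- The logarithmic derivative of `η²`, i.e. `E₂ / 12`. -/
def Ee (z : ℂ) : ℂ := logDeriv et z / (2 * Real.pi * I)

lemma two_pi_I_ne : (2 * Real.pi * I : ℂ) ≠ 0 := by
  have := Real.pi_ne_zero
  simp [this]

lemma Ee_hasSum {z : ℂ} (hz : z ∈ UH) : HasSum (fun m : ℕ =>
    (if m = 0 then 1 / 12 else -2 * ∑ x ∈ m.divisorsAntidiagonal, (x.2 : ℂ)) * qc z ^ m) (Ee z) := by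
  have h1 := EisensteinSeries.hasSum_qExpansion_E2 (z := ⟨z, hz⟩)
  have h2 := ModularForm.logDeriv_eta_eq_E2 ⟨z, hz⟩
  have h3 : Ee z = 1 / 12 * EisensteinSeries.E2 ⟨z, hz⟩ := by
    have h4 : et = fun z => ModularForm.eta z ^ 2 := by
      funext z
      rw [et, dedekindEta_eq_eta]
    have h5 : logDeriv et z = 2 * logDeriv ModularForm.eta z := by
      rw [h4, logDeriv_fun_pow]
      · norm_num
      · exact (ModularForm.differentiableAt_eta_of_mem_upperHalfPlaneSet hz)
    rw [Ee, h5]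
    change logDeriv ModularForm.eta z = _ at h2
    rw [h2]
    have := Real.pi_ne_zero
    have h6 : (Real.pi : ℂ) ≠ 0 := by exact_mod_cast this
    field_simp
  rw [h3]
  refine (h1.mul_left (1 / 12)).congr_fun fun m => ?_
  change _ = 1 / 12 * _ • qc z ^ m
  split_ifs with hm
  · simp
  · rw [ArithmeticFunction.sigma_one_apply, ← Nat.sum_divisorsAntidiagonal' (fun x y => y)]
    push_cast
    simp only [smul_eq_mul]
    ring

lemma et_deriv {z : ℂ} (hz : z ∈ UH) :
    Ee z = 1 / 12 + 2 * (qc z * deriv eul (qc z)) / eul (qc z) := by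
  have hq : qc z ∈ Metric.ball (0 : ℂ) 1 := mem_ball_zero_iff.mpr (norm_qc_lt_one hz)
  have h1 : HasDerivAt eul (deriv eul (qc z)) (qc z) :=
    (eul_diff.differentiableAt (Metric.isOpen_ball.mem_nhds hq)).hasDerivAt
  have h2 : HasDerivAt qc (2 * Real.pi * I * qc z) z := by
    have := ((hasDerivAt_id z).const_mul (2 * Real.pi * I : ℂ)).cexp
    simp only [id, mul_one] at this
    rw [mul_comm]
    exact this
  have h3 : HasDerivAt (ex (1 / 12)) (2 * Real.pi * I / 12 * ex (1 / 12) z) z := by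
    have := (((hasDerivAt_id z).const_mul (((1 / 12 : ℝ) : ℂ))).const_mul
      (2 * Real.pi * I : ℂ)).cexp
    simp only [id, mul_one] at this
    have h3' : cexp (2 * Real.pi * I * (((1 / 12 : ℝ) : ℂ) * z)) * (2 * Real.pi * I *
        ((1 / 12 : ℝ) : ℂ)) = 2 * Real.pi * I / 12 * ex (1 / 12) z := by
      rw [ex]
      push_cast
      ring
    rw [← h3']
    exact this
  have h4 := h3.mul ((h1.comp z h2).pow 2)
  have h5 : et = ex (1 / 12) * (eul ∘ qc) ^ 2 := funext fun z => et_eq z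
  rw [Ee, logDeriv_apply, h5, h4.deriv]
  have h6 : eul (qc z) ≠ 0 := eul_ne_zero (norm_qc_lt_one hz)
  have h7 := ex_ne_zero (1 / 12) z
  have h8 : (Real.pi : ℂ) ≠ 0 := by exact_mod_cast Real.pi_ne_zero
  have h9 := I_ne_zero
  simp only [Function.comp, Pi.mul_apply, Pi.pow_apply, Nat.cast_ofNat]
  field_simp
  ring

lemma eul_analytic : AnalyticAt ℂ eul 0 :=
  eul_diff.analyticAt (Metric.ball_mem_nhds 0 one_pos)

lemma eul_taylor : (fun w => eul w - (1 - w - w ^ 2)) =o[𝓝 0] (fun w => w ^ 2) := by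
  have hd : AnalyticAt ℂ (deriv eul) 0 := eul_analytic.deriv
  set φ : ℂ → ℂ := fun w => deriv eul w / eul w with hφ
  have hφa : AnalyticAt ℂ φ 0 := hd.div eul_analytic (by rw [eul_zero]; exact one_ne_zero)
  have h1 := hφa.differentiableAt.hasDerivAt.isLittleO.comp_tendsto tendsto_qc_nhds
  have h2 := isBigO_of_hasSum (fun z hz => Ee_hasSum hz) 3
  have h3 : (fun z => Ee z - (1 / 12 - 2 * qc z - 6 * qc z ^ 2)) =o[atI] (fun z => qc z ^ 2) := by
    have h4 : (fun z => qc z ^ 3) =o[atI] (fun z => qc z ^ 2) :=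
      (isLittleO_pow_pow (𝕜 := ℂ) (m := 2) (n := 3) (by norm_num)).comp_tendsto tendsto_qc_nhds
    refine (h2.trans_isLittleO h4).congr_left fun z => ?_
    have h5 : ∑ x ∈ Nat.divisorsAntidiagonal 2, (x.2 : ℂ) = 3 := by
      rw [show Nat.divisorsAntidiagonal 2 = {(1, 2), (2, 1)} by decide]
      simp
      norm_num
    simp [Finset.sum_range_succ, h5]
    ring
  have h6 : (fun z => qc z * (φ (qc z) - φ 0 - qc z * deriv φ 0)) =o[atI] (fun z => qc z ^ 2) := by
    have := (isBigO_refl qc atI).mul_isLittleO h1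
    refine this.congr (fun z => ?_) (fun z => ?_)
    · simp [Function.comp]
    · simp [Function.comp, sq]
  have h7 := h3.sub (h6.const_mul_left 2)
  have h8 : (fun z => (0 : ℂ) + (2 * φ 0 + 2) * qc z + (2 * deriv φ 0 + 6) * qc z ^ 2) =o[atI]
      (fun z => qc z ^ 2) := by
    refine h7.congr' ?_ EventuallyEq.rfl
    filter_upwards [UH_mem_atI] with z hz
    rw [et_deriv hz, hφ]
    ring
  obtain ⟨-, h9, h10⟩ := X2.eq_zero_of_isLittleO h8
  have h11 : deriv eul 0 = -1 := by
    have : φ 0 = deriv eul 0 := by rw [hφ]; simp [eul_zero]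
    rw [← this]
    linear_combination h9 / 2
  have h12 : deriv (deriv eul) 0 = -2 := by
    have : deriv φ 0 = deriv (deriv eul) 0 - 1 := by
      rw [hφ, deriv_fun_div hd.differentiableAt eul_analytic.differentiableAt
        (by rw [eul_zero]; exact one_ne_zero), eul_zero, h11]
      ring
    linear_combination h10 / 2 - this
  refine (taylor_two eul_analytic).congr_left fun w => ?_
  rw [eul_zero, h11, h12]
  ring

/-- The second logarithmic coefficient of `Δ(δ z)`. -/
def bD (δ : ℕ) : ℂ := if δ = 1 then -36 else if δ = 2 then -24 else 0

lemma Delta_X2 {δ : ℕ} (hδ : 0 < δ) : X2 (fun z => et (δ * z) ^ 12) δ (bD δ) := by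
  have ht : Tendsto (fun z => qc z ^ δ) atI (𝓝 0) := by
    have := tendsto_qc_nhds.pow δ
    rwa [zero_pow hδ.ne'] at this
  have h1 := eul_taylor.comp_tendsto ht
  have hO : ∀ {k : ℕ}, 3 ≤ k → (fun z => qc z ^ k) =o[atI] (fun z => qc z ^ 2) := fun {k} hk =>
    (isLittleO_pow_pow (𝕜 := ℂ) (m := 2) (n := k) (by omega)).comp_tendsto tendsto_qc_nhds
  have hle : (fun z => (qc z ^ δ) ^ 2) =O[atI] (fun z => qc z ^ 2) := by
    rcases Nat.lt_or_ge 1 δ with h | h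
    · refine ((hO (k := δ * 2) (by omega)).isBigO).congr_left fun z => by rw [pow_mul]
    · obtain rfl : δ = 1 := by omega
      simpa using isBigO_refl _ _
  have h2 : (fun z => eul (qc z ^ δ) - (1 - qc z ^ δ - (qc z ^ δ) ^ 2)) =o[atI]
      (fun z => qc z ^ 2) := h1.trans_isBigO hle
  have h3 : X2 (fun z => eul (qc z ^ δ)) 0 (bD δ / 24) := by
    rcases Nat.lt_or_ge 1 δ with h | h
    · have h4 : (fun z => (qc z ^ δ) ^ 2) =o[atI] (fun z => qc z ^ 2) :=
        (hO (k := δ * 2) (by omega)).congr_left fun z => by rw [pow_mul]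
      rcases Nat.lt_or_ge 2 δ with h' | h'
      · refine ⟨1, one_ne_zero, 0, ?_⟩
        refine ((h2.sub h4).sub (hO (k := δ) (by omega))).congr_left fun z => ?_
        rw [bD, if_neg (by omega), if_neg (by omega)]
        simp
        ring
      · obtain rfl : δ = 2 := by omega
        refine ⟨1, one_ne_zero, 0, ?_⟩
        refine (h2.sub h4).congr_left fun z => ?_
        rw [bD, if_neg (by omega), if_pos rfl]
        simp
        ring
    · obtain rfl : δ = 1 := by omega
      refine ⟨1, one_ne_zero, -1, ?_⟩
      refine h2.congr_left fun z => ?_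
      rw [bD, if_pos rfl]
      simp
      ring
  have h5 := (X2.qzpow (δ : ℤ)).mul (h3.pow 24)
  have h6 : ∀ z, qc z ^ (δ : ℤ) * eul (qc z ^ δ) ^ 24 = et (δ * z) ^ 12 := by
    intro z
    rw [et_eq, qc_nat_mul, mul_pow, ← pow_mul, zpow_natCast, ← qc_nat_mul]
    congr 1
    rw [qc, ex, ← Complex.exp_nat_mul]
    congr 1
    push_cast
    ring
  convert h5.congr (Eventually.of_forall h6) using 1
  · simp
  · push_cast
    ring

/-- The exponents of the unit `∏ Δ(z) / Δ(δ z)`. -/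
def ru (N δ : ℕ) : ℤ := (if δ = 1 then (N.divisors.card : ℤ) else 0) - 1

lemma sum_ru {N : ℕ} (hN : 0 < N) {R : Type*} [CommRing R] (F : ℕ → R) :
    ∑ δ ∈ N.divisors, (ru N δ : R) * F δ = N.divisors.card * F 1 - ∑ δ ∈ N.divisors, F δ := by
  have h1 : 1 ∈ N.divisors := Nat.mem_divisors.mpr ⟨one_dvd N, hN.ne'⟩
  simp only [ru, Int.cast_sub, Int.cast_one, sub_mul, one_mul, Finset.sum_sub_distrib]
  congr 1
  rw [Finset.sum_eq_single_of_mem 1 h1]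
  · simp
  · intro δ _ h
    simp [h]

lemma sum_symDiv_self {N e : ℕ} (hN : N ∈ Lv) (he : e ∈ N.divisors) :
    ∑ δ ∈ N.divisors, symDiv e δ = ∑ δ ∈ N.divisors, δ := by
  rw [← sum_symDiv hN he (fun δ => δ)]
  exact Finset.sum_congr rfl fun δ _ => symDiv_comm _ _

theorem unit_relation {N : ℕ} (hN : N ∈ Lv) :
    (N.divisors.card : ℂ) * ∑ e ∈ N.divisors, e * Ac N e -
      (∑ δ ∈ N.divisors, (δ : ℂ)) * ∑ e ∈ N.divisors, Ac N e =
        72 * N.divisors.card + 2 * ∑ δ ∈ N.divisors, bD δ := by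
  have H := haupt hN
  have hN0 := Lv_pos N hN
  have hsq := Lv_squarefree N hN
  set r : ℕ → ℤ := fun δ => 12 * ru N δ with hr
  set o : ℕ → ℤ := fun e => N.divisors.card * e - ∑ δ ∈ N.divisors, (δ : ℤ) with ho
  have hr0 : ∑ δ ∈ N.divisors, r δ = 0 := by
    have := sum_ru hN0 (R := ℤ) (fun _ => 1)
    simp only [Int.cast_id, mul_one, Finset.sum_const, nsmul_eq_mul, sub_self] at this
    rw [hr, ← Finset.mul_sum, this, mul_zero]
  have hmul : ∀ (e : ℕ) (a b c d : ℤ),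
      z12 ^ (∑ δ ∈ N.divisors, r δ * Xd N e δ a b c d) = 1 := by
    intro e a b c d
    rw [z12_zpow (l := 0), zpow_zero]
    rw [sub_zero]
    exact Finset.dvd_sum fun δ _ => Dvd.intro (ru N δ * Xd N e δ a b c d) (by rw [hr]; ring)
  obtain ⟨R, hR, -, -, hcard, hsum⟩ := H.residue_sum (G := EQ N r) (EQ_diff N r)
    (by
      intro γ hγ z hz
      obtain ⟨a, b, c, d, rfl, hdet⟩ := mem_AL_iff.mp hγ
      rw [EQ_AL hsq (one_dvd N) hr0 hdet hz, hmul]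
      simp [EQ, one_symDiv])
    o
    (by
      intro e he
      obtain ⟨he, -⟩ := H.mem_W'.mp he
      have hmem : e ∈ N.divisors := Nat.mem_divisors.mpr ⟨he, hN0.ne'⟩
      obtain ⟨a, b, c, d, hA, hdet⟩ := mem_AL_iff.mp (rep_mem hsq he)
      have h1 := EQ_prod_asy N r (symDiv e) (fun δ hδ =>
        Nat.pos_of_mem_divisors (symDiv_mem hsq hmem hδ))
      have h2 : (((∑ δ ∈ N.divisors, r δ * symDiv e δ : ℤ) : ℝ) / 12) = o e := by
        have h3 := sum_ru hN0 (R := ℤ) (fun δ => (symDiv e δ : ℤ))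
        have h4 : ∑ δ ∈ N.divisors, r δ * (symDiv e δ : ℤ) = 12 * o e := by
          simp only [hr, ho, mul_assoc, ← Finset.mul_sum]
          congr 1
          rw [symDiv_one] at h3
          simp only [Int.cast_id] at h3
          rw [h3]
          congr 1
          have h5 := congrArg (Nat.cast : ℕ → ℤ) (sum_symDiv_self hN hmem)
          rwa [Nat.cast_sum, Nat.cast_sum] at h5
        rw [h4]
        push_cast
        ring
      rw [h2] at h1
      have hc : (∏ δ ∈ N.divisors, ((Nat.gcd e δ : ℕ) : ℂ) ^ (-r δ)) ≠ 0 := by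
        refine Finset.prod_ne_zero_iff.mpr fun δ hδ => zpow_ne_zero _ ?_
        have := Nat.gcd_pos_of_pos_right e (Nat.pos_of_mem_divisors hδ)
        exact_mod_cast this.ne'
      have h6 := (Asy.const hc).mul h1
      rw [zero_add] at h6
      refine ⟨_, h6.congr fun z hz => ?_⟩
      rw [te, hA, EQ_AL hsq he hr0 hdet hz, hmul, one_mul])
    (β := ∑ δ ∈ N.divisors, ru N δ * bD δ)
    (by
      have h1 := X2.prod N.divisors (F := fun δ z => (et (δ * z) ^ 12) ^ ru N δ)
        (o := fun δ => ru N δ * δ) (β := fun δ => ru N δ * bD δ)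
        (fun δ hδ => (Delta_X2 (Nat.pos_of_mem_divisors hδ)).zpow _)
      have h2 : ∑ δ ∈ N.divisors, ru N δ * (δ : ℤ) = o 1 := by
        have h3 := sum_ru hN0 (R := ℤ) (fun δ => (δ : ℤ))
        simpa [ho] using h3
      rw [h2] at h1
      refine h1.congr (Eventually.of_forall fun z => ?_)
      refine Finset.prod_congr rfl fun δ _ => ?_
      rw [hr, _root_.zpow_mul]
      norm_cast)
  have hc0 : R.roots = 0 := by
    rw [← Multiset.card_eq_zero]
    have : ∑ e ∈ N.divisors, o e = 0 := by
      simp only [ho, Finset.sum_sub_distrib, ← Finset.mul_sum, Finset.sum_const, nsmul_eq_mul,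
        sub_self]
    rw [this, neg_zero] at hcard
    exact_mod_cast hcard
  rw [hc0, Multiset.map_zero, Multiset.sum_zero, sum_ru hN0] at hsum
  have h1N : 1 ∈ N.divisors := Nat.mem_divisors.mpr ⟨one_dvd N, hN0.ne'⟩
  have h5 : ∑ e ∈ W' N, (o e : ℂ) * Aq (gN N) (xe N (tN N) e) =
      ∑ e ∈ N.divisors, (o e : ℂ) * Ac N e := by
    rw [← Finset.add_sum_erase _ _ h1N, Ac, if_pos rfl, mul_zero, zero_add]
    refine Finset.sum_congr rfl fun e he => ?_
    rw [Ac, if_neg (Finset.ne_of_mem_erase he)]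
  have h6 : ∑ e ∈ N.divisors, (o e : ℂ) * Ac N e =
      (N.divisors.card : ℂ) * ∑ e ∈ N.divisors, e * Ac N e -
      (∑ δ ∈ N.divisors, (δ : ℂ)) * ∑ e ∈ N.divisors, Ac N e := by
    simp only [ho]
    push_cast
    simp only [sub_mul, Finset.sum_sub_distrib, Finset.mul_sum, mul_assoc]
  rw [h5, h6, bD, if_pos rfl] at hsum
  linear_combination hsum

lemma hasDerivAt_act {A : MZ} (hA : 0 < A.det) {z : ℂ} (hz : z ∈ UH) :
    HasDerivAt (act A) ((A.det : ℂ) / den A z ^ 2) z := by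
  have h1 : HasDerivAt (fun z : ℂ => (A 0 0 : ℂ) * z + A 0 1) (A 0 0) z := by
    simpa using ((hasDerivAt_id z).const_mul (A 0 0 : ℂ)).add_const (A 0 1 : ℂ)
  have h2 : HasDerivAt (fun z : ℂ => (A 1 0 : ℂ) * z + A 1 1) (A 1 0) z := by
    simpa using ((hasDerivAt_id z).const_mul (A 1 0 : ℂ)).add_const (A 1 1 : ℂ)
  have h3 := h1.div h2 (den_ne_zero hA hz)
  have h4 : (A.det : ℂ) / den A z ^ 2 = (A 0 0 * (A 1 0 * z + A 1 1) -
      (A 0 0 * z + A 0 1) * A 1 0) / (A 1 0 * z + A 1 1) ^ 2 := by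
    rw [Matrix.det_fin_two, den]
    congr 1
    push_cast
    ring
  rw [h4]
  exact h3

lemma deriv_comp_act {F : ℂ → ℂ} (hF : DifferentiableOn ℂ F UH) {A : MZ} (hA : 0 < A.det) {z : ℂ}
    (hz : z ∈ UH) : deriv (fun w => F (act A w)) z =
      deriv F (act A z) * ((A.det : ℂ) / den A z ^ 2) :=
  ((hF.differentiableAt (isOpen_UH.mem_nhds (act_mem hA hz))).hasDerivAt.comp z
    (hasDerivAt_act hA hz)).deriv

lemma hasDerivAt_qc (z : ℂ) : HasDerivAt qc (2 * Real.pi * I * qc z) z := by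
  have := ((hasDerivAt_id z).const_mul (2 * Real.pi * I : ℂ)).cexp
  simp only [id, mul_one] at this
  rw [mul_comm]
  exact this

lemma deriv_comp_qc {F h : ℂ → ℂ} (hh : DifferentiableOn ℂ h (Metric.ball 0 1))
    (hF : ∀ z ∈ UH, F z = h (qc z)) {z : ℂ} (hz : z ∈ UH) :
    deriv F z = 2 * Real.pi * I * (qc z * deriv h (qc z)) := by
  have h1 : F =ᶠ[𝓝 z] h ∘ qc := by
    filter_upwards [isOpen_UH.mem_nhds hz] with w hw
    exact hF w hw
  have hq : qc z ∈ Metric.ball (0 : ℂ) 1 := mem_ball_zero_iff.mpr (norm_qc_lt_one hz)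
  rw [h1.deriv_eq, ((hh.differentiableAt (Metric.isOpen_ball.mem_nhds hq)).hasDerivAt.comp z
    (hasDerivAt_qc z)).deriv]
  ring

lemma tendsto_deriv_qc {h : ℂ → ℂ} (hh : DifferentiableOn ℂ h (Metric.ball 0 1)) :
    Tendsto (fun z => deriv h (qc z)) atI (𝓝 (deriv h 0)) :=
  ((hh.analyticAt (Metric.ball_mem_nhds 0 one_pos)).deriv.continuousAt.tendsto).comp
    tendsto_qc_nhds

namespace Haupt
variable {N : ℕ} {t g : ℂ → ℂ}

lemma deriv_t (H : Haupt N t g) {z : ℂ} (hz : z ∈ UH) :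
    deriv t z = 2 * Real.pi * I * (-(qc z)⁻¹ + qc z * deriv g (qc z)) := by
  have h1 : t =ᶠ[𝓝 z] fun w => (qc w)⁻¹ + g (qc w) := by
    filter_upwards [isOpen_UH.mem_nhds hz] with w hw
    exact H.expand w hw
  have hq : qc z ∈ Metric.ball (0 : ℂ) 1 := mem_ball_zero_iff.mpr (norm_qc_lt_one hz)
  have h2 := ((hasDerivAt_qc z).inv (qc_ne_zero z)).add
    ((H.g_diff.differentiableAt (Metric.isOpen_ball.mem_nhds hq)).hasDerivAt.comp z
    (hasDerivAt_qc z))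
  rw [h1.deriv_eq]
  refine h2.deriv.trans ?_
  have := qc_ne_zero z
  field_simp

lemma deriv_t_X2 (H : Haupt N t g) : X2 (deriv t) (-1) (-deriv g 0) := by
  refine ⟨-(2 * Real.pi * I), neg_ne_zero.mpr two_pi_I_ne, 0, ?_⟩
  have h1 := (tendsto_deriv_qc H.g_diff).sub_const (deriv g 0)
  rw [sub_self] at h1
  have h2 : (fun z => (2 * Real.pi * I) * (qc z ^ 2 * (deriv g (qc z) - deriv g 0))) =o[atI]
      (fun z => qc z ^ 2) := by
    have := ((isBigO_refl (fun z => qc z ^ 2) atI).mul_isLittleO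
      ((isLittleO_one_iff ℂ).mpr h1)).const_mul_left (2 * Real.pi * I)
    simpa only [mul_one] using this
  refine h2.congr' ?_ EventuallyEq.rfl
  filter_upwards [UH_mem_atI] with z hz
  rw [H.deriv_t hz, neg_neg, zpow_one]
  have := qc_ne_zero z
  field_simp
  ring

lemma deriv_te_asy (H : Haupt N t g) {e : ℕ} (he : e ∣ N) (he1 : e ≠ 1) :
    ∃ C, Asy (deriv (te N t e)) 1 C := by
  obtain ⟨h, hd, hq, h0⟩ := H.te_qexp he he1
  have hν := H.te_sub_asy he he1
  have h1 : deriv h 0 = nu N t e := by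
    have h2 := ((hd.differentiableAt (Metric.ball_mem_nhds 0 one_pos)).hasDerivAt.tendsto_slope).comp
      tendsto_qc
    refine tendsto_nhds_unique (h2.congr' ?_) hν.2
    filter_upwards [UH_mem_atI] with z hz
    rw [Function.comp, slope_def_field, h0, ← hq z hz, ex_neg, ex_one, sub_zero, div_eq_mul_inv]
  have h3 := tendsto_deriv_qc hd
  rw [h1] at h3
  have h4 := (Asy.ex_asy 1).mul (Asy.of_tendsto hν.1 h3)
  have h5 := (Asy.const two_pi_I_ne).mul h4
  rw [zero_add, add_zero] at h5
  refine ⟨_, h5.congr fun z hz => ?_⟩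
  rw [deriv_comp_qc hd hq hz, ex_one]

lemma deriv_t_ord (H : Haupt N t g) {α : ℂ} (hα : α ∈ UH) : OrdAt α (deriv t) (od t α - 1) := by
  obtain ⟨hm, φ, hφ, hφ0, hloc⟩ := H.od_local hα
  obtain ⟨m, hm'⟩ : ∃ m, od t α = m + 1 := ⟨od t α - 1, by omega⟩
  rw [hm'] at hloc ⊢
  rw [Nat.add_sub_cancel]
  have h1 : ∀ᶠ z in 𝓝 α, deriv t z = (z - α) ^ m * ((m + 1) * φ z + (z - α) * deriv φ z) := by
    filter_upwards [hloc.eventually_nhds, hφ.eventually_analyticAt] with z hz hφz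
    have h2 : t =ᶠ[𝓝 z] fun w => (w - α) ^ (m + 1) * φ w + t α := by
      filter_upwards [hz] with w hw
      rw [← hw]
      ring
    have h3 := (((((hasDerivAt_id z).sub_const α).pow (m + 1)).mul
      hφz.differentiableAt.hasDerivAt).add_const (t α)).deriv
    rw [h2.deriv_eq]
    refine h3.trans ?_
    simp
    ring
  refine ⟨(m + 1) * φ α + (α - α) * deriv φ α, ?_, ?_⟩
  · rw [sub_self, zero_mul, add_zero]
    exact mul_ne_zero (by exact_mod_cast m.succ_ne_zero) hφ0
  have hc : ContinuousAt (fun z => ((m : ℂ) + 1) * φ z + (z - α) * deriv φ z) α :=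
    (continuousAt_const.mul hφ.continuousAt).add
      ((continuousAt_id.sub continuousAt_const).mul hφ.deriv.continuousAt)
  refine (hc.tendsto.mono_left nhdsWithin_le_nhds).congr' ?_
  filter_upwards [nhdsWithin_le_nhds h1, self_mem_nhdsWithin] with z hz hne
  have : z - α ≠ 0 := sub_ne_zero.mpr hne
  rw [hz]
  field_simp

lemma deriv_te (H : Haupt N t g) {e : ℕ} (he : e ∣ N) {A : MZ} (hA : A ∈ AL N e) {z : ℂ}
    (hz : z ∈ UH) : deriv (te N t e) z = deriv t (act A z) * (e / den A z ^ 2) := by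
  have h1 : te N t e =ᶠ[𝓝 z] fun w => t (act A w) := by
    filter_upwards [isOpen_UH.mem_nhds hz] with w hw
    exact (H.te_eq he hA hw).symm
  rw [h1.deriv_eq, deriv_comp_act H.diff (AL.det_pos (H.dvd_pos he) hA) hz, hA.2.2.2]
  norm_cast

lemma deriv_te_one (H : Haupt N t g) {z : ℂ} (hz : z ∈ UH) : deriv (te N t 1) z = deriv t z := by
  refine Filter.EventuallyEq.deriv_eq ?_
  filter_upwards [isOpen_UH.mem_nhds hz] with w hw
  exact H.te_one hw

lemma deriv_t_diff (H : Haupt N t g) : DifferentiableOn ℂ (deriv t) UH := fun _ hz =>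
  ((H.diff.analyticAt (isOpen_UH.mem_nhds hz)).deriv).differentiableAt.differentiableWithinAt

end Haupt

lemma Delta_AL {N e : ℕ} (hN : Squarefree N) (he : e ∣ N) {A : MZ} (hA : A ∈ AL N e) {z : ℂ}
    (hz : z ∈ UH) : et (act A z) ^ 12 = den A z ^ 12 * et (e * z) ^ 12 := by
  obtain ⟨a, b, c, d, rfl, hdet⟩ := mem_AL_iff.mp hA
  have := et_AL hN he (one_dvd N) hdet hz
  rw [Nat.cast_one, one_mul, symDiv_one, Nat.gcd_one_right, Nat.cast_one, div_one] at this
  rw [this, mul_pow, mul_pow, ← zpow_natCast (z12 ^ _), ← _root_.zpow_mul, mul_comm (Xd _ _ _ _ _ _ _),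
    _root_.zpow_mul, zpow_natCast, z12_pow, _root_.one_zpow, one_mul]

lemma Delta_inv_diff : DifferentiableOn ℂ (fun z => (et z ^ 12)⁻¹) UH :=
  (et_diff.pow 12).inv fun _ hz => pow_ne_zero _ (et_ne_zero hz)

lemma Delta_inv_ord {α : ℂ} (hα : α ∈ UH) : OrdAt α (fun z => (et z ^ 12)⁻¹) 0 :=
  OrdAt.of_ne_zero (Delta_inv_diff.differentiableAt (isOpen_UH.mem_nhds hα)).continuousAt
    (inv_ne_zero (pow_ne_zero _ (et_ne_zero hα)))

/-- The cuspidal orders of `(t')⁶ / Δ`. -/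
def oF (e : ℕ) : ℤ := if e = 1 then -7 else 6 - e

theorem ell_residue {N : ℕ} {t g : ℂ → ℂ} (H : Haupt N t g) : ∃ R : Polynomial ℂ, R ≠ 0 ∧
    (∀ α ∈ UH, R.rootMultiplicity (t α) * od t α = 6 * (od t α - 1)) ∧
    (∀ ρ ∈ R.roots, ∃ α ∈ UH, t α = ρ) ∧
    (R.roots.card : ℤ) = -∑ e ∈ N.divisors, oF e ∧
    (R.roots.map (Aq g)).sum = 12 * deriv g 0 - 72 -
      ∑ e ∈ W' N, oF e * Aq g (xe N t e) := by
  have hsq := H.sqf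
  set F : ℂ → ℂ := fun z => deriv t z ^ 6 * (et z ^ 12)⁻¹ with hF
  have htr : ∀ e, e ∣ N → ∀ A ∈ AL N e, ∀ z ∈ UH,
      F (act A z) = ((e : ℂ) ^ 6)⁻¹ * (deriv (te N t e) z ^ 6 * (et (e * z) ^ 12)⁻¹) := by
    intro e he A hA z hz
    have h1 := H.deriv_te he hA hz
    have h2 := den_ne_zero (AL.det_pos (H.dvd_pos he) hA) hz
    have h3 : (e : ℂ) ≠ 0 := by exact_mod_cast (H.dvd_pos he).ne'
    have h4 : et (e * z) ≠ 0 := et_ne_zero (natmul_mem (H.dvd_pos he) hz)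
    simp only [hF]
    rw [Delta_AL hsq he hA hz, h1]
    field_simp
  obtain ⟨R, hR, hG, hroot, hcard, hsum⟩ := H.residue_sum (G := F)
    ((H.deriv_t_diff.pow 6).mul Delta_inv_diff)
    (by
      intro γ hγ z hz
      rw [htr 1 (one_dvd N) γ hγ z hz, H.deriv_te_one hz]
      simp [hF])
    oF
    (by
      intro e he
      obtain ⟨he, he1⟩ := H.mem_W'.mp he
      obtain ⟨C, hC⟩ := H.deriv_te_asy he he1
      have h3 : ((e : ℂ) ^ 6)⁻¹ ≠ 0 :=
        inv_ne_zero (pow_ne_zero _ (by exact_mod_cast (H.dvd_pos he).ne'))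
      have h1 := (Asy.const h3).mul ((hC.pow 6).mul ((et_natmul_asy (H.dvd_pos he)).pow 12).inv)
      have h2 : (0 : ℝ) + (((6 : ℕ) : ℝ) * 1 + -(((12 : ℕ) : ℝ) * ((e : ℝ) / 12))) = oF e := by
        rw [oF, if_neg he1]
        push_cast
        ring
      rw [h2] at h1
      refine ⟨_, h1.congr fun z hz => ?_⟩
      rw [te, htr e he _ (rep_mem hsq he) z hz])
    (β := 36 - 6 * deriv g 0)
    (by
      have h1 := (H.deriv_t_X2.pow 6).mul (Delta_X2 one_pos).inv
      have h2 : ((6 : ℕ) : ℤ) * -1 + -((1 : ℕ) : ℤ) = oF 1 := by simp [oF]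
      have h3 : ((6 : ℕ) : ℂ) * -deriv g 0 + -bD 1 = 36 - 6 * deriv g 0 := by
        rw [bD, if_pos rfl]
        push_cast
        ring
      rw [h2, h3] at h1
      exact h1.congr (Eventually.of_forall fun z => by simp [hF]))
  refine ⟨R, hR, fun α hα => ?_, hroot, hcard, ?_⟩
  · refine H.rootMultiplicity_eq hα hR hG ?_
    have h1 := (H.deriv_t_ord hα).pow 6
    have h3 : OrdAt α F (6 * (od t α - 1) + 0) := h1.mul (Delta_inv_ord hα)
    rwa [add_zero] at h3
  · rw [hsum]
    ring

/-- A preimage of `ρ` under `t` in the upper half plane, when there is one. -/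
def pt (t : ℂ → ℂ) (ρ : ℂ) : ℂ := by
  classical exact if h : ∃ α ∈ UH, t α = ρ then h.choose else I

/-- The weight with which the value `ρ` of the hauptmodul enters the trace of level `n`. -/
def wt (N : ℕ) (t : ℂ → ℂ) (n : ℕ) (ρ : ℂ) : ℂ :=
  (Apos N n (pt t ρ)).ncard / od t (pt t ρ)

/-- The values of `t` at the elliptic fixed points of the matrices of determinant `n`. -/
def SA (N : ℕ) (t : ℂ → ℂ) (n : ℕ) : Set ℂ := {ρ | ∃ α ∈ UH, t α = ρ ∧ (Apos N n α).Nonempty}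

namespace Haupt
variable {N : ℕ} {t g : ℂ → ℂ}

lemma pt_spec {ρ : ℂ} (h : ∃ α ∈ UH, t α = ρ) : pt t ρ ∈ UH ∧ t (pt t ρ) = ρ := by
  rw [pt, dif_pos h]
  exact h.choose_spec

lemma pt_equiv (H : Haupt N t g) {α : ℂ} (hα : α ∈ UH) :
    ∃ γ ∈ AL N 1, pt t (t α) = act γ α := by
  obtain ⟨h1, h2⟩ := pt_spec ⟨α, hα, rfl⟩
  exact (H.t_eq_iff hα h1).mp h2.symm

lemma wt_eq (H : Haupt N t g) {n : ℕ} (hn : 0 < n) {α : ℂ} (hα : α ∈ UH) :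
    wt N t n (t α) = (Apos N n α).ncard / od t α := by
  obtain ⟨γ, hγ, h⟩ := H.pt_equiv hα
  rw [wt, h, Apos_ncard_act hn (one_dvd N) one_pos hγ hα, H.od_act (one_dvd N) hγ hα]

lemma finite_Apos {n : ℕ} (hn : 0 < n) {α : ℂ} (hα : α ∈ UH) : (Apos N n α).Finite :=
  (finite_FixA hn hα).subset fun _ h => h.1

lemma mem_SA_iff (H : Haupt N t g) {n : ℕ} (hn : 0 < n) {α : ℂ} (hα : α ∈ UH) :
    t α ∈ SA N t n ↔ (Apos N n α).Nonempty := by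
  refine ⟨?_, fun h => ⟨α, hα, rfl, h⟩⟩
  rintro ⟨β, hβ, h, hne⟩
  obtain ⟨γ, hγ, rfl⟩ := (H.t_eq_iff hα hβ).mp h.symm
  have h1 := Apos_ncard_act hn (one_dvd N) one_pos hγ hα
  rw [← Set.ncard_pos (finite_Apos hn hβ), h1, Set.ncard_pos (finite_Apos hn hα)] at hne
  exact hne

lemma wt_eq_mult (H : Haupt N t g) {n : ℕ} (hn : 0 < n) {R : Polynomial ℂ} {α : ℂ} (hα : α ∈ UH)
    (hR : R.rootMultiplicity (t α) * od t α = 6 * (od t α - 1)) :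
    wt N t n (t α) = mult N t n α + sqI n / 6 * R.rootMultiplicity (t α) := by
  have h0 : (od t α : ℂ) ≠ 0 := by exact_mod_cast (H.od_pos hα).ne'
  have h1 : ((Apos N n α).ncard : ℂ) + sqI n = od t α * (mult N t n α + sqI n) := by
    exact_mod_cast H.card_Apos hn hα
  have h2 : (R.rootMultiplicity (t α) : ℂ) * od t α = 6 * (od t α - 1) := by
    have := congrArg (fun k : ℕ => (k : ℂ)) hR
    push_cast [Nat.cast_sub (H.od_pos hα : 1 ≤ od t α)] at this
    exact this
  rw [H.wt_eq hn hα, div_eq_iff h0]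
  linear_combination h1 - (sqI n : ℂ) / 6 * h2

lemma sum_roots {R : Polynomial ℂ} {S : Finset ℂ} (hS : R.roots.toFinset ⊆ S) (h : ℂ → ℂ) :
    (R.roots.map h).sum = ∑ ρ ∈ S, R.rootMultiplicity ρ * h ρ := by
  rw [Finset.sum_multiset_map_count]
  refine (Finset.sum_subset hS fun ρ _ hρ => ?_).trans (Finset.sum_congr rfl fun ρ _ => ?_)
  · rw [Multiset.mem_toFinset] at hρ
    rw [Multiset.count_eq_zero_of_notMem hρ, zero_smul]
  · rw [Polynomial.count_roots, nsmul_eq_mul]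

lemma sum_wt (H : Haupt N t g) {n : ℕ} (hn : 0 < n) {R R' : Polynomial ℂ}
    (hR : ∀ α ∈ UH, R.rootMultiplicity (t α) = mult N t n α)
    (hi : ∀ ρ ∈ R.roots, ∃ α ∈ UH, t α = ρ)
    (hR' : ∀ α ∈ UH, R'.rootMultiplicity (t α) * od t α = 6 * (od t α - 1))
    (hi' : ∀ ρ ∈ R'.roots, ∃ α ∈ UH, t α = ρ) :
    ∃ hf : (SA N t n).Finite, ∀ h : ℂ → ℂ, ∑ ρ ∈ hf.toFinset, wt N t n ρ * h ρ =
      (R.roots.map h).sum + sqI n / 6 * (R'.roots.map h).sum := by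
  classical
  set S := R.roots.toFinset ∪ R'.roots.toFinset with hS
  have hsub : SA N t n ⊆ S := by
    rintro ρ ⟨α, hα, rfl, hne⟩
    rw [← Set.ncard_pos (finite_Apos hn hα)] at hne
    rw [hS, Finset.mem_coe, Finset.mem_union, Multiset.mem_toFinset, Multiset.mem_toFinset,
      ← Multiset.count_pos, ← Multiset.count_pos, Polynomial.count_roots, Polynomial.count_roots]
    by_contra! hc
    have h1 := hR α hα
    have h2 := hR' α hα
    have h3 := H.card_Apos hn hα
    have h4 := H.od_pos hα
    rw [Nat.le_zero.mp hc.1] at h1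
    rw [Nat.le_zero.mp hc.2] at h2
    have h5 : od t α = 1 := by omega
    rw [← h1, h5] at h3
    omega
  have him : ∀ ρ ∈ S, ∃ α ∈ UH, t α = ρ := by
    intro ρ hρ
    rw [hS, Finset.mem_union, Multiset.mem_toFinset, Multiset.mem_toFinset] at hρ
    exact hρ.elim (hi ρ) (hi' ρ)
  refine ⟨S.finite_toSet.subset hsub, fun h => ?_⟩
  rw [sum_roots (S := S) Finset.subset_union_left, sum_roots (S := S) Finset.subset_union_right,
    Finset.mul_sum, ← Finset.sum_add_distrib]
  refine (Finset.sum_subset (fun ρ hρ => hsub (by simpa using hρ)) fun ρ hρ hρ' => ?_).trans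
    (Finset.sum_congr rfl fun ρ hρ => ?_)
  · obtain ⟨α, hα, rfl⟩ := him ρ hρ
    rw [Set.Finite.mem_toFinset, H.mem_SA_iff hn hα, Set.not_nonempty_iff_eq_empty] at hρ'
    rw [H.wt_eq hn hα, hρ']
    simp
  · obtain ⟨α, hα, rfl⟩ := him ρ hρ
    rw [H.wt_eq_mult hn hα (hR' α hα), hR α hα]
    ring

lemma sum_te (H : Haupt N t g) {n : ℕ} (hn : 0 < n) (hf : (SA N t n).Finite) {e : ℕ} (he : e ∣ N)
    (h : ℂ → ℂ) : ∑ ρ ∈ hf.toFinset, wt N t n ρ * h (te N t e (pt t ρ)) =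
      ∑ ρ ∈ hf.toFinset, wt N t n ρ * h ρ := by
  have hrep := rep_mem H.sqf he
  have e0 := H.dvd_pos he
  have key : ∀ ρ ∈ SA N t n, te N t e (pt t ρ) ∈ SA N t n ∧
      te N t e (pt t (te N t e (pt t ρ))) = ρ ∧ wt N t n (te N t e (pt t ρ)) = wt N t n ρ := by
    rintro ρ ⟨α, hα, rfl, hne⟩
    obtain ⟨h1, h2⟩ := pt_spec ⟨α, hα, rfl⟩
    set β := pt t (t α) with hβ
    have hβ' := act_mem (AL.det_pos e0 hrep) h1
    have h4 := Apos_ncard_act hn he e0 hrep h1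
    obtain ⟨γ, hγ, h3⟩ := H.pt_equiv hβ'
    have h5 : te N t e β = t (act (rep N e) β) := rfl
    have hne' : (Apos N n β).Nonempty := by
      rw [← H.mem_SA_iff hn h1, h2, H.mem_SA_iff hn hα]
      exact hne
    refine ⟨?_, ?_, ?_⟩
    · rw [h5, H.mem_SA_iff hn hβ', ← Set.ncard_pos (finite_Apos hn hβ'), h4,
        Set.ncard_pos (finite_Apos hn h1)]
      exact hne'
    · rw [h5, h3, H.te_act he (one_dvd N) hγ hβ', symDiv_one, H.te_act he he hrep h1, symDiv_self e0,
        H.te_one h1, h2]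
    · rw [h5, H.wt_eq hn hβ', h4, H.od_act he hrep h1, ← H.wt_eq hn h1, h2]
  refine Finset.sum_nbij' (fun ρ => te N t e (pt t ρ)) (fun ρ => te N t e (pt t ρ)) ?_ ?_ ?_ ?_ ?_
  · intro ρ hρ
    rw [Set.Finite.mem_toFinset] at hρ ⊢
    exact (key ρ hρ).1
  · intro ρ hρ
    rw [Set.Finite.mem_toFinset] at hρ ⊢
    exact (key ρ hρ).1
  · intro ρ hρ
    exact (key ρ (by simpa using hρ)).2.1
  · intro ρ hρ
    exact (key ρ (by simpa using hρ)).2.1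
  · intro ρ hρ
    rw [(key ρ (by simpa using hρ)).2.2]

end Haupt

lemma sum_W' {M : Type*} [AddCommGroup M] {N : ℕ} (hN : 0 < N) (F : ℕ → M) :
    ∑ e ∈ W' N, F e = ∑ e ∈ N.divisors, F e - F 1 := by
  rw [eq_sub_iff_add_eq, W', Finset.sum_erase_add _ _ (Nat.one_mem_divisors.mpr hN.ne')]

/-- The mean value of the constants `Ac N e`. -/
def Am (N : ℕ) : ℂ := (∑ e ∈ N.divisors, Ac N e) / N.divisors.card

theorem weighted_sum {N : ℕ} (hN : N ∈ Lv) {n : ℕ} (hn : 0 < n) :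
    ∃ hf : (SA N (tN N) n).Finite, ∑ ρ ∈ hf.toFinset, wt N (tN N) n ρ * fS N (pt (tN N) ρ) =
      N.divisors.card * (2 * ∑ e ∈ N.divisors, sg n e * (Ac N e - Am N) + gapS n +
        2 * (n * cf (gN N) n)) + sqI n * (∑ δ ∈ N.divisors, bD δ) / 3 := by
  have H := haupt hN
  have hN0 := Lv_pos N hN
  obtain ⟨R, -, hR, hi, hcard, hsum⟩ := H.Psi_residue hn
  obtain ⟨R', -, hR', hi', hcard', hsum'⟩ := ell_residue H
  obtain ⟨hf, hw⟩ := H.sum_wt hn hR hi hR' hi'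
  refine ⟨hf, ?_⟩
  have hA1 : Ac N 1 = 0 := by rw [Ac, if_pos rfl]
  have hAW : ∀ e ∈ W' N, Aq (gN N) (xe N (tN N) e) = Ac N e := fun e he => by
    rw [Ac, if_neg (H.mem_W'.mp he).2]
  have hσ : sg n 1 = ∑ x ∈ n.divisorsAntidiagonal, x.2 := by simp [sg]
  have hms : (maxS n : ℂ) + minS n = 2 * sg n 1 := by
    rw [hσ]
    exact_mod_cast maxS_add_minS n
  have hsplit : ∑ ρ ∈ hf.toFinset, wt N (tN N) n ρ * fS N (pt (tN N) ρ) =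
      N.divisors.card * (∑ ρ ∈ hf.toFinset, wt N (tN N) n ρ * Aq (gN N) ρ) -
        (∑ e ∈ N.divisors, Ac N e) * ∑ ρ ∈ hf.toFinset, wt N (tN N) n ρ * 1 := by
    have h1 : ∀ e ∈ N.divisors, ∑ ρ ∈ hf.toFinset, wt N (tN N) n ρ *
        Aq (gN N) (te N (tN N) e (pt (tN N) ρ)) =
          ∑ ρ ∈ hf.toFinset, wt N (tN N) n ρ * Aq (gN N) ρ := fun e he =>
      H.sum_te hn hf (Nat.dvd_of_mem_divisors he) _
    rw [← nsmul_eq_mul, ← Finset.sum_const, ← Finset.sum_congr rfl h1, Finset.sum_comm,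
      Finset.mul_sum, ← Finset.sum_sub_distrib]
    refine Finset.sum_congr rfl fun ρ _ => ?_
    rw [fS, mul_sub, Finset.mul_sum]
    ring
  have hX : (R.roots.map (Aq (gN N))).sum = 2 * ∑ e ∈ N.divisors, (sg n e : ℂ) * Ac N e + gapS n +
      2 * (n * cf (gN N) n) - 2 * (sqI n * deriv (gN N) 0) -
        (minS n - sqI n) * ∑ e ∈ N.divisors, Ac N e := by
    have h1 : ∑ e ∈ W' N, (sg n e : ℂ) * Aq (gN N) (xe N (tN N) e) =
        ∑ e ∈ N.divisors, (sg n e : ℂ) * Ac N e := by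
      rw [Finset.sum_congr rfl fun e he => by rw [hAW e he], sum_W' hN0, hA1, mul_zero, sub_zero]
    have h2 : ∑ e ∈ W' N, (oPsi N n e : ℂ) * Aq (gN N) (xe N (tN N) e) =
        ∑ e ∈ N.divisors, ((minS n : ℂ) - sqI n - sg n e) * Ac N e := by
      rw [← sub_zero (∑ e ∈ N.divisors, ((minS n : ℂ) - sqI n - sg n e) * Ac N e),
        ← mul_zero ((minS n : ℂ) - sqI n - sg n 1), ← hA1, ← sum_W' hN0]
      refine Finset.sum_congr rfl fun e he => ?_
      rw [hAW e he, oPsi, if_neg (H.mem_W'.mp he).2]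
      push_cast
      rfl
    rw [hsum, h1, h2, Finset.mul_sum (N.divisors) _ ((minS n : ℂ) - sqI n)]
    simp only [sub_mul, Finset.sum_sub_distrib]
    ring
  have hX' : (R'.roots.map (Aq (gN N))).sum = 12 * deriv (gN N) 0 - 72 -
      6 * ∑ e ∈ N.divisors, Ac N e + ∑ e ∈ N.divisors, e * Ac N e := by
    have h2 : ∑ e ∈ W' N, (oF e : ℂ) * Aq (gN N) (xe N (tN N) e) =
        ∑ e ∈ N.divisors, ((6 : ℂ) - e) * Ac N e := by
      rw [← sub_zero (∑ e ∈ N.divisors, ((6 : ℂ) - e) * Ac N e),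
        ← mul_zero ((6 : ℂ) - (1 : ℕ)), ← hA1, ← sum_W' hN0]
      refine Finset.sum_congr rfl fun e he => ?_
      rw [hAW e he, oF, if_neg (H.mem_W'.mp he).2]
      push_cast
      rfl
    rw [hsum', h2, Finset.mul_sum]
    simp only [sub_mul, Finset.sum_sub_distrib]
    ring
  have hC : (R.roots.map fun _ => (1 : ℂ)).sum = 2 * ∑ e ∈ N.divisors, (sg n e : ℂ) -
      N.divisors.card * minS n + (N.divisors.card - 2) * sqI n := by
    have h1 : ∑ e ∈ N.divisors, oPsi N n e = oPsi N n 1 + ∑ e ∈ W' N, oPsi N n e := by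
      rw [sum_W' hN0]
      ring
    have h2 : ∑ e ∈ W' N, oPsi N n e = ∑ e ∈ W' N, ((minS n : ℤ) - sqI n - sg n e) :=
      Finset.sum_congr rfl fun e he => by rw [oPsi, if_neg (H.mem_W'.mp he).2]
    have h3 : (R.roots.card : ℂ) = ((R.roots.card : ℤ) : ℂ) := by simp
    rw [Multiset.map_const', Multiset.sum_replicate, nsmul_eq_mul, mul_one, h3, hcard, h1, h2, oPsi,
      if_pos rfl, sum_W' hN0, sum_W' hN0]
    push_cast
    simp only [Finset.sum_sub_distrib, Finset.sum_const, nsmul_eq_mul]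
    linear_combination hms
  have hC' : (R'.roots.map fun _ => (1 : ℂ)).sum = 12 - 6 * N.divisors.card +
      ∑ e ∈ N.divisors, (e : ℂ) := by
    have h1 : ∑ e ∈ N.divisors, oF e = oF 1 + ∑ e ∈ W' N, oF e := by
      rw [sum_W' hN0]
      ring
    have h2 : ∑ e ∈ W' N, oF e = ∑ e ∈ W' N, ((6 : ℤ) - e) :=
      Finset.sum_congr rfl fun e he => by rw [oF, if_neg (H.mem_W'.mp he).2]
    have h3 : (R'.roots.card : ℂ) = ((R'.roots.card : ℤ) : ℂ) := by simp
    rw [Multiset.map_const', Multiset.sum_replicate, nsmul_eq_mul, mul_one, h3, hcard', h1, h2, oF,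
      if_pos rfl, sum_W' hN0]
    push_cast
    simp only [Finset.sum_sub_distrib, Finset.sum_const, nsmul_eq_mul]
    ring
  have hcard0 : (N.divisors.card : ℂ) ≠ 0 := by
    exact_mod_cast (Finset.card_pos.mpr ⟨1, Nat.one_mem_divisors.mpr hN0.ne'⟩).ne'
  have hAm : (N.divisors.card : ℂ) * Am N = ∑ e ∈ N.divisors, Ac N e := by
    rw [Am]
    field_simp
  have hu := unit_relation hN
  rw [hsplit, hw, hw, hX, hX', hC, hC']
  simp only [mul_sub, Finset.sum_sub_distrib, ← Finset.sum_mul]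
  linear_combination (2 * ∑ e ∈ N.divisors, (sg n e : ℂ)) * hAm + (sqI n : ℂ) / 6 * hu

/-- The normalization of an integral matrix of determinant `e`. -/
def nrm (e : ℕ) (A : MZ) : Matrix (Fin 2) (Fin 2) ℝ := (Real.sqrt e)⁻¹ • A.map (Int.castRingHom ℝ)

lemma sq_sqrt_inv {e : ℕ} (he : 0 < e) : (Real.sqrt e)⁻¹ * (Real.sqrt e)⁻¹ * e = 1 := by
  have h : (0 : ℝ) < e := by exact_mod_cast he
  have h2 := Real.mul_self_sqrt h.le
  have h3 : Real.sqrt e ≠ 0 := (Real.sqrt_pos.mpr h).ne'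
  field_simp
  nlinarith

lemma nrm_det {e : ℕ} (he : 0 < e) {A : MZ} (hA : A.det = e) : (nrm e A).det = 1 := by
  rw [nrm, Matrix.det_smul, ← RingHom.mapMatrix_apply, ← RingHom.map_det, hA, Fintype.card_fin, sq]
  simpa using sq_sqrt_inv he

lemma nrm_mul (e f : ℕ) (A B : MZ) :
    nrm e A * nrm f B = ((Real.sqrt e)⁻¹ * (Real.sqrt f)⁻¹) • (A * B).map (Int.castRingHom ℝ) := by
  rw [nrm, nrm, Matrix.smul_mul, Matrix.mul_smul, smul_smul, ← Matrix.map_mul]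

lemma sqrt_symDiv {e f : ℕ} (he : 0 < e) (hf : 0 < f) :
    (Real.sqrt e)⁻¹ * (Real.sqrt f)⁻¹ * (Nat.gcd e f : ℝ) = (Real.sqrt (symDiv e f : ℕ))⁻¹ := by
  have hg : 0 < Nat.gcd e f := Nat.gcd_pos_of_pos_left _ he
  have hg' : (0 : ℝ) < Nat.gcd e f := by exact_mod_cast hg
  have h1 : symDiv e f * (Nat.gcd e f) ^ 2 = e * f := by
    calc symDiv e f * (Nat.gcd e f) ^ 2
        = (e / Nat.gcd e f * Nat.gcd e f) * (f / Nat.gcd e f * Nat.gcd e f) := by rw [symDiv]; ring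
      _ = e * f := by
        rw [Nat.div_mul_cancel (Nat.gcd_dvd_left e f), Nat.div_mul_cancel (Nat.gcd_dvd_right e f)]
  have h2 : (symDiv e f : ℝ) * (Nat.gcd e f : ℝ) ^ 2 = e * f := by exact_mod_cast h1
  have h3 : Real.sqrt (symDiv e f : ℕ) * Nat.gcd e f = Real.sqrt e * Real.sqrt f := by
    rw [← Real.sqrt_mul (Nat.cast_nonneg e), ← h2, Real.sqrt_mul (Nat.cast_nonneg _),
      Real.sqrt_sq hg'.le]
  have he' : Real.sqrt e ≠ 0 := (Real.sqrt_pos.mpr (by exact_mod_cast he)).ne'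
  have hf' : Real.sqrt f ≠ 0 := (Real.sqrt_pos.mpr (by exact_mod_cast hf)).ne'
  have hs' : Real.sqrt (symDiv e f : ℕ) ≠ 0 := by
    intro h
    rw [h, zero_mul] at h3
    exact mul_ne_zero he' hf' h3.symm
  field_simp
  linarith

/-- The Fricke group consists of the normalized Atkin–Lehner matrices. -/
theorem mem_FrickeGroup {N : ℕ} (hN : Squarefree N) {g : SL2R} :
    g ∈ FrickeGroup N ↔ ∃ e, e ∣ N ∧ ∃ A ∈ AL N e, g.1 = nrm e A := by
  have hN0 : 0 < N := Nat.pos_of_ne_zero hN.ne_zero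
  constructor
  · intro hg
    induction hg using Subgroup.closure_induction with
    | mem g hg =>
      rcases hg with hg | hg
      · obtain ⟨γ, hγ, rfl⟩ := hg
        refine ⟨1, one_dvd N, γ.1, AL_one_iff.mpr ⟨?_, by simp⟩, ?_⟩
        · have := CongruenceSubgroup.Gamma0_mem.mp hγ
          exact (ZMod.intCast_zmod_eq_zero_iff_dvd _ _).mp this
        · ext i j
          simp [nrm]
      · simp only [Set.mem_iUnion] at hg
        obtain ⟨e, ⟨he, -⟩, x, y, z, w, h⟩ := hg
        have e0 : 0 < e := Nat.pos_of_dvd_of_pos he hN0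
        refine ⟨e, he, !![e * x, y; N * z, e * w], ?_, ?_⟩
        · refine mem_AL_iff.mpr ⟨x, y, z, w, rfl, ?_⟩
          have h1 := g.2
          rw [h, Matrix.det_smul, Matrix.det_fin_two_of, Fintype.card_fin, sq] at h1
          have h2 := sq_sqrt_inv e0
          have h3 : (Real.sqrt e)⁻¹ * (Real.sqrt e)⁻¹ ≠ 0 := left_ne_zero_of_mul (by rw [h2]; simp)
          have h4 : (e : ℝ) * x * (e * w) - y * (N * z) = e := by
            refine mul_left_cancel₀ h3 ?_
            rw [h2, ← h1]
            ring
          exact_mod_cast h4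
        · rw [h, nrm]
          congr 1
          ext i j
          fin_cases i <;> fin_cases j <;> simp [mul_comm]
    | one =>
      exact ⟨1, one_dvd N, 1, one_mem_AL N, by ext i j; simp [nrm]⟩
    | mul x y _ _ hx hy =>
      obtain ⟨e, he, A, hA, h1⟩ := hx
      obtain ⟨f, hf, B, hB, h2⟩ := hy
      obtain ⟨C, hC, h⟩ := AL_mul hN he hf hA hB
      refine ⟨symDiv e f, symDiv_dvd hN he hf, C, hC, ?_⟩
      rw [Matrix.SpecialLinearGroup.coe_mul, h1, h2, nrm_mul, h, nrm,
        ← sqrt_symDiv (Nat.pos_of_dvd_of_pos he hN0) (Nat.pos_of_dvd_of_pos hf hN0), ← smul_smul]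
      ext i j
      simp only [Matrix.smul_apply, Matrix.map_apply, smul_eq_mul, map_mul, eq_intCast,
        Int.cast_natCast]
      ring
    | inv x _ hx =>
      obtain ⟨e, he, A, hA, h1⟩ := hx
      refine ⟨e, he, A.adjugate, adjugate_mem_AL hA, ?_⟩
      rw [Matrix.SpecialLinearGroup.coe_inv, h1, nrm, nrm, Matrix.adjugate_fin_two,
        Matrix.adjugate_fin_two]
      ext i j
      fin_cases i <;> fin_cases j <;> simp
  · rintro ⟨e, he, A, hA, h⟩
    refine Subgroup.subset_closure (Or.inr ?_)
    simp only [Set.mem_iUnion]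
    obtain ⟨a, b, c, d, rfl, -⟩ := mem_AL_iff.mp hA
    refine ⟨e, ⟨he, ?_⟩, a, b, c, d, ?_⟩
    · obtain ⟨m, rfl⟩ := he
      rw [Nat.mul_div_cancel_left m (Nat.pos_of_mul_pos_right hN0)]
      exact (Nat.squarefree_mul_iff.mp hN).1
    · rw [h, nrm]
      congr 1
      ext i j
      fin_cases i <;> fin_cases j <;> simp [mul_comm]

/-- `α` is the root in the upper half plane of the positive definite form `M`. -/
structure IsPt (M : Matrix (Fin 2) (Fin 2) ℝ) (α : ℂ) : Prop where
  pos : 0 < M 0 0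
  symm : M 1 0 = M 0 1
  mem : α ∈ UH
  re : M 0 1 = -(M 0 0 * α.re)
  sq : M 1 1 = M 0 0 * (α.re ^ 2 + α.im ^ 2)

namespace IsPt
variable {M M' : Matrix (Fin 2) (Fin 2) ℝ} {α : ℂ}

lemma of_root (h1 : 0 < M 0 0) (h2 : M 1 0 = M 0 1) (h3 : α ∈ UH)
    (h : (M 0 0 : ℂ) * α ^ 2 + 2 * M 0 1 * α + M 1 1 = 0) : IsPt M α := by
  have h4 := congrArg Complex.im h
  have h5 := congrArg Complex.re h
  simp [pow_two] at h4 h5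
  have him : 0 < α.im := h3
  have h6 : M 0 1 = -(M 0 0 * α.re) := by
    have : (M 0 1 + M 0 0 * α.re) * (2 * α.im) = 0 := by linarith
    rcases mul_eq_zero.mp this with h | h <;> linarith
  refine ⟨h1, h2, h3, h6, ?_⟩
  rw [h6] at h5
  linarith

lemma root (h : IsPt M α) : (M 0 0 : ℂ) * α ^ 2 + 2 * M 0 1 * α + M 1 1 = 0 := by
  apply Complex.ext
  · simp [pow_two, h.re, h.sq]
    ring
  · simp [pow_two, h.re, h.sq]
    ring

lemma det (h : IsPt M α) : M.det = (M 0 0 * α.im) ^ 2 := by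
  rw [Matrix.det_fin_two, h.symm, h.re, h.sq]
  ring

lemma cmPoint (h : IsPt M α) : cmPointC M = α := by
  have h1 : 0 < α.im := h.mem
  have h2 : (M 0 0 : ℂ) ≠ 0 := by exact_mod_cast h.pos.ne'
  rw [cmPointC, h.det, Real.sqrt_sq (mul_pos h.pos h1).le, h.re, div_eq_iff h2]
  nth_rw 3 [← Complex.re_add_im α]
  push_cast
  ring

lemma of_det_pos (h1 : 0 < M 0 0) (h2 : M 1 0 = M 0 1) (h3 : 0 < M.det) : IsPt M (cmPointC M) := by
  have h4 : Real.sqrt M.det ^ 2 = M 0 0 * M 1 1 - M 0 1 * M 0 1 := by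
    rw [Real.sq_sqrt h3.le, Matrix.det_fin_two, h2]
  have h5 := Real.sqrt_pos.mpr h3
  have hre : (cmPointC M).re = -(M 0 1) / M 0 0 := by
    rw [cmPointC, Complex.div_ofReal_re]
    simp
  have him : (cmPointC M).im = Real.sqrt M.det / M 0 0 := by
    rw [cmPointC, Complex.div_ofReal_im]
    simp
  refine ⟨h1, h2, ?_, ?_, ?_⟩
  · change 0 < (cmPointC M).im
    rw [him]
    exact div_pos h5 h1
  · rw [hre]
    field_simp
  · rw [hre, him]
    rw [div_pow, div_pow, h4]
    field_simp
    ring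

lemma eq_of_det (h : IsPt M α) (h' : IsPt M' α) (hd : M.det = M'.det) : M = M' := by
  have h1 : 0 < α.im := h.mem
  rw [h.det, h'.det] at hd
  have h2 : M 0 0 * α.im = M' 0 0 * α.im :=
    (pow_left_inj₀ (mul_pos h.pos h1).le (mul_pos h'.pos h1).le two_ne_zero).mp hd
  have h3 := mul_right_cancel₀ h1.ne' h2
  ext i j
  fin_cases i <;> fin_cases j
  · exact h3
  · simp [h.re, h'.re, h3]
  · simp [h.symm, h'.symm, h.re, h'.re, h3]
  · simp [h.sq, h'.sq, h3]

lemma conj {e : ℕ} (he : 0 < e) {A : MZ} (hA : A.det = e) (hα : α ∈ UH) (h : IsPt M (act A α)) :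
    IsPt ((nrm e A)ᵀ * M * nrm e A) α ∧ ((nrm e A)ᵀ * M * nrm e A).det = M.det := by
  have hd : 0 < A.det := by rw [hA]; exact_mod_cast he
  have hr := sq_sqrt_inv he
  set r := (Real.sqrt e)⁻¹ with hr'
  have hr0 : r * r ≠ 0 := left_ne_zero_of_mul (by rw [hr]; simp)
  have hr1 : 0 < r * r := lt_of_le_of_ne (mul_self_nonneg r) hr0.symm
  have hden := den_ne_zero hd hα
  have hact : act A α * den A α = A 0 0 * α + A 0 1 := by
    rw [act, div_mul_cancel₀ _ hden]
  have e00 : ((nrm e A)ᵀ * M * nrm e A) 0 0 =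
      r * r * (M 0 0 * A 0 0 ^ 2 + 2 * M 0 1 * A 0 0 * A 1 0 + M 1 1 * A 1 0 ^ 2) := by
    simp [nrm, Matrix.mul_apply, Fin.sum_univ_two, h.symm, ← hr']
    ring
  have e01 : ((nrm e A)ᵀ * M * nrm e A) 0 1 =
      r * r * (M 0 0 * A 0 0 * A 0 1 + M 0 1 * (A 0 0 * A 1 1 + A 0 1 * A 1 0) +
        M 1 1 * A 1 0 * A 1 1) := by
    simp [nrm, Matrix.mul_apply, Fin.sum_univ_two, h.symm, ← hr']
    ring
  have e10 : ((nrm e A)ᵀ * M * nrm e A) 1 0 = ((nrm e A)ᵀ * M * nrm e A) 0 1 := by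
    rw [e01]
    simp [nrm, Matrix.mul_apply, Fin.sum_univ_two, h.symm, ← hr']
    ring
  have e11 : ((nrm e A)ᵀ * M * nrm e A) 1 1 =
      r * r * (M 0 0 * A 0 1 ^ 2 + 2 * M 0 1 * A 0 1 * A 1 1 + M 1 1 * A 1 1 ^ 2) := by
    simp [nrm, Matrix.mul_apply, Fin.sum_univ_two, h.symm, ← hr']
    ring
  refine ⟨of_root ?_ e10 hα ?_, ?_⟩
  · have h1 : (M 0 0 * A 0 0 ^ 2 + 2 * M 0 1 * A 0 0 * A 1 0 + M 1 1 * A 1 0 ^ 2 : ℝ) =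
        M 0 0 * ((A 0 0 - A 1 0 * (act A α).re) ^ 2 + (A 1 0 * (act A α).im) ^ 2) := by
      rw [h.re, h.sq]
      ring
    rw [e00, h1]
    refine mul_pos hr1 (mul_pos h.pos ?_)
    have him : (act A α).im ≠ 0 := (show 0 < (act A α).im from h.mem).ne'
    by_cases hc : A 1 0 = 0
    · have ha : A 0 0 ≠ 0 := by
        intro ha
        rw [Matrix.det_fin_two, ha, hc] at hd
        simp at hd
      have ha' : (A 0 0 : ℝ) ≠ 0 := by exact_mod_cast ha
      rw [hc]
      simp only [Int.cast_zero, zero_mul, sub_zero]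
      positivity
    · have hc' : (A 1 0 : ℝ) ≠ 0 := by exact_mod_cast hc
      positivity
  · rw [e00, e01, e11]
    have h1 := h.root
    have h2 : ((r * r : ℝ) : ℂ) * (M 0 0 * (act A α * den A α) ^ 2 +
        2 * M 0 1 * (act A α * den A α) * den A α + M 1 1 * den A α ^ 2) = 0 := by
      linear_combination ((r * r : ℝ) : ℂ) * den A α ^ 2 * h1
    rw [hact, den] at h2
    rw [← h2]
    push_cast
    ring
  · rw [Matrix.det_mul, Matrix.det_mul, Matrix.det_transpose, nrm_det he hA]
    ring

end IsPt

lemma isPt_of_mem_QdN {N : ℕ} {d : ℤ} (hd : 0 < d) {M : Matrix (Fin 2) (Fin 2) ℝ}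
    (hM : M ∈ QdN d N) : IsPt M (cmPointC M) ∧ M.det = d / 4 := by
  obtain ⟨a, b, c, rfl, ha, hdisc, -⟩ := hM
  have hdet : (formMat a b c).det = (d : ℝ) / 4 := by
    have h : (b : ℝ) ^ 2 - 4 * a * c = -d := by exact_mod_cast hdisc
    rw [formMat, Matrix.det_fin_two_of]
    linarith
  refine ⟨IsPt.of_det_pos ?_ rfl ?_, hdet⟩
  · simpa [formMat] using ha
  · rw [hdet]
    have : (0 : ℝ) < d := by exact_mod_cast hd
    positivity

lemma IsPt.conj_adjugate {M : Matrix (Fin 2) (Fin 2) ℝ} {α : ℂ} (h : IsPt M α) {N e : ℕ}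
    (he : 0 < e) {A : MZ} (hA : A ∈ AL N e) :
    IsPt ((nrm e A)ᵀ * M * nrm e A) (act A.adjugate α) ∧
      ((nrm e A)ᵀ * M * nrm e A).det = M.det := by
  have hd := AL.det_pos he hA
  have h1 : act A.adjugate α ∈ UH := act_mem (AL.det_pos he (adjugate_mem_AL hA)) h.mem
  exact IsPt.conj he hA.2.2.2 h1 (by rwa [act_adjugate hd h.mem])

lemma QdN_conj {N e : ℕ} (he : e ∣ N) (he0 : 0 < e) {d : ℤ} (hd : 0 < d)
    {M : Matrix (Fin 2) (Fin 2) ℝ} (hM : M ∈ QdN d N) {A : MZ} (hA : A ∈ AL N e) :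
    (nrm e A)ᵀ * M * nrm e A ∈ QdN d N := by
  obtain ⟨h1, h2⟩ := isPt_of_mem_QdN hd hM
  obtain ⟨h3, h4⟩ := h1.conj_adjugate he0 hA
  obtain ⟨a, b, c, rfl, ha, hdisc, m, rfl⟩ := hM
  obtain ⟨x, y, z, w, rfl, hdet⟩ := mem_AL_iff.mp hA
  obtain ⟨f, rfl⟩ := he
  have hr := sq_sqrt_inv he0
  have hr0 : (Real.sqrt e)⁻¹ * (Real.sqrt e)⁻¹ ≠ 0 := left_ne_zero_of_mul (by rw [hr]; simp)
  set r := (Real.sqrt e)⁻¹ with hr'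
  have hdet' : (e : ℤ) * x * w - y * (f * z) = 1 := by
    have : (e : ℤ) ≠ 0 := by exact_mod_cast he0.ne'
    refine mul_left_cancel₀ this ?_
    push_cast at hdet
    linear_combination hdet
  have key : (nrm e !![(e : ℤ) * x, y; ((e * f : ℕ) : ℤ) * z, e * w])ᵀ *
      formMat (((e * f : ℕ) : ℤ) * m) b c * nrm e !![(e : ℤ) * x, y; ((e * f : ℕ) : ℤ) * z, e * w] =
      formMat (((e * f : ℕ) : ℤ) * (m * e * x ^ 2 + b * x * z + c * f * z ^ 2))
        (2 * (e * f * m * x * y) + b * (e * x * w + y * f * z) + 2 * (c * e * f * z * w))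
        (f * m * y ^ 2 + b * y * w + c * e * w ^ 2) := by
    ext i j
    fin_cases i <;> fin_cases j
    · simp [nrm, formMat, Matrix.mul_apply, Fin.sum_univ_two, ← hr']
      linear_combination ((e : ℝ) * f * (m * e * x ^ 2 + b * x * z + c * f * z ^ 2)) * hr
    · simp [nrm, formMat, Matrix.mul_apply, Fin.sum_univ_two, ← hr']
      linear_combination ((2 * (e * f * m * x * y) + b * (e * x * w + y * f * z) +
        2 * (c * e * f * z * w)) / 2 : ℝ) * hr
    · simp [nrm, formMat, Matrix.mul_apply, Fin.sum_univ_two, ← hr']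
      linear_combination ((2 * (e * f * m * x * y) + b * (e * x * w + y * f * z) +
        2 * (c * e * f * z * w)) / 2 : ℝ) * hr
    · simp [nrm, formMat, Matrix.mul_apply, Fin.sum_univ_two, ← hr']
      linear_combination (f * m * y ^ 2 + b * y * w + c * e * w ^ 2 : ℝ) * hr
  refine ⟨_, _, _, key, ?_, ?_, dvd_mul_right _ _⟩
  · have h5 := h3.pos
    rw [key] at h5
    simp only [formMat, Matrix.of_apply, Matrix.cons_val_zero] at h5
    exact_mod_cast h5
  · rw [← hdisc]
    push_cast
    linear_combination ((e * x * w - y * (f * z) + 1) * (b ^ 2 - 4 * (e * f * m) * c) : ℤ) * hdet'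

/-- The values of `t` at the roots of the forms of discriminant `-d`. -/
def VD (N : ℕ) (t : ℂ → ℂ) (d : ℤ) : Set ℂ := {ρ | ∃ M ∈ QdN d N, t (cmPointC M) = ρ}

/-- The indices of the Atkin–Lehner operators fixing the class of `α`. -/
def KS (N : ℕ) (t : ℂ → ℂ) (α : ℂ) : Finset ℕ := by
  classical exact N.divisors.filter fun e => te N t e α = t α

/-- The values of `t` on the orbit of `α` under the Atkin–Lehner operators. -/
def orb (N : ℕ) (t : ℂ → ℂ) (α : ℂ) : Finset ℂ := by
  classical exact N.divisors.image fun e => te N t e α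

lemma mem_KS {N : ℕ} {t : ℂ → ℂ} {α : ℂ} {e : ℕ} :
    e ∈ KS N t α ↔ e ∈ N.divisors ∧ te N t e α = t α := by simp [KS]

lemma mem_orb {N : ℕ} {t : ℂ → ℂ} {α ρ : ℂ} :
    ρ ∈ orb N t α ↔ ∃ e ∈ N.divisors, te N t e α = ρ := by simp [orb]

lemma Lv_sq : ∀ N ∈ Lv, ∀ e ∈ N.divisors, ∀ f ∈ N.divisors, IsSquare (e * f) → e = f := by
  decide +kernel

lemma nrm_inj {N : ℕ} (hN : N ∈ Lv) {e f : ℕ} (he : e ∣ N) (hf : f ∣ N) {A B : MZ}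
    (hB : B ∈ AL N f) (h : nrm e A = nrm f B) : e = f ∧ A = B := by
  have hN0 := Lv_pos N hN
  have he0 : 0 < e := Nat.pos_of_dvd_of_pos he hN0
  have hf0 : 0 < f := Nat.pos_of_dvd_of_pos hf hN0
  have h1 : Real.sqrt e ≠ 0 := (Real.sqrt_pos.mpr (by exact_mod_cast he0)).ne'
  have h2 : Real.sqrt f ≠ 0 := (Real.sqrt_pos.mpr (by exact_mod_cast hf0)).ne'
  have hent : ∀ i j, (Real.sqrt e)⁻¹ * (A i j : ℝ) = (Real.sqrt f)⁻¹ * B i j := by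
    intro i j
    have := congrFun (congrFun h i) j
    simpa [nrm] using this
  have hef : e = f := by
    refine Lv_sq N hN e (Nat.mem_divisors.mpr ⟨he, hN0.ne'⟩) f (Nat.mem_divisors.mpr ⟨hf, hN0.ne'⟩) ?_
    have hsq : ∀ i j, (A i j * f) ^ 2 = B i j ^ 2 * (e * f : ℕ) := by
      intro i j
      have h3 : (A i j : ℝ) * Real.sqrt f = B i j * Real.sqrt e := by
        have := hent i j
        field_simp at this
        linarith
      have h4 : ((A i j : ℝ) * f) ^ 2 = B i j ^ 2 * (e * f) := by
        have h5 := Real.sq_sqrt (Nat.cast_nonneg (α := ℝ) f)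
        have h6 := Real.sq_sqrt (Nat.cast_nonneg (α := ℝ) e)
        have h7 := congrArg (· ^ 2) h3
        simp only [mul_pow, h5, h6] at h7
        linear_combination (f : ℝ) * h7
      exact_mod_cast h4
    obtain ⟨i, j, hB0⟩ : ∃ i j, B i j ≠ 0 := by
      by_contra! hc
      have h8 := AL.det_pos hf0 hB
      rw [Matrix.det_fin_two, hc, hc, hc, hc] at h8
      simp at h8
    have h9 : B i j ∣ A i j * f := by
      rw [← Int.pow_dvd_pow_iff two_ne_zero, hsq i j]
      exact dvd_mul_right _ _
    obtain ⟨k, hk⟩ := h9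
    have h10 : k ^ 2 = ((e * f : ℕ) : ℤ) := by
      have := hsq i j
      rw [hk, mul_pow] at this
      exact mul_left_cancel₀ (pow_ne_zero 2 hB0) this
    refine ⟨k.natAbs, ?_⟩
    zify
    rw [abs_mul_abs_self, ← sq, h10]
    push_cast
    rfl
  refine ⟨hef, ?_⟩
  subst hef
  ext i j
  have := mul_left_cancel₀ (inv_ne_zero h1) (hent i j)
  exact_mod_cast this

namespace Haupt
variable {N : ℕ} {t g : ℂ → ℂ}

lemma te_eq_te_iff (H : Haupt N t g) (hN : N ∈ Lv) {e f : ℕ} (he : e ∈ N.divisors)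
    (hf : f ∈ N.divisors) {α β : ℂ} (hα : α ∈ UH) (hβ : β ∈ UH) :
    te N t e α = te N t f β ↔ t α = te N t (symDiv e f) β := by
  have hs := symDiv_mem H.sqf he hf
  have hrep := rep_mem H.sqf (Nat.dvd_of_mem_divisors hs)
  have h1 := H.te_act (Nat.dvd_of_mem_divisors he) (Nat.dvd_of_mem_divisors hs) hrep hβ
  rw [Lv_symDiv N hN e he f hf] at h1
  rw [← h1, H.te_eq_iff (Nat.dvd_of_mem_divisors he) hα
    (act_mem (AL.det_pos (H.dvd_pos (Nat.dvd_of_mem_divisors hs)) hrep) hβ)]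
  rfl

lemma card_orb (H : Haupt N t g) (hN : N ∈ Lv) {α : ℂ} (hα : α ∈ UH) :
    (orb N t α).card * (KS N t α).card = N.divisors.card := by
  classical
  have h0 : orb N t α = N.divisors.image fun e => te N t e α := by
    ext ρ
    rw [mem_orb, Finset.mem_image]
  rw [Finset.card_eq_sum_card_image (fun e => te N t e α) N.divisors, ← h0, ← smul_eq_mul,
    ← Finset.sum_const]
  refine Finset.sum_congr rfl fun ρ hρ => ?_
  obtain ⟨e, he, rfl⟩ := mem_orb.mp hρ
  refine Finset.card_nbij' (symDiv e) (symDiv e) ?_ ?_ ?_ ?_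
  · intro s hs
    obtain ⟨hs, h1⟩ := mem_KS.mp hs
    have h2 := symDiv_mem H.sqf he hs
    rw [Finset.mem_coe, Finset.mem_filter]
    refine ⟨h2, Eq.symm ?_⟩
    rw [H.te_eq_te_iff hN he h2 hα hα, Lv_symDiv N hN e he s hs, h1]
  · intro f hf
    rw [Finset.mem_coe, Finset.mem_filter] at hf
    refine mem_KS.mpr ⟨symDiv_mem H.sqf he hf.1, ?_⟩
    exact ((H.te_eq_te_iff hN he hf.1 hα hα).mp hf.2.symm).symm
  · intro s hs
    exact Lv_symDiv N hN e he s (mem_KS.mp hs).1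
  · intro f hf
    rw [Finset.mem_coe, Finset.mem_filter] at hf
    exact Lv_symDiv N hN e he f hf.1

lemma card_fix (H : Haupt N t g) {α : ℂ} (hα : α ∈ UH) :
    {p : ℕ × MZ | p.1 ∣ N ∧ p.2 ∈ AL N p.1 ∧ act p.2 α = α}.ncard =
      (KS N t α).card * (2 * od t α) := by
  have hex : ∀ e ∈ KS N t α, ∃ A ∈ AL N e, act A α = α := by
    intro e he
    obtain ⟨he, h⟩ := mem_KS.mp he
    have hd := Nat.dvd_of_mem_divisors he
    have hrep := rep_mem H.sqf hd
    have hrd := AL.det_pos (H.dvd_pos hd) hrep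
    obtain ⟨γ, hγ, h1⟩ := (H.t_eq_iff (act_mem hrd hα) hα).mp h
    refine ⟨γ * rep N e, AL_one_mul hrep hγ H.sqf hd, ?_⟩
    rw [act_mul (AL.det_pos one_pos hγ) hrd hα, ← h1]
  choose! A hA hfix using hex
  have himg : {p : ℕ × MZ | p.1 ∣ N ∧ p.2 ∈ AL N p.1 ∧ act p.2 α = α} =
      (fun p : ℕ × MZ => (p.1, p.2 * A p.1)) '' ((KS N t α : Set ℕ) ×ˢ Stab N α) := by
    ext ⟨e, B⟩
    constructor
    · rintro ⟨he, hB, hf⟩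
      have hK : e ∈ KS N t α := by
        refine mem_KS.mpr ⟨Nat.mem_divisors.mpr ⟨he, H.pos.ne'⟩, ?_⟩
        rw [← H.te_eq he hB hα, hf]
      obtain ⟨C, hC, h1⟩ := AL_mul_self H.sqf he hB (hA e hK)
      refine ⟨(e, C), ⟨hK, hC, ?_⟩, Prod.ext rfl h1.symm⟩
      have h2 := act_mul (AL.det_pos one_pos hC) (AL.det_pos (H.dvd_pos he) (hA e hK)) hα
      rw [← h1, hf, hfix e hK] at h2
      exact h2.symm
    · rintro ⟨⟨f, C⟩, ⟨hK, hC, hCf⟩, h1⟩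
      obtain ⟨rfl, rfl⟩ := Prod.mk.inj h1
      have hd := Nat.dvd_of_mem_divisors (mem_KS.mp hK).1
      refine ⟨hd, AL_one_mul (hA f hK) hC H.sqf hd, ?_⟩
      change act (C * A f) α = α
      rw [act_mul (AL.det_pos one_pos hC) (AL.det_pos (H.dvd_pos hd) (hA f hK)) hα, hfix f hK, hCf]
  rw [himg, Set.InjOn.ncard_image, Set.ncard_prod, Set.ncard_coe_finset, H.Stab_ncard hα]
  rintro ⟨e, B⟩ ⟨hK, -⟩ ⟨f, C⟩ - h1
  obtain ⟨h2, h3⟩ := Prod.mk.inj h1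
  simp only at h2 h3
  subst h2
  have hd := Nat.dvd_of_mem_divisors (mem_KS.mp hK).1
  have h4 : (A e).det ≠ 0 := (AL.det_pos (H.dvd_pos hd) (hA e hK)).ne'
  have h5 := congrArg (· * (A e).adjugate) h3
  simp only [Matrix.mul_assoc, Matrix.mul_adjugate, Matrix.mul_smul, Matrix.mul_one] at h5
  rw [smul_right_injective MZ h4 h5]

lemma stabOrder_eq (H : Haupt N t g) (hN : N ∈ Lv) {M : Matrix (Fin 2) (Fin 2) ℝ} {α : ℂ}
    (h : IsPt M α) : stabOrder (FrickeGroup N) M = (KS N t α).card * od t α := by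
  have hset : (Subtype.val : SL2R → Matrix (Fin 2) (Fin 2) ℝ) ''
      {g : SL2R | g ∈ FrickeGroup N ∧ (g.1)ᵀ * M * g.1 = M} =
      (fun p : ℕ × MZ => nrm p.1 p.2) ''
        {p : ℕ × MZ | p.1 ∣ N ∧ p.2 ∈ AL N p.1 ∧ act p.2 α = α} := by
    ext X
    constructor
    · rintro ⟨x, ⟨hx, hx2⟩, rfl⟩
      obtain ⟨e, he, A, hA, hxA⟩ := (mem_FrickeGroup H.sqf).mp hx
      refine ⟨(e, A), ⟨he, hA, ?_⟩, hxA.symm⟩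
      obtain ⟨h1, -⟩ := h.conj_adjugate (H.dvd_pos he) hA
      rw [← hxA, hx2] at h1
      have h2 := act_adjugate (AL.det_pos (H.dvd_pos he) hA) h.mem
      rwa [← h1.cmPoint, h.cmPoint] at h2
    · rintro ⟨⟨e, A⟩, ⟨he, hA, hf⟩, rfl⟩
      refine ⟨⟨nrm e A, nrm_det (H.dvd_pos he) hA.2.2.2⟩,
        ⟨(mem_FrickeGroup H.sqf).mpr ⟨e, he, A, hA, rfl⟩, ?_⟩, rfl⟩
      change act A α = α at hf
      obtain ⟨h1, h2⟩ := IsPt.conj (H.dvd_pos he) hA.2.2.2 h.mem (by rwa [hf])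
      exact h1.eq_of_det h h2
  have h1 : Nat.card {g : SL2R // g ∈ FrickeGroup N ∧ (g.1)ᵀ * M * g.1 = M} =
      (KS N t α).card * (2 * od t α) := by
    rw [← H.card_fix h.mem]
    have h2 := (congrArg Set.ncard hset).symm.trans
      (Set.ncard_image_of_injective _ Subtype.val_injective)
    rw [Set.InjOn.ncard_image] at h2
    · exact h2.symm
    · rintro ⟨e, A⟩ ⟨he, -, -⟩ ⟨f, B⟩ ⟨hf, hB, -⟩ h3
      obtain ⟨rfl, rfl⟩ := nrm_inj hN he hf hB h3
      rfl
  rw [stabOrder, h1, mul_left_comm, Nat.mul_div_cancel_left _ two_pos]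

end Haupt

namespace Haupt
variable {N : ℕ} {t g : ℂ → ℂ}

lemma exists_act_of_formRel (H : Haupt N t g) {d : ℤ} (hd : 0 < d) {M M' : QdN d N}
    (h : formRel (FrickeGroup N) (QdN d N) M M') :
    ∃ e, e ∣ N ∧ ∃ B ∈ AL N e, cmPointC M'.1 = act B (cmPointC M.1) := by
  obtain ⟨x, hx, h⟩ := h
  obtain ⟨e, he, A, hA, hxA⟩ := (mem_FrickeGroup H.sqf).mp hx
  refine ⟨e, he, A.adjugate, adjugate_mem_AL hA, ?_⟩
  rw [h, hxA]
  exact ((isPt_of_mem_QdN hd M.2).1.conj_adjugate (H.dvd_pos he) hA).1.cmPoint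

lemma formRel_of_te (H : Haupt N t g) {d : ℤ} (hd : 0 < d) {M M' : QdN d N} {e : ℕ} (he : e ∣ N)
    (h : t (cmPointC M'.1) = te N t e (cmPointC M.1)) :
    formRel (FrickeGroup N) (QdN d N) M M' := by
  obtain ⟨hM, hMd⟩ := isPt_of_mem_QdN hd M.2
  obtain ⟨hM', hMd'⟩ := isPt_of_mem_QdN hd M'.2
  have hR := rep_mem H.sqf he
  have hR0 := AL.det_pos (H.dvd_pos he) hR
  obtain ⟨γ, hγ, h1⟩ := (H.t_eq_iff (act_mem hR0 hM.mem) hM'.mem).mp h.symm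
  have hB := AL_one_mul hR hγ H.sqf he
  rw [← act_mul (AL.det_pos one_pos hγ) hR0 hM.mem] at h1
  have hA := adjugate_mem_AL hB
  have hA0 := AL.det_pos (H.dvd_pos he) hA
  have h2 := act_adjugate hA0 hM.mem
  rw [Matrix.adjugate_adjugate _ (by simp), Fintype.card_fin] at h2
  simp only [Nat.sub_self, pow_zero, one_smul] at h2
  rw [← h1] at h2
  obtain ⟨h3, h4⟩ := IsPt.conj (H.dvd_pos he) hA.2.2.2 hM'.mem (by rwa [h2])
  refine ⟨⟨nrm e _, nrm_det (H.dvd_pos he) hA.2.2.2⟩,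
    (mem_FrickeGroup H.sqf).mpr ⟨e, he, _, hA, rfl⟩, ?_⟩
  exact hM'.eq_of_det h3 (by rw [h4, hMd, hMd'])

lemma orb_act (H : Haupt N t g) {e : ℕ} (he : e ∣ N) {B : MZ} (hB : B ∈ AL N e) {α : ℂ}
    (hα : α ∈ UH) : orb N t α ⊆ orb N t (act B α) := by
  intro ρ hρ
  obtain ⟨f, hf, rfl⟩ := mem_orb.mp hρ
  have hf' := Nat.dvd_of_mem_divisors hf
  have hB' := adjugate_mem_AL hB
  have hB0 := AL.det_pos (H.dvd_pos he) hB
  refine mem_orb.mpr ⟨symDiv f e, Nat.mem_divisors.mpr ⟨symDiv_dvd H.sqf hf' he, H.pos.ne'⟩, ?_⟩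
  rw [← H.te_act hf' he hB' (act_mem hB0 hα)]
  have h2 := act_adjugate (AL.det_pos (H.dvd_pos he) hB') hα
  rw [Matrix.adjugate_adjugate _ (by simp), Fintype.card_fin] at h2
  simp only [Nat.sub_self, pow_zero, one_smul] at h2
  rw [h2]

lemma t_mem_orb (H : Haupt N t g) {α : ℂ} (hα : α ∈ UH) : t α ∈ orb N t α :=
  mem_orb.mpr ⟨1, Nat.one_mem_divisors.mpr H.pos.ne', H.te_one hα⟩

lemma orb_out (H : Haupt N t g) {d : ℤ} (hd : 0 < d) (M : QdN d N) :
    t (cmPointC M.1) ∈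
      orb N t (cmPointC (Quot.out (Quot.mk (formRel (FrickeGroup N) (QdN d N)) M)).1) := by
  have key : ∀ M₁ M₂ : QdN d N, Relation.EqvGen (formRel (FrickeGroup N) (QdN d N)) M₁ M₂ →
      orb N t (cmPointC M₁.1) = orb N t (cmPointC M₂.1) := by
    intro M₁ M₂ h
    induction h with
    | rel x y h =>
      obtain ⟨e, he, B, hB, h1⟩ := H.exists_act_of_formRel hd h
      have hx := (isPt_of_mem_QdN hd x.2).1.mem
      refine (H.orb_act he hB hx).antisymm ?_ |>.trans (by rw [h1])
      have hB0 := AL.det_pos (H.dvd_pos he) hB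
      have h2 := H.orb_act he (adjugate_mem_AL hB) (act_mem hB0 hx)
      have h3 := act_adjugate (AL.det_pos (H.dvd_pos he) (adjugate_mem_AL hB)) hx
      rw [Matrix.adjugate_adjugate _ (by simp), Fintype.card_fin] at h3
      simp only [Nat.sub_self, pow_zero, one_smul] at h3
      rwa [h3] at h2
    | refl x => rfl
    | symm x y _ ih => exact ih.symm
    | trans x y z _ _ ih1 ih2 => exact ih1.trans ih2
  have h1 := Quot.eqvGen_exact (Quot.out_eq (Quot.mk (formRel (FrickeGroup N) (QdN d N)) M))
  rw [key _ _ h1]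
  exact H.t_mem_orb (isPt_of_mem_QdN hd M.2).1.mem

lemma orb_subset_VD (H : Haupt N t g) {d : ℤ} (hd : 0 < d) (M : QdN d N) {ρ : ℂ}
    (h : ρ ∈ orb N t (cmPointC M.1)) : ρ ∈ VD N t d := by
  obtain ⟨e, he, rfl⟩ := mem_orb.mp h
  have he' := Nat.dvd_of_mem_divisors he
  have hA := adjugate_mem_AL (rep_mem H.sqf he')
  obtain ⟨hM, -⟩ := isPt_of_mem_QdN hd M.2
  refine ⟨_, QdN_conj he' (H.dvd_pos he') hd M.2 hA, ?_⟩
  rw [(hM.conj_adjugate (H.dvd_pos he') hA).1.cmPoint, Matrix.adjugate_adjugate _ (by simp),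
    Fintype.card_fin]
  simp only [Nat.sub_self, pow_zero, one_smul]
  rfl

lemma orb_value (H : Haupt N t g) {f : ℂ → ℂ}
    (hf : ∀ e, e ∣ N → ∀ A ∈ AL N e, ∀ z ∈ UH, f (act A z) = f z) {α ρ : ℂ} (hα : α ∈ UH)
    (h : ρ ∈ orb N t α) : f (pt t ρ) / od t (pt t ρ) = f α / od t α := by
  obtain ⟨e, he, rfl⟩ := mem_orb.mp h
  have he' := Nat.dvd_of_mem_divisors he
  have hR := rep_mem H.sqf he'
  have h1 := act_mem (AL.det_pos (H.dvd_pos he') hR) hα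
  obtain ⟨γ, hγ, h2⟩ := H.pt_equiv h1
  rw [te, h2, hf 1 (one_dvd N) γ hγ _ h1, hf e he' _ hR _ hα, H.od_act (one_dvd N) hγ h1,
    H.od_act he' hR hα]

theorem classTrace_eq (H : Haupt N t g) (hN : N ∈ Lv) {d : ℤ} (hd : 0 < d)
    (hfin : (VD N t d).Finite) {f : ℂ → ℂ}
    (hf : ∀ e, e ∣ N → ∀ A ∈ AL N e, ∀ z ∈ UH, f (act A z) = f z) :
    N.divisors.card * classTrace (FrickeGroup N) f (QdN d N) =
      ∑ ρ ∈ hfin.toFinset, f (pt t ρ) / od t (pt t ρ) := by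
  classical
  set α : Quot (formRel (FrickeGroup N) (QdN d N)) → ℂ := fun O => cmPointC (Quot.out O).1 with hα
  have hU : ∀ O, α O ∈ UH := fun O => (isPt_of_mem_QdN hd (Quot.out O).2).1.mem
  have hrel : ∀ O O' e, e ∣ N → t (α O') = te N t e (α O) → O = O' := by
    intro O O' e he h
    rw [← Quot.out_eq O, ← Quot.out_eq O']
    exact Quot.sound (H.formRel_of_te hd he h)
  have hft : Finite (Quot (formRel (FrickeGroup N) (QdN d N))) := by
    have : Finite (VD N t d) := hfin
    refine Finite.of_injective (β := VD N t d) (fun O => ⟨t (α O), _, (Quot.out O).2, rfl⟩) ?_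
    intro O O' h
    refine hrel O O' 1 (one_dvd N) ?_
    rw [H.te_one (hU O)]
    exact (congrArg Subtype.val h).symm
  have := Fintype.ofFinite (Quot (formRel (FrickeGroup N) (QdN d N)))
  have hset : hfin.toFinset = Finset.univ.biUnion fun O => orb N t (α O) := by
    ext ρ
    simp only [Set.Finite.mem_toFinset, Finset.mem_biUnion, Finset.mem_univ, true_and]
    constructor
    · rintro ⟨M, hM, rfl⟩
      exact ⟨_, H.orb_out hd ⟨M, hM⟩⟩
    · rintro ⟨O, hO⟩
      exact H.orb_subset_VD hd _ hO
  rw [hset, Finset.sum_biUnion, classTrace, finsum_eq_sum_of_fintype, Finset.mul_sum]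
  · refine Finset.sum_congr rfl fun O _ => ?_
    rw [Finset.sum_congr rfl fun ρ hρ => H.orb_value hf (hU O) hρ, Finset.sum_const, nsmul_eq_mul,
      H.stabOrder_eq hN (isPt_of_mem_QdN hd (Quot.out O).2).1]
    change _ * (f (α O) / ((KS N t (α O)).card * od t (α O) : ℕ)) = _
    have h1 := H.card_orb hN (hU O)
    have h2 : (KS N t (α O)).card ≠ 0 := by
      refine (Finset.card_pos.mpr ⟨1, mem_KS.mpr ⟨Nat.one_mem_divisors.mpr H.pos.ne', ?_⟩⟩).ne'
      exact H.te_one (hU O)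
    have h3 := (H.od_pos (hU O)).ne'
    rw [← h1]
    push_cast
    field_simp
  · intro O _ O' _ hne
    refine Finset.disjoint_left.mpr fun ρ hρ hρ' => hne ?_
    obtain ⟨e, he, h1⟩ := mem_orb.mp hρ
    obtain ⟨e', he', h2⟩ := mem_orb.mp hρ'
    refine (hrel O' O (symDiv e e') (symDiv_dvd H.sqf (Nat.dvd_of_mem_divisors he)
      (Nat.dvd_of_mem_divisors he')) ?_).symm
    exact (H.te_eq_te_iff hN he he' (hU O) (hU O')).mp (h1.trans h2.symm)

end Haupt

lemma mem_QdN_root {N : ℕ} {d : ℤ} {a b c : ℤ} {α : ℂ} (hα : α ∈ UH) (ha : 0 < a)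
    (hroot : (a : ℂ) * α ^ 2 + b * α + c = 0) (hdisc : b ^ 2 - 4 * a * c = -d)
    (hNa : (N : ℤ) ∣ a) : formMat a b c ∈ QdN d N ∧ cmPointC (formMat a b c) = α := by
  refine ⟨⟨a, b, c, rfl, ha, hdisc, hNa⟩, (IsPt.of_root ?_ ?_ hα ?_).cmPoint⟩
  · simpa [formMat] using ha
  · simp [formMat]
  · simp only [formMat, Matrix.of_apply, Matrix.cons_val', Matrix.cons_val_zero,
      Matrix.cons_val_one, Matrix.cons_val_fin_one]
    push_cast
    linear_combination hroot

lemma Apos_spec {N n : ℕ} {α : ℂ} (hα : α ∈ UH) {A : MZ} (hA : A ∈ Apos N n α)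
    (hn : 0 < n) :
    (A 1 0 : ℂ) * α ^ 2 + ((A 1 1 - A 0 0 : ℤ) : ℂ) * α + ((-A 0 1 : ℤ) : ℂ) = 0 ∧
      (A 1 1 - A 0 0) ^ 2 - 4 * A 1 0 * (-A 0 1) = -(4 * n - (A 0 0 + A 1 1) ^ 2) ∧
      (A 0 0 + A 1 1) ^ 2 < 4 * n ∧ (N : ℤ) ∣ A 1 0 := by
  obtain ⟨⟨⟨h1, h2⟩, h3⟩, h4⟩ := hA
  have hd : 0 < A.det := by rw [h2]; exact_mod_cast hn
  have hroot : (A 1 0 : ℂ) * α ^ 2 + ((A 1 1 - A 0 0 : ℤ) : ℂ) * α + ((-A 0 1 : ℤ) : ℂ) = 0 := by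
    rw [act, div_eq_iff (den_ne_zero hd hα), den] at h3
    push_cast
    linear_combination -h3
  rw [Matrix.det_fin_two] at h2
  refine ⟨hroot, by linear_combination -4 * h2, ?_, h1⟩
  have hα' : 0 < α.im := hα
  have h4' : (0 : ℝ) < A 1 0 := by exact_mod_cast h4
  have him := congrArg Complex.im hroot
  have hre := congrArg Complex.re hroot
  simp only [pow_two, Complex.add_re, Complex.add_im, Complex.mul_re, Complex.mul_im,
    Complex.intCast_re, Complex.intCast_im, Complex.zero_re, Complex.zero_im] at him hre
  have h5 : ((A 1 1 - A 0 0 : ℤ) : ℝ) = -(2 * A 1 0 * α.re) := by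
    have : α.im * (((A 1 1 - A 0 0 : ℤ) : ℝ) + 2 * A 1 0 * α.re) = 0 := by linarith
    rcases mul_eq_zero.mp this with h | h
    · exact absurd h hα'.ne'
    · linarith
  have h6 : ((A 1 1 - A 0 0 : ℤ) : ℝ) ^ 2 - 4 * A 1 0 * (-A 0 1 : ℤ) = -(2 * A 1 0 * α.im) ^ 2 := by
    have h7 : ((-A 0 1 : ℤ) : ℝ) = A 1 0 * (α.re ^ 2 + α.im ^ 2) := by
      rw [h5] at hre
      linarith
    rw [h7, h5]
    ring
  have h8 : (A 1 1 - A 0 0) ^ 2 - 4 * A 1 0 * (-A 0 1) < 0 := by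
    have : ((A 1 1 - A 0 0 : ℤ) : ℝ) ^ 2 - 4 * A 1 0 * (-A 0 1 : ℤ) < 0 := by
      rw [h6]
      have : 0 < 2 * (A 1 0 : ℝ) * α.im := by positivity
      nlinarith
    exact_mod_cast this
  nlinarith

namespace Haupt
variable {N : ℕ} {t g : ℂ → ℂ}

lemma mem_VD_iff (H : Haupt N t g) {n : ℕ} (hn : 0 < n) {α : ℂ} (hα : α ∈ UH) {r : ℤ}
    (hr : r ^ 2 < 4 * n) :
    t α ∈ VD N t (4 * n - r ^ 2) ↔ ∃ A ∈ Apos N n α, A 0 0 + A 1 1 = r := by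
  have hd : 0 < 4 * (n : ℤ) - r ^ 2 := by linarith
  constructor
  · rintro ⟨M, hM, h⟩
    have hM1 := (isPt_of_mem_QdN hd hM).1
    obtain ⟨γ, hγ, h1⟩ := (H.t_eq_iff hM1.mem hα).mp h
    have hA := adjugate_mem_AL hγ
    have hM' := QdN_conj (one_dvd N) one_pos hd hM hA
    have hM2 := (hM1.conj_adjugate one_pos hA).1
    rw [Matrix.adjugate_adjugate _ (by simp), Fintype.card_fin] at hM2
    simp only [Nat.sub_self, pow_zero, one_smul] at hM2
    rw [← h1] at hM2
    obtain ⟨a, b, c, h2, ha, hdisc, hNa⟩ := hM'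
    rw [h2] at hM2
    have hroot := hM2.root
    simp only [formMat, Matrix.of_apply, Matrix.cons_val', Matrix.cons_val_zero,
      Matrix.cons_val_one, Matrix.cons_val_fin_one] at hroot
    push_cast at hroot
    obtain ⟨k, hk⟩ : ∃ k, r - b = 2 * k := by
      have h3 : Even (r - b) := by
        have : Even ((r - b) * (r + b)) := ⟨2 * (n - a * c), by linear_combination -hdisc⟩
        rcases Int.even_mul.mp this with h | h
        · exact h
        · have := h.sub (even_two_mul b)
          rwa [show r + b - 2 * b = r - b by ring] at this
      obtain ⟨k, hk⟩ := h3
      exact ⟨k, by linarith⟩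
    have hdet : (!![k, -c; a, r - k] : MZ).det = n := by
      have hb : b = r - 2 * k := by linarith
      rw [Matrix.det_fin_two_of]
      rw [hb] at hdisc
      linarith
    have hdet0 : 0 < (!![k, -c; a, r - k] : MZ).det := by rw [hdet]; exact_mod_cast hn
    refine ⟨!![k, -c; a, r - k], ⟨⟨⟨by simpa using hNa, hdet⟩, ?_⟩, by simpa using ha⟩, by simp⟩
    rw [act, div_eq_iff (den_ne_zero hdet0 hα), den]
    simp only [Matrix.of_apply, Matrix.cons_val', Matrix.cons_val_zero,
      Matrix.cons_val_one, Matrix.cons_val_fin_one]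
    have hb : (b : ℂ) = r - 2 * k := by
      have : b = r - 2 * k := by linarith
      exact_mod_cast this
    push_cast
    linear_combination -hroot + α * hb
  · rintro ⟨A, hA, rfl⟩
    obtain ⟨h1, h2, h3, h4⟩ := Apos_spec hα hA hn
    obtain ⟨h5, h6⟩ := mem_QdN_root hα hA.2 h1 h2 h4
    exact ⟨_, h5, by rw [h6]⟩

lemma Apos_trace_injOn {n : ℕ} (hn : 0 < n) {α : ℂ} (hα : α ∈ UH) :
    Set.InjOn (fun A : MZ => A 0 0 + A 1 1) (Apos N n α) := by
  intro A hA B hB h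
  simp only at h
  obtain ⟨h1, h2, h3, h4⟩ := Apos_spec hα hA hn
  obtain ⟨h1', h2', h3', h4'⟩ := Apos_spec hα hB hn
  have hd : 0 < 4 * (n : ℤ) - (A 0 0 + A 1 1) ^ 2 := by linarith
  rw [← h] at h2'
  obtain ⟨h5, h6⟩ := mem_QdN_root hα hA.2 h1 h2 h4
  obtain ⟨h5', h6'⟩ := mem_QdN_root hα hB.2 h1' h2' h4'
  have h7 := isPt_of_mem_QdN hd h5
  have h7' := isPt_of_mem_QdN hd h5'
  rw [h6] at h7
  rw [h6'] at h7'
  have h8 := h7.1.eq_of_det h7'.1 (h7.2.trans h7'.2.symm)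
  have e1 := congrFun₂ h8 0 0
  have e2 := congrFun₂ h8 0 1
  have e3 := congrFun₂ h8 1 1
  simp only [formMat, Matrix.of_apply, Matrix.cons_val', Matrix.cons_val_zero,
    Matrix.cons_val_one, Matrix.cons_val_fin_one] at e1 e2 e3
  have f1 : A 1 0 = B 1 0 := by exact_mod_cast e1
  have f2 : A 1 1 - A 0 0 = B 1 1 - B 0 0 := by
    have := mul_right_cancel₀ (b := (2 : ℝ)⁻¹) (by norm_num) e2
    exact_mod_cast this
  have f3 : -A 0 1 = -B 0 1 := by exact_mod_cast e3
  ext i j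
  fin_cases i <;> fin_cases j <;> simp <;> omega

def Rr (n : ℕ) : Finset ℤ := (Finset.Icc (-(2 * n + 2 : ℤ)) (2 * n + 2)).filter fun r => r ^ 2 < 4 * n

lemma Apos_ncard_eq (H : Haupt N t g) {n : ℕ} (hn : 0 < n) {α : ℂ} (hα : α ∈ UH)
    [DecidablePred fun r => t α ∈ VD N t (4 * n - r ^ 2)] :
    ((Rr n).filter fun r => t α ∈ VD N t (4 * n - r ^ 2)).card = (Apos N n α).ncard := by
  rw [← (Apos_trace_injOn (N := N) hn hα).ncard_image, ← Set.ncard_coe_finset]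
  congr 1
  ext r
  simp only [Rr, Finset.coe_filter, Finset.mem_filter, Finset.mem_Icc, Set.mem_ofPred, Set.mem_image]
  constructor
  · rintro ⟨⟨-, hr⟩, h⟩
    exact (H.mem_VD_iff hn hα hr).mp h
  · rintro ⟨A, hA, rfl⟩
    have hr := (Apos_spec hα hA hn).2.2.1
    refine ⟨⟨⟨?_, ?_⟩, hr⟩, (H.mem_VD_iff hn hα hr).mpr ⟨A, hA, rfl⟩⟩ <;> nlinarith

lemma VD_subset (H : Haupt N t g) {n : ℕ} (hn : 0 < n) {r : ℤ} (hr : r ^ 2 < 4 * n) :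
    VD N t (4 * n - r ^ 2) ⊆ SA N t n := by
  rintro ρ ⟨M, hM, rfl⟩
  have hM1 := (isPt_of_mem_QdN (by linarith) hM).1
  obtain ⟨A, hA, -⟩ := (H.mem_VD_iff hn hM1.mem hr).mp ⟨M, hM, rfl⟩
  exact (H.mem_SA_iff hn hM1.mem).mpr ⟨A, hA⟩

theorem sum_classTrace (H : Haupt N t g) (hN : N ∈ Lv) {n : ℕ} (hn : 0 < n)
    (hfin : (SA N t n).Finite) {f : ℂ → ℂ}
    (hf : ∀ e, e ∣ N → ∀ A ∈ AL N e, ∀ z ∈ UH, f (act A z) = f z) :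
    N.divisors.card * ∑ r ∈ Rr n, classTrace (FrickeGroup N) f (QdN (4 * n - r ^ 2) N) =
      ∑ ρ ∈ hfin.toFinset, wt N t n ρ * f (pt t ρ) := by
  classical
  rw [Finset.mul_sum]
  have h1 : ∀ r ∈ Rr n, N.divisors.card * classTrace (FrickeGroup N) f (QdN (4 * n - r ^ 2) N) =
      ∑ ρ ∈ hfin.toFinset, if ρ ∈ VD N t (4 * n - r ^ 2) then
        f (pt t ρ) / od t (pt t ρ) else 0 := by
    intro r hr
    have hr' : r ^ 2 < 4 * n := (Finset.mem_filter.mp hr).2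
    have hsub := H.VD_subset hn hr'
    rw [H.classTrace_eq hN (by linarith) (hfin.subset hsub) hf, ← Finset.sum_filter]
    refine Finset.sum_congr ?_ fun _ _ => rfl
    ext ρ
    simp only [Set.Finite.mem_toFinset, Finset.mem_filter]
    exact ⟨fun h => ⟨hsub h, h⟩, fun h => h.2⟩
  rw [Finset.sum_congr rfl h1, Finset.sum_comm]
  refine Finset.sum_congr rfl fun ρ hρ => ?_
  obtain ⟨α, hα, rfl, -⟩ := hfin.mem_toFinset.mp hρ
  obtain ⟨hp, hp'⟩ := pt_spec (t := t) ⟨α, hα, rfl⟩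
  rw [← Finset.sum_filter, Finset.sum_const, nsmul_eq_mul, H.Apos_ncard_eq hn hα,
    H.wt_eq hn hα]
  have h2 : od t (pt t (t α)) = od t α := by
    obtain ⟨γ, hγ, h3⟩ := H.pt_equiv hα
    rw [h3, H.od_act (one_dvd N) hγ hα]
  rw [h2]
  ring

end Haupt

def rBox (n : ℕ) : Finset ℤ := Finset.Icc (-(2 * n + 2 : ℤ)) (2 * n + 2)

lemma mem_rBox {n : ℕ} {r : ℤ} (h : r ^ 2 ≤ 4 * n + 4) : r ∈ rBox n := by
  rw [rBox, Finset.mem_Icc]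
  constructor <;> nlinarith

lemma card_gap {n k : ℕ} (hn : 0 < n) (hk : 0 < k) (hk2 : k ≤ 2) :
    (n.divisorsAntidiagonal.filter fun x => x.1 = x.2 + k ∨ x.2 = x.1 + k).card =
      ((rBox n).filter fun r : ℤ => r ^ 2 = 4 * n + k ^ 2).card := by
  refine Finset.card_bij (fun x _ => if x.1 < x.2 then ((x.1 : ℤ) + x.2) else -((x.1 : ℤ) + x.2))
    ?_ ?_ ?_
  · rintro ⟨a, d⟩ h
    simp only [Finset.mem_filter, Nat.mem_divisorsAntidiagonal] at h ⊢
    obtain ⟨⟨h1, -⟩, h2⟩ := h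
    have h3 : ((a : ℤ) + d) ^ 2 = 4 * n + k ^ 2 := by
      rw [← h1]
      push_cast
      rcases h2 with rfl | rfl <;> push_cast <;> ring
    have h4 : (if a < d then (a : ℤ) + d else -((a : ℤ) + d)) ^ 2 = 4 * n + k ^ 2 := by
      split_ifs
      · exact h3
      · rw [neg_sq, h3]
    refine ⟨mem_rBox ?_, h4⟩
    rw [h4]
    have : (k : ℤ) ≤ 2 := by exact_mod_cast hk2
    nlinarith
  · rintro ⟨a, d⟩ h ⟨a', d'⟩ h' heq
    simp only [Finset.mem_filter, Nat.mem_divisorsAntidiagonal] at h h' heq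
    rw [Prod.mk.injEq]
    split_ifs at heq <;> omega
  · intro r h
    simp only [Finset.mem_filter] at h
    have h2 := h.2
    have hs : (r.natAbs : ℤ) ^ 2 = 4 * n + k ^ 2 := by rw [Int.natAbs_sq, h2]
    have hs' : r.natAbs ^ 2 = 4 * n + k ^ 2 := by exact_mod_cast hs
    have hlt : k < r.natAbs := lt_of_pow_lt_pow_left₀ 2 (Nat.zero_le _) (by omega)
    obtain ⟨m, hm⟩ := Nat.exists_eq_add_of_lt hlt
    have hpar : Even (m + 1) := by
      have : Even ((m + 1) * (m + 1)) := by
        refine ⟨2 * n - k * (m + 1), ?_⟩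
        rw [hm] at hs'
        have : 2 * n = k * (m + 1) + (2 * n - k * (m + 1)) := by
          refine (Nat.add_sub_cancel' ?_).symm
          nlinarith
        nlinarith
      exact (Nat.even_mul.mp this).elim id id
    obtain ⟨a, ha⟩ := hpar
    have hr : r.natAbs = 2 * a + k := by omega
    have hn' : a * (a + k) = n := by
      rw [hr] at hs'
      nlinarith
    have hrr : r = 2 * a + k ∨ r = -(2 * a + k) := by omega
    rcases hrr with h3 | h3
    · refine ⟨(a, a + k), ?_, ?_⟩
      · simp [hn', hn.ne']
      · simp only
        rw [if_pos (by omega), h3]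
        push_cast
        ring
    · refine ⟨(a + k, a), ?_, ?_⟩
      · simp [mul_comm (a + k), hn', hn.ne']
      · simp only
        rw [if_neg (by omega), h3]
        push_cast
        ring

lemma gapS_eq {n : ℕ} (hn : 0 < n) :
    gapS n = ((rBox n).filter fun r : ℤ => r ^ 2 = 4 * n + 1).card +
      2 * ((rBox n).filter fun r : ℤ => r ^ 2 = 4 * n + 4).card := by
  have h1 := card_gap hn one_pos (by norm_num)
  have h2 := card_gap hn two_pos le_rfl
  norm_num at h1 h2
  rw [← h1, ← h2, gapS, Finset.card_filter, Finset.card_filter, Finset.mul_sum,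
    ← Finset.sum_add_distrib]
  refine Finset.sum_congr rfl fun x _ => ?_
  unfold gap
  split_ifs <;> omega

lemma card_sq {n : ℕ} (hn : 0 < n) :
    ((rBox n).filter fun r : ℤ => r ^ 2 = 4 * n).card = 2 * sqI n := by
  by_cases h : IsSquare n
  · obtain ⟨m, hm⟩ := h
    rw [sqI_eq_one ⟨m, hm⟩]
    have hm0 : m ≠ 0 := by rintro rfl; omega
    have : (rBox n).filter (fun r : ℤ => r ^ 2 = 4 * n) = {2 * (m : ℤ), -(2 * (m : ℤ))} := by
      ext r
      simp only [Finset.mem_filter, Finset.mem_insert, Finset.mem_singleton]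
      have h1 : r ^ 2 = 4 * n ↔ r = 2 * m ∨ r = -(2 * m) := by
        rw [hm, ← sq_eq_sq_iff_eq_or_eq_neg]
        push_cast
        constructor <;> intro h <;> linarith
      rw [← h1]
      exact ⟨fun h => h.2, fun h => ⟨mem_rBox (by omega), h⟩⟩
    rw [this, Finset.card_pair (by omega)]
  · rw [sqI_eq_zero h, Finset.card_eq_zero.mpr, mul_zero]
    refine Finset.filter_eq_empty_iff.mpr fun r _ h1 => h ?_
    have h2 : Even r := by
      have : Even (r ^ 2) := ⟨2 * n, by rw [h1]; ring⟩
      exact (Int.even_pow.mp this).1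
    obtain ⟨s, rfl⟩ := h2
    refine ⟨s.natAbs, ?_⟩
    have : (n : ℤ) = s.natAbs * s.natAbs := by
      rw [Int.natAbs_mul_self']
      nlinarith
    exact_mod_cast this

def t0 (N : ℕ) : ℂ := if N = 2 then 5 else if N = 6 ∨ N = 10 then 5 / 2 else 3

lemma t2Star_of_pos (N : ℕ) (P : Polynomial ℂ) {d : ℤ} (hd : 0 < d) :
    t2Star N P d = classTrace (FrickeGroup N) (fun z => Polynomial.eval (jnStar N z) P) (QdN d N) := by
  rw [t2Star, if_pos hd]

lemma t2Star_zero (N : ℕ) (P : Polynomial ℂ) : t2Star N P 0 = t0 N := by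
  simp [t2Star, t0]

lemma t2Star_of_neg (N : ℕ) (P : Polynomial ℂ) {d : ℤ} (hd : d < 0) :
    t2Star N P d = (if d = -1 then -1 else 0) + (if d = -4 then -2 else 0) := by
  rw [t2Star, if_neg (by omega), if_neg (by omega)]
  split_ifs <;> first | omega | simp

lemma t2Star_eq (N : ℕ) (P : Polynomial ℂ) (n : ℕ) (r : ℤ) :
    t2Star N P (4 * n - r ^ 2) = (if r ^ 2 < 4 * n then
      classTrace (FrickeGroup N) (fun z => Polynomial.eval (jnStar N z) P)
        (QdN (4 * n - r ^ 2) N) else 0) + ((if r ^ 2 = 4 * n then t0 N else 0) +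
      ((if r ^ 2 = 4 * n + 1 then -1 else 0) + (if r ^ 2 = 4 * n + 4 then -2 else 0))) := by
  rcases lt_trichotomy (r ^ 2) (4 * (n : ℤ)) with h | h | h
  · rw [if_pos h, if_neg (by omega), if_neg (by omega), if_neg (by omega),
      t2Star_of_pos N P (by omega)]
    simp
  · rw [if_neg (by omega), if_pos h, if_neg (by omega), if_neg (by omega), h, sub_self,
      t2Star_zero]
    simp
  · rw [if_neg (by omega), if_neg (by omega), t2Star_of_neg N P (by omega), zero_add, zero_add]
    congr 1
    · exact if_congr (by omega) rfl rfl
    · exact if_congr (by omega) rfl rfl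

lemma finsum_t2Star (N : ℕ) (P : Polynomial ℂ) (n : ℕ) :
    ∑ᶠ r : ℤ, t2Star N P (4 * n - r ^ 2) = ∑ r ∈ rBox n, t2Star N P (4 * n - r ^ 2) := by
  refine finsum_eq_sum_of_support_subset _ fun r hr => ?_
  by_contra h
  refine hr ?_
  have h1 : ¬ r ^ 2 ≤ 4 * n + 4 := fun h2 => h (mem_rBox h2)
  change t2Star N P (4 * n - r ^ 2) = 0
  rw [t2Star_of_neg N P (by omega), if_neg (by omega), if_neg (by omega), add_zero]

lemma t0_eq : ∀ N ∈ Lv, t0 N = -(∑ δ ∈ N.divisors, bD δ) / (6 * N.divisors.card) := by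
  intro N hN
  have h : ∀ N ∈ Lv, (if N = 2 then 5 else if N = 6 ∨ N = 10 then 5 / 2 else 3 : ℚ) =
      -(∑ δ ∈ N.divisors, (if δ = 1 then -36 else if δ = 2 then -24 else 0)) /
        (6 * N.divisors.card) := by decide +kernel
  have h1 := congrArg (fun x : ℚ => (x : ℂ)) (h N hN)
  push_cast [apply_ite (Rat.cast : ℚ → ℂ)] at h1
  rw [t0, h1]
  rfl

theorem coeff_pos {N : ℕ} (hN : N ∈ Lv) {P : Polynomial ℂ} {e : ℤ → ℂ}
    (hP : HasQExp (fun z => Polynomial.eval (jnStar N z) P) e (-2)) (he2 : e (-2) = 1)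
    (he1 : e (-1) = 0) (he0 : e 0 = 0) {n : ℕ} (hn : 0 < n) :
    ∑ᶠ r : ℤ, t2Star N P (4 * n - r ^ 2) =
      2 * (n * cf (gN N) n) + 2 * ∑ e ∈ N.divisors, sg n e * (Ac N e - Am N) := by
  have H := haupt hN
  have hj := eval_jnStar hN hP he2 he1 he0
  obtain ⟨hf, hw⟩ := weighted_sum hN hn
  have hinv : ∀ e, e ∣ N → ∀ A ∈ AL N e, ∀ z ∈ UH,
      Polynomial.eval (jnStar N (act A z)) P = Polynomial.eval (jnStar N z) P := by
    intro e he A hA z hz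
    rw [hj _ (act_mem (AL.det_pos (H.dvd_pos he) hA) hz), hj z hz, fS_AL hN he hA hz]
  have hs := H.sum_classTrace hN hn hf (f := fun z => Polynomial.eval (jnStar N z) P) hinv
  have hs' : ∑ ρ ∈ hf.toFinset, wt N (tN N) n ρ * Polynomial.eval (jnStar N (pt (tN N) ρ)) P =
      ∑ ρ ∈ hf.toFinset, wt N (tN N) n ρ * fS N (pt (tN N) ρ) := by
    refine Finset.sum_congr rfl fun ρ hρ => ?_
    obtain ⟨α, hα, rfl, -⟩ := hf.mem_toFinset.mp hρ
    rw [hj _ (pt_spec ⟨α, hα, rfl⟩).1]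
  rw [hs', hw] at hs
  have hW : (N.divisors.card : ℂ) ≠ 0 := by
    exact_mod_cast (Finset.card_pos.mpr ⟨1, Nat.one_mem_divisors.mpr H.pos.ne'⟩).ne'
  rw [finsum_t2Star, Finset.sum_congr rfl fun r _ => t2Star_eq N P n r]
  simp only [Finset.sum_add_distrib]
  rw [← Finset.sum_filter, ← Finset.sum_filter, ← Finset.sum_filter, ← Finset.sum_filter]
  simp only [Finset.sum_const, nsmul_eq_mul]
  rw [card_sq hn, t0_eq N hN]
  have hg := congrArg (fun x : ℕ => (x : ℂ)) (gapS_eq hn)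
  push_cast at hg
  have hR : Finset.filter (fun r : ℤ => r ^ 2 < 4 * n) (rBox n) = Rr n := rfl
  rw [hR]
  set S := ∑ r ∈ Rr n, classTrace (FrickeGroup N) (fun z => Polynomial.eval (jnStar N z) P)
    (QdN (4 * n - r ^ 2) N) with hS
  refine mul_left_cancel₀ hW ?_
  rw [mul_add, hs, hg]
  push_cast
  field_simp
  ring

lemma coeff_zero (N : ℕ) (P : Polynomial ℂ) :
    ∑ᶠ r : ℤ, t2Star N P (4 * (0 : ℕ) - r ^ 2) = t0 N - 6 := by
  have h : rBox 0 = {-2, -1, 0, 1, 2} := by decide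
  rw [finsum_t2Star, Finset.sum_congr rfl fun r _ => t2Star_eq N P 0 r, h]
  norm_num [Finset.sum_insert]
  ring

lemma coeff_neg (N : ℕ) (P : Polynomial ℂ) : ∑ᶠ r : ℤ, t2Star N P (4 * (-1) - r ^ 2) = -2 := by
  rw [finsum_eq_single _ 0]
  · rw [t2Star_of_neg N P (by norm_num)]
    norm_num
  · intro r hr
    have : 0 < r ^ 2 := by positivity
    rw [t2Star_of_neg N P (by omega), if_neg (by omega), if_neg (by omega), add_zero]

def etl (δ : ℕ) (z : ℂ) : ℂ := δ * Ee (δ * z)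

lemma logDeriv_et_natmul {δ : ℕ} (hδ : 0 < δ) {z : ℂ} (hz : z ∈ UH) :
    logDeriv (fun w => et (δ * w)) z = 2 * Real.pi * I * etl δ z := by
  have h1 : DifferentiableAt ℂ et (δ * z) :=
    et_diff.differentiableAt (isOpen_UH.mem_nhds (natmul_mem hδ hz))
  have h2 : HasDerivAt (fun w : ℂ => (δ : ℂ) * w) δ z := by
    simpa using (hasDerivAt_id z).const_mul (δ : ℂ)
  have h3 := h1.hasDerivAt.comp z h2
  rw [logDeriv_apply, show deriv (fun w => et (δ * w)) z = _ from h3.deriv, etl, Ee, logDeriv_apply]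
  have := two_pi_I_ne
  field_simp

lemma etl_AL {N e δ : ℕ} (hN : Squarefree N) (he : e ∈ N.divisors) (hδ : δ ∈ N.divisors) {A : MZ}
    (hA : A ∈ AL N e) {z : ℂ} (hz : z ∈ UH) :
    etl δ (act A z) * (e / den A z ^ 2) =
      A 1 0 / den A z / (2 * Real.pi * I) + etl (symDiv e δ) z := by
  have he0 := Nat.pos_of_mem_divisors he
  have hδ0 := Nat.pos_of_mem_divisors hδ
  have hA0 := AL.det_pos he0 hA
  have hs0 := Nat.pos_of_mem_divisors (symDiv_mem hN he hδ)
  have hd := den_ne_zero hA0 hz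
  obtain ⟨C, hC, hC'⟩ : ∃ C : ℂ, C ≠ 0 ∧
      ∀ w ∈ UH, et (δ * act A w) = C * den A w * et ((symDiv e δ : ℕ) * w) := by
    obtain ⟨a, b, c, d, rfl, hdet⟩ := mem_AL_iff.mp hA
    refine ⟨z12 ^ Xd N e δ a b c d / (Nat.gcd e δ : ℕ), ?_, fun w hw => ?_⟩
    · have h12 : z12 ≠ 0 := fun h => by simpa [h] using z12_pow
      have : ((Nat.gcd e δ : ℕ) : ℂ) ≠ 0 := by
        exact_mod_cast (Nat.gcd_pos_of_pos_left δ he0).ne'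
      exact div_ne_zero (zpow_ne_zero _ h12) this
    · rw [et_AL hN (Nat.dvd_of_mem_divisors he) (Nat.dvd_of_mem_divisors hδ) hdet hw]
      ring
  have hden : HasDerivAt (den A) (A 1 0) z := by
    have h := ((hasDerivAt_id z).const_mul (A 1 0 : ℂ)).add_const (A 1 1 : ℂ)
    rw [mul_one] at h
    exact h
  have h1 : logDeriv (fun w => et (δ * act A w)) z =
      logDeriv (fun w => C * den A w * et ((symDiv e δ : ℕ) * w)) z := by
    rw [logDeriv_apply, logDeriv_apply, hC' z hz]
    congr 1
    refine Filter.EventuallyEq.deriv_eq ?_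
    filter_upwards [isOpen_UH.mem_nhds hz] with w hw using hC' w hw
  have h2 : logDeriv (fun w => et (δ * act A w)) z =
      logDeriv (fun w => et (δ * w)) (act A z) * (e / den A z ^ 2) := by
    have h3 := deriv_comp_act (et_natmul_diff hδ0) hA0 hz
    rw [hA.2.2.2] at h3
    rw [logDeriv_apply, logDeriv_apply, h3]
    push_cast
    ring
  have hsd := (et_natmul_diff hs0).differentiableAt (isOpen_UH.mem_nhds hz)
  rw [h2, logDeriv_mul (f := fun w => C * den A w) (g := fun w => et ((symDiv e δ : ℕ) * w)) z
    (mul_ne_zero hC hd) (et_ne_zero (natmul_mem hs0 hz))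
    (hden.differentiableAt.const_mul C) hsd, logDeriv_const_mul z C hC,
    logDeriv_et_natmul hδ0 (act_mem hA0 hz), logDeriv_et_natmul hs0 hz, logDeriv_apply,
    hden.deriv] at h1
  have := two_pi_I_ne
  refine mul_left_cancel₀ this ?_
  rw [mul_add, mul_div_cancel₀ _ this, ← h1]
  ring

/-- The image of the generating function under the Atkin–Lehner involution of index `e`. -/
def Ge (N e : ℕ) (z : ℂ) : ℂ :=
  2 * (deriv (te N (tN N) e) z / (2 * Real.pi * I)) -
    ∑ δ ∈ N.divisors, (Ac N δ - Am N) * etl (symDiv e δ) z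

lemma sum_Ac_sub {N : ℕ} (hN : N ∈ Lv) : ∑ δ ∈ N.divisors, (Ac N δ - Am N) = 0 := by
  have hW : (N.divisors.card : ℂ) ≠ 0 := by
    exact_mod_cast (Finset.card_pos.mpr ⟨1, Nat.one_mem_divisors.mpr (haupt hN).pos.ne'⟩).ne'
  rw [Finset.sum_sub_distrib, Finset.sum_const, nsmul_eq_mul, Am, mul_div_cancel₀ _ hW, sub_self]

lemma Ge_AL {N e : ℕ} (hN : N ∈ Lv) (he : e ∈ N.divisors) {A : MZ} (hA : A ∈ AL N e) {z : ℂ}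
    (hz : z ∈ UH) : Ge N 1 (act A z) * (e / den A z ^ 2) = Ge N e z := by
  have H := haupt hN
  have hA0 := AL.det_pos (Nat.pos_of_mem_divisors he) hA
  have h1 : ∑ δ ∈ N.divisors, (Ac N δ - Am N) * etl (symDiv 1 δ) (act A z) * (e / den A z ^ 2) =
      ∑ δ ∈ N.divisors, ((Ac N δ - Am N) * (A 1 0 / den A z / (2 * Real.pi * I)) +
        (Ac N δ - Am N) * etl (symDiv e δ) z) := by
    refine Finset.sum_congr rfl fun δ hδ => ?_
    rw [one_symDiv, mul_assoc, etl_AL H.sqf he hδ hA hz, mul_add]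
  rw [Finset.sum_add_distrib, ← Finset.sum_mul, ← Finset.sum_mul, sum_Ac_sub hN, zero_mul, zero_add] at h1
  rw [Ge, Ge, ← h1, sub_mul, H.deriv_te_one (act_mem hA0 hz),
    H.deriv_te (Nat.dvd_of_mem_divisors he) hA hz]
  ring

lemma exists_qexp_etl {δ : ℕ} (hδ : 0 < δ) : ∃ h : ℂ → ℂ, DifferentiableOn ℂ h (Metric.ball 0 1) ∧
    ∀ z ∈ UH, etl δ z = h (qc z) := by
  have hk : DifferentiableOn ℂ (fun q => 1 / 12 + 2 * (q * deriv eul q) / eul q)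
      (Metric.ball 0 1) := by
    refine (differentiableOn_const _).add (DifferentiableOn.div ?_ eul_diff fun q hq =>
      eul_ne_zero (by simpa using hq))
    exact (differentiableOn_id.mul (eul_diff.deriv Metric.isOpen_ball)).const_mul 2
  refine ⟨fun q => δ * (1 / 12 + 2 * (q ^ δ * deriv eul (q ^ δ)) / eul (q ^ δ)), ?_, ?_⟩
  · refine (hk.comp (differentiableOn_pow δ) fun q hq => ?_).const_mul _
    simp only [Metric.mem_ball, dist_zero_right, norm_pow] at hq ⊢
    exact pow_lt_one₀ (norm_nonneg q) hq hδ.ne'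
  · intro z hz
    rw [etl, et_deriv (natmul_mem hδ hz), qc_nat_mul]

namespace Haupt
variable {N : ℕ} {t g : ℂ → ℂ}

lemma exists_qexp_deriv_te (H : Haupt N t g) {e : ℕ} (he : e ∣ N) :
    ∃ h : ℂ → ℂ, DifferentiableOn ℂ h (Metric.ball 0 1) ∧
      ∀ z ∈ UH, qc z * (deriv (te N t e) z / (2 * Real.pi * I)) = h (qc z) := by
  have := two_pi_I_ne
  by_cases he1 : e = 1
  · subst he1
    refine ⟨fun q => -1 + q * (q * deriv g q), (differentiableOn_const _).add
      (differentiableOn_id.mul (differentiableOn_id.mul (H.g_diff.deriv Metric.isOpen_ball))), ?_⟩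
    intro z hz
    rw [H.deriv_te_one hz, H.deriv_t hz]
    have := qc_ne_zero z
    field_simp
  · obtain ⟨h, hh, h1, -⟩ := H.te_qexp he he1
    refine ⟨fun q => q * (q * deriv h q), differentiableOn_id.mul (differentiableOn_id.mul
      (hh.deriv Metric.isOpen_ball)), fun z hz => ?_⟩
    rw [deriv_comp_qc hh h1 hz]
    field_simp

end Haupt

lemma exists_qexp_Ge {N e : ℕ} (hN : N ∈ Lv) (he : e ∈ N.divisors) :
    ∃ h : ℂ → ℂ, DifferentiableOn ℂ h (Metric.ball 0 1) ∧
      ∀ z ∈ UH, qc z * Ge N e z = h (qc z) := by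
  have H := haupt hN
  obtain ⟨h, hh, h1⟩ := H.exists_qexp_deriv_te (Nat.dvd_of_mem_divisors he)
  have h2 : ∀ δ : ℕ, ∃ k : ℂ → ℂ, DifferentiableOn ℂ k (Metric.ball 0 1) ∧
      (0 < δ → ∀ z ∈ UH, etl δ z = k (qc z)) := by
    intro δ
    rcases Nat.eq_zero_or_pos δ with rfl | hδ
    · exact ⟨0, differentiableOn_const 0, fun h => absurd h (lt_irrefl 0)⟩
    · obtain ⟨k, hk, hk'⟩ := exists_qexp_etl hδ
      exact ⟨k, hk, fun _ => hk'⟩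
  choose k hk hk' using h2
  refine ⟨fun q => 2 * h q - q * ∑ δ ∈ N.divisors, (Ac N δ - Am N) * k (symDiv e δ) q, ?_, ?_⟩
  · refine (hh.const_mul 2).sub (differentiableOn_id.mul (DifferentiableOn.fun_sum fun δ _ => ?_))
    exact (hk _).const_mul _
  · intro z hz
    have h3 : ∑ δ ∈ N.divisors, (Ac N δ - Am N) * etl (symDiv e δ) z =
        ∑ δ ∈ N.divisors, (Ac N δ - Am N) * k (symDiv e δ) (qc z) := by
      refine Finset.sum_congr rfl fun δ hδ => ?_
      rw [hk' _ (Nat.pos_of_mem_divisors (symDiv_mem H.sqf he hδ)) z hz]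
    rw [Ge, h3]
    linear_combination 2 * h1 z hz

lemma hasSum_cf {h : ℂ → ℂ} (hh : DifferentiableOn ℂ h (Metric.ball 0 1)) {q : ℂ} (hq : ‖q‖ < 1) :
    HasSum (fun n : ℕ => cf h n * q ^ n) (h q) := by
  have := Complex.hasSum_taylorSeries_on_ball hh (z := q) (by simpa using hq)
  refine this.congr_fun fun n => ?_
  simp only [sub_zero, smul_eq_mul, cf]
  ring

lemma Ge_diff {N e : ℕ} (hN : N ∈ Lv) (he : e ∈ N.divisors) : DifferentiableOn ℂ (Ge N e) UH := by
  obtain ⟨h, hh, h1⟩ := exists_qexp_Ge hN he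
  have h2 : DifferentiableOn ℂ (fun z => (qc z)⁻¹ * h (qc z)) UH := by
    refine (differentiable_qc.differentiableOn.inv fun z _ => qc_ne_zero z).mul
      (hh.comp differentiable_qc.differentiableOn fun z hz => ?_)
    simpa using norm_qc_lt_one hz
  refine h2.congr fun z hz => ?_
  rw [← h1 z hz, inv_mul_cancel_left₀ (qc_ne_zero z)]

lemma Ge_merom {N : ℕ} (hN : N ∈ Lv) : MeromAtCusps 2 (Ge N 1) := by
  have H := haupt hN
  intro a b c d hdet
  obtain ⟨e, u, e', rfl, he, hB⟩ :=
    exists_AL_of_det_one H.sqf (γ := !![a, b; c, d]) (by rw [Matrix.det_fin_two_of, hdet])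
  have heN : e' ∈ N.divisors := Nat.mem_divisors.mpr ⟨he, H.pos.ne'⟩
  have he0 := H.dvd_pos he
  have heC : (e' : ℂ) ≠ 0 := by exact_mod_cast he0.ne'
  obtain ⟨h, hh, h1⟩ := exists_qexp_Ge hN heN
  set ζ : ℂ := qc (u / e') with hζ
  have hζ0 : ζ ≠ 0 := qc_ne_zero _
  refine ⟨e', fun n => cf h (n + 1).toNat * ζ ^ n / e', -1, he0, fun τ hτ => ?_⟩
  have hw : (τ + u) / e' ∈ UH := by
    change 0 < ((τ + u) / e' : ℂ).im
    rw [Complex.div_natCast_im]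
    have : (0 : ℝ) < e' := by exact_mod_cast he0
    simpa using div_pos hτ this
  set w := (τ + u) / e' with hwd
  have hq : qc w = ζ * Complex.exp (2 * Real.pi * I * τ / e') := by
    rw [hwd, add_div, qc_add, mul_comm, hζ]
    congr 1
    rw [qc, mul_div_assoc]
  have hU : (0 : ℤ) < (!![(e' : ℤ), -u; 0, 1] : MZ).det := by
    rw [Matrix.det_fin_two_of]
    simpa using he0
  have hγ : (0 : ℤ) < (!![a, b; c, d] : MZ).det := by
    rw [Matrix.det_fin_two_of, hdet]
    exact one_pos
  have hUw : act !![(e' : ℤ), -u; 0, 1] w = τ := by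
    simp [act, den, hwd]
    field_simp
    ring
  have hact := act_mul hγ hU hw
  have hden : den (!![a, b; c, d] * !![(e' : ℤ), -u; 0, 1] : MZ) w = c * τ + d := by
    rw [den_mul hU hw, hUw]
    simp [den]
  rw [hUw] at hact
  have hG := Ge_AL hN heN hB hw
  rw [hact, hden] at hG
  have hcd : (c : ℂ) * τ + d ≠ 0 := by
    simpa [den] using den_ne_zero hγ (z := τ) hτ
  have hval : ((c : ℂ) * τ + d) ^ (-2 : ℤ) * Ge N 1 ((a * τ + b) / (c * τ + d)) =
      (qc w)⁻¹ * h (qc w) / e' := by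
    rw [← h1 w hw, inv_mul_cancel_left₀ (qc_ne_zero w), ← hG]
    have : act !![a, b; c, d] τ = (a * τ + b) / (c * τ + d) := by simp [act, den]
    rw [this, _root_.zpow_neg]
    field_simp
  rw [hval]
  have hs := ((hasSum_cf hh (norm_qc_lt_one hw)).mul_left (qc w)⁻¹).div_const (e' : ℂ)
  refine hs.congr_fun fun j => ?_
  have h0 := qc_ne_zero w
  have hj : (qc w)⁻¹ * qc w ^ j = qc w ^ (-1 + (j : ℤ)) := by
    rw [zpow_add₀ h0, _root_.zpow_neg_one, zpow_natCast]
  simp only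
  rw [show (-1 + (j : ℤ) + 1).toNat = j by simp, mul_left_comm, hj, hq, mul_zpow]
  ring

lemma hasSum_mul_deriv {h : ℂ → ℂ} (hh : DifferentiableOn ℂ h (Metric.ball 0 1)) {q : ℂ}
    (hq : ‖q‖ < 1) : HasSum (fun n : ℕ => n * cf h n * q ^ n) (q * deriv h q) := by
  have h1 := (hasSum_cf (hh.deriv Metric.isOpen_ball) hq).mul_left q
  rw [← hasSum_nat_add_iff' 1]
  simp only [Finset.range_one, Finset.sum_singleton, Nat.cast_zero, zero_mul, sub_zero]
  refine h1.congr_fun fun n => ?_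
  have h2 : ((n + 1 : ℕ) : ℂ) ≠ 0 := by exact_mod_cast n.succ_ne_zero
  have h3 : (n.factorial : ℂ) ≠ 0 := by exact_mod_cast n.factorial_ne_zero
  rw [cf, cf, iteratedDeriv_succ', Nat.factorial_succ, pow_succ]
  push_cast at h2 ⊢
  field_simp

lemma etl_hasSum {δ : ℕ} (hδ : 0 < δ) {z : ℂ} (hz : z ∈ UH) :
    HasSum (fun m : ℕ => (if m = 0 then (δ : ℂ) / 12 else -2 * sg m δ) * qc z ^ m) (etl δ z) := by
  have h1 := (Ee_hasSum (natmul_mem hδ hz)).mul_left (δ : ℂ)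
  have hinj : Function.Injective fun k : ℕ => δ * k := fun a b h => Nat.eq_of_mul_eq_mul_left hδ h
  refine (hinj.hasSum_iff ?_).mp (h1.congr_fun fun k => ?_)
  · intro m hm
    have h2 : ¬ δ ∣ m := fun ⟨k, hk⟩ => hm ⟨k, hk.symm⟩
    have h3 : m ≠ 0 := by
      rintro rfl
      exact h2 (dvd_zero δ)
    rw [if_neg h3, sg, if_neg h2]
    simp
  · simp only [Function.comp_apply, qc_nat_mul, ← pow_mul]
    rw [← mul_assoc]
    congr 1
    rcases Nat.eq_zero_or_pos k with rfl | hk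
    · simp
      ring
    · rw [if_neg hk.ne', if_neg (Nat.mul_pos hδ hk).ne', sg, if_pos (dvd_mul_right δ k),
        Nat.mul_div_cancel_left k hδ]
      push_cast
      ring

lemma sum_Ac_t0 {N : ℕ} (hN : N ∈ Lv) :
    ∑ δ ∈ N.divisors, (Ac N δ - Am N) * (δ / 12) = 6 - t0 N := by
  have hW : (N.divisors.card : ℂ) ≠ 0 := by
    exact_mod_cast (Finset.card_pos.mpr ⟨1, Nat.one_mem_divisors.mpr (haupt hN).pos.ne'⟩).ne'
  have h1 := unit_relation hN
  have h2 : ∑ δ ∈ N.divisors, (Ac N δ - Am N) * (δ / 12) =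
      (∑ δ ∈ N.divisors, δ * Ac N δ - Am N * ∑ δ ∈ N.divisors, (δ : ℂ)) / 12 := by
    rw [Finset.mul_sum, ← Finset.sum_sub_distrib, Finset.sum_div]
    refine Finset.sum_congr rfl fun δ _ => ?_
    ring
  rw [h2, t0_eq N hN, Am]
  field_simp
  linear_combination 6 * h1

lemma Ge_hasSum {N : ℕ} (hN : N ∈ Lv) {z : ℂ} (hz : z ∈ UH) :
    HasSum (fun m : ℕ => ((if m = 0 then t0 N - 6 else 2 * (m * cf (gN N) m) +
      2 * ∑ δ ∈ N.divisors, sg m δ * (Ac N δ - Am N)) : ℂ) * qc z ^ m)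
      (Ge N 1 z + 2 * (qc z)⁻¹) := by
  have H := haupt hN
  have h1 := (hasSum_mul_deriv H.g_diff (norm_qc_lt_one hz)).mul_left 2
  have h2 := hasSum_sum (s := N.divisors) fun δ hδ =>
    (etl_hasSum (Nat.pos_of_mem_divisors hδ) hz).mul_left (Ac N δ - Am N)
  have h3 := h1.sub h2
  have hval : Ge N 1 z + 2 * (qc z)⁻¹ = 2 * (qc z * deriv (gN N) (qc z)) -
      ∑ δ ∈ N.divisors, (Ac N δ - Am N) * etl δ z := by
    rw [Ge, H.deriv_te_one hz, H.deriv_t hz, mul_div_cancel_left₀ _ two_pi_I_ne]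
    simp only [one_symDiv]
    ring
  rw [hval]
  refine h3.congr_fun fun m => ?_
  rcases Nat.eq_zero_or_pos m with rfl | hm
  · simp only [if_true, pow_zero, mul_one]
    rw [sum_Ac_t0 hN]
    push_cast
    ring
  · simp only [if_neg hm.ne']
    rw [add_mul, mul_assoc 2 (∑ δ ∈ N.divisors, _) (qc z ^ m), Finset.sum_mul, Finset.mul_sum,
      sub_eq_add_neg, ← Finset.sum_neg_distrib]
    congr 1
    · ring
    · refine Finset.sum_congr rfl fun δ _ => ?_
      ring

theorem Ge_generating {N : ℕ} (hN : N ∈ Lv) {P : Polynomial ℂ} {e : ℤ → ℂ}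
    (hP : HasQExp (fun z => Polynomial.eval (jnStar N z) P) e (-2)) (he2 : e (-2) = 1)
    (he1 : e (-1) = 0) (he0 : e 0 = 0) {z : ℂ} (hz : z ∈ UH) :
    HasSum (fun n : ℕ => (∑ᶠ r : ℤ, t2Star N P (4 * ((n : ℤ) - 1) - r ^ 2)) *
      qc z ^ ((n : ℤ) - 1)) (Ge N 1 z) := by
  rw [← hasSum_nat_add_iff' 1]
  simp only [Finset.range_one, Finset.sum_singleton, Nat.cast_zero, zero_sub]
  rw [coeff_neg, _root_.zpow_neg_one, neg_mul, sub_neg_eq_add]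
  refine (Ge_hasSum hN hz).congr_fun fun m => ?_
  have hm : ((m + 1 : ℕ) : ℤ) - 1 = m := by push_cast; ring
  rw [hm, zpow_natCast]
  congr 1
  rcases Nat.eq_zero_or_pos m with rfl | h
  · rw [if_pos rfl, coeff_zero]
  · rw [if_neg h.ne', coeff_pos hN hP he2 he1 he0 h]

end TraceForm
end

open TraceForm in
/-- **Proposition 4.3.** For `N ∈ {2,3,5,6,7,10,13}`, the generating function
`G₂^{(N*)}(τ) = Σ_{n ≥ -1} (Σ_{r ∈ ℤ} t₂^{(N*)}(4n - r²)) qⁿ` converges on the upper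
half-plane and is a weakly holomorphic modular form of weight `2` on `Γ₀(N)`. -/
theorem trace_generating_function_weight_two (N : ℕ)
    (hN : N ∈ ({2, 3, 5, 6, 7, 10, 13} : Set ℕ))
    (P : Polynomial ℂ) (e : ℤ → ℂ)
    (hP : HasQExp (fun z => Polynomial.eval (jnStar N z) P) e (-2))
    (he2 : e (-2) = 1) (he1 : e (-1) = 0) (he0 : e 0 = 0) :
    ∃ G : ℂ → ℂ,
      (∀ τ : ℂ, 0 < τ.im →
        HasSum (fun n : ℕ =>
            (∑ᶠ r : ℤ, t2Star N P (4 * ((n : ℤ) - 1) - r ^ 2)) * qc τ ^ ((n : ℤ) - 1))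
          (G τ)) ∧
      DifferentiableOn ℂ G {z : ℂ | 0 < z.im} ∧
      (∀ a b c d : ℤ, a * d - b * c = 1 → (N : ℤ) ∣ c → ∀ τ : ℂ, 0 < τ.im →
        G (((a : ℂ) * τ + b) / ((c : ℂ) * τ + d)) = ((c : ℂ) * τ + d) ^ 2 * G τ) ∧
      MeromAtCusps 2 G := by
  have hL : N ∈ Lv := by
    simpa [Lv] using hN
  have h1 : 1 ∈ N.divisors := Nat.one_mem_divisors.mpr (haupt hL).pos.ne'
  refine ⟨Ge N 1, fun τ hτ => Ge_generating hL hP he2 he1 he0 hτ, Ge_diff hL h1, ?_, Ge_merom hL⟩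
  intro a b c d hdet hc τ hτ
  have hA : (Matrix.of ![![a, b], ![c, d]] : MZ) ∈ AL N 1 := by
    rw [AL_one_iff]
    exact ⟨by simpa using hc, by rw [Matrix.det_fin_two_of, hdet]; rfl⟩
  have hz : τ ∈ UH := hτ
  have h2 := Ge_AL hL h1 hA hz
  have hd : (c : ℂ) * τ + d ≠ 0 := by
    simpa [den] using den_ne_zero (AL.det_pos one_pos hA) hz
  have h3 : den (Matrix.of ![![a, b], ![c, d]]) τ = c * τ + d := by simp [den]
  have h4 : act (Matrix.of ![![a, b], ![c, d]]) τ = (a * τ + b) / (c * τ + d) := by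
    simp [act, den]
  rw [h3, h4] at h2
  rw [← h2, Nat.cast_one, mul_left_comm, mul_one_div_cancel (pow_ne_zero 2 hd), mul_one]
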